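/- Assume (β,h) satisfy the AT condition and condition (AT+). Then there exists c = c_{β,h} > 0, independent of N, such that with probability tending to one as N → ∞, D + β²(1−q) − β G ≥ D + β²(1−q) − (2β²/N) m ⊗ m − β G ≥ c in the sense of quadratic forms, where D ∈ ℝ^{N×N} is diagonal with D_{ij} = δ_{ij}/(1 − m_i²) and m = (m_1,…,m_N) is the magnetization vector. In particular, with probability tending to one, D + β²(1−q) − β G is invertible and ‖(D + β²(1−q) − β G)^{−1}‖_op ≤ c^{−1}. -/

import Mathlib

open MeasureTheory ProbabilityTheory Real Filter

noncomputable section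

namespace SK

/-- The spin value `±1` encoded by a Boolean. -/
def spin (b : Bool) : ℝ := if b then 1 else -1

/-- SK Hamiltonian with coupling matrix `g`, inverse temperature `β` and external
field vector `hv`:  `H(σ) = β ∑_{i<j} g_{ij} σ_i σ_j + ∑_i hv_i σ_i`. -/
def hamiltonian (N : ℕ) (β : ℝ) (g : Fin N → Fin N → ℝ) (hv : Fin N → ℝ)
    (σ : Fin N → ℝ) : ℝ :=
  β * ∑ i : Fin N, ∑ j : Fin N, (if i < j then g i j * σ i * σ j else 0)
    + ∑ i : Fin N, hv i * σ i

/-- Partition function `Z_N`. -/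
def partitionZ (N : ℕ) (β : ℝ) (g : Fin N → Fin N → ℝ) (hv : Fin N → ℝ) : ℝ :=
  ∑ s : Fin N → Bool, Real.exp (hamiltonian N β g hv (fun i => spin (s i)))

/-- Gibbs expectation `⟨f⟩`. -/
def gibbs (N : ℕ) (β : ℝ) (g : Fin N → Fin N → ℝ) (hv : Fin N → ℝ)
    (f : (Fin N → ℝ) → ℝ) : ℝ :=
  (∑ s : Fin N → Bool, f (fun i => spin (s i)) *
      Real.exp (hamiltonian N β g hv (fun i => spin (s i)))) / partitionZ N β g hv

/-- Magnetization `m_i = ⟨σ_i⟩`. -/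
def mag (N : ℕ) (β : ℝ) (g : Fin N → Fin N → ℝ) (hv : Fin N → ℝ) (i : Fin N) : ℝ :=
  gibbs N β g hv (fun σ => σ i)

/-- Two point correlation `m_{ij} = ⟨σ_i σ_j⟩ - ⟨σ_i⟩⟨σ_j⟩`. -/
def corr (N : ℕ) (β : ℝ) (g : Fin N → Fin N → ℝ) (hv : Fin N → ℝ) (i j : Fin N) : ℝ :=
  gibbs N β g hv (fun σ => σ i * σ j) - mag N β g hv i * mag N β g hv j

/-- Operator (ℓ²→ℓ²) norm of an `N×N` real matrix. -/
def opNorm (N : ℕ) (A : Fin N → Fin N → ℝ) : ℝ :=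
  sSup {x : ℝ | ∃ u : Fin N → ℝ, (∑ i, u i ^ 2) = 1 ∧
    x = Real.sqrt (∑ i, (∑ j, A i j * u j) ^ 2)}

/-- `q ↦ E tanh²(h + β √q Z)`, `Z` standard Gaussian. -/
def qtanh (β h q : ℝ) : ℝ :=
  ∫ z, Real.tanh (h + β * Real.sqrt q * z) ^ 2 ∂(gaussianReal 0 1)

/-- `q` is the (unique) solution in `(0,1)` of `q = E tanh²(h + β √q Z)`. -/
def isFixedq (β h q : ℝ) : Prop := 0 < q ∧ q < 1 ∧ q = qtanh β h q

/-- The de Almeida–Thouless condition `β² E sech⁴(h + β √q Z) < 1`. -/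
def ATcond (β h q : ℝ) : Prop :=
  β ^ 2 * ∫ z, (Real.cosh (h + β * Real.sqrt q * z))⁻¹ ^ 4 ∂(gaussianReal 0 1) < 1

/-- The functional `Φ(m, q')` from condition (AT+). -/
def Phi (β h q m q' : ℝ) : ℝ :=
  Real.log 2 + β ^ 2 / 4 * (1 - q') ^ 2 - β ^ 2 / 4 * m * (q' ^ 2 - q ^ 2)
    + (1 / m) * ∫ z, Real.log (∫ z', Real.cosh (h + β * Real.sqrt q * z
        + β * Real.sqrt (q' - q) * z') ^ m ∂(gaussianReal 0 1)) ∂(gaussianReal 0 1)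

/-- Condition (AT+): `(∂_m Φ)(m, q')|_{m=1} < 0` for all `q < q' ≤ 1`. -/
def ATplus (β h q : ℝ) : Prop :=
  ∀ q' : ℝ, q < q' → q' ≤ 1 → deriv (fun m => Phi β h q m q') 1 < 0

/-- `G` is a GOE random matrix: symmetric, zero diagonal, and the entries above the
diagonal are i.i.d. centered Gaussians of variance `1/N`. -/
def IsGOE (N : ℕ) {Ω : Type*} [MeasurableSpace Ω] (P : Measure Ω)
    (G : Ω → Fin N → Fin N → ℝ) : Prop :=
  (∀ ω i j, G ω i j = G ω j i) ∧ (∀ ω i, G ω i i = 0) ∧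
  iIndepFun (m := fun _ : {p : Fin N × Fin N // p.1 < p.2} => (inferInstance : MeasurableSpace ℝ))
    (fun p ω => G ω p.1.1 p.1.2) P ∧
  ∀ p : {p : Fin N × Fin N // p.1 < p.2},
    Measure.map (fun ω => G ω p.1.1 p.1.2) P = gaussianReal 0 (N : NNReal)⁻¹


/-- Euclidean inner product on `ℝ^N`. -/
def dotp (N : ℕ) (u v : Fin N → ℝ) : ℝ := ∑ i, u i * v i

/-- Matrix-vector multiplication. -/
def mulVec (N : ℕ) (A : Fin N → Fin N → ℝ) (u : Fin N → ℝ) : Fin N → ℝ :=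
  fun i => ∑ j, A i j * u j

/-- Matrix product. -/
def matMul (N : ℕ) (A B : Fin N → Fin N → ℝ) : Fin N → Fin N → ℝ :=
  fun i j => ∑ k, A i k * B k j

/-- The identity `N×N` matrix. -/
def idMat (N : ℕ) : Fin N → Fin N → ℝ := fun i j => if i = j then 1 else 0

/-- The matrix `D + β²(1-q)·id - β G`. -/
def hessMat (N : ℕ) (β h q : ℝ) (g : Fin N → Fin N → ℝ) : Fin N → Fin N → ℝ :=
  fun i j => (if i = j then (1 - mag N β g (fun _ => h) i ^ 2)⁻¹ else 0)
    + β ^ 2 * (1 - q) * idMat N i j - β * g i j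

/-- The matrix `D + β²(1-q)·id - (2β²/N) m ⊗ m - β G`. -/
def hessMat' (N : ℕ) (β h q : ℝ) (g : Fin N → Fin N → ℝ) : Fin N → Fin N → ℝ :=
  fun i j => hessMat N β h q g i j
    - 2 * β ^ 2 / N * (mag N β g (fun _ => h) i * mag N β g (fun _ => h) j)

set_option linter.unusedSectionVars false
set_option linter.unusedVariables false
open Finset (mul_sum sum_congr sum_add_distrib sum_le_sum sum_sub_distrib sum_mul sum_nonneg mem_univ sum_comm sum_div single_le_sum abs_sum_le_sum_abs sum_const_zero sum_pos sum_mul_sum univ_nonempty)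
open Fintype (sum_prod_type sum_sum_type sum_bool)

/-- Congruence for a sum over a fixed finite set. -/
lemma scg {ι M : Type*} [AddCommMonoid M] {s : Finset ι} {f g : ι → M} (h : ∀ i ∈ s, f i = g i) : s.sum f = s.sum g :=
  Finset.sum_congr rfl h

/-- Left multiplication is monotone. -/
lemma mul_le_l {a b c : ℝ} (h : b ≤ c) (ha : 0 ≤ a) : a * b ≤ a * c := mul_le_mul_of_nonneg_left h ha

/-- Right multiplication is monotone. -/
lemma mul_le_r {a b c : ℝ} (h : b ≤ c) (ha : 0 ≤ a) : b * a ≤ c * a := mul_le_mul_of_nonneg_right h ha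

section
/-- Standard Gaussian measure on `ℝ`. -/
def gs : Measure ℝ := gaussianReal 0 1
instance : IsProbabilityMeasure gs := by unfold gs; infer_instance
/-- Standard Gaussian measure on a finite product. -/
def gp (ι : Type*) [Fintype ι] : Measure (ι → ℝ) := Measure.pi (fun _ => gs)
instance (ι : Type*) [Fintype ι] : IsProbabilityMeasure (gp ι) := by unfold gp; infer_instance

lemma gs_stein {f f' : ℝ → ℝ} (hf : ∀ x, HasDerivAt f (f' x) x) {C : ℝ}
    (hC : ∀ x, |f x| ≤ C) (hC' : ∀ x, |f' x| ≤ C) (hf' : Measurable f') :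
    ∫ z, z * f z ∂gs = ∫ z, f' z ∂gs := by
  have hfc : Continuous f := continuous_iff_continuousAt.2 (fun x => (hf x).continuousAt)
  unfold gs
  rw [integral_gaussianReal_eq_integral_smul (by norm_num), integral_gaussianReal_eq_integral_smul (by norm_num)]
  have hd : ∀ x, HasDerivAt (gaussianPDFReal 0 1) (- (x * gaussianPDFReal 0 1 x)) x := by
    intro x
    unfold gaussianPDFReal
    have h1 : HasDerivAt (fun x : ℝ => - (x - 0) ^ 2 / (2 * ((1:NNReal):ℝ))) (-x) x := by
      have := ((hasDerivAt_id x).sub_const 0).pow 2 |>.neg |>.div_const (2 * ((1:NNReal):ℝ))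
      refine this.congr_deriv ?_
      simp only [id, NNReal.coe_one]; push_cast; ring
    refine ((h1.exp).const_mul (√(2 * π * ((1:NNReal):ℝ)))⁻¹).congr_deriv ?_
    ring
  have hpi : Integrable (gaussianPDFReal 0 1) := integrable_gaussianPDFReal 0 1
  have hxp : Integrable (fun x => x * gaussianPDFReal 0 1 x) := by
    have h2 : Integrable (fun x : ℝ => x) (gaussianReal 0 1) := by
      have := memLp_id_gaussianReal (μ := 0) (v := 1) 1
      exact (memLp_one_iff_integrable.1 this)
    rw [gaussianReal_of_var_ne_zero _ (by norm_num)] at h2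
    rw [integrable_withDensity_iff (measurable_gaussianPDF 0 1) (by
      filter_upwards with x; exact gaussianPDF_lt_top)] at h2
    simpa [toReal_gaussianPDF] using h2
  have key := integral_mul_deriv_eq_deriv_mul_of_integrable (u := f) (v := gaussianPDFReal 0 1)
    (u' := f') (v' := fun x => - (x * gaussianPDFReal 0 1 x)) (fun x _ => hf x) (fun x _ => hd x)
    (by
      refine (hxp.neg.bdd_mul (c := C) hfc.aestronglyMeasurable ?_)
      filter_upwards with x; exact hC x)
    (by
      refine (hpi.bdd_mul (c := C) hf'.aestronglyMeasurable ?_)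
      filter_upwards with x; exact hC' x)
    (by
      refine (hpi.bdd_mul (c := C) hfc.aestronglyMeasurable ?_)
      filter_upwards with x; exact hC x)
  have e1 : ∀ x, f x * -(x * gaussianPDFReal 0 1 x) = - (gaussianPDFReal 0 1 x • (x * f x)) := by
    intro x; simp; ring
  simp_rw [e1, integral_neg] at key
  rw [neg_inj] at key
  rw [key]
  congr 1; ext x; simp; ring

section pi
variable {ι : Type*} [Fintype ι]

lemma gp_eval (k : ι) : MeasurePreserving (fun g : ι → ℝ => g k) (gp ι) gs := by
  unfold gp; exact measurePreserving_eval _ k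

lemma gs_integrable_exp (C : ℝ) : Integrable (fun z => exp (C * |z|)) gs := by
  have h1 : Integrable (fun z => exp (C * z) + exp (-C * z)) gs := by
    unfold gs
    exact (integrable_exp_mul_gaussianReal C).add (integrable_exp_mul_gaussianReal (-C))
  refine h1.mono' (by fun_prop) ?_
  filter_upwards with z
  rw [norm_of_nonneg (exp_pos _).le]
  rcases abs_cases z with h | h
  · rw [h.1]; linarith [exp_pos (-C * z)]
  · rw [h.1]; have : C * -z = -C * z := by ring
    rw [this]; linarith [exp_pos (C * z)]

lemma gp_integrable_exp (C : ℝ) : Integrable (fun g : ι → ℝ => exp (C * ∑ k, |g k|)) (gp ι) := by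
  have : (fun g : ι → ℝ => exp (C * ∑ k, |g k|)) = fun g => ∏ k, exp (C * |g k|) := by
    ext g; rw [mul_sum, exp_sum]
  rw [this]
  unfold gp
  exact Integrable.fintype_prod (f := fun _ z => exp (C * |z|)) (fun _ => gs_integrable_exp C)

lemma gp_integrable_abs : Integrable (fun g : ι → ℝ => ∑ k, |g k|) (gp ι) := by
  refine (gp_integrable_exp 1).mono' (Continuous.aestronglyMeasurable (by fun_prop)) ?_
  filter_upwards with g
  rw [norm_of_nonneg (sum_nonneg fun _ _ => abs_nonneg _)]
  have := add_one_le_exp (1 * ∑ k, |g k|)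
  linarith

lemma gp_integrable_of_bd {f : (ι → ℝ) → ℝ} (hf : Measurable f) {C D : ℝ}
    (h : ∀ g, |f g| ≤ C + D * ∑ k, |g k|) : Integrable f (gp ι) := by
  refine ((integrable_const C).add ((gp_integrable_abs (ι := ι)).const_mul D)).mono'
    hf.aestronglyMeasurable ?_
  filter_upwards with g
  simpa using h g

variable [DecidableEq ι]

lemma gp_update (k : ι) : MeasurePreserving (fun p : (ι → ℝ) × ℝ => Function.update p.1 k p.2)
    ((gp ι).prod gs) (gp ι) := by
  have hm : Measurable (fun p : (ι → ℝ) × ℝ => Function.update p.1 k p.2) := by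
    rw [measurable_pi_iff]; intro i
    by_cases h : i = k
    · subst h; simp; exact measurable_snd
    · simp [h]; fun_prop
  refine ⟨hm, ?_⟩
  refine (Measure.pi_eq (μ := fun _ : ι => gs) ?_).symm
  intro s hs
  unfold gp
  rw [Measure.map_apply hm (MeasurableSet.univ_pi hs)]
  have : (fun p : (ι → ℝ) × ℝ => Function.update p.1 k p.2) ⁻¹' (Set.univ.pi s)
      = (Set.univ.pi (Function.update s k Set.univ)) ×ˢ s k := by
    ext p
    simp only [Set.mem_preimage, Set.mem_univ_pi, Set.mem_prod]
    constructor
    · intro h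
      refine ⟨fun i => ?_, by simpa using h k⟩
      by_cases hi : i = k
      · subst hi; simp
      · simpa [hi] using h i
    · rintro ⟨h, h2⟩ i
      by_cases hi : i = k
      · subst hi; simpa using h2
      · simpa [hi] using h i
  rw [this, Measure.prod_prod, Measure.pi_pi, ← Finset.prod_erase_mul _ _ (mem_univ k),
    ← Finset.prod_erase_mul _ (fun i => gs (s i)) (mem_univ k)]
  simp
  congr 1
  refine Finset.prod_congr rfl fun i hi => ?_
  simp [Finset.ne_of_mem_erase hi]

lemma gp_stein (k : ι) {f f' : (ι → ℝ) → ℝ}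
    (hf : ∀ g z, HasDerivAt (fun z => f (Function.update g k z)) (f' (Function.update g k z)) z)
    (hfm : Measurable f) (hfm' : Measurable f')
    {C : ℝ} (hC : ∀ x, |f x| ≤ C) (hC' : ∀ x, |f' x| ≤ C) :
    ∫ g, g k * f g ∂gp ι = ∫ g, f' g ∂gp ι := by
  have hi1 : Integrable (fun g => g k * f g) (gp ι) := by
    have := (gp_integrable_abs (ι := ι))
    have h2 : Integrable (fun g : ι → ℝ => g k) (gp ι) := by
      refine gp_integrable_of_bd (measurable_pi_apply k) (C := 0) (D := 1) ?_
      intro g; simp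
      exact single_le_sum (f := fun k => |g k|) (fun _ _ => abs_nonneg _) (mem_univ k)
    refine h2.mul_bdd (c := C) hfm.aestronglyMeasurable ?_
    filter_upwards with x; exact hC x
  have hi2 : Integrable f' (gp ι) := by
    refine (integrable_const C).mono' hfm'.aestronglyMeasurable ?_
    filter_upwards with x; exact hC' x
  have hmp := gp_update k
  rw [← hmp.map_eq, integral_map hmp.measurable.aemeasurable (by rw [hmp.map_eq]; exact hi1.1),
    integral_map hmp.measurable.aemeasurable (by rw [hmp.map_eq]; exact hi2.1)]
  rw [integral_prod, integral_prod]
  · congr 1; ext g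
    simp only [Function.update_self]
    refine gs_stein (f := fun z => f (Function.update g k z)) (hf g) (fun x => hC _) (fun x => hC' _) ?_
    exact hfm'.comp (measurable_update g)
  · exact (hmp.integrable_comp hi2.1).2 hi2
  · exact (hmp.integrable_comp hi1.1).2 hi1

end pi
end

section
section
variable {ι κ : Type*} [Fintype ι] [Fintype κ]

lemma gp_comp_inj (e : κ → ι) (he : Function.Injective e) :
    MeasurePreserving (fun g : ι → ℝ => fun k => g (e k)) (gp ι) (gp κ) := by
  classical
  have hm : Measurable (fun g : ι → ℝ => fun k => g (e k)) := by fun_prop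
  refine ⟨hm, ?_⟩
  refine (Measure.pi_eq (μ := fun _ : κ => gs) ?_).symm
  intro s hs
  rw [Measure.map_apply hm (MeasurableSet.univ_pi hs)]
  set t : ι → Set ℝ := fun i => if h : ∃ k, e k = i then s h.choose else Set.univ with ht
  have hte : ∀ k, t (e k) = s k := by
    intro k
    have h : ∃ k', e k' = e k := ⟨k, rfl⟩
    simp only [ht, dif_pos h]
    rw [he h.choose_spec]
  have : (fun g : ι → ℝ => fun k => g (e k)) ⁻¹' (Set.univ.pi s) = Set.univ.pi t := by
    ext g
    simp only [Set.mem_preimage, Set.mem_univ_pi]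
    constructor
    · intro h i
      by_cases hi : ∃ k, e k = i
      · obtain ⟨k, rfl⟩ := hi
        rw [hte]; exact h k
      · simp [ht, dif_neg hi]
    · intro h k
      rw [← hte]; exact h _
  rw [this]
  unfold gp
  rw [Measure.pi_pi]
  symm
  refine Fintype.prod_of_injective e he _ _ ?_ ?_
  · intro i hi
    have : ¬ ∃ k, e k = i := by simpa using hi
    simp [ht, dif_neg this]
  · intro k; rw [hte]

lemma gp_sum_mp : MeasurePreserving (fun p : (ι → ℝ) × (κ → ℝ) => (Sum.elim p.1 p.2 : ι ⊕ κ → ℝ))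
    ((gp ι).prod (gp κ)) (gp (ι ⊕ κ)) := by
  have := measurePreserving_sumPiEquivProdPi_symm (X := fun _ : ι ⊕ κ => ℝ) (fun _ => gs)
  refine ⟨?_, ?_⟩
  · rw [measurable_pi_iff]; rintro (i | i)
    · simp; fun_prop
    · simp; fun_prop
  · have h2 := this.map_eq
    unfold gp
    convert h2 using 2
    ext p i
    cases i <;> rfl

lemma gp_sum_integral {f : (ι ⊕ κ → ℝ) → ℝ} (hf : Integrable f (gp (ι ⊕ κ))) :
    ∫ g, f g ∂gp (ι ⊕ κ) = ∫ x, ∫ y, f (Sum.elim x y) ∂gp κ ∂gp ι := by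
  have hmp := gp_sum_mp (ι := ι) (κ := κ)
  conv_lhs => rw [← hmp.map_eq]
  rw [integral_map hmp.measurable.aemeasurable (by rw [hmp.map_eq]; exact hf.1), integral_prod]
  exact (hmp.integrable_comp hf.1).2 hf

lemma gp_integral_comp_inj (e : κ → ι) (he : Function.Injective e) {f : (κ → ℝ) → ℝ}
    (hf : AEStronglyMeasurable f (gp κ)) :
    ∫ g, f (fun k => g (e k)) ∂gp ι = ∫ g, f g ∂gp κ := by
  have hmp := gp_comp_inj e he
  conv_rhs => rw [← hmp.map_eq]
  rw [integral_map hmp.measurable.aemeasurable (by rw [hmp.map_eq]; exact hf)]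

lemma gp_integral_eval (k : ι) {f : ℝ → ℝ} (hf : Measurable f) :
    ∫ g, f (g k) ∂gp ι = ∫ z, f z ∂gs := by
  have hmp := gp_eval k
  conv_rhs => rw [← hmp.map_eq]
  rw [integral_map hmp.measurable.aemeasurable hf.aestronglyMeasurable]

lemma gp_linear (a : ι → ℝ) : Measure.map (fun g : ι → ℝ => ∑ k, a k * g k) (gp ι)
    = gaussianReal 0 (∑ k, (a k ^ 2).toNNReal) := by
  have hm : Measurable (fun g : ι → ℝ => ∑ k, a k * g k) := by fun_prop
  have : IsProbabilityMeasure (Measure.map (fun g : ι → ℝ => ∑ k, a k * g k) (gp ι)) :=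
    Measure.isProbabilityMeasure_map hm.aemeasurable
  apply Measure.ext_of_charFun
  ext t
  rw [charFun_gaussianReal, charFun_apply_real, integral_map hm.aemeasurable (by fun_prop)]
  have : ∀ g : ι → ℝ, Complex.exp (t * ((∑ k, a k * g k : ℝ) : ℂ) * Complex.I)
      = ∏ k, Complex.exp (((t * a k : ℝ) : ℂ) * (g k : ℂ) * Complex.I) := by
    intro g
    rw [← Complex.exp_sum]
    congr 1
    push_cast
    rw [mul_sum, sum_mul]
    refine scg fun k _ => by ring
  simp_rw [this]
  unfold gp
  rw [integral_fintype_prod_eq_prod (f := fun k (z : ℝ) => Complex.exp (((t * a k : ℝ) : ℂ) * (z : ℂ) * Complex.I))]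
  have h2 : ∀ k, ∫ z, Complex.exp (((t * a k : ℝ) : ℂ) * (z : ℂ) * Complex.I) ∂gs
      = Complex.exp (- (t * a k) ^ 2 / 2) := by
    intro k
    rw [← charFun_apply_real, gs, charFun_gaussianReal]
    push_cast; congr 1; simp; ring
  simp_rw [h2]
  rw [← Complex.exp_sum]
  congr 1
  push_cast
  have : ∀ k, ((((a k ^ 2).toNNReal : NNReal) : ℝ)) = a k ^ 2 := fun k => Real.coe_toNNReal _ (sq_nonneg _)
  simp only [this]
  push_cast
  simp only [Complex.ofReal_zero, mul_zero, zero_mul, zero_sub]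
  rw [sum_mul, sum_div, ← Finset.sum_neg_distrib]
  refine scg fun k _ => by ring

lemma gs_scale (a : ℝ) : Measure.map (fun z => a * z) gs = gaussianReal 0 ((a ^ 2).toNNReal) := by
  unfold gs
  rw [gaussianReal_map_const_mul]
  simp
  congr 1
  ext; simp [Real.coe_toNNReal _ (sq_nonneg a)]

lemma gp_integral_linear (a : ι → ℝ) {f : ℝ → ℝ} (hf : Measurable f) {b : ℝ} (hb : ∑ k, a k ^ 2 = b ^ 2) :
    ∫ g, f (∑ k, a k * g k) ∂gp ι = ∫ z, f (b * z) ∂gs := by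
  have hm : Measurable (fun g : ι → ℝ => ∑ k, a k * g k) := by fun_prop
  have hm2 : Measurable (fun z : ℝ => b * z) := by fun_prop
  rw [← integral_map (μ := gp ι) hm.aemeasurable (f := f) hf.aestronglyMeasurable,
    ← integral_map (μ := gs) hm2.aemeasurable (f := f) hf.aestronglyMeasurable, gp_linear, gs_scale]
  congr 2
  rw [← hb]
  ext
  push_cast
  rw [Real.coe_toNNReal _ (sum_nonneg fun _ _ => sq_nonneg _)]
  exact scg fun k _ => Real.coe_toNNReal _ (sq_nonneg _)

/-- Jensen for log. -/
lemma jensen_log {α : Type*} [MeasurableSpace α] {μ : Measure α} [IsProbabilityMeasure μ] {f : α → ℝ}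
    (hpos : ∀ x, 0 < f x) (hf : Integrable f μ) (hl : Integrable (fun x => log (f x)) μ) :
    ∫ x, log (f x) ∂μ ≤ log (∫ x, f x ∂μ) := by
  have hI : 0 < ∫ x, f x ∂μ := by
    rw [integral_pos_iff_support_of_nonneg (fun x => (hpos x).le) hf]
    have : Function.support f = Set.univ := by ext x; simp [(hpos x).ne']
    rw [this]; simp
  set I := ∫ x, f x ∂μ with hIdef
  have h1 : ∀ x, log (f x) ≤ log I + (f x / I - 1) := by
    intro x
    have := log_le_sub_one_of_pos (div_pos (hpos x) hI)
    rw [log_div (hpos x).ne' hI.ne'] at this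
    linarith
  calc ∫ x, log (f x) ∂μ ≤ ∫ x, (log I + (f x / I - 1)) ∂μ := by
        refine integral_mono hl ?_ h1
        exact (integrable_const _).add ((hf.div_const _).sub (integrable_const _))
    _ = log I := by
        have hsub : Integrable (fun x => f x / I - 1) μ := (hf.div_const _).sub (integrable_const _)
        rw [integral_add (integrable_const _) hsub,
          integral_sub (hf.div_const _) (integrable_const _), integral_div]
        simp [← hIdef, div_self hI.ne']

lemma gs_mgf (a : ℝ) : ∫ z, exp (a * z) ∂gs = exp (a ^ 2 / 2) := by
  have := mgf_gaussianReal (p := gs) (X := fun z => z) (μ := 0) (v := 1) (by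
    unfold gs; exact Measure.map_id) a
  simpa [mgf] using this

lemma gp_integral_prod (f : ι → ℝ → ℝ) :
    ∫ g, ∏ k, f k (g k) ∂gp ι = ∏ k, ∫ z, f k z ∂gs := by
  unfold gp; exact integral_fintype_prod_eq_prod f

end
end

section
section
variable {S ι : Type*} [Fintype S] [Fintype ι]

/-- Smoothness package for a function of finitely many real variables. -/
structure SmoothF (F : (S → ℝ) → ℝ) (dF : S → (S → ℝ) → ℝ) (ddF : S → S → (S → ℝ) → ℝ) (C : ℝ) :
    Prop where
  cdF : ∀ s, Continuous (dF s)
  cddF : ∀ s s', Continuous (ddF s s')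
  bdF : ∀ s x, |dF s x| ≤ C
  bddF : ∀ s s' x, |ddF s s' x| ≤ C
  cF : Continuous F
  hF : ∀ (x : ℝ → S → ℝ) (x' : S → ℝ) (t : ℝ), (∀ s, HasDerivAt (fun t => x t s) (x' s) t) →
    HasDerivAt (fun t => F (x t)) (∑ s, dF s (x t) * x' s) t
  hdF : ∀ s₀, ∀ (x : ℝ → S → ℝ) (x' : S → ℝ) (t : ℝ), (∀ s, HasDerivAt (fun t => x t s) (x' s) t) →
    HasDerivAt (fun t => dF s₀ (x t)) (∑ s, ddF s₀ s (x t) * x' s) t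

/-- A linear form. -/
def lf (A : S → ι → ℝ) (g : ι → ℝ) (s : S) : ℝ := ∑ k, A s k * g k

/-- The interpolating process. -/
def Xt (A B : S → ι → ℝ) (c d : S → ℝ) (t : ℝ) (g : ι → ℝ) (s : S) : ℝ :=
  √t * lf A g s + √(1 - t) * lf B g s + c s + t * d s

lemma lf_cont (A : S → ι → ℝ) (s : S) : Continuous (fun g => lf A g s) := by
  unfold lf; fun_prop

lemma Xt_cont (A B : S → ι → ℝ) (c d : S → ℝ) (t : ℝ) : Continuous (Xt A B c d t) := by
  unfold Xt; refine continuous_pi fun s => ?_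
  have := lf_cont A s
  have := lf_cont B s
  fun_prop

lemma lf_integrable (A : S → ι → ℝ) (s : S) : Integrable (fun g => lf A g s) (gp ι) := by
  refine gp_integrable_of_bd (lf_cont A s).measurable (C := 0) (D := ∑ k, |A s k|) ?_
  intro g
  unfold lf
  rw [zero_add, sum_mul]
  refine (abs_sum_le_sum_abs _ _).trans (sum_le_sum fun k _ => ?_)
  rw [abs_mul]
  exact mul_le_l (single_le_sum (f := fun k => |g k|)
    (fun _ _ => abs_nonneg _) (mem_univ k)) (abs_nonneg _)

variable {F : (S → ℝ) → ℝ} {dF : S → (S → ℝ) → ℝ} {ddF : S → S → (S → ℝ) → ℝ} {C : ℝ}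

lemma SmoothF.lip (h : SmoothF F dF ddF C) (x : S → ℝ) : |F x| ≤ |F 0| + C * ∑ s, |x s| := by
  have h1 : ∀ t ∈ Set.univ, HasDerivWithinAt (fun t : ℝ => F (t • x)) (∑ s, dF s (t • x) * x s) Set.univ t := by
    intro t _
    refine (h.hF (fun t => t • x) x t ?_).hasDerivWithinAt
    intro s
    simpa using (hasDerivAt_id t).mul_const (x s)
  have h2 := convex_univ.norm_image_sub_le_of_norm_hasDerivWithin_le (C := C * ∑ s, |x s|) h1 (by
    intro t _
    refine (abs_sum_le_sum_abs _ _).trans ?_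
    rw [mul_sum]
    refine sum_le_sum fun s _ => ?_
    rw [abs_mul]
    exact mul_le_r (h.bdF s _) (abs_nonneg _)) (Set.mem_univ 0) (Set.mem_univ 1)
  simp at h2
  have := abs_sub_abs_le_abs_sub (F x) (F 0)
  linarith

lemma SmoothF.integrable (h : SmoothF F dF ddF C) (X : (ι → ℝ) → S → ℝ) (hX : ∀ s, Integrable (fun g => X g s) (gp ι)) :
    Integrable (fun g => F (X g)) (gp ι) := by
  have h1 : Integrable (fun g => |F 0| + C * ∑ s, |X g s|) (gp ι) :=
    (integrable_const _).add ((integrable_finsetSum _ fun s _ => (hX s).abs).const_mul C)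
  refine h1.mono' ?_ ?_
  · have : AEMeasurable X (gp ι) := aemeasurable_pi_iff.2 fun s => (hX s).1.aemeasurable
    exact (h.cF.measurable.comp_aemeasurable this).aestronglyMeasurable
  · filter_upwards with g; exact h.lip _

lemma Xt_integrable (A B : S → ι → ℝ) (c d : S → ℝ) (t : ℝ) (s : S) :
    Integrable (fun g => Xt A B c d t g s) (gp ι) := by
  unfold Xt
  exact (((lf_integrable A s).const_mul _).add ((lf_integrable B s).const_mul _)).add
    (integrable_const _) |>.add (integrable_const _)

/-- Derivative integrand of the interpolation. -/
def Dexp (dF : S → (S → ℝ) → ℝ) (ddF : S → S → (S → ℝ) → ℝ) (d : S → ℝ) (Δ : S → S → ℝ) (x : S → ℝ) : ℝ :=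
  ∑ s, dF s x * d s + (1 / 2) * ∑ s, ∑ s', Δ s s' * ddF s s' x

lemma SmoothF.stein [DecidableEq ι] (h : SmoothF F dF ddF C) (b : S → ι → ℝ) (e : S → ℝ) (s : S) (k : ι) :
    ∫ g, g k * dF s (fun s => lf b g s + e s) ∂gp ι
      = ∫ g, ∑ s', ddF s s' (fun s => lf b g s + e s) * b s' k ∂gp ι := by
  have hc : Continuous (fun (g : ι → ℝ) => (fun s => lf b g s + e s)) :=
    continuous_pi fun s => (lf_cont b s).add continuous_const
  have hC0 : 0 ≤ C := (abs_nonneg _).trans (h.bdF s 0)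
  refine gp_stein k (f := fun g => dF s (fun s => lf b g s + e s))
    (f' := fun g => ∑ s', ddF s s' (fun s => lf b g s + e s) * b s' k) ?_ ?_ ?_
    (C := C + C * ∑ s', |b s' k|) ?_ ?_
  · intro g z
    refine h.hdF s (fun z => fun s => lf b (Function.update g k z) s + e s) (fun s' => b s' k) z ?_
    intro s'
    have : ∀ z, lf b (Function.update g k z) s' + e s' = b s' k * z + (∑ k' ∈ Finset.univ.erase k, b s' k' * g k' + e s') := by
      intro z
      unfold lf
      rw [← Finset.add_sum_erase _ _ (mem_univ k)]
      simp only [Function.update_self]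
      rw [add_assoc]
      congr 2
      refine scg fun k' hk' => ?_
      rw [Function.update_of_ne (Finset.ne_of_mem_erase hk')]
    simp_rw [this]
    simpa using ((hasDerivAt_id z).const_mul (b s' k)).add_const (∑ k' ∈ Finset.univ.erase k, b s' k' * g k' + e s')
  · exact ((h.cdF s).comp hc).measurable
  · refine Continuous.measurable ?_
    refine continuous_finsetSum _ fun s' _ => ((h.cddF s s').comp hc).mul continuous_const
  · intro g
    have := h.bdF s (fun s => lf b g s + e s)
    have h2 : 0 ≤ C * ∑ s', |b s' k| := mul_nonneg hC0 (sum_nonneg fun _ _ => abs_nonneg _)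
    linarith
  · intro g
    refine (abs_sum_le_sum_abs _ _).trans ?_
    have : ∑ s', |ddF s s' (fun s => lf b g s + e s) * b s' k| ≤ C * ∑ s', |b s' k| := by
      rw [mul_sum]
      refine sum_le_sum fun s' _ => ?_
      rw [abs_mul]
      exact mul_le_r (h.bddF s s' _) (abs_nonneg _)
    linarith

lemma SmoothF.hasDerivAt (h : SmoothF F dF ddF C) (A B : S → ι → ℝ) (c d : S → ℝ) (Δ : S → S → ℝ)
    (hAB : ∀ s s', ∑ k, A s k * B s' k = 0)
    (hΔ : ∀ s s', Δ s s' = ∑ k, A s k * A s' k - ∑ k, B s k * B s' k) {t : ℝ} (ht0 : 0 < t) (ht1 : t < 1) :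
    HasDerivAt (fun t => ∫ g, F (Xt A B c d t g) ∂gp ι)
      (∫ g, Dexp dF ddF d Δ (Xt A B c d t g) ∂gp ι) t := by
  classical
  rcases isEmpty_or_nonempty S with hS | hS
  · have : ∀ t g, Xt A B c d t g = 0 := fun t g => Subsingleton.elim _ _
    simp_rw [this]
    simpa [Dexp] using hasDerivAt_const t (∫ g : ι → ℝ, F 0 ∂gp ι)
  have hC0 : 0 ≤ C := (abs_nonneg _).trans (h.bdF hS.some 0)
  set X' : ℝ → (ι → ℝ) → S → ℝ := fun t g s => (1 / (2 * √t)) * lf A g s - (1 / (2 * √(1 - t))) * lf B g s + d s with hX'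
  have hder : ∀ g, ∀ t, 0 < t → t < 1 → HasDerivAt (fun t => F (Xt A B c d t g))
      (∑ s, dF s (Xt A B c d t g) * X' t g s) t := by
    intro g t h0 h1
    refine h.hF _ _ t ?_
    intro s
    unfold Xt
    have h2 := (Real.hasDerivAt_sqrt h0.ne').mul_const (lf A g s)
    have h4 : HasDerivAt (fun t : ℝ => √(1 - t)) (-(1 / (2 * √(1 - t)))) t := by
      have := (Real.hasDerivAt_sqrt (sub_pos.2 h1).ne').comp t ((hasDerivAt_id t).const_sub 1)
      refine this.congr_deriv ?_
      ring
    have h5 := ((h2.add (h4.mul_const (lf B g s))).add_const (c s)).add ((hasDerivAt_id t).mul_const (d s))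
    refine h5.congr_deriv ?_
    simp only [hX']; ring
  set m := min t (1 - t) / 2 with hm
  have hm0 : 0 < m := by rw [hm]; have := lt_min ht0 (sub_pos.2 ht1); linarith
  have hmt : m ≤ t / 2 := by rw [hm]; linarith [min_le_left t (1 - t)]
  have hmt' : m ≤ (1 - t) / 2 := by rw [hm]; linarith [min_le_right t (1 - t)]
  set K := 1 / (2 * √m) with hK
  have hKb : ∀ x, m ≤ x → |1 / (2 * √x)| ≤ K := by
    intro x hx
    rw [abs_of_nonneg (by positivity)]
    rw [hK]
    have := Real.sqrt_le_sqrt hx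
    have h3 := Real.sqrt_pos.2 hm0
    gcongr
  have D := hasDerivAt_integral_of_dominated_loc_of_deriv_le (μ := gp ι)
    (F := fun t g => F (Xt A B c d t g)) (x₀ := t)
    (F' := fun t g => ∑ s, dF s (Xt A B c d t g) * X' t g s) (s := Metric.ball t m)
    (bound := fun g => ∑ s, C * (K * |lf A g s| + K * |lf B g s| + |d s|))
    (Metric.ball_mem_nhds t hm0)
    (.of_forall fun t => (h.cF.comp (Xt_cont A B c d t)).aestronglyMeasurable)
    (h.integrable _ (Xt_integrable A B c d t))
    (by
      refine Continuous.aestronglyMeasurable ?_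
      refine continuous_finsetSum _ fun s _ => ((h.cdF s).comp (Xt_cont A B c d t)).mul ?_
      have := lf_cont A s
      have := lf_cont B s
      simp only [hX']
      fun_prop)
    (by
      filter_upwards with g x hx
      rw [Metric.mem_ball, Real.dist_eq, abs_lt] at hx
      refine (abs_sum_le_sum_abs _ _).trans (sum_le_sum fun s _ => ?_)
      rw [abs_mul]
      refine mul_le_mul (h.bdF s _) ?_ (abs_nonneg _) hC0
      simp only [hX']
      refine (abs_add_le _ _).trans (add_le_add ((abs_sub _ _).trans (add_le_add ?_ ?_)) le_rfl)
      · rw [abs_mul]; exact mul_le_r (hKb _ (by linarith)) (abs_nonneg _)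
      · rw [abs_mul]; exact mul_le_r (hKb _ (by linarith)) (abs_nonneg _))
    (by
      refine integrable_finsetSum _ fun s _ => Integrable.const_mul ?_ _
      exact ((((lf_integrable A s).abs).const_mul _).add (((lf_integrable B s).abs).const_mul _)).add
        (integrable_const _))
    (by
      filter_upwards with g x hx
      rw [Metric.mem_ball, Real.dist_eq, abs_lt] at hx
      exact hder g x (by linarith) (by linarith))
  refine D.2.congr_deriv ?_
  -- Stein
  set b : S → ι → ℝ := fun s k => √t * A s k + √(1 - t) * B s k with hb
  set a : S → ι → ℝ := fun s k => (1 / (2 * √t)) * A s k - (1 / (2 * √(1 - t))) * B s k with ha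
  set e : S → ℝ := fun s => c s + t * d s with he
  have hX : ∀ g, Xt A B c d t g = fun s => lf b g s + e s := by
    intro g; ext s
    simp only [Xt, lf, hb, he, add_mul, sum_add_distrib, mul_sum]
    ring_nf
  have hXa : ∀ g s, X' t g s = ∑ k, a s k * g k + d s := by
    intro g s
    simp only [hX', lf, ha, sub_mul, sum_sub_distrib, mul_sum]
    ring_nf
  have hc : Continuous (fun (g : ι → ℝ) => (fun s => lf b g s + e s)) :=
    continuous_pi fun s => (lf_cont b s).add continuous_const
  have hIdd : ∀ s s', Integrable (fun g => ddF s s' (fun s => lf b g s + e s)) (gp ι) := by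
    intro s s'
    refine (integrable_const C).mono' ((h.cddF s s').comp hc).aestronglyMeasurable ?_
    filter_upwards with g; exact h.bddF _ _ _
  have hId : ∀ s, Integrable (fun g => dF s (fun s => lf b g s + e s)) (gp ι) := by
    intro s
    refine (integrable_const C).mono' ((h.cdF s).comp hc).aestronglyMeasurable ?_
    filter_upwards with g; exact h.bdF _ _
  have hIdk : ∀ s k, Integrable (fun g => g k * dF s (fun s => lf b g s + e s)) (gp ι) := by
    intro s k
    have h2 : Integrable (fun g : ι → ℝ => g k) (gp ι) := by
      refine gp_integrable_of_bd (measurable_pi_apply k) (C := 0) (D := 1) ?_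
      intro g; simp
      exact single_le_sum (f := fun k => |g k|) (fun _ _ => abs_nonneg _) (mem_univ k)
    refine h2.mul_bdd (c := C) ((h.cdF s).comp hc).aestronglyMeasurable ?_
    filter_upwards with x; exact h.bdF _ _
  have hsum : ∀ g, ∑ s, dF s (Xt A B c d t g) * X' t g s
      = ∑ s, dF s (fun s => lf b g s + e s) * d s + ∑ s, ∑ k, a s k * (g k * dF s (fun s => lf b g s + e s)) := by
    intro g
    rw [← sum_add_distrib]
    refine scg fun s _ => ?_
    rw [hX g, hXa, mul_add, mul_sum, add_comm]
    congr 1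
    refine scg fun k _ => by ring
  have hAB' : ∀ s s', ∑ k, a s k * b s' k = Δ s s' / 2 := by
    intro s s'
    have h0 := Real.sqrt_pos.2 ht0
    have h1 := Real.sqrt_pos.2 (sub_pos.2 ht1)
    have : ∀ k, a s k * b s' k = (A s k * A s' k) / 2 - (B s k * B s' k) / 2
        + (√(1 - t) / (2 * √t)) * (A s k * B s' k) - (√t / (2 * √(1 - t))) * (A s' k * B s k) := by
      intro k
      simp only [ha, hb]
      field_simp
      ring
    simp_rw [this]
    rw [sum_sub_distrib, sum_add_distrib, sum_sub_distrib, ← mul_sum, ← mul_sum,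
      hAB, hAB, hΔ, ← sum_div, ← sum_div]
    ring
  simp_rw [hsum, hX, Dexp]
  rw [integral_add (integrable_finsetSum _ fun s _ => (hId s).mul_const _)
    (integrable_finsetSum _ fun s _ => integrable_finsetSum _ fun k _ => (hIdk s k).const_mul _),
    integral_add (integrable_finsetSum _ fun s _ => (hId s).mul_const _)
    ((integrable_finsetSum _ fun s _ => integrable_finsetSum _ fun s' _ => (hIdd s s').const_mul _).const_mul _)]
  congr 1
  rw [integral_const_mul, integral_finsetSum _ (fun s _ => integrable_finsetSum _ fun k _ => (hIdk s k).const_mul _),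
    integral_finsetSum _ (fun s _ => integrable_finsetSum _ fun s' _ => (hIdd s s').const_mul _), mul_sum]
  refine scg fun s _ => ?_
  rw [integral_finsetSum _ (fun k _ => (hIdk s k).const_mul _), integral_finsetSum _ (fun s' _ => (hIdd s s').const_mul _)]
  simp_rw [integral_const_mul, h.stein b e s]
  have h3 : ∀ k, ∫ g, ∑ s', ddF s s' (fun s => lf b g s + e s) * b s' k ∂gp ι
      = ∑ s', (∫ g, ddF s s' (fun s => lf b g s + e s) ∂gp ι) * b s' k := by
    intro k
    rw [integral_finsetSum _ (fun s' _ => (hIdd s s').mul_const _)]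
    simp_rw [integral_mul_const]
  simp_rw [h3, mul_sum]
  rw [sum_comm]
  refine scg fun s' _ => ?_
  have h4 : Δ s s' = 2 * ∑ k, a s k * b s' k := by rw [hAB']; ring
  rw [h4, mul_sum, sum_mul, mul_sum]
  refine scg fun k _ => by ring

lemma SmoothF.continuousOn (h : SmoothF F dF ddF C) (A B : S → ι → ℝ) (c d : S → ℝ) :
    ContinuousOn (fun t => ∫ g, F (Xt A B c d t g) ∂gp ι) (Set.Icc 0 1) := by
  rcases isEmpty_or_nonempty S with hS | hS
  · have : ∀ t g, Xt A B c d t g = 0 := fun t g => Subsingleton.elim _ _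
    simp_rw [this]
    exact continuousOn_const
  have hC0 : 0 ≤ C := (abs_nonneg _).trans (h.bdF hS.some 0)
  refine continuousOn_of_dominated (bound := fun g => |F 0| + C * ∑ s, (|lf A g s| + |lf B g s| + |c s| + |d s|)) ?_ ?_ ?_ ?_
  · intro t _; exact (h.cF.comp (Xt_cont A B c d t)).aestronglyMeasurable
  · intro t ht
    filter_upwards with g
    refine (h.lip _).trans ?_
    gcongr with s _
    unfold Xt
    have e1 : |√t| ≤ 1 := by
      rw [abs_of_nonneg (Real.sqrt_nonneg _)]; exact Real.sqrt_le_one.2 ht.2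
    have e2 : |√(1 - t)| ≤ 1 := by
      rw [abs_of_nonneg (Real.sqrt_nonneg _)]; exact Real.sqrt_le_one.2 (by linarith [ht.1])
    have e3 : |t| ≤ 1 := by rw [abs_of_nonneg ht.1]; exact ht.2
    refine (abs_add_le _ _).trans (add_le_add ((abs_add_le _ _).trans (add_le_add ((abs_add_le _ _).trans
      (add_le_add ?_ ?_)) le_rfl)) ?_) <;> rw [abs_mul]
    · nlinarith [abs_nonneg (lf A g s)]
    · nlinarith [abs_nonneg (lf B g s)]
    · nlinarith [abs_nonneg (d s)]
  · refine (integrable_const _).add (Integrable.const_mul (integrable_finsetSum _ fun s _ => ?_) _)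
    exact ((((lf_integrable A s).abs).add ((lf_integrable B s).abs)).add (integrable_const _)).add (integrable_const _)
  · filter_upwards with g
    refine Continuous.continuousOn (h.cF.comp ?_)
    refine continuous_pi fun s => ?_
    unfold Xt; fun_prop

lemma SmoothF.interp_le (h : SmoothF F dF ddF C) (A B : S → ι → ℝ) (c d : S → ℝ) (Δ : S → S → ℝ)
    (hAB : ∀ s s', ∑ k, A s k * B s' k = 0)
    (hΔ : ∀ s s', Δ s s' = ∑ k, A s k * A s' k - ∑ k, B s k * B s' k) {C₀ : ℝ}
    (hC : ∀ t, 0 < t → t < 1 → ∫ g, Dexp dF ddF d Δ (Xt A B c d t g) ∂gp ι ≤ C₀) :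
    ∫ g, F (fun s => lf A g s + c s + d s) ∂gp ι ≤ ∫ g, F (fun s => lf B g s + c s) ∂gp ι + C₀ := by
  have h1 := (convex_Icc (0:ℝ) 1).image_sub_le_mul_sub_of_deriv_le (h.continuousOn A B c d) (by
    intro t ht
    rw [interior_Icc] at ht
    exact (h.hasDerivAt A B c d Δ hAB hΔ ht.1 ht.2).differentiableAt.differentiableWithinAt) (C := C₀) (by
    intro t ht
    rw [interior_Icc] at ht
    rw [(h.hasDerivAt A B c d Δ hAB hΔ ht.1 ht.2).deriv]
    exact hC t ht.1 ht.2) 0 (by simp) 1 (by simp) zero_le_one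
  have e1 : ∀ g, Xt A B c d 1 g = (fun s => lf A g s + c s + d s) := by
    intro g; ext s; simp [Xt]
  have e2 : ∀ g, Xt A B c d 0 g = (fun s => lf B g s + c s) := by
    intro g; ext s; simp [Xt]
  simp only [e1, e2] at h1
  linarith

/-- Version with `A` and `B` driven by independent families. -/
lemma SmoothF.interp_le' {ι' : Type*} [Fintype ι'] (h : SmoothF F dF ddF C) (A : S → ι → ℝ) (B : S → ι' → ℝ)
    (c d : S → ℝ) (Δ : S → S → ℝ)
    (hΔ : ∀ s s', Δ s s' = ∑ k, A s k * A s' k - ∑ k, B s k * B s' k) {C₀ : ℝ}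
    (hC : ∀ t, 0 < t → t < 1 → ∫ g, Dexp dF ddF d Δ
      (Xt (fun s => Sum.elim (A s) 0 : S → ι ⊕ ι' → ℝ) (fun s => Sum.elim 0 (B s)) c d t g) ∂gp (ι ⊕ ι') ≤ C₀) :
    ∫ g, F (fun s => lf A g s + c s + d s) ∂gp ι ≤ ∫ g, F (fun s => lf B g s + c s) ∂gp ι' + C₀ := by
  have key := h.interp_le (fun s => Sum.elim (A s) 0 : S → ι ⊕ ι' → ℝ) (fun s => Sum.elim 0 (B s)) c d Δ
    (by intro s s'; simp) (by intro s s'; rw [hΔ]; simp) hC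
  have e1 : ∀ g : ι ⊕ ι' → ℝ, ∀ s, lf (fun s => Sum.elim (A s) 0 : S → ι ⊕ ι' → ℝ) g s = lf A (fun k => g (Sum.inl k)) s := by
    intro g s; simp [lf]
  have e2 : ∀ g : ι ⊕ ι' → ℝ, ∀ s, lf (fun s => Sum.elim 0 (B s) : S → ι ⊕ ι' → ℝ) g s = lf B (fun k => g (Sum.inr k)) s := by
    intro g s; simp [lf]
  simp only [e1, e2] at key
  rw [gp_integral_comp_inj Sum.inl Sum.inl_injective (f := fun g => F (fun s => lf A g s + c s + d s)),
    gp_integral_comp_inj Sum.inr Sum.inr_injective (f := fun g => F (fun s => lf B g s + c s))] at key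
  · exact key
  · exact (h.cF.comp (continuous_pi fun s => ((lf_cont B s).add continuous_const))).aestronglyMeasurable
  · exact (h.cF.comp (continuous_pi fun s => (((lf_cont A s).add continuous_const)).add continuous_const)).aestronglyMeasurable

end
end

section
section
variable {K J : Type*} [Fintype K] [Fintype J] [Nonempty K] [Nonempty J]

/-- inner partition function -/
def Zin (x : K × J → ℝ) (k : K) : ℝ := ∑ j, exp (x (k, j))
/-- outer partition function -/
def Zout (m : ℝ) (x : K × J → ℝ) : ℝ := ∑ k, Zin x k ^ m
/-- the functional `(1/m) log ∑_k (∑_j e^{x_kj})^m` -/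
def Fm (m : ℝ) (x : K × J → ℝ) : ℝ := (1 / m) * log (Zout m x)
/-- inner Gibbs weight -/
def muw (x : K × J → ℝ) (k : K) (j : J) : ℝ := exp (x (k, j)) / Zin x k
/-- outer weight -/
def pw (m : ℝ) (x : K × J → ℝ) (k : K) : ℝ := Zin x k ^ m / Zout m x
/-- total weight -/
def Ww (m : ℝ) (s : K × J) (x : K × J → ℝ) : ℝ := pw m x s.1 * muw x s.1 s.2

open Classical in
/-- second derivative of `Fm` -/
def ddFm (m : ℝ) (s s' : K × J) (x : K × J → ℝ) : ℝ :=
  Ww m s x * ((if s = s' then 1 else 0) - (1 - m) * (if s.1 = s'.1 then muw x s'.1 s'.2 else 0) - m * Ww m s' x)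

omit [Fintype K] [Nonempty K] in
lemma Zin_pos (x : K × J → ℝ) (k : K) : 0 < Zin x k :=
  sum_pos (fun _ _ => exp_pos _) univ_nonempty
lemma Zout_pos (m : ℝ) (x : K × J → ℝ) : 0 < Zout m x :=
  sum_pos (fun k _ => rpow_pos_of_pos (Zin_pos x k) m) univ_nonempty
omit [Fintype K] [Nonempty K] in
lemma muw_pos (x : K × J → ℝ) (k : K) (j : J) : 0 < muw x k j := div_pos (exp_pos _) (Zin_pos x k)
lemma pw_pos (m : ℝ) (x : K × J → ℝ) (k : K) : 0 < pw m x k :=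
  div_pos (rpow_pos_of_pos (Zin_pos x k) m) (Zout_pos m x)
lemma Ww_pos (m : ℝ) (s : K × J) (x : K × J → ℝ) : 0 < Ww m s x := mul_pos (pw_pos m x _) (muw_pos x _ _)
omit [Fintype K] [Nonempty K] in
lemma muw_sum (x : K × J → ℝ) (k : K) : ∑ j, muw x k j = 1 := by
  unfold muw; rw [← sum_div]; exact div_self (Zin_pos x k).ne'
lemma pw_sum (m : ℝ) (x : K × J → ℝ) : ∑ k, pw m x k = 1 := by
  unfold pw; rw [← sum_div]; exact div_self (Zout_pos m x).ne'
lemma Ww_sum_k (m : ℝ) (x : K × J → ℝ) (k : K) : ∑ j, Ww m (k, j) x = pw m x k := by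
  unfold Ww; simp only; rw [← mul_sum, muw_sum, mul_one]
lemma Ww_sum (m : ℝ) (x : K × J → ℝ) : ∑ s, Ww m s x = 1 := by
  rw [sum_prod_type]; simp_rw [Ww_sum_k]; exact pw_sum m x
lemma Ww_le (m : ℝ) (s : K × J) (x : K × J → ℝ) : Ww m s x ≤ 1 := by
  rw [← Ww_sum m x]
  exact single_le_sum (f := fun s => Ww m s x) (fun _ _ => (Ww_pos m _ x).le) (mem_univ s)
omit [Fintype K] [Nonempty K] in
lemma muw_le (x : K × J → ℝ) (k : K) (j : J) : muw x k j ≤ 1 := by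
  rw [← muw_sum x k]
  exact single_le_sum (f := fun j => muw x k j) (fun _ _ => (muw_pos x _ _).le) (mem_univ j)

omit [Fintype K] [Nonempty K] in
lemma Zin_cont (k : K) : Continuous (fun x : K × J → ℝ => Zin x k) := by
  unfold Zin; fun_prop
lemma Zout_cont (m : ℝ) : Continuous (fun x : K × J → ℝ => Zout m x) := by
  unfold Zout
  exact continuous_finsetSum _ fun k _ => (Zin_cont k).rpow_const (fun x => Or.inl (Zin_pos x k).ne')
lemma Fm_cont (m : ℝ) : Continuous (fun x : K × J → ℝ => Fm m x) := by
  unfold Fm; exact continuous_const.mul ((Zout_cont m).log fun x => (Zout_pos m x).ne')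
omit [Fintype K] [Nonempty K] in
lemma muw_cont (k : K) (j : J) : Continuous (fun x : K × J → ℝ => muw x k j) := by
  unfold muw; exact Continuous.div (by fun_prop) (Zin_cont k) (fun x => (Zin_pos x k).ne')
lemma pw_cont (m : ℝ) (k : K) : Continuous (fun x : K × J → ℝ => pw m x k) := by
  unfold pw; exact Continuous.div ((Zin_cont k).rpow_const (fun x => Or.inl (Zin_pos x k).ne')) (Zout_cont m)
    (fun x => (Zout_pos m x).ne')
lemma Ww_cont (m : ℝ) (s : K × J) : Continuous (fun x : K × J → ℝ => Ww m s x) :=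
  (pw_cont m _).mul (muw_cont _ _)

section deriv
variable {x : ℝ → K × J → ℝ} {x' : K × J → ℝ} {t : ℝ}

omit [Fintype K] [Nonempty K] in
lemma Zin_deriv (hx : ∀ s, HasDerivAt (fun t => x t s) (x' s) t) (k : K) :
    HasDerivAt (fun t => Zin (x t) k) (Zin (x t) k * ∑ j, muw (x t) k j * x' (k, j)) t := by
  unfold Zin
  refine (HasDerivAt.fun_sum (u := Finset.univ) fun j _ => (hx (k, j)).exp).congr_deriv ?_
  rw [mul_sum]
  refine scg fun j _ => ?_
  have := (Zin_pos (x t) k).ne'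
  unfold muw
  change _ = Zin (x t) k * _
  field_simp

omit [Fintype K] [Nonempty K] in
lemma Zin_rpow_deriv (m : ℝ) (hx : ∀ s, HasDerivAt (fun t => x t s) (x' s) t) (k : K) :
    HasDerivAt (fun t => Zin (x t) k ^ m) (Zin (x t) k ^ m * (m * ∑ j, muw (x t) k j * x' (k, j))) t := by
  refine ((Zin_deriv hx k).rpow_const (Or.inl (Zin_pos (x t) k).ne')).congr_deriv ?_
  have := (Zin_pos (x t) k)
  rw [rpow_sub_one this.ne']
  field_simp

lemma Zout_deriv (m : ℝ) (hx : ∀ s, HasDerivAt (fun t => x t s) (x' s) t) :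
    HasDerivAt (fun t => Zout m (x t)) (Zout m (x t) * (m * ∑ s, Ww m s (x t) * x' s)) t := by
  unfold Zout
  refine (HasDerivAt.fun_sum (u := Finset.univ) fun k _ => Zin_rpow_deriv m hx k).congr_deriv ?_
  change _ = Zout m (x t) * _
  rw [sum_prod_type, mul_sum, mul_sum]
  refine scg fun k _ => ?_
  have := (Zout_pos m (x t)).ne'
  simp only [Ww, mul_assoc]
  rw [← mul_sum]
  unfold pw
  field_simp

lemma Fm_deriv {m : ℝ} (hm : 0 < m) (hx : ∀ s, HasDerivAt (fun t => x t s) (x' s) t) :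
    HasDerivAt (fun t => Fm m (x t)) (∑ s, Ww m s (x t) * x' s) t := by
  unfold Fm
  refine (((Zout_deriv m hx).log (Zout_pos m (x t)).ne').const_mul (1 / m)).congr_deriv ?_
  have := (Zout_pos m (x t)).ne'
  field_simp

lemma Ww_deriv (m : ℝ) (s : K × J) (hx : ∀ s, HasDerivAt (fun t => x t s) (x' s) t) :
    HasDerivAt (fun t => Ww m s (x t)) (∑ s', ddFm m s s' (x t) * x' s') t := by
  classical
  unfold Ww pw muw
  have h1 := (Zin_rpow_deriv m hx s.1).div (Zout_deriv m hx) (Zout_pos m (x t)).ne'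
  have h2 := ((hx s).exp).div (Zin_deriv hx s.1) (Zin_pos (x t) s.1).ne'
  refine (h1.mul h2).congr_deriv ?_
  have hz := (Zin_pos (x t) s.1).ne'
  have hzz := (Zout_pos m (x t)).ne'
  have e : ∑ s', ddFm m s s' (x t) * x' s'
      = Ww m s (x t) * (x' s - (1 - m) * ∑ j, muw (x t) s.1 j * x' (s.1, j) - m * ∑ s', Ww m s' (x t) * x' s') := by
    have e1 : ∑ s', (if s = s' then (1:ℝ) else 0) * x' s' = x' s := by simp
    have e2 : ∑ s' : K × J, (if s.1 = s'.1 then muw (x t) s'.1 s'.2 else 0) * x' s'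
        = ∑ j, muw (x t) s.1 j * x' (s.1, j) := by
      rw [sum_prod_type, Finset.sum_eq_single s.1]
      · simp
      · intro k _ hk; simp [hk.symm]
      · simp
    rw [← e1, ← e2]
    simp only [mul_sum, ← sum_sub_distrib]
    refine scg fun s' _ => ?_
    unfold ddFm; ring
  rw [e]
  simp only [Pi.div_apply]
  unfold Ww pw
  set Q := ∑ s', Zin (x t) s'.1 ^ m / Zout m (x t) * muw (x t) s'.1 s'.2 * x' s'
  set R := ∑ j, muw (x t) s.1 j * x' (s.1, j)
  unfold muw
  field_simp
  ring
end deriv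

lemma Fm_smooth {m : ℝ} (hm : 0 < m) : SmoothF (S := K × J) (Fm m) (Ww m) (ddFm m) (3 + 2 * m) where
  cdF := Ww_cont m
  cddF := by
    intro s s'
    unfold ddFm
    refine (Ww_cont m s).mul ((continuous_const.sub (continuous_const.mul ?_)).sub (continuous_const.mul (Ww_cont m s')))
    split_ifs
    · exact muw_cont _ _
    · exact continuous_const
  bdF := by
    intro s x
    rw [abs_of_nonneg (Ww_pos m s x).le]; linarith [Ww_le m s x]
  bddF := by
    intro s s' x
    unfold ddFm
    rw [abs_mul, abs_of_nonneg (Ww_pos m s x).le]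
    have h1 := Ww_le m s x
    have h2 := Ww_le m s' x
    have h3 := Ww_pos m s x
    have h4 := Ww_pos m s' x
    have h5 := muw_le x s'.1 s'.2
    have h6 := muw_pos x s'.1 s'.2
    refine (mul_le_of_le_one_left (abs_nonneg _) h1).trans ?_
    rw [abs_le]
    constructor <;> split_ifs <;> nlinarith
  cF := Fm_cont m
  hF := fun x x' t hx => Fm_deriv hm hx
  hdF := fun s x x' t hx => Ww_deriv m s hx

lemma Fm_Dexp (m : ℝ) (d : K × J → ℝ) (Δ : K × J → K × J → ℝ) (x : K × J → ℝ) :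
    Dexp (Ww m) (ddFm m) d Δ x = ∑ s, Ww m s x * d s + (1 / 2) * (∑ s, Ww m s x * Δ s s
      - (1 - m) * ∑ s : K × J, ∑ j', Ww m s x * muw x s.1 j' * Δ s (s.1, j')
      - m * ∑ s, ∑ s', Ww m s x * Ww m s' x * Δ s s') := by
  classical
  unfold Dexp
  congr 2
  rw [mul_sum, mul_sum, ← sum_sub_distrib, ← sum_sub_distrib]
  refine scg fun s _ => ?_
  have e1 : Ww m s x * Δ s s = ∑ s', (if s = s' then (1:ℝ) else 0) * (Ww m s x * Δ s s') := by simp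
  have e2 : ∑ j', Ww m s x * muw x s.1 j' * Δ s (s.1, j')
     = ∑ s' : K × J, (if s.1 = s'.1 then muw x s'.1 s'.2 else 0) * (Ww m s x * Δ s s') := by
      rw [sum_prod_type, Finset.sum_eq_single s.1]
      · simp
        refine scg fun j _ => by ring
      · intro k _ hk; simp [hk.symm]
      · simp
  rw [e1, e2, mul_sum, mul_sum, ← sum_sub_distrib, ← sum_sub_distrib]
  refine scg fun s' _ => ?_
  unfold ddFm; ring

lemma Fm_Dexp_le {m : ℝ} (hm : 0 ≤ m) (hm1 : m ≤ 1) (d : K × J → ℝ) (Δ : K × J → K × J → ℝ) (b e : K × J → ℝ)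
    {C₀ : ℝ} {D : K → K → ℝ}
    (hb : ∀ k j j', b (k, j) + b (k, j') ≤ Δ (k, j) (k, j'))
    (he : ∀ s s', e s + e s' - D s.1 s'.1 ≤ Δ s s')
    (hC : ∀ s, d s + 1 / 2 * Δ s s - (1 - m) * b s - m * e s ≤ C₀) (x : K × J → ℝ) :
    Dexp (Ww m) (ddFm m) d Δ x ≤ C₀ + m / 2 * ∑ k, ∑ k', pw m x k * pw m x k' * D k k' := by
  rw [Fm_Dexp]
  have h1 : 2 * ∑ s, Ww m s x * b s ≤ ∑ s : K × J, ∑ j', Ww m s x * muw x s.1 j' * Δ s (s.1, j') := by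
    have e1 : ∑ s : K × J, ∑ j', Ww m s x * muw x s.1 j' * (b s + b (s.1, j')) = 2 * ∑ s, Ww m s x * b s := by
      simp_rw [mul_add, sum_add_distrib]
      rw [two_mul]
      congr 1
      · refine scg fun s _ => ?_
        rw [← sum_mul, ← mul_sum, muw_sum, mul_one]
      · rw [sum_prod_type, sum_prod_type]
        refine scg fun k _ => ?_
        rw [sum_comm]
        refine scg fun j' _ => ?_
        simp only
        rw [← sum_mul, ← sum_mul, Ww_sum_k]
        rfl
    rw [← e1]
    refine sum_le_sum fun s _ => sum_le_sum fun j' _ => ?_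
    exact mul_le_l (hb _ _ _) (mul_nonneg (Ww_pos m s x).le (muw_pos x _ _).le)
  have h2 : 2 * ∑ s, Ww m s x * e s - ∑ k, ∑ k', pw m x k * pw m x k' * D k k'
      ≤ ∑ s, ∑ s', Ww m s x * Ww m s' x * Δ s s' := by
    have e1 : ∑ s : K × J, ∑ s' : K × J, Ww m s x * Ww m s' x * (e s + e s') = 2 * ∑ s, Ww m s x * e s := by
      simp_rw [mul_add, sum_add_distrib]
      rw [two_mul]
      congr 1
      · refine scg fun s _ => ?_
        rw [← sum_mul, ← mul_sum, Ww_sum, mul_one]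
      · rw [sum_comm]
        refine scg fun s' _ => ?_
        rw [← sum_mul, ← sum_mul, Ww_sum, one_mul]
    have e2 : ∑ s : K × J, ∑ s' : K × J, Ww m s x * Ww m s' x * D s.1 s'.1
        = ∑ k, ∑ k', pw m x k * pw m x k' * D k k' := by
      rw [sum_prod_type]
      refine scg fun k _ => ?_
      simp_rw [sum_prod_type]
      rw [sum_comm]
      refine scg fun k' _ => ?_
      simp_rw [← sum_mul, ← mul_sum, Ww_sum_k, ← sum_mul, Ww_sum_k]
    rw [← e1, ← e2]
    rw [← sum_sub_distrib]
    refine sum_le_sum fun s _ => ?_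
    rw [← sum_sub_distrib]
    refine sum_le_sum fun s' _ => ?_
    rw [← mul_sub]
    exact mul_le_l (he _ _) (mul_nonneg (Ww_pos m s x).le (Ww_pos m s' x).le)
  have h3 : ∑ s, Ww m s x * (d s + 1 / 2 * Δ s s - (1 - m) * b s - m * e s) ≤ C₀ := by
    calc _ ≤ ∑ s, Ww m s x * C₀ := sum_le_sum fun s _ => mul_le_l (hC s) (Ww_pos m s x).le
      _ = C₀ := by rw [← sum_mul, Ww_sum, one_mul]
  have h4 : ∑ s, Ww m s x * (d s + 1 / 2 * Δ s s - (1 - m) * b s - m * e s)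
      = ∑ s, Ww m s x * d s + 1 / 2 * ∑ s, Ww m s x * Δ s s - (1 - m) * ∑ s, Ww m s x * b s - m * ∑ s, Ww m s x * e s := by
    simp only [mul_sum, ← sum_add_distrib, ← sum_sub_distrib]
    refine scg fun s _ => by ring
  rw [h4] at h3
  have h5 := mul_le_l h1 (sub_nonneg.2 hm1)
  have h6 := mul_le_l h2 hm
  nlinarith

end
end

section
section
variable {K J S ι ι' : Type*} [Fintype K] [Fintype J] [Nonempty K] [Nonempty J] [Fintype S] [Fintype ι] [Fintype ι']

lemma SmoothF.Dexp_cont {F : (S → ℝ) → ℝ} {dF : S → (S → ℝ) → ℝ} {ddF : S → S → (S → ℝ) → ℝ} {C : ℝ}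
    (h : SmoothF F dF ddF C) (d : S → ℝ) (Δ : S → S → ℝ) : Continuous (Dexp dF ddF d Δ) := by
  unfold Dexp
  refine (continuous_finsetSum _ fun s _ => (h.cdF s).mul continuous_const).add (continuous_const.mul
    (continuous_finsetSum _ fun s _ => continuous_finsetSum _ fun s' _ => continuous_const.mul (h.cddF s s')))

lemma SmoothF.Dexp_bdd {F : (S → ℝ) → ℝ} {dF : S → (S → ℝ) → ℝ} {ddF : S → S → (S → ℝ) → ℝ} {C : ℝ}
    (h : SmoothF F dF ddF C) (d : S → ℝ) (Δ : S → S → ℝ) :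
    ∀ x, |Dexp dF ddF d Δ x| ≤ ∑ s, C * |d s| + (1 / 2) * ∑ s, ∑ s', |Δ s s'| * C := by
  intro x
  unfold Dexp
  refine (abs_add_le _ _).trans (add_le_add ?_ ?_)
  · refine (abs_sum_le_sum_abs _ _).trans (sum_le_sum fun s _ => ?_)
    rw [abs_mul]; exact mul_le_r (h.bdF s x) (abs_nonneg _)
  · rw [abs_mul, abs_of_nonneg (by norm_num : (0:ℝ) ≤ 1 / 2)]
    refine mul_le_l ?_ (by norm_num)
    refine (abs_sum_le_sum_abs _ _).trans (sum_le_sum fun s _ => ?_)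
    refine (abs_sum_le_sum_abs _ _).trans (sum_le_sum fun s' _ => ?_)
    rw [abs_mul]; exact mul_le_l (h.bddF s s' x) (abs_nonneg _)

lemma SmoothF.Dexp_integrable {F : (S → ℝ) → ℝ} {dF : S → (S → ℝ) → ℝ} {ddF : S → S → (S → ℝ) → ℝ} {C : ℝ}
    (h : SmoothF F dF ddF C) (d : S → ℝ) (Δ : S → S → ℝ) {α : Type*} [MeasurableSpace α] {μ : Measure α}
    [IsProbabilityMeasure μ] {X : α → S → ℝ} (hX : Measurable X) :
    Integrable (fun a => Dexp dF ddF d Δ (X a)) μ := by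
  refine (integrable_const (∑ s, C * |d s| + (1 / 2) * ∑ s, ∑ s', |Δ s s'| * C)).mono'
    ((h.Dexp_cont d Δ).measurable.comp hX).aestronglyMeasurable ?_
  filter_upwards with a; exact h.Dexp_bdd d Δ _

lemma SmoothF.interp_le_pt {F : (S → ℝ) → ℝ} {dF : S → (S → ℝ) → ℝ} {ddF : S → S → (S → ℝ) → ℝ} {C : ℝ}
    (h : SmoothF F dF ddF C) (A : S → ι → ℝ) (B : S → ι' → ℝ)
    (c d : S → ℝ) (Δ : S → S → ℝ)
    (hΔ : ∀ s s', Δ s s' = ∑ k, A s k * A s' k - ∑ k, B s k * B s' k) {C₀ : ℝ}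
    (hC : ∀ x, Dexp dF ddF d Δ x ≤ C₀) :
    ∫ g, F (fun s => lf A g s + c s + d s) ∂gp ι ≤ ∫ g, F (fun s => lf B g s + c s) ∂gp ι' + C₀ := by
  refine h.interp_le' A B c d Δ hΔ ?_
  intro t _ _
  calc _ ≤ ∫ g : ι ⊕ ι' → ℝ, C₀ ∂gp (ι ⊕ ι') := by
        refine integral_mono (h.Dexp_integrable d Δ (Xt_cont _ _ c d t).measurable) (integrable_const _) fun g => hC _
    _ = C₀ := by simp

lemma Fm_interp {m : ℝ} (hm : 0 < m) (hm1 : m ≤ 1) (A : K × J → ι → ℝ) (B : K × J → ι' → ℝ) (c d : K × J → ℝ)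
    (Δ : K × J → K × J → ℝ) (hΔ : ∀ s s', Δ s s' = ∑ k, A s k * A s' k - ∑ k, B s k * B s' k)
    (b e : K × J → ℝ) {C₀ D : ℝ}
    (hb : ∀ k j j', b (k, j) + b (k, j') ≤ Δ (k, j) (k, j'))
    (he : ∀ s s', e s + e s' - D ≤ Δ s s')
    (hC : ∀ s, d s + 1 / 2 * Δ s s - (1 - m) * b s - m * e s ≤ C₀) :
    ∫ g, Fm m (fun s => lf A g s + c s + d s) ∂gp ι ≤ ∫ g, Fm m (fun s => lf B g s + c s) ∂gp ι' + (C₀ + m / 2 * D) := by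
  refine (Fm_smooth hm).interp_le_pt A B c d Δ hΔ ?_
  intro x
  refine (Fm_Dexp_le hm.le hm1 d Δ b e (D := fun _ _ => D) hb he hC x).trans (le_of_eq ?_)
  congr 2
  rw [← one_mul D]
  simp_rw [← mul_assoc, ← sum_mul, ← mul_sum, mul_one, pw_sum]
  simp_rw [mul_one, pw_sum]
end
end

section
section
variable {J ι : Type*} [Fintype J] [Fintype ι] [Nonempty J]

/-- log-sum-exp -/
def lse (x : J → ℝ) : ℝ := log (∑ j, exp (x j))

lemma lse_sum_pos (x : J → ℝ) : 0 < ∑ j, exp (x j) := sum_pos (fun _ _ => exp_pos _) univ_nonempty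

lemma lse_cont : Continuous (lse (J := J)) := by
  unfold lse
  exact Continuous.log (by fun_prop) (fun x => (lse_sum_pos x).ne')

lemma lse_mono {x y : J → ℝ} (h : ∀ j, x j ≤ y j) : lse x ≤ lse y := by
  unfold lse
  exact log_le_log (lse_sum_pos x) (sum_le_sum fun j _ => exp_le_exp.2 (h j))

lemma lse_add_const (x : J → ℝ) (c : ℝ) : lse (fun j => x j + c) = lse x + c := by
  unfold lse
  simp_rw [exp_add]
  rw [← sum_mul, log_mul (lse_sum_pos x).ne' (exp_pos c).ne', log_exp]

lemma lse_ge (x : J → ℝ) (j : J) : x j ≤ lse x := by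
  unfold lse
  rw [le_log_iff_exp_le (lse_sum_pos x)]
  exact single_le_sum (f := fun j => exp (x j)) (fun _ _ => (exp_pos _).le) (mem_univ j)

lemma lse_abs_le (x : J → ℝ) : |lse x| ≤ log (Fintype.card J) + ∑ j, |x j| := by
  have hc : (0:ℝ) < Fintype.card J := by exact_mod_cast Fintype.card_pos
  have h0 : 0 ≤ log (Fintype.card J) := log_natCast_nonneg _
  have hj : ∀ j, |x j| ≤ ∑ j, |x j| := fun j =>
    single_le_sum (f := fun j => |x j|) (fun _ _ => abs_nonneg _) (mem_univ j)
  rw [abs_le]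
  constructor
  · have j := Classical.arbitrary J
    have := lse_ge x j
    have := neg_abs_le (x j)
    have := hj j
    linarith
  · unfold lse
    have : ∑ j, exp (x j) ≤ Fintype.card J * exp (∑ j, |x j|) := by
      calc _ ≤ ∑ j : J, exp (∑ j, |x j|) := sum_le_sum fun j _ => exp_le_exp.2 ((le_abs_self _).trans (hj j))
        _ = _ := by simp
    refine (log_le_log (lse_sum_pos x) this).trans ?_
    rw [log_mul hc.ne' (exp_pos _).ne', log_exp]

lemma lse_integrable {α : Type*} [MeasurableSpace α] {μ : Measure α} [IsFiniteMeasure μ] {X : α → J → ℝ}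
    (hX : ∀ j, Integrable (fun a => X a j) μ) : Integrable (fun a => lse (X a)) μ := by
  have h1 : Integrable (fun a => log (Fintype.card J) + ∑ j, |X a j|) μ :=
    (integrable_const _).add (integrable_finsetSum _ fun j _ => (hX j).abs)
  refine h1.mono' ?_ ?_
  · have : AEMeasurable X μ := aemeasurable_pi_iff.2 fun s => (hX s).1.aemeasurable
    exact (lse_cont.measurable.comp_aemeasurable this).aestronglyMeasurable
  · filter_upwards with a; exact lse_abs_le _

lemma lf_add_integrable (A : J → ι → ℝ) (c : J → ℝ) (j : J) : Integrable (fun g => lf A g j + c j) (gp ι) :=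
  (lf_integrable A j).add (integrable_const _)

/-- Concentration of the log-partition function. -/
lemma concentration (A : J → ι → ℝ) (c : J → ℝ) {V : ℝ} (hV : 1 ≤ V)
    (hA : ∀ j j', ∑ k, A j k * A j' k ≤ V) :
    ∫ g, |lse (fun j => lf A g j + c j) - ∫ g', lse (fun j => lf A g' j + c j) ∂gp ι| ∂gp ι ≤ 3 * √V := by
  set f : (ι → ℝ) → ℝ := fun g => lse (fun j => lf A g j + c j) with hf
  have hfi : Integrable f (gp ι) := lse_integrable (lf_add_integrable A c)
  have hs1 : 1 ≤ √V := Real.one_le_sqrt.2 hV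
  set m := 1 / √V with hm
  have hm0 : 0 < m := by positivity
  have hm1 : m ≤ 1 := by rw [hm]; exact (div_le_one (by linarith)).2 hs1
  set A2 : Bool × J → ι ⊕ ι → ℝ := fun s => if s.1 then Sum.elim (A s.2) 0 else Sum.elim 0 (A s.2) with hA2
  set Δ : Bool × J → Bool × J → ℝ := fun s s' => if s.1 = s'.1 then 0 else - ∑ k, A s.2 k * A s'.2 k with hΔ
  have key := Fm_interp (K := Bool) (J := J) hm0 hm1 (ι := ι ⊕ ι) (ι' := ι) A2 (fun s => A s.2)
    (fun s => c s.2) 0 Δ (by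
      rintro ⟨k, j⟩ ⟨k', j'⟩
      cases k <;> cases k' <;> simp [hA2, hΔ]) 0 0 (C₀ := 0) (D := V) (by intro k j j'; simp [hΔ]) (by
            rintro ⟨k, j⟩ ⟨k', j'⟩
            simp only [hΔ]
            split_ifs
            · simp; linarith
            · simp; exact hA _ _) (by intro s; simp [hΔ])
  have hZ1 : ∀ x : J → ℝ, (∑ j, exp (x j)) ^ m = exp (m * lse x) := by
    intro x
    rw [rpow_def_of_pos (lse_sum_pos x), mul_comm]; rfl
  have hF2 : ∀ g : ι → ℝ, Fm m (fun s : Bool × J => lf (fun s => A s.2) g s + c s.2) = log 2 / m + f g := by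
    intro g
    simp only [Fm, Zout, Zin, sum_bool]
    have : ∀ j k, lf (fun s : Bool × J => A s.2) g (k, j) = lf A g j := fun j k => rfl
    simp only [this, hZ1]
    rw [← two_mul, log_mul (by norm_num) (exp_pos _).ne', log_exp]
    simp only [hf]
    field_simp
  have hF1 : ∀ g : ι ⊕ ι → ℝ, max (f (fun k => g (Sum.inl k))) (f (fun k => g (Sum.inr k)))
      ≤ Fm m (fun s : Bool × J => lf A2 g s + c s.2 + (0 : Bool × J → ℝ) s) := by
    intro g
    simp only [Fm, Zout, Zin, sum_bool]
    have e1 : ∀ j, lf A2 g (true, j) + c j + (0 : Bool × J → ℝ) (true, j) = lf A (fun k => g (Sum.inl k)) j + c j := by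
      intro j; simp [lf, hA2]
    have e2 : ∀ j, lf A2 g (false, j) + c j + (0 : Bool × J → ℝ) (false, j) = lf A (fun k => g (Sum.inr k)) j + c j := by
      intro j; simp [lf, hA2]
    simp only [e1, e2, hZ1]
    rw [one_div, ← div_eq_inv_mul, le_div_iff₀ hm0, le_log_iff_exp_le (by positivity)]
    rcases max_cases (f (fun k => g (Sum.inl k))) (f (fun k => g (Sum.inr k))) with h | h <;> rw [h.1, mul_comm]
    · simp only [hf]; linarith [exp_pos (m * lse fun j => lf A (fun k => g (Sum.inr k)) j + c j)]
    · simp only [hf]; linarith [exp_pos (m * lse fun j => lf A (fun k => g (Sum.inl k)) j + c j)]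
  simp_rw [hF2] at key
  have hi1 : Integrable (fun g : ι ⊕ ι → ℝ => f (fun k => g (Sum.inl k))) (gp (ι ⊕ ι)) :=
    ((gp_comp_inj Sum.inl Sum.inl_injective).integrable_comp hfi.1).2 hfi
  have hi2 : Integrable (fun g : ι ⊕ ι → ℝ => f (fun k => g (Sum.inr k))) (gp (ι ⊕ ι)) :=
    ((gp_comp_inj Sum.inr Sum.inr_injective).integrable_comp hfi.1).2 hfi
  have hle := (integral_mono (μ := gp (ι ⊕ ι)) (hi1.sup hi2) ((Fm_smooth hm0).integrable _ (fun s =>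
    ((lf_integrable A2 s).add (integrable_const _)).add (integrable_const _))) hF1).trans key
  rw [integral_add (integrable_const _) hfi] at hle
  have hmax : ∀ g : ι ⊕ ι → ℝ, max (f (fun k => g (Sum.inl k))) (f (fun k => g (Sum.inr k)))
      = (f (fun k => g (Sum.inl k)) + f (fun k => g (Sum.inr k)) + |f (fun k => g (Sum.inr k)) - f (fun k => g (Sum.inl k))|) / 2 :=
    fun g => by
      rcases le_total (f (fun k => g (Sum.inl k))) (f (fun k => g (Sum.inr k))) with h | h
      · rw [max_eq_right h, abs_of_nonneg (by linarith)]; ring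
      · rw [max_eq_left h, abs_of_nonpos (by linarith)]; ring
  have hi3 : Integrable (fun g : ι ⊕ ι → ℝ => |f (fun k => g (Sum.inr k)) - f (fun k => g (Sum.inl k))|) (gp (ι ⊕ ι)) :=
    (hi2.sub hi1).abs
  have hi4 : Integrable (fun g : ι ⊕ ι → ℝ => f (fun k => g (Sum.inl k)) + f (fun k => g (Sum.inr k))) (gp (ι ⊕ ι)) :=
    hi1.add hi2
  have e1 : ∫ g : ι ⊕ ι → ℝ, (f (fun k => g (Sum.inl k)) ⊔ f (fun k => g (Sum.inr k))) ∂gp (ι ⊕ ι)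
      = (∫ g, f g ∂gp ι + ∫ g, f g ∂gp ι + ∫ g : ι ⊕ ι → ℝ, |f (fun k => g (Sum.inr k)) - f (fun k => g (Sum.inl k))| ∂gp (ι ⊕ ι)) / 2 := by
    simp_rw [hmax]
    rw [integral_div, integral_add hi4 hi3, integral_add hi1 hi2,
      gp_integral_comp_inj Sum.inl Sum.inl_injective hfi.1, gp_integral_comp_inj Sum.inr Sum.inr_injective hfi.1]
  have e2 : ∫ g : ι ⊕ ι → ℝ, |f (fun k => g (Sum.inr k)) - f (fun k => g (Sum.inl k))| ∂gp (ι ⊕ ι)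
      ≤ 2 * (log 2 / m + m / 2 * V) := by
    have h0 : ∫ g : ι ⊕ ι → ℝ, (f (fun k => g (Sum.inl k)) ⊔ f (fun k => g (Sum.inr k))) ∂gp (ι ⊕ ι) ≤ log 2 / m + ∫ g, f g ∂gp ι + m / 2 * V := by
      refine hle.trans (le_of_eq ?_); simp
    rw [e1] at h0; linarith
  have e3 : 2 * (log 2 / m + m / 2 * V) ≤ 3 * √V := by
    have hsq : √V * √V = V := Real.mul_self_sqrt (by linarith)
    have : log 2 / m = log 2 * √V := by rw [hm]; field_simp
    rw [this]
    have : m / 2 * V = √V / 2 := by rw [hm]; field_simp; nlinarith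
    rw [this]
    have := Real.log_two_lt_d9
    nlinarith
  rw [gp_sum_integral hi3] at e2
  simp only [Sum.elim_inl, Sum.elim_inr] at e2
  refine le_trans ?_ (e2.trans e3)
  refine integral_mono_of_nonneg (by filter_upwards with g; exact abs_nonneg _) ?_ ?_
  · have h5 := (gp_sum_mp (ι := ι) (κ := ι)).integrable_comp hi3.1 |>.2 hi3
    have h6 := h5.integral_prod_left
    simpa using h6
  · filter_upwards with g
    have h7 : ∫ y, (f y - f g) ∂gp ι = ∫ y, f y ∂gp ι - f g := by
      rw [integral_sub hfi (integrable_const _)]; simp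
    have h8 := abs_integral_le_integral_abs (f := fun y => f y - f g) (μ := gp ι)
    rw [h7, abs_sub_comm] at h8
    exact h8
end
end

section
section
variable {J ι ι0 ι1 : Type*} [Fintype J] [Nonempty J] [Fintype ι] [Fintype ι0] [Fintype ι1]

lemma pw_sq_bound {K : Type*} [Fintype K] [Nonempty K] {m : ℝ} (hm : 0 < m) (hm1 : m ≤ 1) (x : K × J → ℝ)
    (U : J → ℝ) (ζ : K → ℝ) (hx : ∀ k j, |x (k, j) - U j| ≤ ζ k) :
    ∑ k, pw m x k ^ 2 ≤ (Fintype.card K : ℝ)⁻¹ ^ 2 * ∑ k, exp (4 * ζ k) := by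
  set Z0 := ∑ j, exp (U j) with hZ0
  have hZ0p : 0 < Z0 := lse_sum_pos U
  have hζ : ∀ k, 0 ≤ ζ k := fun k => (abs_nonneg _).trans (hx k (Classical.arbitrary J))
  have hup : ∀ k, Zin x k ≤ exp (ζ k) * Z0 := by
    intro k
    unfold Zin
    rw [hZ0, mul_sum]
    refine sum_le_sum fun j _ => ?_
    rw [← exp_add, exp_le_exp]
    linarith [(abs_le.1 (hx k j)).2]
  have hlo : ∀ k, exp (- ζ k) * Z0 ≤ Zin x k := by
    intro k
    unfold Zin
    rw [hZ0, mul_sum]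
    refine sum_le_sum fun j _ => ?_
    rw [← exp_add, exp_le_exp]
    linarith [(abs_le.1 (hx k j)).1]
  have hup' : ∀ k, Zin x k ^ m ≤ exp (ζ k) * Z0 ^ m := by
    intro k
    refine (rpow_le_rpow (Zin_pos x k).le (hup k) hm.le).trans ?_
    rw [mul_rpow (exp_pos _).le hZ0p.le, ← exp_mul]
    refine mul_le_r (exp_le_exp.2 ?_) (rpow_nonneg hZ0p.le m)
    nlinarith [hζ k]
  have hlo' : ∀ k, exp (-ζ k) * Z0 ^ m ≤ Zin x k ^ m := by
    intro k
    refine le_trans ?_ (rpow_le_rpow (by positivity) (hlo k) hm.le)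
    rw [mul_rpow (exp_pos _).le hZ0p.le, ← exp_mul]
    refine mul_le_r (exp_le_exp.2 ?_) (rpow_nonneg hZ0p.le m)
    nlinarith [hζ k]
  have hZm : 0 < Z0 ^ m := rpow_pos_of_pos hZ0p m
  set E := ∑ k, exp (ζ k) with hE
  set E' := ∑ k, exp (-ζ k) with hE'
  have hE'p : 0 < E' := sum_pos (fun _ _ => exp_pos _) univ_nonempty
  have hEp : 0 < E := sum_pos (fun _ _ => exp_pos _) univ_nonempty
  have hout : E' * Z0 ^ m ≤ Zout m x := by
    unfold Zout; rw [hE', sum_mul]; exact sum_le_sum fun k _ => hlo' k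
  set n : ℝ := (Fintype.card K : ℝ) with hn
  have hnp : 0 < n := by rw [hn]; exact_mod_cast Fintype.card_pos
  have hCS : n ^ 2 ≤ E * E' := by
    have := Finset.sum_mul_sq_le_sq_mul_sq Finset.univ (fun k => exp (ζ k / 2)) (fun k => exp (-ζ k / 2))
    simp only [← exp_add, ← exp_nat_mul] at this
    have e1 : ∀ k : K, ζ k / 2 + -ζ k / 2 = 0 := fun k => by ring
    have e2 : ∀ k : K, ((2:ℕ):ℝ) * (ζ k / 2) = ζ k := fun k => by push_cast; ring
    have e3 : ∀ k : K, ((2:ℕ):ℝ) * (- ζ k / 2) = - ζ k := fun k => by push_cast; ring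
    simp only [e1, e2, e3] at this
    simpa [hn] using this
  have hp : ∀ k, pw m x k ≤ exp (ζ k) * E / n ^ 2 := by
    intro k
    unfold pw
    calc _ ≤ (exp (ζ k) * Z0 ^ m) / (E' * Z0 ^ m) := by
          gcongr
          exact hup' k
      _ = exp (ζ k) / E' := by field_simp
      _ ≤ _ := by
          rw [div_le_div_iff₀ hE'p (by positivity)]
          nlinarith [exp_pos (ζ k)]
  have hE2 : E ^ 2 ≤ n * ∑ k, exp (2 * ζ k) := by
    have := sq_sum_le_card_mul_sum_sq (s := Finset.univ) (f := fun k => exp (ζ k))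
    simpa [← exp_nat_mul, hn, hE] using this
  have hE4 : (∑ k, exp (2 * ζ k)) ^ 2 ≤ n * ∑ k, exp (4 * ζ k) := by
    have := sq_sum_le_card_mul_sum_sq (s := Finset.univ) (f := fun k => exp (2 * ζ k))
    simp only [← exp_nat_mul, Finset.card_univ] at this
    have e3 : ∀ k : K, ((2:ℕ):ℝ) * (2 * ζ k) = 4 * ζ k := fun k => by push_cast; ring
    simpa only [e3] using this
  calc ∑ k, pw m x k ^ 2 ≤ ∑ k, (exp (ζ k) * E / n ^ 2) ^ 2 :=
        sum_le_sum fun k _ => pow_le_pow_left₀ (pw_pos m x k).le (hp k) 2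
    _ = (∑ k, exp (2 * ζ k)) * E ^ 2 / n ^ 4 := by
        rw [sum_mul, sum_div]
        refine scg fun k _ => ?_
        have : exp (2 * ζ k) = exp (ζ k) ^ 2 := by rw [← exp_nat_mul]; norm_num
        rw [this]; ring
    _ ≤ (∑ k, exp (2 * ζ k)) * (n * ∑ k, exp (2 * ζ k)) / n ^ 4 := by
        have : 0 ≤ ∑ k, exp (2 * ζ k) := sum_nonneg fun _ _ => (exp_pos _).le
        gcongr
    _ = n * (∑ k, exp (2 * ζ k)) ^ 2 / n ^ 4 := by ring
    _ ≤ n * (n * ∑ k, exp (4 * ζ k)) / n ^ 4 := by gcongr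
    _ = _ := by field_simp

/-- two-level partition function -/
def Z2 (B0 : J → ι0 → ℝ) (B1 : J → ι1 → ℝ) (c : J → ℝ) (x : ι0 → ℝ) (y : ι1 → ℝ) : ℝ :=
  ∑ j, exp (lf B0 x j + lf B1 y j + c j)

lemma lf_abs_le (B1 : J → ι1 → ℝ) {L : ℝ} (hL : ∀ j i, |B1 j i| ≤ L) (y : ι1 → ℝ) (j : J) :
    |lf B1 y j| ≤ L * ∑ i, |y i| := by
  unfold lf
  refine (abs_sum_le_sum_abs _ _).trans ?_
  rw [mul_sum]
  refine sum_le_sum fun i _ => ?_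
  rw [abs_mul]; exact mul_le_r (hL j i) (abs_nonneg _)

section Z2
variable (B0 : J → ι0 → ℝ) (B1 : J → ι1 → ℝ) (c : J → ℝ) {L : ℝ} (hL : ∀ j i, |B1 j i| ≤ L)

lemma Z2_pos (x : ι0 → ℝ) (y : ι1 → ℝ) : 0 < Z2 B0 B1 c x y :=
  sum_pos (fun _ _ => exp_pos _) univ_nonempty

lemma Z2_cont : Continuous (fun p : (ι0 → ℝ) × (ι1 → ℝ) => Z2 B0 B1 c p.1 p.2) := by
  unfold Z2 lf; fun_prop

lemma Z2_rpow_cont (m : ℝ) : Continuous (fun p : (ι0 → ℝ) × (ι1 → ℝ) => Z2 B0 B1 c p.1 p.2 ^ m) :=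
  (Z2_cont B0 B1 c).rpow_const fun p => Or.inl (Z2_pos B0 B1 c p.1 p.2).ne'

include hL in
lemma Z2_up {m : ℝ} (hm : 0 < m) (x : ι0 → ℝ) (y : ι1 → ℝ) :
    Z2 B0 B1 c x y ^ m ≤ exp (m * L * ∑ i, |y i|) * exp (m * lse (fun j => lf B0 x j + c j)) := by
  have : Z2 B0 B1 c x y ≤ exp (L * ∑ i, |y i|) * ∑ j, exp (lf B0 x j + c j) := by
    unfold Z2
    rw [mul_sum]
    refine sum_le_sum fun j _ => ?_
    rw [← exp_add, exp_le_exp]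
    linarith [(abs_le.1 (lf_abs_le B1 hL y j)).2]
  refine (rpow_le_rpow (Z2_pos _ _ _ _ _).le this hm.le).trans (le_of_eq ?_)
  rw [mul_rpow (exp_pos _).le (lse_sum_pos _).le, ← exp_mul, rpow_def_of_pos (lse_sum_pos _), mul_comm _ m]
  congr 2
  · ring
  · rw [mul_comm]; rfl

include hL in
lemma Z2_lo {m : ℝ} (hm : 0 < m) (x : ι0 → ℝ) (y : ι1 → ℝ) :
    exp (- (m * L) * ∑ i, |y i|) * exp (m * lse (fun j => lf B0 x j + c j)) ≤ Z2 B0 B1 c x y ^ m := by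
  have : exp (- L * ∑ i, |y i|) * ∑ j, exp (lf B0 x j + c j) ≤ Z2 B0 B1 c x y := by
    unfold Z2
    rw [mul_sum]
    refine sum_le_sum fun j _ => ?_
    rw [← exp_add, exp_le_exp]
    linarith [(abs_le.1 (lf_abs_le B1 hL y j)).1]
  refine (le_of_eq ?_).trans (rpow_le_rpow (mul_nonneg (exp_pos _).le (lse_sum_pos _).le) this hm.le)
  rw [mul_rpow (exp_pos _).le (lse_sum_pos _).le, ← exp_mul, rpow_def_of_pos (lse_sum_pos _), mul_comm _ m]
  congr 2
  · ring
  · rw [mul_comm]; rfl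

lemma bdd_entries : ∃ L : ℝ, 0 ≤ L ∧ ∀ j i, |B1 j i| ≤ L := by
  refine ⟨∑ j, ∑ i, |B1 j i|, sum_nonneg fun _ _ => sum_nonneg fun _ _ => abs_nonneg _, fun j i => ?_⟩
  refine (single_le_sum (f := fun i => |B1 j i|) (fun _ _ => abs_nonneg _) (mem_univ i)).trans ?_
  exact single_le_sum (f := fun j => ∑ i, |B1 j i|) (fun _ _ => sum_nonneg fun _ _ => abs_nonneg _) (mem_univ j)

lemma Z2_integrable {m : ℝ} (hm : 0 < m) (x : ι0 → ℝ) : Integrable (fun y => Z2 B0 B1 c x y ^ m) (gp ι1) := by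
  obtain ⟨L, _, hL⟩ := bdd_entries B1
  refine ((gp_integrable_exp (m * L)).mul_const (exp (m * lse (fun j => lf B0 x j + c j)))).mono' ?_ ?_
  · exact ((Z2_rpow_cont B0 B1 c m).comp (by fun_prop : Continuous fun y : ι1 → ℝ => (x, y))).aestronglyMeasurable
  · filter_upwards with y
    rw [norm_of_nonneg (rpow_nonneg (Z2_pos _ _ _ _ _).le _)]
    exact Z2_up B0 B1 c hL hm x y

lemma Z2_int_pos {m : ℝ} (hm : 0 < m) (x : ι0 → ℝ) : 0 < ∫ y, Z2 B0 B1 c x y ^ m ∂gp ι1 := by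
  rw [integral_pos_iff_support_of_nonneg (fun y => rpow_nonneg (Z2_pos _ _ _ _ _).le _) (Z2_integrable B0 B1 c hm x)]
  have : (Function.support fun y => Z2 B0 B1 c x y ^ m) = Set.univ := by
    ext y; simp [(rpow_pos_of_pos (Z2_pos B0 B1 c x y) m).ne']
  rw [this]; simp

lemma Z2_log_integrable {m : ℝ} (hm : 0 < m) :
    Integrable (fun x => log (∫ y, Z2 B0 B1 c x y ^ m ∂gp ι1)) (gp ι0) := by
  obtain ⟨L, _, hL⟩ := bdd_entries B1
  have hexp : ∀ C : ℝ, 0 < ∫ y : ι1 → ℝ, exp (C * ∑ k, |y k|) ∂gp ι1 := by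
    intro C
    rw [integral_pos_iff_support_of_nonneg (fun y => (exp_pos _).le) (gp_integrable_exp C)]
    have : (Function.support fun y : ι1 → ℝ => exp (C * ∑ k, |y k|)) = Set.univ := by
      ext y; simp [(exp_pos _).ne']
    rw [this]; simp
  set M1 := log (∫ y : ι1 → ℝ, exp (m * L * ∑ k, |y k|) ∂gp ι1)
  set M2 := log (∫ y : ι1 → ℝ, exp (- (m * L) * ∑ k, |y k|) ∂gp ι1)
  have hli : Integrable (fun x => lse (fun j => lf B0 x j + c j)) (gp ι0) := lse_integrable (lf_add_integrable B0 c)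
  have hb : Integrable (fun x => |M1| + |M2| + m * |lse (fun j => lf B0 x j + c j)|) (gp ι0) :=
    (integrable_const _).add (hli.abs.const_mul m)
  refine hb.mono' ?_ ?_
  · refine (Measurable.log ?_).aestronglyMeasurable
    exact ((Z2_rpow_cont B0 B1 c m).stronglyMeasurable.integral_prod_right').measurable
  · filter_upwards with x
    have h1 : log (∫ y, Z2 B0 B1 c x y ^ m ∂gp ι1) ≤ M1 + m * lse (fun j => lf B0 x j + c j) := by
      rw [← log_exp (m * lse (fun j => lf B0 x j + c j)), ← log_mul (hexp _).ne' (exp_pos _).ne']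
      refine log_le_log (Z2_int_pos B0 B1 c hm x) ?_
      rw [← integral_mul_const]
      exact integral_mono (Z2_integrable B0 B1 c hm x) ((gp_integrable_exp (m * L)).mul_const _) (Z2_up B0 B1 c hL hm x)
    have h2 : M2 + m * lse (fun j => lf B0 x j + c j) ≤ log (∫ y, Z2 B0 B1 c x y ^ m ∂gp ι1) := by
      rw [← log_exp (m * lse (fun j => lf B0 x j + c j)), ← log_mul (hexp _).ne' (exp_pos _).ne']
      refine log_le_log (mul_pos (hexp _) (exp_pos _)) ?_
      rw [← integral_mul_const]
      exact integral_mono ((gp_integrable_exp (-(m * L))).mul_const _) (Z2_integrable B0 B1 c hm x) (Z2_lo B0 B1 c hL hm x)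
    have h3 : |m * lse (fun j => lf B0 x j + c j)| = m * |lse (fun j => lf B0 x j + c j)| := by
      rw [abs_mul, abs_of_pos hm]
    rw [Real.norm_eq_abs, abs_le]
    have := abs_le.1 h3.le
    have := abs_nonneg M1; have := abs_nonneg M2; have := le_abs_self M1; have := neg_abs_le M2
    constructor <;> linarith
end Z2

end
end

section
section
variable {J ι ι0 ι1 : Type*} [Fintype J] [Nonempty J] [Fintype ι] [Fintype ι0] [Fintype ι1]

/-- replicated coefficients -/
def Brep (n : ℕ) (B0 : J → ι0 → ℝ) (B1 : J → ι1 → ℝ) (s : Fin (n+1) × J) : ι0 ⊕ (Fin (n+1) × ι1) → ℝ :=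
  Sum.elim (B0 s.2) (fun p => if p.1 = s.1 then B1 s.2 p.2 else 0)

lemma Brep_cov (n : ℕ) (B0 : J → ι0 → ℝ) (B1 : J → ι1 → ℝ) (s s' : Fin (n+1) × J) :
    ∑ k, Brep n B0 B1 s k * Brep n B0 B1 s' k
      = ∑ k, B0 s.2 k * B0 s'.2 k + if s.1 = s'.1 then ∑ k, B1 s.2 k * B1 s'.2 k else 0 := by
  unfold Brep
  simp only [sum_sum_type, Sum.elim_inl, Sum.elim_inr, sum_prod_type]
  congr 1
  split_ifs with h
  · rw [Finset.sum_eq_single s.1]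
    · simp [h]
    · intro b _ hb; simp [hb]
    · simp
  · refine Finset.sum_eq_zero fun k _ => Finset.sum_eq_zero fun i _ => ?_
    by_cases h1 : k = s.1
    · have : k ≠ s'.1 := fun h2 => h (h1.symm.trans h2)
      simp [this]
    · simp [h1]

lemma Brep_lf (n : ℕ) (B0 : J → ι0 → ℝ) (B1 : J → ι1 → ℝ) (s : Fin (n+1) × J) (g : ι0 ⊕ (Fin (n+1) × ι1) → ℝ) :
    lf (Brep n B0 B1) g s = lf B0 (fun i => g (Sum.inl i)) s.2 + lf B1 (fun i => g (Sum.inr (s.1, i))) s.2 := by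
  unfold Brep lf
  simp only [sum_sum_type, Sum.elim_inl, Sum.elim_inr, sum_prod_type]
  congr 1
  rw [Finset.sum_eq_single s.1]
  · simp
  · intro b _ hb; simp [hb]
  · simp

lemma RSB1_rhs {m : ℝ} (hm : 0 < m) (n : ℕ) (B0 : J → ι0 → ℝ) (B1 : J → ι1 → ℝ) (c : J → ℝ) :
    ∫ g, Fm m (fun s => lf (Brep n B0 B1) g s + c s.2) ∂gp (ι0 ⊕ (Fin (n+1) × ι1))
      ≤ (1 / m) * log (n + 1) + (1 / m) * ∫ x, log (∫ y, Z2 B0 B1 c x y ^ m ∂gp ι1) ∂gp ι0 := by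
  have hinte : Integrable (fun g => Fm m (fun s => lf (Brep n B0 B1) g s + c s.2)) (gp (ι0 ⊕ (Fin (n+1) × ι1))) :=
    (Fm_smooth hm).integrable _ (lf_add_integrable (Brep n B0 B1) (fun s => c s.2))
  rw [gp_sum_integral hinte]
  have hpt : ∀ x (w : Fin (n+1) × ι1 → ℝ), Fm m (fun s => lf (Brep n B0 B1) (Sum.elim x w) s + c s.2)
      = (1 / m) * log (∑ k, Z2 B0 B1 c x (fun i => w (k, i)) ^ m) := by
    intro x w
    unfold Fm Zout Zin Z2
    simp only [Brep_lf, Sum.elim_inl, Sum.elim_inr]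
  have hintx : Integrable (fun x => ∫ w, Fm m (fun s => lf (Brep n B0 B1) (Sum.elim x w) s + c s.2) ∂gp (Fin (n+1) × ι1)) (gp ι0) := by
    have hmp := gp_sum_mp (ι := ι0) (κ := Fin (n+1) × ι1)
    exact ((hmp.integrable_comp hinte.1).2 hinte).integral_prod_left
  have hlogi := Z2_log_integrable B0 B1 c hm
  have hr : Integrable (fun x => (1 / m) * log (n + 1) + (1 / m) * log (∫ y, Z2 B0 B1 c x y ^ m ∂gp ι1)) (gp ι0) :=
    (integrable_const _).add (hlogi.const_mul _)
  refine (integral_mono hintx hr fun x => ?_).trans (le_of_eq ?_)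
  · simp only [hpt]
    rw [integral_const_mul, ← mul_add]
    refine mul_le_l ?_ (by positivity)
    have hki : ∀ k, Integrable (fun w : Fin (n+1) × ι1 → ℝ => Z2 B0 B1 c x (fun i => w (k, i)) ^ m) (gp (Fin (n+1) × ι1)) := by
      intro k
      have := gp_comp_inj (fun i : ι1 => (k, i)) (fun a b hab => by simpa using hab)
      exact (this.integrable_comp (Z2_integrable B0 B1 c hm x).1).2 (Z2_integrable B0 B1 c hm x)
    have hl : Integrable (fun w : Fin (n+1) × ι1 → ℝ => log (∑ k, Z2 B0 B1 c x (fun i => w (k, i)) ^ m)) (gp (Fin (n+1) × ι1)) := by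
      have h1 := (Fm_smooth (K := Fin (n+1)) (J := J) hm).integrable (ι := Fin (n+1) × ι1)
        (fun w s => lf (Brep n B0 B1) (Sum.elim x w) s + c s.2) ?_
      · simp only [hpt] at h1
        have h2 := h1.const_mul m
        refine h2.congr ?_
        filter_upwards with w
        field_simp
      · intro s
        simp only [Brep_lf, Sum.elim_inl, Sum.elim_inr]
        have := gp_comp_inj (fun i : ι1 => (s.1, i)) (fun a b hab => by simpa using hab)
        exact ((integrable_const _).add ((this.integrable_comp (lf_integrable B1 s.2).1).2 (lf_integrable B1 s.2))).add (integrable_const _)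
    refine (jensen_log (fun w => sum_pos (fun k _ => rpow_pos_of_pos (Z2_pos _ _ _ _ _) m) univ_nonempty)
      (integrable_finsetSum _ fun k _ => hki k) hl).trans (le_of_eq ?_)
    rw [integral_finsetSum _ fun k _ => hki k]
    have : ∀ k : Fin (n+1), ∫ w : Fin (n+1) × ι1 → ℝ, Z2 B0 B1 c x (fun i => w (k, i)) ^ m ∂gp (Fin (n+1) × ι1)
        = ∫ y, Z2 B0 B1 c x y ^ m ∂gp ι1 := by
      intro k
      exact gp_integral_comp_inj (fun i : ι1 => (k, i)) (fun a b hab => by simpa using hab)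
        (f := fun y => Z2 B0 B1 c x y ^ m) (Z2_integrable B0 B1 c hm x).1
    simp only [this, Finset.sum_const, Finset.card_univ, Fintype.card_fin, nsmul_eq_mul]
    rw [log_mul (by positivity) (Z2_int_pos B0 B1 c hm x).ne']
    push_cast; rfl
  · rw [integral_add (integrable_const _) (hlogi.const_mul _), integral_const_mul (1 / m) (fun x => log (∫ y, Z2 B0 B1 c x y ^ m ∂gp ι1))]; simp

lemma RSB1_pre {m : ℝ} (hm : 0 < m) (hm1 : m ≤ 1) (n : ℕ) (A : J → ι → ℝ) (B0 : J → ι0 → ℝ) (B1 : J → ι1 → ℝ) (c d b e : J → ℝ) {C₀ D L : ℝ}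
    (hD : ∀ j j', |∑ i, B1 j i * B1 j' i| ≤ D) (hL : ∀ j i, |B1 j i| ≤ L)
    (he : ∀ j j', e j + e j' ≤ ∑ i, A j i * A j' i - ∑ i, B0 j i * B0 j' i)
    (hb : ∀ j j', b j + b j' ≤ ∑ i, A j i * A j' i - ∑ i, B0 j i * B0 j' i - ∑ i, B1 j i * B1 j' i)
    (hC : ∀ j, d j + 1 / 2 * (∑ i, A j i * A j i - ∑ i, B0 j i * B0 j i - ∑ i, B1 j i * B1 j i) - (1 - m) * b j - m * e j ≤ C₀) :
    ∫ g, lse (fun j => lf A g j + c j + d j) ∂gp ι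
      ≤ (1 / m) * ∫ x, log (∫ y, Z2 B0 B1 c x y ^ m ∂gp ι1) ∂gp ι0 + C₀
        + (m / 2 * D * ∫ y : ι1 → ℝ, exp (4 * (L * ∑ i, |y i|)) ∂gp ι1) * (1 / ((n : ℝ) + 1)) := by
  set Mx := ∫ y : ι1 → ℝ, exp (4 * (L * ∑ i, |y i|)) ∂gp ι1 with hMx
  have hD0 : 0 ≤ D := (abs_nonneg _).trans (hD (Classical.arbitrary J) (Classical.arbitrary J))
  set A' : Fin (n+1) × J → ι → ℝ := fun s => A s.2 with hA'
  set Δ : Fin (n+1) × J → Fin (n+1) × J → ℝ := fun s s' => ∑ i, A' s i * A' s' i - ∑ k, Brep n B0 B1 s k * Brep n B0 B1 s' k with hΔ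
  have key := (Fm_smooth (K := Fin (n+1)) (J := J) hm).interp_le' A' (Brep n B0 B1) (fun s => c s.2) (fun s => d s.2) Δ
    (fun s s' => rfl) (C₀ := C₀ + (m / 2 * D * Mx) * (1 / ((n : ℝ) + 1))) ?_
  · have hl : ∀ g : ι → ℝ, Fm m (fun s : Fin (n+1) × J => lf A' g s + c s.2 + d s.2)
        = (1 / m) * log (n + 1) + lse (fun j => lf A g j + c j + d j) := by
      intro g
      unfold Fm Zout Zin
      have : ∀ k : Fin (n+1), ∑ j, exp (lf A' g (k, j) + c j + d j) = ∑ j, exp (lf A g j + c j + d j) := fun k => rfl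
      simp only [this, Finset.sum_const, Finset.card_univ, Fintype.card_fin, nsmul_eq_mul]
      have hp := lse_sum_pos (fun j => lf A g j + c j + d j)
      rw [log_mul (by positivity) (rpow_pos_of_pos hp m).ne', log_rpow hp]
      unfold lse
      push_cast
      field_simp
    simp only [hl] at key
    have hi : Integrable (fun g => lse (fun j => lf A g j + c j + d j)) (gp ι) := by
      have := lse_integrable (lf_add_integrable A (fun j => c j + d j))
      simpa only [add_assoc] using this
    rw [integral_add (integrable_const _) hi] at key
    have hr := RSB1_rhs hm n B0 B1 c
    simp at key
    simp at hr ⊢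
    linarith
  · intro t ht0 ht1
    set X := Xt (fun s => Sum.elim (A' s) 0 : Fin (n+1) × J → ι ⊕ (ι0 ⊕ (Fin (n+1) × ι1)) → ℝ) (fun s => Sum.elim 0 (Brep n B0 B1 s)) (fun s => c s.2) (fun s => d s.2) t with hX
    have hpt : ∀ g, Dexp (Ww m) (ddFm m) (fun s => d s.2) Δ (X g) ≤
        C₀ + m / 2 * D * ((((n+1 : ℕ) : ℝ))⁻¹ ^ 2 * ∑ k : Fin (n+1), exp (4 * (L * ∑ i, |g (Sum.inr (Sum.inr (k, i)))|))) := by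
      intro g
      refine (Fm_Dexp_le hm.le hm1 (fun s => d s.2) Δ (fun s => b s.2) (fun s => e s.2)
        (C₀ := C₀) (D := fun k k' => if k = k' then D else 0) ?_ ?_ ?_ (X g)).trans ?_
      · intro k j j'
        simp only [hΔ, Brep_cov, if_true]
        have := hb j j'; linarith
      · intro s s'
        simp only [hΔ, Brep_cov]
        have := he s.2 s'.2
        have h2 := (abs_le.1 (hD s.2 s'.2)).2
        split_ifs <;> simp only [hA'] <;> linarith
      · intro s
        simp only [hΔ, Brep_cov, if_true]
        have := hC s.2
        simp only [hA']; linarith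
      · rw [add_le_add_iff_left, mul_assoc (m/2)]
        refine mul_le_l ?_ (by positivity)
        have h1 : ∑ k, ∑ k', pw m (X g) k * pw m (X g) k' * (if k = k' then D else 0) = D * ∑ k, pw m (X g) k ^ 2 := by
          rw [mul_sum]
          refine scg fun k _ => ?_
          simp; ring
        rw [h1]
        refine mul_le_l ?_ hD0
        have := pw_sq_bound hm hm1 (X g)
          (fun j => √t * lf A (fun i => g (Sum.inl i)) j + √(1-t) * lf B0 (fun i => g (Sum.inr (Sum.inl i))) j + c j + t * d j)
          (fun k => L * ∑ i, |g (Sum.inr (Sum.inr (k, i)))|) ?_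
        · simpa using this
        · intro k j
          have e1 : ∀ s, lf (fun s => Sum.elim (A' s) 0 : Fin (n+1) × J → ι ⊕ (ι0 ⊕ (Fin (n+1) × ι1)) → ℝ) g s = lf A (fun k => g (Sum.inl k)) s.2 := by
            intro s; simp [lf, hA']
          have e2 : ∀ s, lf (fun s => Sum.elim 0 (Brep n B0 B1 s) : Fin (n+1) × J → ι ⊕ (ι0 ⊕ (Fin (n+1) × ι1)) → ℝ) g s = lf (Brep n B0 B1) (fun k => g (Sum.inr k)) s := by
            intro s; simp [lf]
          have e3 : X g (k, j) - (√t * lf A (fun i => g (Sum.inl i)) j + √(1-t) * lf B0 (fun i => g (Sum.inr (Sum.inl i))) j + c j + t * d j)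
              = √(1-t) * lf B1 (fun i => g (Sum.inr (Sum.inr (k, i)))) j := by
            simp only [hX, Xt, e1, e2, Brep_lf]; ring
          rw [e3, abs_mul, abs_of_nonneg (sqrt_nonneg _)]
          have h1 : √(1-t) ≤ 1 := by rw [Real.sqrt_le_iff]; constructor <;> linarith
          have h2 := lf_abs_le B1 hL (fun i => g (Sum.inr (Sum.inr (k, i)))) j
          calc _ ≤ 1 * |lf B1 (fun i => g (Sum.inr (Sum.inr (k, i)))) j| := mul_le_r h1 (abs_nonneg _)
            _ ≤ _ := by rw [one_mul]; exact h2
    have hei : ∀ k : Fin (n+1), Integrable (fun g : ι ⊕ (ι0 ⊕ (Fin (n+1) × ι1)) → ℝ => exp (4 * (L * ∑ i, |g (Sum.inr (Sum.inr (k, i)))|))) (gp (ι ⊕ (ι0 ⊕ (Fin (n+1) × ι1)))) := by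
      intro k
      have h1 := gp_comp_inj (ι := ι ⊕ (ι0 ⊕ (Fin (n+1) × ι1))) (fun i : ι1 => (Sum.inr (Sum.inr (k, i)))) (fun a b hab => by simpa using hab)
      have h2 : Integrable (fun y : ι1 → ℝ => exp (4 * (L * ∑ i, |y i|))) (gp ι1) := by
        have := gp_integrable_exp (ι := ι1) (4 * L)
        simpa only [mul_assoc] using this
      exact (h1.integrable_comp h2.1).2 h2
    have heI : ∀ k : Fin (n+1), ∫ g : ι ⊕ (ι0 ⊕ (Fin (n+1) × ι1)) → ℝ, exp (4 * (L * ∑ i, |g (Sum.inr (Sum.inr (k, i)))|)) ∂(gp (ι ⊕ (ι0 ⊕ (Fin (n+1) × ι1)))) = Mx := by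
      intro k
      exact gp_integral_comp_inj (ι := ι ⊕ (ι0 ⊕ (Fin (n+1) × ι1))) (fun i : ι1 => (Sum.inr (Sum.inr (k, i)))) (fun a b hab => by simpa using hab)
        (f := fun y => exp (4 * (L * ∑ i, |y i|))) (Continuous.aestronglyMeasurable (by fun_prop))
    have hri : Integrable (fun g : ι ⊕ (ι0 ⊕ (Fin (n+1) × ι1)) → ℝ => m / 2 * D * ((((n+1 : ℕ) : ℝ))⁻¹ ^ 2 * ∑ k : Fin (n+1), exp (4 * (L * ∑ i, |g (Sum.inr (Sum.inr (k, i)))|)))) (gp (ι ⊕ (ι0 ⊕ (Fin (n+1) × ι1)))) :=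
      ((integrable_finsetSum _ fun k _ => hei k).const_mul _).const_mul _
    have hri2 : Integrable (fun g : ι ⊕ (ι0 ⊕ (Fin (n+1) × ι1)) → ℝ => C₀ + m / 2 * D * ((((n+1 : ℕ) : ℝ))⁻¹ ^ 2 * ∑ k : Fin (n+1), exp (4 * (L * ∑ i, |g (Sum.inr (Sum.inr (k, i)))|)))) (gp (ι ⊕ (ι0 ⊕ (Fin (n+1) × ι1)))) :=
      (integrable_const _).add hri
    refine (integral_mono ((Fm_smooth hm).Dexp_integrable _ Δ (Xt_cont _ _ _ _ t).measurable) hri2 hpt).trans (le_of_eq ?_)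
    rw [integral_add (integrable_const _) hri, integral_const_mul, integral_const_mul, integral_finsetSum _ fun k _ => hei k]
    simp only [heI]
    simp
    field_simp

/-- one-step bound -/
lemma RSB1 {m : ℝ} (hm : 0 < m) (hm1 : m ≤ 1) (A : J → ι → ℝ) (B0 : J → ι0 → ℝ) (B1 : J → ι1 → ℝ) (c d b e : J → ℝ) {C₀ : ℝ}
    (he : ∀ j j', e j + e j' ≤ ∑ i, A j i * A j' i - ∑ i, B0 j i * B0 j' i)
    (hb : ∀ j j', b j + b j' ≤ ∑ i, A j i * A j' i - ∑ i, B0 j i * B0 j' i - ∑ i, B1 j i * B1 j' i)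
    (hC : ∀ j, d j + 1 / 2 * (∑ i, A j i * A j i - ∑ i, B0 j i * B0 j i - ∑ i, B1 j i * B1 j i) - (1 - m) * b j - m * e j ≤ C₀) :
    ∫ g, lse (fun j => lf A g j + c j + d j) ∂gp ι
      ≤ (1 / m) * ∫ x, log (∫ y, Z2 B0 B1 c x y ^ m ∂gp ι1) ∂gp ι0 + C₀ := by
  obtain ⟨L, _, hL⟩ := bdd_entries B1
  obtain ⟨D, _, hD⟩ := bdd_entries (fun j j' => ∑ i, B1 j i * B1 j' i)
  have h := fun n => RSB1_pre hm hm1 n A B0 B1 c d b e hD hL he hb hC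
  have ht := (tendsto_one_div_add_atTop_nhds_zero_nat (𝕜 := ℝ)).const_mul (m / 2 * D * ∫ y : ι1 → ℝ, exp (4 * (L * ∑ i, |y i|)) ∂gp ι1)
  have ht2 := ht.const_add ((1 / m) * ∫ x, log (∫ y, Z2 B0 B1 c x y ^ m ∂gp ι1) ∂gp ι0 + C₀)
  rw [mul_zero, add_zero] at ht2
  exact ge_of_tendsto' ht2 h
end
end

section
/-- spin value copy -/
def sp (b : Bool) : ℝ := if b then 1 else -1
lemma sp_sq (b : Bool) : sp b ^ 2 = 1 := by cases b <;> simp [sp]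
lemma sp_mul_self (b : Bool) : sp b * sp b = 1 := by cases b <;> simp [sp]
lemma sp_abs (b : Bool) : |sp b| = 1 := by cases b <;> simp [sp]

/-- configurations -/
abbrev Cfg (N : ℕ) := Fin N → Bool
/-- pairs of sites -/
abbrev Edg (N : ℕ) := {p : Fin N × Fin N // p.1 < p.2}

lemma sum_edg (N : ℕ) (f : Fin N → Fin N → ℝ) :
    ∑ p : Edg N, f p.1.1 p.1.2 = ∑ i, ∑ j, if i < j then f i j else 0 := by
  rw [← Fintype.sum_prod_type' (f := fun i j => if i < j then f i j else 0), ← Finset.sum_filter]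
  exact (Finset.sum_subtype (Finset.univ.filter fun p : Fin N × Fin N => p.1 < p.2) (by simp) (fun p => f p.1 p.2)).symm

lemma sum_edg_mul (N : ℕ) (a : Fin N → ℝ) :
    ∑ p : Edg N, a p.1.1 * a p.1.2 = ((∑ i, a i) ^ 2 - ∑ i, a i ^ 2) / 2 := by
  rw [sum_edg N (fun i j => a i * a j)]
  have h1 : (∑ i, a i) ^ 2 = ∑ i, ∑ j, a i * a j := by rw [sq, sum_mul_sum]
  have h2 : ∀ i j : Fin N, a i * a j = (if i < j then a i * a j else 0) + (if j < i then a j * a i else 0) + (if i = j then a i ^ 2 else 0) := by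
    intro i j
    rcases lt_trichotomy i j with h | h | h
    · simp [h, h.not_gt, h.ne]
    · subst h; simp [sq]
    · simp [h, h.not_gt, h.ne', mul_comm]
  have h3 : ∑ i, ∑ j, a i * a j = (∑ i, ∑ j, if i < j then a i * a j else 0) + (∑ i, ∑ j, if j < i then a j * a i else 0) + ∑ i, a i ^ 2 := by
    rw [← sum_add_distrib, ← sum_add_distrib]
    refine scg fun i _ => ?_
    rw [show (a i ^ 2) = ∑ j, (if i = j then a i ^ 2 else 0) by simp, ← sum_add_distrib, ← sum_add_distrib]
    exact scg fun j _ => h2 i j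
  have h4 : (∑ i, ∑ j, if j < i then a j * a i else 0) = ∑ i, ∑ j, if i < j then a i * a j else 0 := sum_comm
  rw [h1, h3, h4]; ring

/-- unnormalised overlap -/
def ov {N : ℕ} (s s' : Cfg N) : ℝ := ∑ i, sp (s i) * sp (s' i)
lemma ov_self {N : ℕ} (s : Cfg N) : ov s s = N := by simp [ov, sp_mul_self]
lemma ov_comm {N : ℕ} (s s' : Cfg N) : ov s s' = ov s' s := by simp [ov, mul_comm]
lemma ov_abs {N : ℕ} (s s' : Cfg N) : |ov s s'| ≤ N := by
  unfold ov
  refine (abs_sum_le_sum_abs _ _).trans ?_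
  simp [abs_mul, sp_abs]

/-- coefficients of the interpolating Hamiltonian -/
def HA (N : ℕ) (β q t : ℝ) (s : Cfg N) : Edg N ⊕ Fin N → ℝ :=
  Sum.elim (fun p => √t * β / √N * (sp (s p.1.1) * sp (s p.1.2))) (fun i => √(1 - t) * β * √q * sp (s i))

lemma HA_cov {N : ℕ} (hN : 0 < N) (β : ℝ) {q t : ℝ} (hq : 0 ≤ q) (ht0 : 0 ≤ t) (ht1 : t ≤ 1) (s s' : Cfg N) :
    ∑ k, HA N β q t s k * HA N β q t s' k = t * β ^ 2 / 2 * (ov s s' ^ 2 / N - 1) + (1 - t) * β ^ 2 * q * ov s s' := by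
  have hNr : (0:ℝ) < N := by exact_mod_cast hN
  unfold HA
  simp only [sum_sum_type, Sum.elim_inl, Sum.elim_inr]
  congr 1
  · have h := sum_edg_mul N (fun i => sp (s i) * sp (s' i))
    have h1 : ∑ i, (sp (s i) * sp (s' i)) ^ 2 = (N:ℝ) := by simp [mul_pow, sp_sq]
    rw [h1] at h
    have e : ∀ p : Edg N, √t * β / √N * (sp (s p.1.1) * sp (s p.1.2)) * (√t * β / √N * (sp (s' p.1.1) * sp (s' p.1.2)))
        = (t * β ^ 2 / N) * (sp (s p.1.1) * sp (s' p.1.1) * (sp (s p.1.2) * sp (s' p.1.2))) := by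
      intro p
      have h2 : √t * √t = t := Real.mul_self_sqrt ht0
      have h3 : √(N:ℝ) * √N = N := Real.mul_self_sqrt hNr.le
      have h4 : √(N:ℝ) ≠ 0 := (Real.sqrt_pos.2 hNr).ne'
      calc _ = ((√t * √t) * β ^ 2 / (√(N:ℝ) * √N)) * (sp (s p.1.1) * sp (s' p.1.1) * (sp (s p.1.2) * sp (s' p.1.2))) := by
            field_simp
        _ = _ := by rw [h2, h3]
    simp only [e]
    rw [← mul_sum, h]
    unfold ov
    field_simp
  · unfold ov
    rw [mul_sum]
    refine scg fun i _ => ?_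
    have h2 : √q * √q = q := Real.mul_self_sqrt hq
    have h3 : √(1-t) * √(1-t) = 1 - t := Real.mul_self_sqrt (by linarith)
    calc _ = (√(1-t) * √(1-t)) * β ^ 2 * (√q * √q) * (sp (s i) * sp (s' i)) := by ring
      _ = _ := by rw [h2, h3]

lemma sum_pairs_prod {N : ℕ} (φ : Fin N → Bool → Bool → ℝ) :
    ∑ w : Cfg N × Cfg N, ∏ i, φ i (w.1 i) (w.2 i) = ∏ i, ∑ b, ∑ b', φ i b b' := by
  rw [Fintype.prod_sum (fun i b => ∑ b', φ i b b'), sum_prod_type]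
  refine scg fun s _ => ?_
  exact (Fintype.prod_sum (fun i b' => φ i (s i) b')).symm

/-- single-site two-spin partition function -/
def zs (o1 o2 l : ℝ) : ℝ := ∑ b, ∑ b', exp (o1 * sp b + o2 * sp b' + l * (sp b * sp b'))

lemma zs_pos (o1 o2 l : ℝ) : 0 < zs o1 o2 l := by
  unfold zs; simp only [sum_bool]; positivity

lemma zs_eq (o1 o2 l : ℝ) : zs o1 o2 l = 4 * (cosh o1 * cosh o2 * cosh l + sinh o1 * sinh o2 * sinh l) := by
  unfold zs
  simp only [sum_bool, sp, cosh_eq, sinh_eq, if_true, Bool.false_eq_true, if_false]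
  have e1 : exp (o1 * 1 + o2 * 1 + l * (1 * 1)) = exp o1 * exp o2 * exp l := by rw [← exp_add, ← exp_add]; ring_nf
  have e2 : exp (o1 * 1 + o2 * -1 + l * (1 * -1)) = exp o1 * exp (-o2) * exp (-l) := by rw [← exp_add, ← exp_add]; ring_nf
  have e3 : exp (o1 * -1 + o2 * 1 + l * (-1 * 1)) = exp (-o1) * exp o2 * exp (-l) := by rw [← exp_add, ← exp_add]; ring_nf
  have e4 : exp (o1 * -1 + o2 * -1 + l * (-1 * -1)) = exp (-o1) * exp (-o2) * exp l := by rw [← exp_add, ← exp_add]; ring_nf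
  rw [e1, e2, e3, e4]; ring

section
variable {N : ℕ}
/-- outer coefficients of comparison field -/
def cB0 (P R : ℝ) (w : Cfg N × Cfg N) (k : Fin N × Bool) : ℝ :=
  if k.2 then P * (sp (w.1 k.1) + sp (w.2 k.1)) else R * (sp (w.1 k.1) - sp (w.2 k.1))
/-- inner coefficients of comparison field -/
def cB1 (C ε : ℝ) (w : Cfg N × Cfg N) (i : Fin N) : ℝ := C * (sp (w.1 i) + ε * sp (w.2 i))
/-- external field and coupling -/
def cc (h l : ℝ) (w : Cfg N × Cfg N) : ℝ := h * ∑ i, sp (w.1 i) + h * ∑ i, sp (w.2 i) + l * ov w.1 w.2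

lemma cB0_cov (P R : ℝ) (w w' : Cfg N × Cfg N) :
    ∑ k, cB0 P R w k * cB0 P R w' k = (P^2+R^2) * (ov w.1 w'.1 + ov w.2 w'.2) + (P^2-R^2) * (ov w.1 w'.2 + ov w.2 w'.1) := by
  simp only [sum_prod_type, sum_bool, cB0, ov, if_true, Bool.false_eq_true, if_false, ← sum_add_distrib, mul_sum]
  exact scg fun i _ => by ring

lemma cB1_cov (C : ℝ) {ε : ℝ} (hε : ε ^ 2 = 1) (w w' : Cfg N × Cfg N) :
    ∑ k, cB1 C ε w k * cB1 C ε w' k = C ^ 2 * (ov w.1 w'.1 + ov w.2 w'.2 + ε * (ov w.1 w'.2 + ov w.2 w'.1)) := by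
  simp only [cB1, ov, ← sum_add_distrib, mul_sum]
  exact scg fun i _ => by linear_combination (C^2 * (sp (w.2 i) * sp (w'.2 i))) * hε

lemma cZ2 (P R C ε h l : ℝ) (x : Fin N × Bool → ℝ) (y : Fin N → ℝ) :
    Z2 (cB0 P R) (cB1 C ε) (cc h l) x y
      = ∏ i, zs (h + P * x (i, true) + R * x (i, false) + C * y i) (h + P * x (i, true) - R * x (i, false) + ε * C * y i) l := by
  unfold Z2 zs
  rw [← sum_pairs_prod (fun i b b' => exp ((h + P * x (i, true) + R * x (i, false) + C * y i) * sp b + (h + P * x (i, true) - R * x (i, false) + ε * C * y i) * sp b' + l * (sp b * sp b')))]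
  refine scg fun w _ => ?_
  rw [← exp_sum]
  congr 1
  simp only [lf, cB0, cB1, cc, ov, sum_prod_type, sum_bool, if_true, Bool.false_eq_true, if_false, mul_sum, ← sum_add_distrib]
  exact scg fun i _ => by ring

/-- single-site two-level functional -/
def Efun (P R C ε h l m : ℝ) : ℝ :=
  ∫ x : Bool → ℝ, log (∫ y, zs (h + P * x true + R * x false + C * y) (h + P * x true - R * x false + ε * C * y) l ^ m ∂gs) ∂gp Bool

lemma cJ_eq {m : ℝ} (hm : 0 < m) (P R C ε h l : ℝ) :
    ∫ x, log (∫ y, Z2 (cB0 (N := N) P R) (cB1 C ε) (cc h l) x y ^ m ∂gp (Fin N)) ∂gp (Fin N × Bool) = N * Efun P R C ε h l m := by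
  -- the one-site case gives integrability
  set F : (Bool → ℝ) → ℝ → ℝ := fun x y => zs (h + P * x true + R * x false + C * y) (h + P * x true - R * x false + ε * C * y) l ^ m with hF
  have hone : ∀ (x : Bool → ℝ) (y : ℝ), F x y = Z2 (cB0 (N := 1) P R) (cB1 C ε) (cc h l) (fun k => x k.2) (fun _ => y) ^ m := by
    intro x y; rw [cZ2]; simp [hF]
  have hFc : Continuous (fun p : (Bool → ℝ) × ℝ => F p.1 p.2) := by
    simp only [hone]
    exact (Z2_rpow_cont (cB0 (N := 1) P R) (cB1 C ε) (cc h l) m).comp (f := fun p : (Bool → ℝ) × ℝ => ((fun k => p.1 k.2 : Fin 1 × Bool → ℝ), (fun _ => p.2 : Fin 1 → ℝ))) (by fun_prop)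
  have hI1 : ∀ x : Bool → ℝ, ∫ y, F x y ∂gs = ∫ y, Z2 (cB0 (N := 1) P R) (cB1 C ε) (cc h l) (fun k => x k.2) y ^ m ∂gp (Fin 1) := by
    intro x
    rw [← gp_integral_eval (0 : Fin 1) (f := fun y => F x y)]
    · refine integral_congr_ae (.of_forall fun y => ?_)
      simp only [hone]
      congr 2
      ext i; rw [Subsingleton.elim i 0]
    · exact (hFc.comp (by fun_prop : Continuous fun y : ℝ => (x, y))).measurable
  have hpos : ∀ x : Bool → ℝ, 0 < ∫ y, F x y ∂gs := by
    intro x; rw [hI1]; exact Z2_int_pos _ _ _ hm _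
  have hmeas : Measurable (fun x : Bool → ℝ => log (∫ y, F x y ∂gs)) :=
    Measurable.log (hFc.stronglyMeasurable.integral_prod_right').measurable
  have hmp1 := gp_comp_inj (κ := Bool) (ι := Fin 1 × Bool) (fun b => ((0 : Fin 1), b)) (fun a b hab => by simpa using hab)
  have hinte : Integrable (fun x : Bool → ℝ => log (∫ y, F x y ∂gs)) (gp Bool) := by
    rw [← (hmp1.integrable_comp hmeas.aestronglyMeasurable)]
    refine (Z2_log_integrable (cB0 (N := 1) P R) (cB1 C ε) (cc h l) hm).congr ?_
    filter_upwards with x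
    simp only [Function.comp, hI1]
    congr 3
  have hmpi : ∀ i : Fin N, MeasurePreserving (fun g : Fin N × Bool → ℝ => fun b => g (i, b)) (gp (Fin N × Bool)) (gp Bool) :=
    fun i => gp_comp_inj (fun b => (i, b)) (fun a b hab => by simpa using hab)
  have hpt : ∀ x : Fin N × Bool → ℝ, log (∫ y, Z2 (cB0 (N := N) P R) (cB1 C ε) (cc h l) x y ^ m ∂gp (Fin N))
      = ∑ i, log (∫ y, F (fun b => x (i, b)) y ∂gs) := by
    intro x
    have e1 : ∫ y, Z2 (cB0 (N := N) P R) (cB1 C ε) (cc h l) x y ^ m ∂gp (Fin N) = ∫ y : Fin N → ℝ, ∏ i, F (fun b => x (i, b)) (y i) ∂gp (Fin N) := by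
      refine integral_congr_ae (.of_forall fun y => ?_)
      simp only [cZ2]
      rw [← Real.finsetProd_rpow _ _ (fun i _ => (zs_pos _ _ _).le)]
    rw [e1]
    clear_value F
    rw [gp_integral_prod (fun i => F (fun b => x (i, b)))]
    exact log_prod (fun i _ => (hpos _).ne')
  simp only [hpt]
  rw [integral_finsetSum]
  · have : ∀ i : Fin N, ∫ x : Fin N × Bool → ℝ, log (∫ y, F (fun b => x (i, b)) y ∂gs) ∂gp (Fin N × Bool) = Efun P R C ε h l m := by
      intro i
      exact gp_integral_comp_inj (fun b => (i, b)) (fun a b hab => by simpa using hab) (f := fun x => log (∫ y, F x y ∂gs)) hmeas.aestronglyMeasurable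
    simp [this]
  · intro i _
    exact ((hmpi i).integrable_comp hmeas.aestronglyMeasurable).2 hinte

/-- coupled Hamiltonian coefficients -/
def HA2 (β q t : ℝ) (w : Cfg N × Cfg N) (k : Edg N ⊕ Fin N) : ℝ := HA N β q t w.1 k + HA N β q t w.2 k

lemma HA2_cov (hN : 0 < N) (β : ℝ) {q t : ℝ} (hq : 0 ≤ q) (ht0 : 0 ≤ t) (ht1 : t ≤ 1) (w w' : Cfg N × Cfg N) :
    ∑ k, HA2 β q t w k * HA2 β q t w' k
      = t * β ^ 2 / 2 * ((ov w.1 w'.1 ^ 2 + ov w.1 w'.2 ^ 2 + ov w.2 w'.1 ^ 2 + ov w.2 w'.2 ^ 2) / N - 4)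
        + (1 - t) * β ^ 2 * q * (ov w.1 w'.1 + ov w.1 w'.2 + ov w.2 w'.1 + ov w.2 w'.2) := by
  have e : ∀ k, HA2 β q t w k * HA2 β q t w' k = HA N β q t w.1 k * HA N β q t w'.1 k + HA N β q t w.1 k * HA N β q t w'.2 k
      + (HA N β q t w.2 k * HA N β q t w'.1 k + HA N β q t w.2 k * HA N β q t w'.2 k) := by intro k; unfold HA2; ring
  simp only [e, sum_add_distrib, HA_cov hN β hq ht0 ht1]
  ring

lemma coupled_raw (hN : 0 < N) (β h l : ℝ) {q t m p r c ε P R : ℝ} (hq : 0 ≤ q) (ht0 : 0 ≤ t) (ht1 : t ≤ 1)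
    (hm : 0 < m) (hm1 : m ≤ 1) (hε : ε ^ 2 = 1) (hpr : p ^ 2 + r ^ 2 = q)
    (hP : P ^ 2 = β ^ 2 * ((1 - t) * q + t * p ^ 2)) (hR : R ^ 2 = t * β ^ 2 * r ^ 2) :
    ∫ g, lse (fun w : Cfg N × Cfg N => lf (HA2 β q t) g w + cc h l w
        + (- N * (t * β ^ 2 / 2) * (ov w.1 w.2 / N - (p ^ 2 - r ^ 2 + ε * c ^ 2)) ^ 2)) ∂gp (Edg N ⊕ Fin N)
      ≤ N * ((1 / m) * Efun P R (√t * β * c) ε h l m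
        + t * β ^ 2 / 2 * ((1 - q - c ^ 2) ^ 2 - m * ((q + c ^ 2) ^ 2 + (p ^ 2 - r ^ 2 + ε * c ^ 2) ^ 2 - q ^ 2 - (p ^ 2 - r ^ 2) ^ 2))) := by
  have hNr : (0:ℝ) < N := by exact_mod_cast hN
  set v := p ^ 2 - r ^ 2 with hv
  set v2 := v + ε * c ^ 2 with hv2
  set Q := q + c ^ 2 with hQ
  have hs : √t ^ 2 = t := Real.sq_sqrt ht0
  have hPR1 : P ^ 2 + R ^ 2 = β ^ 2 * q := by rw [hP, hR]; linear_combination (t * β ^ 2) * hpr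
  have hPR2 : P ^ 2 - R ^ 2 = β ^ 2 * ((1 - t) * q + t * v) := by rw [hP, hR, hv]; ring
  have hC2 : (√t * β * c) ^ 2 = t * β ^ 2 * c ^ 2 := by rw [mul_pow, mul_pow, hs]
  have hD0 : ∀ w w' : Cfg N × Cfg N, ∑ i, HA2 β q t w i * HA2 β q t w' i - ∑ i, cB0 P R w i * cB0 P R w' i
      = t * β ^ 2 * N / 2 * ((ov w.1 w'.1 / N - q) ^ 2 + (ov w.2 w'.2 / N - q) ^ 2 + (ov w.1 w'.2 / N - v) ^ 2 + (ov w.2 w'.1 / N - v) ^ 2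
        - 2 * q ^ 2 - 2 * v ^ 2) - 2 * (t * β ^ 2) := by
    intro w w'
    rw [HA2_cov hN β hq ht0 ht1, cB0_cov, hPR1, hPR2]
    field_simp; ring
  have hD1 : ∀ w w' : Cfg N × Cfg N, ∑ i, HA2 β q t w i * HA2 β q t w' i - ∑ i, cB0 P R w i * cB0 P R w' i - ∑ i, cB1 (√t * β * c) ε w i * cB1 (√t * β * c) ε w' i
      = t * β ^ 2 * N / 2 * ((ov w.1 w'.1 / N - Q) ^ 2 + (ov w.2 w'.2 / N - Q) ^ 2 + (ov w.1 w'.2 / N - v2) ^ 2 + (ov w.2 w'.1 / N - v2) ^ 2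
        - 2 * Q ^ 2 - 2 * v2 ^ 2) - 2 * (t * β ^ 2) := by
    intro w w'
    rw [hD0, cB1_cov _ hε, hC2, hQ, hv2]
    field_simp; ring
  have htb : 0 ≤ t * β ^ 2 * N / 2 := by positivity
  have key := RSB1 hm hm1 (HA2 (N := N) β q t) (cB0 P R) (cB1 (√t * β * c) ε) (cc h l)
    (fun w => - N * (t * β ^ 2 / 2) * (ov w.1 w.2 / N - v2) ^ 2)
    (fun _ => - (t * β ^ 2 * N / 2) * (Q ^ 2 + v2 ^ 2) - t * β ^ 2)
    (fun _ => - (t * β ^ 2 * N / 2) * (q ^ 2 + v ^ 2) - t * β ^ 2)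
    (C₀ := N * (t * β ^ 2 / 2 * ((1 - Q) ^ 2 - m * (Q ^ 2 + v2 ^ 2 - q ^ 2 - v ^ 2)))) ?_ ?_ ?_
  · rw [cJ_eq hm] at key
    refine key.trans (le_of_eq ?_)
    rw [hQ]; ring
  · intro w w'
    rw [hD0]
    have := mul_nonneg htb (by positivity : 0 ≤ (ov w.1 w'.1 / N - q) ^ 2 + (ov w.2 w'.2 / N - q) ^ 2 + (ov w.1 w'.2 / N - v) ^ 2 + (ov w.2 w'.1 / N - v) ^ 2)
    nlinarith
  · intro w w'
    rw [hD1]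
    have := mul_nonneg htb (by positivity : 0 ≤ (ov w.1 w'.1 / N - Q) ^ 2 + (ov w.2 w'.2 / N - Q) ^ 2 + (ov w.1 w'.2 / N - v2) ^ 2 + (ov w.2 w'.1 / N - v2) ^ 2)
    nlinarith
  · intro w
    rw [hD1, ov_self, ov_self, ov_comm w.2 w.1, div_self hNr.ne']
    apply le_of_eq; ring

lemma soft_pen {t β l x u a Λ : ℝ} (ht1 : t ≤ 1) (hΛ : β ^ 2 / 2 < Λ) :
    - Λ * x ^ 2 ≤ l * (x + u) - (t * β ^ 2 / 2) * (x + a) ^ 2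
      + (- l * u + t * β ^ 2 / 2 * a ^ 2 + (l - t * β ^ 2 * a) ^ 2 / (4 * (Λ - β ^ 2 / 2))) := by
  obtain ⟨D, hD⟩ : ∃ D, D = Λ - β ^ 2 / 2 := ⟨_, rfl⟩
  have hd : 0 < D := by rw [hD]; linarith
  obtain ⟨b, hb⟩ : ∃ b, b = l - t * β ^ 2 * a := ⟨_, rfl⟩
  rw [← hD, ← hb]
  have hΛ' : Λ = D + β ^ 2 / 2 := by rw [hD]; ring
  have h4 : 0 ≤ (2 * D * x + b) ^ 2 / (4 * D) := by positivity
  have h5 : (2 * D * x + b) ^ 2 / (4 * D) = D * x ^ 2 + b * x + b ^ 2 / (4 * D) := by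
    field_simp; ring
  have h6 : t * (β ^ 2 / 2 * x ^ 2) ≤ 1 * (β ^ 2 / 2 * x ^ 2) := mul_le_r ht1 (by positivity)
  rw [h5] at h4
  rw [hΛ']
  have h7 : b * x = l * x - t * β ^ 2 * a * x := by rw [hb]; ring
  linarith

/-- coupled free energy with soft constraint -/
def LL (N : ℕ) (β h q t Λ u : ℝ) : ℝ :=
  ∫ g, lse (fun w : Cfg N × Cfg N => lf (HA2 β q t) g w + cc h 0 w - N * Λ * (ov w.1 w.2 / N - u) ^ 2) ∂gp (Edg N ⊕ Fin N)

lemma coupled_main (hN : 0 < N) (β h l : ℝ) {q t m p r c ε P R Λ u : ℝ} (hq : 0 ≤ q) (ht0 : 0 ≤ t) (ht1 : t ≤ 1)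
    (hm : 0 < m) (hm1 : m ≤ 1) (hε : ε ^ 2 = 1) (hpr : p ^ 2 + r ^ 2 = q)
    (hP : P ^ 2 = β ^ 2 * ((1 - t) * q + t * p ^ 2)) (hR : R ^ 2 = t * β ^ 2 * r ^ 2) (hΛ : β ^ 2 / 2 < Λ) :
    LL N β h q t Λ u ≤ N * ((1 / m) * Efun P R (√t * β * c) ε h l m
        + t * β ^ 2 / 2 * ((1 - q - c ^ 2) ^ 2 - m * ((q + c ^ 2) ^ 2 + (p ^ 2 - r ^ 2 + ε * c ^ 2) ^ 2 - q ^ 2 - (p ^ 2 - r ^ 2) ^ 2))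
        + (- l * u + t * β ^ 2 / 2 * (u - (p ^ 2 - r ^ 2 + ε * c ^ 2)) ^ 2
          + (l - t * β ^ 2 * (u - (p ^ 2 - r ^ 2 + ε * c ^ 2))) ^ 2 / (4 * (Λ - β ^ 2 / 2)))) := by
  have hNr : (0:ℝ) < N := by exact_mod_cast hN
  have key := coupled_raw (N := N) hN β h l (c := c) hq ht0 ht1 hm hm1 hε hpr hP hR
  set v2 := p ^ 2 - r ^ 2 + ε * c ^ 2 with hv2
  set K := (- l * u + t * β ^ 2 / 2 * (u - v2) ^ 2 + (l - t * β ^ 2 * (u - v2)) ^ 2 / (4 * (Λ - β ^ 2 / 2))) with hK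
  have h1 : LL N β h q t Λ u ≤ ∫ g, (lse (fun w : Cfg N × Cfg N => lf (HA2 β q t) g w + cc h l w
        + (- N * (t * β ^ 2 / 2) * (ov w.1 w.2 / N - v2) ^ 2)) + N * K) ∂gp (Edg N ⊕ Fin N) := by
    unfold LL
    refine integral_mono ?_ ?_ ?_
    · have := lse_integrable (lf_add_integrable (HA2 (N := N) β q t) (fun w => cc h 0 w - N * Λ * (ov w.1 w.2 / N - u) ^ 2))
      simpa only [add_sub_assoc] using this
    · have := lse_integrable (lf_add_integrable (HA2 (N := N) β q t) (fun w => cc h l w + (- N * (t * β ^ 2 / 2) * (ov w.1 w.2 / N - v2) ^ 2)))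
      simp only [← add_assoc] at this
      exact this.add (integrable_const _)
    · intro g
      beta_reduce
      rw [← lse_add_const]
      refine lse_mono fun w => ?_
      set x := ov w.1 w.2 / N - u with hx
      have e1 : cc h l w = cc h 0 w + l * (N * (x + u)) := by
        unfold cc; rw [hx]; field_simp; ring
      have e2 : ov w.1 w.2 / N - v2 = x + (u - v2) := by rw [hx]; ring
      rw [e1, e2]
      have h3 := soft_pen (l := l) (x := x) (u := u) (a := u - v2) ht1 hΛ
      have h4 := mul_le_l h3 hNr.le
      rw [← hK] at h4
      linarith
  refine h1.trans ?_
  rw [integral_add ?_ (integrable_const _)]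
  · simp only [integral_const, probReal_univ, one_smul]
    linarith
  · have := lse_integrable (lf_add_integrable (HA2 (N := N) β q t) (fun w => cc h l w + (- N * (t * β ^ 2 / 2) * (ov w.1 w.2 / N - v2) ^ 2)))
    simpa only [← add_assoc] using this
end
end

section
/-- squared hyperbolic secant -/
def sc (x : ℝ) : ℝ := (cosh x)⁻¹ ^ 2
lemma sc_pos (x : ℝ) : 0 < sc x := by unfold sc; have := cosh_pos x; positivity
lemma sc_eq (x : ℝ) : sc x = 1 - tanh x ^ 2 := by
  unfold sc; rw [tanh_eq_sinh_div_cosh]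
  have := cosh_pos x
  field_simp
  have := cosh_sq x; linarith
lemma tanh_sq_lt (x : ℝ) : tanh x ^ 2 < 1 := by have := sc_pos x; rw [sc_eq] at this; linarith
lemma tanh_abs (x : ℝ) : |tanh x| ≤ 1 := by rw [← sq_le_one_iff_abs_le_one]; exact (tanh_sq_lt x).le
lemma sc_le (x : ℝ) : sc x ≤ 1 := by rw [sc_eq]; nlinarith [sq_nonneg (tanh x)]
lemma sc_abs (x : ℝ) : |sc x| ≤ 1 := by rw [abs_of_pos (sc_pos x)]; exact sc_le x
lemma hasDerivAt_tanh (x : ℝ) : HasDerivAt tanh (sc x) x := by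
  have h : tanh = fun x => sinh x / cosh x := by ext x; exact tanh_eq_sinh_div_cosh x
  rw [h]
  refine ((hasDerivAt_sinh x).div (hasDerivAt_cosh x) (cosh_pos x).ne').congr_deriv ?_
  unfold sc
  have := cosh_pos x
  have h2 := cosh_sq x
  field_simp; linarith
lemma hasDerivAt_sc (x : ℝ) : HasDerivAt sc (-2 * tanh x * sc x) x := by
  have h : sc = fun x => 1 - tanh x ^ 2 := by ext x; exact sc_eq x
  have := ((hasDerivAt_tanh x).pow 2).const_sub 1
  rw [h]
  refine this.congr_deriv ?_
  rw [sc_eq]; simp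
lemma tanh_cont : Continuous tanh := continuous_iff_continuousAt.2 fun x => (hasDerivAt_tanh x).continuousAt
lemma sc_cont : Continuous sc := continuous_iff_continuousAt.2 fun x => (hasDerivAt_sc x).continuousAt

lemma logcosh_nonneg (x : ℝ) : 0 ≤ log (cosh x) := log_nonneg (one_le_cosh x)
lemma cosh_le_exp_abs (x : ℝ) : cosh x ≤ exp |x| := by
  rw [cosh_eq]
  have h1 := exp_le_exp.2 (le_abs_self x); have h2 := exp_le_exp.2 (neg_le_abs x)
  linarith
lemma logcosh_le (x : ℝ) : log (cosh x) ≤ |x| := by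
  rw [← log_exp |x|]; exact log_le_log (cosh_pos x) (cosh_le_exp_abs x)
lemma logcosh_cont : Continuous (fun x => log (cosh x)) := continuous_cosh.log fun x => (cosh_pos x).ne'

def fd (β h q z : ℝ) : ℝ := h + β * √q * z
/-- RS constants -/
def lc (β h q : ℝ) : ℝ := ∫ z, log (cosh (fd β h q z)) ∂gs
/-- E sech^4 -/
def s4 (β h q : ℝ) : ℝ := ∫ z, sc (fd β h q z) ^ 2 ∂gs
/-- replica symmetric free energy -/
def RS (β h q t : ℝ) : ℝ := log 2 + lc β h q + β ^ 2 / 4 * t * (1 - q) ^ 2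

/-- the product of two tanh -/
def TF (x : Bool → ℝ) : ℝ := tanh (x true) * tanh (x false)
/-- first derivatives -/
def dTF (s : Bool) (x : Bool → ℝ) : ℝ := sc (x s) * tanh (x (!s))
/-- second derivatives -/
def ddTF (s s' : Bool) (x : Bool → ℝ) : ℝ := if s = s' then -2 * tanh (x s) * sc (x s) * tanh (x (!s)) else sc (x true) * sc (x false)

lemma TF_smooth : SmoothF TF dTF ddTF 2 where
  cdF s := by
    unfold dTF; exact (sc_cont.comp (continuous_apply s)).mul (tanh_cont.comp (continuous_apply _))
  cddF s s' := by
    unfold ddTF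
    have h1 := fun s : Bool => sc_cont.comp (continuous_apply (A := fun _ : Bool => ℝ) s)
    have h2 := fun s : Bool => tanh_cont.comp (continuous_apply (A := fun _ : Bool => ℝ) s)
    split_ifs
    · exact (((continuous_const.mul (h2 s)).mul (h1 s)).mul (h2 _))
    · exact (h1 true).mul (h1 false)
  bdF s x := by
    unfold dTF
    rw [abs_mul]
    have := mul_le_mul (sc_abs (x s)) (tanh_abs (x !s)) (abs_nonneg _) zero_le_one
    linarith
  bddF s s' x := by
    unfold ddTF
    split_ifs
    · rw [abs_mul, abs_mul, abs_mul]
      have h1 := mul_le_mul (tanh_abs (x s)) (sc_abs (x s)) (abs_nonneg _) zero_le_one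
      have h2 := mul_le_mul h1 (tanh_abs (x !s)) (abs_nonneg _) (by norm_num)
      norm_num at *
      linarith
    · rw [abs_mul]
      have := mul_le_mul (sc_abs (x true)) (sc_abs (x false)) (abs_nonneg _) zero_le_one
      linarith
  cF := by
    unfold TF; exact (tanh_cont.comp (continuous_apply _)).mul (tanh_cont.comp (continuous_apply _))
  hF x x' t hx := by
    unfold TF dTF
    refine (((hasDerivAt_tanh _).comp t (hx true)).mul ((hasDerivAt_tanh _).comp t (hx false))).congr_deriv ?_
    simp; ring
  hdF s x x' t hx := by
    unfold dTF ddTF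
    refine (((hasDerivAt_sc _).comp t (hx s)).mul ((hasDerivAt_tanh _).comp t (hx (!s)))).congr_deriv ?_
    cases s <;> simp <;> ring

/-- expected product of tanh -/
def TT (h P R : ℝ) : ℝ := ∫ x : Bool → ℝ, tanh (h + P * x true + R * x false) * tanh (h + P * x true - R * x false) ∂gp Bool

lemma gs_int_bd {f : ℝ → ℝ} (hf : Continuous f) {C : ℝ} (h : ∀ x, |f x| ≤ C) {μ : Measure ℝ} [IsProbabilityMeasure μ] : Integrable f μ := by
  refine (integrable_const C).mono' hf.aestronglyMeasurable ?_
  filter_upwards with x; exact h x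
lemma int_bd {α : Type*} [TopologicalSpace α] [MeasurableSpace α] [BorelSpace α] {f : α → ℝ} (hf : Measurable f) {C : ℝ} (h : ∀ x, |f x| ≤ C) {μ : Measure α} [IsProbabilityMeasure μ] : Integrable f μ := by
  refine (integrable_const C).mono' hf.aestronglyMeasurable ?_
  filter_upwards with x; exact h x

lemma fd_cont (β h q : ℝ) : Continuous (fd β h q) := by unfold fd; fun_prop

lemma TT_ge {β h q P R s : ℝ} (hq0 : 0 ≤ q) (hqf : q = ∫ z, tanh (fd β h q z) ^ 2 ∂gs)
    (h1 : P ^ 2 + R ^ 2 = β ^ 2 * q) (h2 : P ^ 2 - R ^ 2 = β ^ 2 * s) (hs : s ≤ q) :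
    q - β ^ 2 * s4 β h q * (q - s) ≤ TT h P R := by
  set A : Bool → Unit → ℝ := fun _ _ => β * √q with hA
  set B : Bool → Bool → ℝ := fun s k => if k then P else (if s then R else -R) with hB
  have hsq : √q * √q = q := mul_self_sqrt hq0
  set Δ : Bool → Bool → ℝ := fun a b => if a = b then 0 else β ^ 2 * (q - s) with hΔ
  have key := TF_smooth.interp_le' A B (fun _ => h) 0 Δ (by
    intro a b
    simp only [hA, hB, hΔ, sum_bool, Finset.univ_unique, Finset.sum_singleton]
    cases a <;> cases b <;> simp <;> nlinarith) (C₀ := β ^ 2 * (q - s) * s4 β h q) ?_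
  · have e1 : ∫ g, TF (fun s => lf A g s + (fun _ => h) s + (0 : Bool → ℝ) s) ∂gp Unit = q := by
      rw [hqf]
      rw [← gp_integral_eval () (f := fun z => tanh (fd β h q z) ^ 2)]
      · refine integral_congr_ae (.of_forall fun g => ?_)
        simp only [TF, lf, hA, fd, Finset.univ_unique, Finset.sum_singleton, Pi.zero_apply, add_zero]
        rw [sq, add_comm]
      · exact ((tanh_cont.comp (fd_cont β h q)).pow 2).measurable
    have e2 : ∫ g, TF (fun s => lf B g s + (fun _ => h) s) ∂gp Bool = TT h P R := by
      unfold TT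
      refine integral_congr_ae (.of_forall fun g => ?_)
      simp only [TF, lf, hB, sum_bool]
      have e1 : P * g true + R * g false + h = h + P * g true + R * g false := by ring
      have e2 : P * g true + -(R * g false) + h = h + P * g true - R * g false := by ring
      simp [e1, e2]
    rw [e1, e2] at key
    linarith
  · intro t ht0 ht1
    set A' : Bool → Unit ⊕ Bool → ℝ := fun s => Sum.elim (A s) 0
    set B' : Bool → Unit ⊕ Bool → ℝ := fun s => Sum.elim 0 (B s)
    have hβs : 0 ≤ β ^ 2 * (q - s) := mul_nonneg (sq_nonneg _) (by linarith)
    have hX := Xt_cont A' B' (fun _ => h) 0 t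
    have hXs : ∀ s : Bool, ∫ g, sc (Xt A' B' (fun _ => h) 0 t g s) ^ 2 ∂gp (Unit ⊕ Bool) = s4 β h q := by
      intro s
      have := gp_integral_linear (fun k => √t * A' s k + √(1-t) * B' s k) (f := fun y => sc (h + y) ^ 2) (b := β * √q)
        (((sc_cont.comp (by fun_prop : Continuous fun y : ℝ => h + y)).pow 2).measurable) ?_
      · unfold s4 fd
        rw [← this]
        refine integral_congr_ae (.of_forall fun g => ?_)
        simp only [Xt, lf, Pi.zero_apply, mul_sum, add_mul, sum_add_distrib]
        congr 2
        have : ∀ x y : ℝ, x * y * 1 = x * y := fun x y => by ring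
        simp only [mul_assoc, mul_zero]
        ring
      · have ht : √t ^ 2 = t := sq_sqrt ht0.le
        have ht' : √(1-t) ^ 2 = 1 - t := sq_sqrt (by linarith)
        have hB2 : ∀ s, B s true ^ 2 + B s false ^ 2 = β ^ 2 * q := by intro s; cases s <;> simp [hB] <;> linarith
        simp only [A', B', sum_sum_type, Sum.elim_inl, Sum.elim_inr, Pi.zero_apply, mul_zero, add_zero, zero_add, mul_pow, ht, ht', sum_bool, Finset.univ_unique, Finset.sum_singleton, hA]
        rw [← mul_add, hB2, sq_sqrt hq0]; ring
    have hi : ∀ s : Bool, Integrable (fun g => sc (Xt A' B' (fun _ => h) 0 t g s) ^ 2) (gp (Unit ⊕ Bool)) := by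
      intro s
      refine int_bd ((sc_cont.comp ((continuous_apply s).comp hX)).pow 2).measurable (C := 1) fun g => ?_
      show |sc (Xt A' B' (fun _ => h) 0 t g s) ^ 2| ≤ 1
      rw [abs_pow]; exact pow_le_one₀ (abs_nonneg _) (sc_abs _)
    have hr : Integrable (fun g => β ^ 2 * (q - s) * (1/2) * (sc (Xt A' B' (fun _ => h) 0 t g true) ^ 2 + sc (Xt A' B' (fun _ => h) 0 t g false) ^ 2)) (gp (Unit ⊕ Bool)) :=
      ((hi true).add (hi false)).const_mul _
    refine (integral_mono (TF_smooth.Dexp_integrable _ _ hX.measurable) hr fun g => ?_).trans (le_of_eq ?_)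
    · simp only [Dexp, hΔ, ddTF, sum_bool]
      simp
      have := mul_nonneg hβs (sq_nonneg (sc (Xt A' B' (fun _ => h) 0 t g true) - sc (Xt A' B' (fun _ => h) 0 t g false)))
      nlinarith
    · rw [integral_const_mul, integral_add (hi true) (hi false), hXs, hXs]; ring

lemma coshsinh_le {l T : ℝ} (hl : |l| ≤ 1) (hT : |T| ≤ 1) : cosh l + T * sinh l ≤ 1 + (l * T + l ^ 2) := by
  have h1 := (abs_le.1 (Real.abs_exp_sub_one_sub_id_le hl)).2
  have h2 := (abs_le.1 (Real.abs_exp_sub_one_sub_id_le (x := -l) (by rwa [abs_neg]))).2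
  rw [cosh_eq, sinh_eq]
  have hT' := abs_le.1 hT
  nlinarith [mul_le_l h1 (by linarith : 0 ≤ (1+T)/2), mul_le_l h2 (by linarith : 0 ≤ (1-T)/2)]

lemma zs_eq' (o1 o2 l : ℝ) : zs o1 o2 l = 4 * (cosh o1 * cosh o2) * (cosh l + tanh o1 * tanh o2 * sinh l) := by
  rw [zs_eq, tanh_eq_sinh_div_cosh, tanh_eq_sinh_div_cosh]
  have := cosh_pos o1; have := cosh_pos o2
  field_simp

lemma cs_pos {l T : ℝ} (hT : |T| ≤ 1) : 0 < cosh l + T * sinh l := by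
  have hT' := abs_le.1 hT
  rw [cosh_eq, sinh_eq]
  have h1 := exp_pos l; have h2 := exp_pos (-l)
  rcases eq_or_lt_of_le hT'.1 with h | h
  · rw [← h]; nlinarith
  · nlinarith

/-- function of the first field only -/
lemma gpB_lin {f : ℝ → ℝ} (hf : Measurable f) (h P R : ℝ) {β q : ℝ} (hq : 0 ≤ q) (h1 : P ^ 2 + R ^ 2 = β ^ 2 * q) :
    ∫ x : Bool → ℝ, f (h + P * x true + R * x false) ∂gp Bool = ∫ z, f (fd β h q z) ∂gs := by
  have := gp_integral_linear (fun k : Bool => if k then P else R) (f := fun y => f (h + y)) (hf.comp (by fun_prop)) (b := β * √q) (by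
    simp; rw [mul_pow, sq_sqrt hq]; exact h1)
  simp only [sum_bool] at this
  unfold fd
  rw [← this]
  simp [add_assoc]

lemma Efun_AB {β h q P R l : ℝ} (ε : ℝ) (hq0 : 0 ≤ q) (hl : |l| ≤ 1) (h1 : P ^ 2 + R ^ 2 = β ^ 2 * q) :
    Efun P R 0 ε h l 1 ≤ 2 * log 2 + 2 * lc β h q + l * TT h P R + l ^ 2 := by
  have ep : ∀ x : Bool → ℝ, h + P * x true - R * x false = h + P * x true + (-R) * x false := fun x => by ring
  have hc : Continuous (fun x : Bool → ℝ => h + P * x true + R * x false) := by fun_prop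
  have hc' : Continuous (fun x : Bool → ℝ => h + P * x true - R * x false) := by fun_prop
  have hTi : Integrable (fun x : Bool → ℝ => tanh (h + P * x true + R * x false) * tanh (h + P * x true - R * x false)) (gp Bool) := by
    refine int_bd ((tanh_cont.comp hc).mul (tanh_cont.comp hc')).measurable (C := 1) fun x => ?_
    show |tanh (h + P * x true + R * x false) * tanh (h + P * x true - R * x false)| ≤ 1
    rw [abs_mul]; exact mul_le_one₀ (tanh_abs _) (abs_nonneg _) (tanh_abs _)
  have hLi : ∀ R : ℝ, Integrable (fun x : Bool → ℝ => log (cosh (h + P * x true + R * x false))) (gp Bool) := by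
    intro R
    refine gp_integrable_of_bd (C := |h|) (D := |P| + |R|) (logcosh_cont.comp (by fun_prop : Continuous (fun x : Bool → ℝ => h + P * x true + R * x false))).measurable fun x => ?_
    rw [abs_of_nonneg (logcosh_nonneg _)]
    refine (logcosh_le _).trans ?_
    have h1 := abs_add_le (h + P * x true) (R * x false)
    have h2 := abs_add_le h (P * x true)
    rw [abs_mul] at h1 h2
    simp only [sum_bool]
    nlinarith [abs_nonneg P, abs_nonneg R, abs_nonneg (x true), abs_nonneg (x false)]
  have hL : ∀ R : ℝ, P ^ 2 + R ^ 2 = β ^ 2 * q → ∫ x : Bool → ℝ, log (cosh (h + P * x true + R * x false)) ∂gp Bool = lc β h q :=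
    fun R hR => gpB_lin (f := fun y => log (cosh y)) logcosh_cont.measurable h P R hq0 hR
  have e1 : ∀ x : Bool → ℝ, log (∫ y, zs (h + P * x true + R * x false + 0 * y) (h + P * x true - R * x false + ε * 0 * y) l ^ (1:ℝ) ∂gs)
      = log 4 + log (cosh (h + P * x true + R * x false)) + log (cosh (h + P * x true + (-R) * x false))
        + log (cosh l + tanh (h + P * x true + R * x false) * tanh (h + P * x true - R * x false) * sinh l) := by
    intro x
    simp only [zero_mul, mul_zero, add_zero, rpow_one, integral_const, probReal_univ, one_smul]
    rw [zs_eq', ep]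
    have h1 := cosh_pos (h + P * x true + R * x false)
    have h2 := cosh_pos (h + P * x true + (-R) * x false)
    have hT : |tanh (h + P * x true + R * x false) * tanh (h + P * x true + (-R) * x false)| ≤ 1 := by
      rw [abs_mul]; exact mul_le_one₀ (tanh_abs _) (abs_nonneg _) (tanh_abs _)
    have h3 := cs_pos (l := l) hT
    rw [log_mul (by positivity) h3.ne', log_mul (by norm_num) (by positivity), log_mul h1.ne' h2.ne']
    ring
  unfold Efun
  simp only [e1]
  have hR2 : P ^ 2 + (-R) ^ 2 = β ^ 2 * q := by rw [neg_sq]; exact h1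
  set T : (Bool → ℝ) → ℝ := fun x => tanh (h + P * x true + R * x false) * tanh (h + P * x true - R * x false) with hT
  have hTb : ∀ x, |T x| ≤ 1 := fun x => by
    rw [hT]; simp only [abs_mul]; exact mul_le_one₀ (tanh_abs _) (abs_nonneg _) (tanh_abs _)
  have hi1 : Integrable (fun x : Bool → ℝ => log 4 + log (cosh (h + P * x true + R * x false)) + log (cosh (h + P * x true + (-R) * x false))) (gp Bool) :=
    ((integrable_const _).add (hLi R)).add (hLi (-R))
  have hTm : Measurable T := ((tanh_cont.comp hc).mul (tanh_cont.comp hc')).measurable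
  have hi2 : Integrable (fun x : Bool → ℝ => log (cosh l + T x * sinh l)) (gp Bool) := by
    have hu : ∀ x, log (cosh l + T x * sinh l) ≤ 1 + |l| + l ^ 2 := fun x => by
      have := log_le_sub_one_of_pos (cs_pos (l := l) (hTb x))
      have h2 := coshsinh_le hl (hTb x)
      have h3 : l * T x ≤ |l| := by
        have := le_abs_self (l * T x); rw [abs_mul] at this
        nlinarith [abs_nonneg l, hTb x]
      linarith
    have hlo : ∀ x, - |l| ≤ log (cosh l + T x * sinh l) := fun x => by
      rw [le_log_iff_exp_le (cs_pos (hTb x)), cosh_eq, sinh_eq]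
      have h1 := exp_le_exp.2 (neg_abs_le l)
      have h2 := exp_le_exp.2 (neg_le_neg (le_abs_self l))
      have hT' := abs_le.1 (hTb x)
      nlinarith
    refine int_bd ((measurable_const.add (hTm.mul_const _)).log) (C := 1 + |l| + l ^ 2) fun x => ?_
    show |log (cosh l + T x * sinh l)| ≤ _
    rw [abs_le]; exact ⟨by have := hlo x; nlinarith [sq_nonneg l], hu x⟩
  have hi3 : Integrable (fun x : Bool → ℝ => l * T x + l ^ 2) (gp Bool) := (hTi.const_mul l).add (integrable_const _)
  have hle : ∫ x, log (cosh l + T x * sinh l) ∂gp Bool ≤ l * TT h P R + l ^ 2 := by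
    refine (integral_mono hi2 hi3 fun x => ?_).trans (le_of_eq ?_)
    · have := log_le_sub_one_of_pos (cs_pos (l := l) (hTb x))
      have h2 := coshsinh_le hl (hTb x)
      simp only; linarith
    · rw [integral_add (hTi.const_mul l) (integrable_const _), integral_const_mul]; simp [TT, hT]
  have hlast : ∫ x : Bool → ℝ, (log 4 + log (cosh (h + P * x true + R * x false)) + log (cosh (h + P * x true + (-R) * x false))) ∂gp Bool
      = 2 * log 2 + 2 * lc β h q := by
    have hi0 : Integrable (fun x : Bool → ℝ => log 4 + log (cosh (h + P * x true + R * x false))) (gp Bool) := (integrable_const _).add (hLi R)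
    rw [integral_add hi0 (hLi (-R)), integral_add (integrable_const _) (hLi R), hL R h1, hL (-R) hR2]
    have : log 4 = 2 * log 2 := by rw [show (4:ℝ) = 2 ^ 2 by norm_num, log_pow]; norm_num
    simp [this]; ring
  rw [integral_add hi1 hi2, hlast]
  linarith
end

section
lemma s4_nonneg (β h q : ℝ) : 0 ≤ s4 β h q := integral_nonneg fun z => sq_nonneg _

lemma TT_abs (h P R : ℝ) : |TT h P R| ≤ 1 := by
  unfold TT
  have := norm_integral_le_of_norm_le_const (μ := gp Bool) (f := fun x : Bool → ℝ => tanh (h + P * x true + R * x false) * tanh (h + P * x true - R * x false)) (C := 1)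
    (.of_forall fun x => by
      rw [norm_eq_abs, abs_mul]; exact mul_le_one₀ (tanh_abs _) (abs_nonneg _) (tanh_abs _))
  simpa using this

lemma slack_le {a L B : ℝ} (hL : 0 < L) (ha : a ^ 2 ≤ B) : a ^ 2 / (4 * L) ≤ B / (4 * L) := by gcongr

lemma scalA {u q α T l S : ℝ} (hx : (1 - α) * (q - u) ≤ T - u) (hα : α ≤ 1) (hu : u ≤ q) (hl : l = -(T - u) / 4) (hS : S ≤ l ^ 2) :
    l * T + l ^ 2 + (- l * u + S) ≤ - ((1 - α) ^ 2 / 8) * (u - q) ^ 2 := by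
  have h0 : 0 ≤ (1 - α) * (q - u) := mul_nonneg (by linarith) (by linarith)
  have : ((1 - α) * (q - u)) ^ 2 ≤ (T - u) ^ 2 := by gcongr
  subst hl
  nlinarith

lemma scx {α t q u T : ℝ} (hα0 : 0 ≤ α) (ht1 : t ≤ 1) (hu : u ≤ q) (hT : q - α * (q - ((1 - t) * q + t * u)) ≤ T) :
    (1 - α) * (q - u) ≤ T - u := by
  have : α * (t * (q - u)) ≤ α * (q - u) := mul_le_l (by nlinarith) hα0
  nlinarith

lemma finA {l T α u q S E β t L : ℝ} (hsc : l * T + l ^ 2 + (- l * u + S) ≤ - ((1 - α) ^ 2 / 8) * (u - q) ^ 2)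
    (hE : E ≤ 2 * log 2 + 2 * L + l * T + l ^ 2) :
    1 / 1 * E + t * β ^ 2 / 2 * ((1 - q - 0 ^ 2) ^ 2 - 1 * ((q + 0 ^ 2) ^ 2 + ((q + u) / 2 - (q - u) / 2 + 1 * 0 ^ 2) ^ 2 - q ^ 2 - ((q + u) / 2 - (q - u) / 2) ^ 2))
      + (- l * u + t * β ^ 2 / 2 * 0 ^ 2 + S) ≤ 2 * (log 2 + L + β ^ 2 / 4 * t * (1 - q) ^ 2) - (1 - α) ^ 2 / 8 * (u - q) ^ 2 := by
  ring_nf at hsc hE ⊢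
  linarith

lemma scalB {y d b S l x : ℝ} (hy : 0 ≤ y) (hd : 0 ≤ d) (hx : y + d ≤ x) (hl : l = - x / 4) (hb : b ≤ y / 4 * d) (hS : S ≤ y ^ 2 / 16) :
    l * x + l ^ 2 + (b + S) ≤ - (y ^ 2 / 16) := by
  have : (y + d) ^ 2 ≤ x ^ 2 := by gcongr
  subst hl
  nlinarith [mul_nonneg hy hd]

lemma scB1 {α t q u T : ℝ} (hα0 : 0 ≤ α) (hq0 : 0 ≤ q) (ht1 : t ≤ 1) (hT : q - α * (q - (1 - 2 * t) * q) ≤ T) :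
    2 * q * (1 - α) + (- u - q) ≤ T - u := by
  have : α * (2 * t * q) ≤ α * (2 * q) := mul_le_l (by nlinarith) hα0
  nlinarith

lemma scB2 {β t d α q w0 : ℝ} (hd : 0 ≤ d) (hw : t * d ≤ w0) (hw0 : β ^ 2 * w0 ≤ q * (1 - α)) : t * β ^ 2 / 2 * (- d) ^ 2 ≤ (2 * q * (1 - α)) / 4 * d := by
  have h1 : β ^ 2 * (t * d) ≤ q * (1 - α) := (mul_le_l hw (sq_nonneg _)).trans hw0
  nlinarith

lemma scB3 {l β t d : ℝ} (h1 : -1 ≤ l) (h2 : l ≤ 1) (ht : 0 ≤ t) (ht1 : t ≤ 1) (hd : 0 ≤ d) (hd1 : d ≤ 1) :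
    (l - t * β ^ 2 * (- d)) ^ 2 ≤ (1 + β ^ 2) ^ 2 := by
  have htd : 0 ≤ t * d := mul_nonneg ht hd
  have htd1 : t * d ≤ 1 := by nlinarith
  have := mul_nonneg (sq_nonneg β) htd
  have := mul_le_l htd1 (sq_nonneg β)
  refine sq_le_sq' ?_ ?_ <;> nlinarith [sq_nonneg β]

lemma finB {l T y u d q S E β t L : ℝ} (hsc : l * (T - u) + l ^ 2 + (t * β ^ 2 / 2 * (-d) ^ 2 + S) ≤ - (y ^ 2 / 16))
    (hE : E ≤ 2 * log 2 + 2 * L + l * T + l ^ 2) :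
    1 / 1 * E + t * β ^ 2 / 2 * ((1 - q - 0 ^ 2) ^ 2 - 1 * ((q + 0 ^ 2) ^ 2 + (0 ^ 2 - q + 1 * 0 ^ 2) ^ 2 - q ^ 2 - (0 ^ 2 - q) ^ 2))
      + (- l * u + t * β ^ 2 / 2 * (-d) ^ 2 + S) ≤ 2 * (log 2 + L + β ^ 2 / 4 * t * (1 - q) ^ 2) - y ^ 2 / 16 := by
  ring_nf at hsc hE ⊢
  linarith

section
variable {N : ℕ} {β h q : ℝ}

lemma caseA (hN : 0 < N) (hq0 : 0 ≤ q) (hqf : q = ∫ z, tanh (fd β h q z) ^ 2 ∂gs) {α : ℝ} (hα : α ≤ 1) (hαd : β ^ 2 * s4 β h q = α)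
    {t u Λ : ℝ} (ht0 : 0 ≤ t) (ht1 : t ≤ 1) (hΛ : β ^ 2 / 2 + 1 ≤ Λ) (hu0 : -1 ≤ u) (hu3 : u ≤ 1) (hu1 : -q ≤ u) (hu2 : u ≤ q) :
    LL N β h q t Λ u ≤ N * (2 * RS β h q t - (1 - α) ^ 2 / 8 * (u - q) ^ 2) := by
  have hα0 : 0 ≤ α := by rw [← hαd]; exact mul_nonneg (sq_nonneg _) (s4_nonneg _ _ _)
  have hp : √((q + u) / 2) ^ 2 = (q + u) / 2 := sq_sqrt (by linarith)
  have hr : √((q - u) / 2) ^ 2 = (q - u) / 2 := sq_sqrt (by linarith)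
  obtain ⟨P, hP⟩ : ∃ P : ℝ, P ^ 2 = β ^ 2 * ((1 - t) * q + t * ((q + u) / 2)) :=
    ⟨_, sq_sqrt (mul_nonneg (sq_nonneg _) (add_nonneg (mul_nonneg (by linarith) hq0) (mul_nonneg ht0 (by linarith))))⟩
  obtain ⟨R, hR⟩ : ∃ R : ℝ, R ^ 2 = t * β ^ 2 * ((q - u) / 2) :=
    ⟨_, sq_sqrt (mul_nonneg (mul_nonneg ht0 (sq_nonneg _)) (by linarith))⟩
  have hPR : P ^ 2 + R ^ 2 = β ^ 2 * q := by rw [hP, hR]; ring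
  have hT := TT_ge (h := h) (s := (1 - t) * q + t * u) hq0 hqf hPR (by rw [hP, hR]; ring) (by nlinarith)
  have hTa := abs_le.1 (TT_abs h P R)
  obtain ⟨l, hl⟩ : ∃ l, l = -(TT h P R - u) / 4 := ⟨_, rfl⟩
  have hl1 : |l| ≤ 1 := by rw [abs_le]; constructor <;> linarith
  have key := coupled_main hN β h l (q := q) (t := t) (m := 1) (p := √((q + u) / 2)) (r := √((q - u) / 2)) (c := 0) (ε := 1) (P := P) (R := R) (Λ := Λ) (u := u)
    hq0 ht0 ht1 one_pos le_rfl (by norm_num) (by rw [hp, hr]; ring) (by rw [hp, hP]) (by rw [hr, hR]) (by linarith)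
  have hE := Efun_AB (β := β) (q := q) (P := P) (R := R) (h := h) (l := l) 1 hq0 hl1 hPR
  rw [hp, hr] at key
  refine key.trans (mul_le_l ?_ (Nat.cast_nonneg N))
  have hs : l ^ 2 / (4 * (Λ - β ^ 2 / 2)) ≤ l ^ 2 := by
    rw [div_le_iff₀ (by linarith)]; nlinarith [sq_nonneg l]
  rw [hαd] at hT
  have hsc := scalA (scx hα0 ht1 hu2 hT) hα hu2 hl hs
  have e0 : √t * β * 0 = 0 := by ring
  have ev : u - ((q + u) / 2 - (q - u) / 2 + 1 * (0:ℝ) ^ 2) = 0 := by ring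
  have ez : l - t * β ^ 2 * 0 = l := by ring
  rw [e0, ev, ez]
  exact finA hsc hE

lemma caseB (hN : 0 < N) (hq0 : 0 ≤ q) (hqf : q = ∫ z, tanh (fd β h q z) ^ 2 ∂gs) {α : ℝ} (hα : α ≤ 1) (hαd : β ^ 2 * s4 β h q = α)
    {t u Λ w0 : ℝ} (ht0 : 0 ≤ t) (ht1 : t ≤ 1) (hΛ : β ^ 2 / 2 + 1 ≤ Λ)
    (hΛ2 : (1 + β ^ 2) ^ 2 / (4 * (Λ - β ^ 2 / 2)) ≤ (2 * q * (1 - α)) ^ 2 / 16)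
    (hw0 : β ^ 2 * w0 ≤ q * (1 - α))
    (hu0 : -1 ≤ u) (hu1 : u ≤ -q) (hw : t * (- u - q) ≤ w0) :
    LL N β h q t Λ u ≤ N * (2 * RS β h q t - (2 * q * (1 - α)) ^ 2 / 16) := by
  have hα0 : 0 ≤ α := by rw [← hαd]; exact mul_nonneg (sq_nonneg _) (s4_nonneg _ _ _)
  have hr : √q ^ 2 = q := sq_sqrt hq0
  obtain ⟨P, hP⟩ : ∃ P : ℝ, P ^ 2 = β ^ 2 * ((1 - t) * q + t * 0 ^ 2) :=
    ⟨_, sq_sqrt (mul_nonneg (sq_nonneg _) (add_nonneg (mul_nonneg (by linarith) hq0) (by simp)))⟩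
  obtain ⟨R, hR⟩ : ∃ R : ℝ, R ^ 2 = t * β ^ 2 * q :=
    ⟨_, sq_sqrt (mul_nonneg (mul_nonneg ht0 (sq_nonneg _)) (by linarith))⟩
  have hPR : P ^ 2 + R ^ 2 = β ^ 2 * q := by rw [hP, hR]; ring
  have hT := TT_ge (h := h) (s := (1 - 2 * t) * q) hq0 hqf hPR (by rw [hP, hR]; ring) (by nlinarith)
  have hTa := abs_le.1 (TT_abs h P R)
  obtain ⟨l, hl⟩ : ∃ l, l = -(TT h P R - u) / 4 := ⟨_, rfl⟩
  have hl2 : -1 ≤ l := by linarith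
  have hl3 : l ≤ 1 := by linarith
  have key := coupled_main hN β h l (q := q) (t := t) (m := 1) (p := 0) (r := √q) (c := 0) (ε := 1) (P := P) (R := R) (Λ := Λ) (u := u)
    hq0 ht0 ht1 one_pos le_rfl (by norm_num) (by rw [hr]; ring) hP (by rw [hr, hR]) (by linarith)
  have hE := Efun_AB (β := β) (q := q) (P := P) (R := R) (h := h) (l := l) 1 hq0 (abs_le.2 ⟨hl2, hl3⟩) hPR
  rw [hr] at key
  refine key.trans (mul_le_l ?_ (Nat.cast_nonneg N))
  have e0 : √t * β * 0 = 0 := by ring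
  have ev : u - ((0:ℝ) ^ 2 - q + 1 * (0:ℝ) ^ 2) = - (- u - q) := by ring
  rw [e0, ev]
  rw [hαd] at hT
  have hd0 : 0 ≤ - u - q := by linarith
  have hsl := (slack_le (L := Λ - β ^ 2 / 2) (by linarith) (scB3 (β := β) hl2 hl3 ht0 ht1 hd0 (by linarith))).trans hΛ2
  have hsc := scalB (mul_nonneg (by linarith) (by linarith)) hd0 (scB1 hα0 hq0 ht1 hT) hl (scB2 hd0 hw hw0) hsl
  exact finB hsc hE
end
end

section
lemma gs_exp_int (a : ℝ) : Integrable (fun z => exp (a * z)) gs := by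
  refine (gs_integrable_exp |a|).mono' (by fun_prop) (.of_forall fun z => ?_)
  rw [norm_eq_abs, abs_of_pos (exp_pos _), exp_le_exp, ← abs_mul]; exact le_abs_self _

lemma gs_poly {n : ℕ} (c k : Fin n → ℝ) (b : ℝ) :
    Integrable (fun y => ∑ i, c i * exp (k i * b * y)) gs ∧ ∫ y, ∑ i, c i * exp (k i * b * y) ∂gs = ∑ i, c i * exp ((k i) ^ 2 * b ^ 2 / 2) := by
  have hi : ∀ i ∈ Finset.univ, Integrable (fun y => c i * exp (k i * b * y)) gs := fun i _ => (gs_exp_int _).const_mul _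
  refine ⟨integrable_finsetSum _ hi, ?_⟩
  rw [integral_finsetSum _ hi]
  refine scg fun i _ => ?_
  rw [integral_const_mul, gs_mgf, mul_pow]

lemma cosh_add_poly (a b y : ℝ) : cosh (a + b * y) = ∑ i : Fin 2, (![exp a / 2, exp (-a) / 2] : Fin 2 → ℝ) i * exp ((![1, -1] : Fin 2 → ℝ) i * b * y) := by
  simp only [Fin.sum_univ_two, Matrix.cons_val_zero, Matrix.cons_val_one]
  rw [cosh_eq, neg_add, exp_add, exp_add]
  ring_nf

lemma cosh_add_int (a b : ℝ) : Integrable (fun y => cosh (a + b * y)) gs := by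
  simp only [cosh_add_poly]; exact (gs_poly _ _ b).1
lemma cosh_add_integral (a b : ℝ) : ∫ y, cosh (a + b * y) ∂gs = exp (b ^ 2 / 2) * cosh a := by
  simp only [cosh_add_poly]; rw [(gs_poly _ _ b).2]
  simp [Fin.sum_univ_two]; rw [cosh_eq]; ring

lemma inv_ge_poly {v : ℝ} (hv : 0 < v) : 4 - 6 * v + 4 * v ^ 2 - v ^ 3 ≤ v⁻¹ := by
  rw [← sub_nonneg]
  have : v⁻¹ - (4 - 6 * v + 4 * v ^ 2 - v ^ 3) = (1 - v) ^ 4 / v := by field_simp; ring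
  rw [this]; positivity

/-- lower bound for the averaged sech -/
lemma sech_poly {p r : ℝ} (hp : 0 ≤ p) (hr : 0 ≤ r) (hpr : p + r = 1) {x : ℝ} (hx0 : 0 ≤ x) (hx : 4 * x ≤ 1) :
    1 - 4 * (p * r) * x - 21 * x ^ 2 ≤ exp (-(x / 2)) * (4 - 6 * exp (x / 2) + 4 * ((p ^ 2 + r ^ 2) * exp (2 * x) + 2 * (p * r))
      - ((p ^ 3 + r ^ 3) * exp (9 * x / 2) + 3 * (p * r) * exp (x / 2))) := by
  have e1 : exp (-(x / 2)) * exp (x / 2) = 1 := by rw [← exp_add]; simp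
  have e2 : exp (-(x / 2)) * exp (2 * x) = exp (3 * x / 2) := by rw [← exp_add]; ring_nf
  have e3 : exp (-(x / 2)) * exp (9 * x / 2) = exp (4 * x) := by rw [← exp_add]; ring_nf
  have h1 : 1 - x / 2 ≤ exp (-(x / 2)) := by have := add_one_le_exp (-(x / 2)); linarith
  have h2 : 1 + 3 * x / 2 ≤ exp (3 * x / 2) := by have := add_one_le_exp (3 * x / 2); linarith
  have h3 : exp (4 * x) ≤ 1 + 4 * x + 16 * x ^ 2 := by
    have := (abs_le.1 (abs_exp_sub_one_sub_id_le (x := 4 * x) (by rw [abs_of_nonneg (by linarith)]; exact hx))).2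
    nlinarith
  have h4 : exp (3 * x / 2) ≤ 1 + 3 * x / 2 + 9 / 4 * x ^ 2 := by
    have := (abs_le.1 (abs_exp_sub_one_sub_id_le (x := 3 * x / 2) (by rw [abs_of_nonneg (by linarith)]; linarith))).2
    nlinarith
  have h5 : 1 + 4 * x ≤ exp (4 * x) := by have := add_one_le_exp (4 * x); linarith
  have hs : p ^ 2 + r ^ 2 = 1 - 2 * (p * r) := by have : r = 1 - p := by linarith
                                                  subst this; ring
  have hc : p ^ 3 + r ^ 3 = 1 - 3 * (p * r) := by have : r = 1 - p := by linarith
                                                  subst this; ring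
  have hpr0 : 0 ≤ p * r := mul_nonneg hp hr
  have hpr1 : p * r ≤ 1 / 4 := by nlinarith [sq_nonneg (p - r)]
  rw [hs, hc]
  generalize p * r = π₁ at *
  generalize exp (-(x / 2)) = A at *
  generalize exp (x / 2) = B at *
  generalize exp (2 * x) = D at *
  generalize exp (9 * x / 2) = F at *
  generalize exp (3 * x / 2) = D' at *
  generalize exp (4 * x) = F' at *
  have hbr : 8 * (D' - A) - 3 * (F' - 1) ≤ 4 * x + 18 * x ^ 2 := by linarith
  have hbr2 := mul_le_l hbr hpr0
  have : A * (4 - 6 * B + 4 * ((1 - 2 * π₁) * D + 2 * π₁) - ((1 - 3 * π₁) * F + 3 * π₁ * B))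
     = 4 * A - 6 + 4 * D' - F' - π₁ * (8 * (D' - A) - 3 * (F' - 1)) := by
    rw [← e2, ← e3]; linear_combination (-6 - 3 * π₁) * e1
  rw [this]
  nlinarith [sq_nonneg x]

lemma sech_avg (a b : ℝ) (hb : 4 * b ^ 2 ≤ 1) :
    sc a * (1 - sc a * b ^ 2 - 21 * (b ^ 2) ^ 2) * (exp (b ^ 2 / 2) * cosh a) ≤ ∫ y, (cosh (a + b * y))⁻¹ ∂gs := by
  obtain ⟨T, hT⟩ : ∃ T, T = tanh a := ⟨_, rfl⟩
  have hTa := abs_le.1 (tanh_abs a)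
  rw [← hT] at hTa
  obtain ⟨p, hp⟩ : ∃ p, p = (1 + T) / 2 := ⟨_, rfl⟩
  obtain ⟨r, hr⟩ : ∃ r, r = (1 - T) / 2 := ⟨_, rfl⟩
  have hp0 : 0 ≤ p := by linarith
  have hr0 : 0 ≤ r := by linarith
  have hpr : p + r = 1 := by linarith
  have hsc : sc a = 4 * (p * r) := by rw [sc_eq, ← hT, hp, hr]; ring
  have hc := cosh_pos a
  have hv : ∀ y, cosh (a + b * y) = cosh a * (p * exp (b * y) + r * exp (-(b * y))) := by
    intro y
    have : T * cosh a = sinh a := by rw [hT, tanh_eq_sinh_div_cosh]; field_simp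
    rw [cosh_add, ← this, cosh_eq (b * y), sinh_eq, hp, hr]; ring
  set c : Fin 7 → ℝ := ![4 + 8 * (p * r), -6 * p - 3 * p ^ 2 * r, -6 * r - 3 * p * r ^ 2, 4 * p ^ 2, 4 * r ^ 2, - p ^ 3, - r ^ 3] with hcd
  set k : Fin 7 → ℝ := ![0, 1, -1, 2, -2, 3, -3] with hkd
  obtain ⟨hi, hI⟩ := gs_poly c k b
  have hlow : ∀ y, (cosh a)⁻¹ * (∑ i, c i * exp (k i * b * y)) ≤ (cosh (a + b * y))⁻¹ := by
    intro y
    rw [hv, mul_inv]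
    have hvp : 0 < p * exp (b * y) + r * exp (-(b * y)) := by
      have := cosh_pos (a + b * y); rw [hv] at this; exact (mul_pos_iff_of_pos_left hc).1 this
    refine mul_le_l (le_trans (le_of_eq ?_) (inv_ge_poly hvp)) (inv_pos.2 hc).le
    simp only [hcd, hkd, Fin.sum_univ_succ, Fin.sum_univ_zero]
    simp
    have q1 : exp (-(b * y)) * exp (b * y) = 1 := by rw [← exp_add]; simp
    have q2 : exp (2 * b * y) = exp (b * y) ^ 2 := by rw [← exp_nat_mul]; ring_nf
    have q3 : exp (-(2 * b * y)) = exp (-(b * y)) ^ 2 := by rw [← exp_nat_mul]; ring_nf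
    have q4 : exp (3 * b * y) = exp (b * y) ^ 3 := by rw [← exp_nat_mul]; ring_nf
    have q5 : exp (-(3 * b * y)) = exp (-(b * y)) ^ 3 := by rw [← exp_nat_mul]; ring_nf
    rw [q2, q3, q4, q5]
    generalize exp (b * y) = E at *
    generalize exp (-(b * y)) = F at *
    linear_combination (-8 * p * r + 3 * p ^ 2 * r * E + 3 * p * r ^ 2 * F) * q1
  have hinte : Integrable (fun y => (cosh (a + b * y))⁻¹) gs := by
    refine gs_int_bd (C := 1) ?_ fun y => ?_
    · exact (continuous_cosh.comp (by fun_prop : Continuous fun y : ℝ => a + b * y)).inv₀ fun y => (cosh_pos _).ne'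
    · rw [abs_of_pos (inv_pos.2 (cosh_pos _))]; exact inv_le_one_of_one_le₀ (one_le_cosh _)
  have hmono := integral_mono (hi.const_mul (cosh a)⁻¹) hinte hlow
  rw [integral_const_mul, hI] at hmono
  refine le_trans ?_ hmono
  have hsp := sech_poly hp0 hr0 hpr (sq_nonneg b) hb
  have hsum : ∑ i, c i * exp (k i ^ 2 * b ^ 2 / 2) = (4 - 6 * exp (b ^ 2 / 2) + 4 * ((p ^ 2 + r ^ 2) * exp (2 * b ^ 2) + 2 * (p * r))
      - ((p ^ 3 + r ^ 3) * exp (9 * b ^ 2 / 2) + 3 * (p * r) * exp (b ^ 2 / 2))) := by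
    simp only [hcd, hkd, Fin.sum_univ_succ, Fin.sum_univ_zero]
    simp
    have q2 : (2:ℝ) ^ 2 * b ^ 2 / 2 = 2 * b ^ 2 := by ring
    have q3 : (3:ℝ) ^ 2 * b ^ 2 / 2 = 9 * b ^ 2 / 2 := by ring
    rw [q2, q3]
    have : r = 1 - p := by linarith
    subst this; ring
  rw [hsum]
  have hE : exp (-(b ^ 2 / 2)) = (exp (b ^ 2 / 2))⁻¹ := exp_neg _
  rw [hE] at hsp
  have hE0 := exp_pos (b ^ 2 / 2)
  have h3 := (le_inv_mul_iff₀ hE0).1 hsp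
  have hcc : sc a * cosh a = (cosh a)⁻¹ := by unfold sc; field_simp
  calc _ = (cosh a)⁻¹ * (exp (b ^ 2 / 2) * (1 - 4 * (p * r) * b ^ 2 - 21 * (b ^ 2) ^ 2)) := by rw [← hcc, ← hsc]; ring
    _ ≤ _ := mul_le_l h3 (inv_pos.2 hc).le

/-- pointwise bound -/
lemma zs_half {o l : ℝ} (hl0 : 0 ≤ l) (hl1 : l ≤ 1) :
    zs o o l ^ (1/2 : ℝ) ≤ 2 * (1 + l / 2 + l ^ 2 / 2) * cosh o - l * (cosh o)⁻¹ := by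
  have hc := cosh_pos o
  have hT : |tanh o * tanh o| ≤ 1 := by rw [abs_mul]; exact mul_le_one₀ (tanh_abs _) (abs_nonneg _) (tanh_abs _)
  have h1 := coshsinh_le (l := l) (by rw [abs_of_nonneg hl0]; exact hl1) hT
  have e : 2 * (1 + l / 2 + l ^ 2 / 2) * cosh o - l * (cosh o)⁻¹ = 2 * cosh o * (1 + (l * (tanh o * tanh o) + l ^ 2) / 2) := by
    have : tanh o * tanh o = 1 - sc o := by rw [sc_eq]; ring
    rw [this]; unfold sc; field_simp; ring
  rw [e]
  have hD0 : 0 ≤ l * (tanh o * tanh o) + l ^ 2 := by have := mul_self_nonneg (tanh o); positivity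
  rw [← sqrt_eq_rpow, sqrt_le_left (by positivity), zs_eq']
  generalize l * (tanh o * tanh o) + l ^ 2 = D at *
  have : 4 * (cosh o * cosh o) * (cosh l + tanh o * tanh o * sinh l) ≤ 4 * (cosh o * cosh o) * (1 + D) := mul_le_l h1 (by positivity)
  nlinarith [mul_nonneg (mul_self_nonneg (cosh o)) (sq_nonneg D)]

lemma zs_half_ge {o l : ℝ} (hl0 : 0 ≤ l) : 1 ≤ zs o o l ^ (1/2 : ℝ) := by
  refine one_le_rpow ?_ (by norm_num)
  rw [zs_eq']
  have h1 := one_le_cosh o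
  have h2 := one_le_cosh l
  have h3 : 0 ≤ sinh l := sinh_nonneg_iff.2 hl0
  have h4 : 0 ≤ tanh o * tanh o * sinh l := mul_nonneg (mul_self_nonneg _) h3
  nlinarith [mul_le_mul h1 h1 zero_le_one (by linarith)]

lemma zs_cont (l : ℝ) : Continuous fun o : ℝ × ℝ => zs o.1 o.2 l := by
  unfold zs; fun_prop

lemma inner_C {a b l : ℝ} (hl0 : 0 ≤ l) (hl1 : l ≤ 1) (hb : 4 * b ^ 2 ≤ 1) :
    0 ≤ log (∫ y, zs (a + b * y) (a + b * y) l ^ (1/2:ℝ) ∂gs) ∧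
    log (∫ y, zs (a + b * y) (a + b * y) l ^ (1/2:ℝ) ∂gs) ≤
      log 2 + b ^ 2 / 2 + log (cosh a) + l ^ 2 / 2 + l / 2 * (tanh a ^ 2 + b ^ 2 * sc a ^ 2 + 21 * (b ^ 2) ^ 2) := by
  have hinv : Integrable (fun y => (cosh (a + b * y))⁻¹) gs := by
    refine gs_int_bd (C := 1) ?_ fun y => ?_
    · exact (continuous_cosh.comp (by fun_prop : Continuous fun y : ℝ => a + b * y)).inv₀ fun y => (cosh_pos _).ne'
    · rw [abs_of_pos (inv_pos.2 (cosh_pos _))]; exact inv_le_one_of_one_le₀ (one_le_cosh _)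
  have hU : Integrable (fun y => 2 * (1 + l / 2 + l ^ 2 / 2) * cosh (a + b * y) - l * (cosh (a + b * y))⁻¹) gs :=
    ((cosh_add_int a b).const_mul _).sub (hinv.const_mul _)
  have hzc : Continuous (fun y : ℝ => zs (a + b * y) (a + b * y) l ^ (1/2:ℝ)) :=
    ((zs_cont l).comp (by fun_prop : Continuous fun y : ℝ => ((a + b * y, a + b * y) : ℝ × ℝ))).rpow_const fun y => Or.inr (by norm_num)
  have hz : Integrable (fun y => zs (a + b * y) (a + b * y) l ^ (1/2:ℝ)) gs := by
    refine hU.mono' hzc.aestronglyMeasurable (.of_forall fun y => ?_)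
    rw [norm_eq_abs, abs_of_nonneg (rpow_nonneg (zs_pos _ _ _).le _)]; exact zs_half hl0 hl1
  have hge : 1 ≤ ∫ y, zs (a + b * y) (a + b * y) l ^ (1/2:ℝ) ∂gs := by
    have := integral_mono (μ := gs) (integrable_const (1:ℝ)) hz fun y => zs_half_ge hl0
    simpa using this
  refine ⟨log_nonneg hge, ?_⟩
  have hle := integral_mono hz hU fun y => zs_half hl0 hl1
  rw [integral_sub ((cosh_add_int a b).const_mul _) (hinv.const_mul _), integral_const_mul, integral_const_mul, cosh_add_integral] at hle
  have hs := sech_avg a b hb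
  have hc := cosh_pos a
  have hE := exp_pos (b ^ 2 / 2)
  obtain ⟨τ, hτ⟩ : ∃ τ, τ = tanh a ^ 2 + b ^ 2 * sc a ^ 2 + 21 * (b ^ 2) ^ 2 := ⟨_, rfl⟩
  have hτ0 : 0 ≤ τ := by rw [hτ]; positivity
  have hge1 : 1 - τ ≤ sc a * (1 - sc a * b ^ 2 - 21 * (b ^ 2) ^ 2) := by
    have h1 := sc_le a; have h2 := (sc_pos a).le
    have : tanh a ^ 2 = 1 - sc a := by rw [sc_eq]; ring
    rw [hτ, this]; nlinarith [mul_nonneg (by linarith : 0 ≤ 1 - sc a) (sq_nonneg (b ^ 2))]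
  have hfin : ∫ y, zs (a + b * y) (a + b * y) l ^ (1/2:ℝ) ∂gs ≤ 2 * exp (b ^ 2 / 2) * cosh a * (1 + (l ^ 2 / 2 + l / 2 * τ)) := by
    have h1 := mul_le_r hge1 (mul_pos hE hc).le
    have h2 := mul_le_l (h1.trans hs) hl0
    nlinarith [mul_nonneg (mul_nonneg (sq_nonneg l) hE.le) hc.le]
  rw [← hτ]
  refine (log_le_log (by linarith) hfin).trans ?_
  rw [log_mul (by positivity) (by positivity), log_mul (by positivity) hc.ne', log_mul two_ne_zero hE.ne', log_exp]
  have := log_le_sub_one_of_pos (show 0 < 1 + (l ^ 2 / 2 + l / 2 * τ) by positivity)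
  linarith

lemma fd_lc_int (β h q : ℝ) : Integrable (fun z => log (cosh (fd β h q z))) gs := by
  have h1 := (gs_integrable_exp 1)
  refine ((integrable_const |h|).add (h1.const_mul |β * √q|)).mono' (logcosh_cont.comp (fd_cont β h q)).aestronglyMeasurable (.of_forall fun z => ?_)
  rw [norm_eq_abs, abs_of_nonneg (logcosh_nonneg _)]
  refine (logcosh_le _).trans ?_
  unfold fd
  refine (abs_add_le _ _).trans ?_
  rw [abs_mul]
  have : |z| ≤ exp (1 * |z|) := by have := add_one_le_exp (1 * |z|); linarith
  show _ ≤ |h| + |β * √q| * exp (1 * |z|)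
  gcongr

lemma Efun_C {β h q b l P : ℝ} (hq0 : 0 ≤ q) (hqf : q = ∫ z, tanh (fd β h q z) ^ 2 ∂gs) (hP : P ^ 2 = β ^ 2 * q)
    (hl0 : 0 ≤ l) (hl1 : l ≤ 1) (hb : 4 * b ^ 2 ≤ 1) :
    2 * Efun P 0 b 1 h l (1/2) ≤ 2 * log 2 + b ^ 2 + 2 * lc β h q + l ^ 2 + l * (q + b ^ 2 * s4 β h q + 21 * (b ^ 2) ^ 2) := by
  unfold Efun
  set U : ℝ → ℝ := fun a => log 2 + b ^ 2 / 2 + log (cosh a) + l ^ 2 / 2 + l / 2 * (tanh a ^ 2 + b ^ 2 * sc a ^ 2 + 21 * (b ^ 2) ^ 2) with hU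
  have i1 := fd_lc_int β h q
  have i2 : Integrable (fun z => tanh (fd β h q z) ^ 2) gs :=
    gs_int_bd ((tanh_cont.comp (fd_cont β h q)).pow 2) (C := 1) fun z => by
      show |tanh (fd β h q z) ^ 2| ≤ 1
      rw [abs_pow]; exact pow_le_one₀ (abs_nonneg _) (tanh_abs _)
  have i3 : Integrable (fun z => sc (fd β h q z) ^ 2) gs :=
    gs_int_bd ((sc_cont.comp (fd_cont β h q)).pow 2) (C := 1) fun z => by
      show |sc (fd β h q z) ^ 2| ≤ 1
      rw [abs_pow]; exact pow_le_one₀ (abs_nonneg _) (sc_abs _)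
  have i4 : Integrable (fun z => b ^ 2 * sc (fd β h q z) ^ 2) gs := i3.const_mul _
  have i5 : Integrable (fun z => tanh (fd β h q z) ^ 2 + b ^ 2 * sc (fd β h q z) ^ 2) gs := i2.add i4
  have i6 : Integrable (fun z => tanh (fd β h q z) ^ 2 + b ^ 2 * sc (fd β h q z) ^ 2 + 21 * (b ^ 2) ^ 2) gs := i5.add (integrable_const _)
  have i7 : Integrable (fun z => l / 2 * (tanh (fd β h q z) ^ 2 + b ^ 2 * sc (fd β h q z) ^ 2 + 21 * (b ^ 2) ^ 2)) gs := i6.const_mul _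
  have i8 : Integrable (fun z => log 2 + b ^ 2 / 2 + log (cosh (fd β h q z))) gs := (integrable_const _).add i1
  have i9 : Integrable (fun z => log 2 + b ^ 2 / 2 + log (cosh (fd β h q z)) + l ^ 2 / 2) gs := i8.add (integrable_const _)
  have hUi : Integrable (fun z => U (fd β h q z)) gs := i9.add i7
  have hUc : Continuous U := by
    have h1 := logcosh_cont; have h2 := tanh_cont; have h3 := sc_cont
    simp only [hU]; fun_prop
  have hIe : ∫ z, U (fd β h q z) ∂gs = log 2 + b ^ 2 / 2 + lc β h q + l ^ 2 / 2 + l / 2 * (q + b ^ 2 * s4 β h q + 21 * (b ^ 2) ^ 2) := by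
    simp only [hU]
    rw [integral_add i9 i7, integral_add i8 (integrable_const _), integral_add (integrable_const _) i1, integral_const_mul,
      integral_add i5 (integrable_const _), integral_add i2 i4, integral_const_mul, ← hqf]
    simp [lc, s4]
  have hlin := gpB_lin (f := U) hUc.measurable h P 0 hq0 (by rw [hP]; ring : P ^ 2 + 0 ^ 2 = β ^ 2 * q)
  have hUB : Integrable (fun x : Bool → ℝ => U (h + P * x true + 0 * x false)) (gp Bool) := by
    by_contra hcon
    have h1 : ∀ z, 0 ≤ U z := fun z => by
      have := logcosh_nonneg z
      have := log_nonneg (one_le_two (α := ℝ))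
      simp only [hU]; positivity
    refine hcon (gp_integrable_of_bd (C := log 2 + b ^ 2 / 2 + |h| + l ^ 2 / 2 + l / 2 * (1 + b ^ 2 * 1 + 21 * (b ^ 2) ^ 2)) (D := |P|) (hUc.comp (by fun_prop : Continuous fun x : Bool → ℝ => h + P * x true + 0 * x false)).measurable fun x => ?_)
    show |U (h + P * x true + 0 * x false)| ≤ _
    rw [abs_of_nonneg (h1 _)]
    simp only [hU, sum_bool]
    have h2 := logcosh_le (h + P * x true + 0 * x false)
    have h3 : |h + P * x true + 0 * x false| ≤ |h| + |P| * |x true| := by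
      rw [zero_mul, add_zero, ← abs_mul]; exact abs_add_le _ _
    have h4 := (tanh_sq_lt (h + P * x true + 0 * x false)).le
    have h5 : sc (h + P * x true + 0 * x false) ^ 2 ≤ 1 := pow_le_one₀ (sc_pos _).le (sc_le _)
    have h6 : 0 ≤ |P| * |x false| := by positivity
    generalize h + P * x true + 0 * x false = a at *
    have h7 : l / 2 * (tanh a ^ 2 + b ^ 2 * sc a ^ 2 + 21 * (b ^ 2) ^ 2) ≤ l / 2 * (1 + b ^ 2 * 1 + 21 * (b ^ 2) ^ 2) := by gcongr
    linarith
  have hin : ∀ x : Bool → ℝ, (∫ y, zs (h + P * x true + 0 * x false + b * y) (h + P * x true - 0 * x false + 1 * b * y) l ^ (1/2:ℝ) ∂gs)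
      = ∫ y, zs (h + P * x true + 0 * x false + b * y) (h + P * x true + 0 * x false + b * y) l ^ (1/2:ℝ) ∂gs := fun x => by
    simp
  simp only [hin]
  have := integral_mono_of_nonneg (μ := gp Bool) (.of_forall fun x : Bool → ℝ => (inner_C (a := h + P * x true + 0 * x false) hl0 hl1 hb).1) hUB
    (.of_forall fun x => (inner_C (a := h + P * x true + 0 * x false) hl0 hl1 hb).2)
  rw [hlin, hIe] at this
  linarith
end

section
lemma finC {l τ α u q S E β t L d b2 : ℝ} (hd : d = u - q) (hb2 : b2 = β ^ 2 * (t * d))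
    (hx : (1 - α) / 2 * d ≤ u - τ) (hα : α ≤ 1) (hd0 : 0 ≤ d) (hl : l = (u - τ) / 4) (hS : S ≤ l ^ 2)
    (hE : 2 * E ≤ 2 * log 2 + b2 + 2 * L + l ^ 2 + l * τ) :
    1 / (1/2) * E + t * β ^ 2 / 2 * ((1 - q - d) ^ 2 - (1/2) * ((q + d) ^ 2 + (q - 0 ^ 2 + 1 * d) ^ 2 - q ^ 2 - (q - 0 ^ 2) ^ 2))
      + (- l * u + t * β ^ 2 / 2 * 0 ^ 2 + S) ≤ 2 * (log 2 + L + β ^ 2 / 4 * t * (1 - q) ^ 2) - (1 - α) ^ 2 / 32 * (u - q) ^ 2 := by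
  have h0 : 0 ≤ (1 - α) / 2 * d := mul_nonneg (by linarith) hd0
  have h1 : ((1 - α) / 2 * d) ^ 2 ≤ (u - τ) ^ 2 := by gcongr
  rw [← hd]
  subst hb2
  have h2 : l * τ - l * u + 2 * l ^ 2 = - (u - τ) ^ 2 / 8 := by subst hl; ring
  nlinarith

lemma scC {α β d w w0 u q τ : ℝ} (hα0 : 0 ≤ α) (hd : d = u - q) (hw : 0 ≤ w) (hwd : w ≤ d) (hw0 : w ≤ w0) (h21 : 21 * β ^ 4 * w0 ≤ (1 - α) / 2)
    (hτ : τ = q + α * w + 21 * (β ^ 2 * w) ^ 2) : (1 - α) / 2 * d ≤ u - τ := by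
  have h1 : α * w ≤ α * d := mul_le_l hwd hα0
  have h2 : 21 * β ^ 4 * w ≤ (1 - α) / 2 := (mul_le_l hw0 (by positivity)).trans h21
  have h3 : 21 * (β ^ 2 * w) ^ 2 ≤ (1 - α) / 2 * d := by
    have : 21 * (β ^ 2 * w) ^ 2 = (21 * β ^ 4 * w) * w := by ring
    rw [this]; exact mul_le_mul h2 hwd hw (by have : 0 ≤ 21 * β ^ 4 * w := by positivity
                                              linarith)
  rw [hτ]; linarith

section
variable {N : ℕ} {β h q : ℝ}

lemma caseC (hN : 0 < N) (hq0 : 0 ≤ q) (hqf : q = ∫ z, tanh (fd β h q z) ^ 2 ∂gs) {α : ℝ} (hα : α ≤ 1) (hαd : β ^ 2 * s4 β h q = α)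
    {t u Λ w0 : ℝ} (ht0 : 0 ≤ t) (ht1 : t ≤ 1) (hΛ : β ^ 2 / 2 + 1 ≤ Λ)
    (hw0 : 4 * (β ^ 2 * w0) ≤ 1) (h21 : 21 * β ^ 4 * w0 ≤ (1 - α) / 2)
    (hu0 : q ≤ u) (hu1 : u ≤ 1) (hw : t * (u - q) ≤ w0) :
    LL N β h q t Λ u ≤ N * (2 * RS β h q t - (1 - α) ^ 2 / 32 * (u - q) ^ 2) := by
  have hα0 : 0 ≤ α := by rw [← hαd]; exact mul_nonneg (sq_nonneg _) (s4_nonneg _ _ _)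
  have hp : √q ^ 2 = q := sq_sqrt hq0
  obtain ⟨d, hd⟩ : ∃ d, d = u - q := ⟨_, rfl⟩
  have hd0 : 0 ≤ d := by linarith
  have hc : √d ^ 2 = d := sq_sqrt hd0
  rw [← hd] at hw
  have hP : (β * √q) ^ 2 = β ^ 2 * q := by rw [mul_pow, hp]
  obtain ⟨b, hb⟩ : ∃ b, b = √t * β * √d := ⟨_, rfl⟩
  have hb2 : b ^ 2 = β ^ 2 * (t * d) := by rw [hb, mul_pow, mul_pow, hc, sq_sqrt ht0]; ring
  have hbd : 4 * b ^ 2 ≤ 1 := by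
    rw [hb2]; have := mul_le_l hw (sq_nonneg β); linarith
  obtain ⟨τ, hτ⟩ : ∃ τ, τ = q + b ^ 2 * s4 β h q + 21 * (b ^ 2) ^ 2 := ⟨_, rfl⟩
  have hτ2 : τ = q + α * (t * d) + 21 * (β ^ 2 * (t * d)) ^ 2 := by rw [hτ, hb2, ← hαd]; ring
  have htd : 0 ≤ t * d := mul_nonneg ht0 hd0
  have hx := scC hα0 hd htd (by nlinarith) hw h21 hτ2
  have hτ0 : 0 ≤ τ := by rw [hτ2]; positivity
  obtain ⟨l, hl⟩ : ∃ l, l = (u - τ) / 4 := ⟨_, rfl⟩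
  have hl0 : 0 ≤ l := by
    have : 0 ≤ (1 - α) / 2 * d := mul_nonneg (by linarith) hd0
    linarith
  have hl1 : l ≤ 1 := by linarith
  have hE := Efun_C (b := b) hq0 hqf hP hl0 hl1 hbd
  rw [← hτ] at hE
  have key := coupled_main hN β h l (q := q) (t := t) (m := 1/2) (p := √q) (r := 0) (c := √d) (ε := 1) (P := β * √q) (R := 0) (Λ := Λ) (u := u)
    hq0 ht0 ht1 (by norm_num) (by norm_num) (by norm_num) (by rw [hp]; ring) (by rw [hP, hp]; ring) (by ring) (by linarith)
  rw [hp, hc, ← hb] at key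
  refine key.trans (mul_le_l ?_ (Nat.cast_nonneg N))
  have hs : l ^ 2 / (4 * (Λ - β ^ 2 / 2)) ≤ l ^ 2 := by
    rw [div_le_iff₀ (by linarith)]; nlinarith [sq_nonneg l]
  have ev : u - (q - 0 ^ 2 + 1 * d) = 0 := by rw [hd]; ring
  have ez : l - t * β ^ 2 * 0 = l := by ring
  rw [ev, ez]
  exact finC hd hb2 hx hα hd0 hl hs hE
end

/-- log of averaged power of cosh -/
def Lc (n a C : ℝ) : ℝ := log (∫ y, cosh (a + C * y) ^ n ∂gs)

lemma coshpow_bd {n a C y : ℝ} (hn : 0 ≤ n) : cosh (a + C * y) ^ n ≤ exp (n * |a|) * exp (n * |C| * |y|) := by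
  have h1 : cosh (a + C * y) ≤ exp (|a| + |C| * |y|) := (cosh_le_exp_abs _).trans (exp_le_exp.2 (by
    rw [← abs_mul]; exact abs_add_le _ _))
  calc _ ≤ exp (|a| + |C| * |y|) ^ n := rpow_le_rpow (cosh_pos _).le h1 hn
    _ = _ := by rw [← exp_mul, ← exp_add]; ring_nf

lemma coshpow_cont {n : ℝ} (hn : 0 ≤ n) : Continuous fun o : ℝ => cosh o ^ n := continuous_cosh.rpow_const fun _ => Or.inr hn

lemma coshpow_int {n : ℝ} (hn : 0 ≤ n) (a C : ℝ) : Integrable (fun y => cosh (a + C * y) ^ n) gs := by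
  refine ((gs_integrable_exp (n * |C|)).const_mul (exp (n * |a|))).mono' ((coshpow_cont hn).comp (by fun_prop : Continuous fun y : ℝ => a + C * y)).aestronglyMeasurable
    (.of_forall fun y => ?_)
  rw [norm_eq_abs, abs_of_nonneg (rpow_nonneg (cosh_pos _).le _)]
  exact coshpow_bd hn

lemma coshpow_ge {n : ℝ} (hn : 0 ≤ n) (a C : ℝ) : 1 ≤ ∫ y, cosh (a + C * y) ^ n ∂gs := by
  have := integral_mono (μ := gs) (integrable_const (1:ℝ)) (coshpow_int hn a C) fun y => one_le_rpow (one_le_cosh _) hn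
  simpa using this

/-- moment constant -/
def Kc (n C : ℝ) : ℝ := ∫ y, exp (n * C * |y|) ∂gs

lemma coshpow_le {n : ℝ} (hn : 0 ≤ n) (a : ℝ) {C C0 : ℝ} (hC : |C| ≤ C0) : ∫ y, cosh (a + C * y) ^ n ∂gs ≤ exp (n * |a|) * Kc n C0 := by
  unfold Kc
  rw [← integral_const_mul]
  refine integral_mono (coshpow_int hn a C) ((gs_integrable_exp (n * C0)).const_mul _) fun y => (coshpow_bd hn).trans ?_
  show _ ≤ exp (n * |a|) * exp (n * C0 * |y|)
  gcongr

lemma Lc_nonneg {n : ℝ} (hn : 0 ≤ n) (a C : ℝ) : 0 ≤ Lc n a C := log_nonneg (coshpow_ge hn a C)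
lemma Lc_le {n : ℝ} (hn : 0 ≤ n) (a : ℝ) {C C0 : ℝ} (hC : |C| ≤ C0) : Lc n a C ≤ n * |a| + log (Kc n C0) := by
  have h1 := coshpow_ge hn a C
  have h2 := coshpow_le hn a hC
  have hK : 0 < Kc n C0 := by
    have : 0 < exp (n * |a|) * Kc n C0 := by linarith
    exact (mul_pos_iff_of_pos_left (exp_pos _)).1 this
  refine (log_le_log (by linarith) h2).trans ?_
  rw [log_mul (exp_pos _).ne' hK.ne', log_exp]

lemma Lc_meas {n : ℝ} (hn : 0 ≤ n) (C : ℝ) : Measurable fun a => Lc n a C := by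
  have hc : Continuous (fun p : ℝ × ℝ => cosh (p.1 + C * p.2) ^ n) := (coshpow_cont hn).comp (by fun_prop)
  exact (hc.stronglyMeasurable.integral_prod_right (ν := gs)).measurable.log

lemma Lc_neg (n a C : ℝ) : Lc n a (-C) = Lc n a C := by
  unfold Lc
  congr 1
  have : MeasurePreserving (fun y : ℝ => -y) gs gs := by
    refine ⟨measurable_neg, ?_⟩
    have := gaussianReal_map_neg (μ := 0) (v := 1)
    simpa [gs] using this
  rw [← this.integral_comp' (f := MeasurableEquiv.neg ℝ) (g := fun y => cosh (a + C * y) ^ n)]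
  simp

lemma cs_log {n : ℝ} (hn : 0 ≤ n) (a1 a2 C1 C2 : ℝ) :
    0 ≤ log (∫ y, zs (a1 + C1 * y) (a2 + C2 * y) 0 ^ (n / 2) ∂gs) ∧
    log (∫ y, zs (a1 + C1 * y) (a2 + C2 * y) 0 ^ (n / 2) ∂gs) ≤ n * log 2 + 1 / 2 * (Lc n a1 C1 + Lc n a2 C2) := by
  have e : ∀ y, zs (a1 + C1 * y) (a2 + C2 * y) 0 ^ (n / 2) = 2 ^ n * (cosh (a1 + C1 * y) ^ (n / 2) * cosh (a2 + C2 * y) ^ (n / 2)) := fun y => by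
    rw [zs_eq']
    have h1 := (cosh_pos (a1 + C1 * y)).le; have h2 := (cosh_pos (a2 + C2 * y)).le
    simp only [cosh_zero, sinh_zero, mul_zero, add_zero, mul_one]
    rw [mul_rpow (by norm_num) (by positivity), mul_rpow h1 h2, show (4:ℝ) = 2 ^ (2:ℝ) by norm_num, ← rpow_mul (by norm_num)]
    congr 2; ring
  simp only [e]
  set f : ℝ → ℝ := fun y => cosh (a1 + C1 * y) ^ (n / 2) with hf
  set g : ℝ → ℝ := fun y => cosh (a2 + C2 * y) ^ (n / 2) with hg
  have hn2 : 0 ≤ n / 2 := by linarith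
  have f1 : ∀ y, 1 ≤ f y := fun y => one_le_rpow (one_le_cosh _) hn2
  have g1 : ∀ y, 1 ≤ g y := fun y => one_le_rpow (one_le_cosh _) hn2
  have fc : Continuous f := (coshpow_cont hn2).comp (by fun_prop)
  have gc : Continuous g := (coshpow_cont hn2).comp (by fun_prop)
  have f2 : ∀ y, f y ^ 2 = cosh (a1 + C1 * y) ^ n := fun y => by
    rw [hf]; simp only; rw [← rpow_natCast, ← rpow_mul (cosh_pos _).le]; congr 1; push_cast; ring
  have g2 : ∀ y, g y ^ 2 = cosh (a2 + C2 * y) ^ n := fun y => by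
    rw [hg]; simp only; rw [← rpow_natCast, ← rpow_mul (cosh_pos _).le]; congr 1; push_cast; ring
  have fi : Integrable (fun y => f y ^ 2) gs := by simp only [f2]; exact coshpow_int hn _ _
  have gi : Integrable (fun y => g y ^ 2) gs := by simp only [g2]; exact coshpow_int hn _ _
  have fgi : Integrable (fun y => f y * g y) gs := by
    refine (fi.add gi).mono' (fc.mul gc).aestronglyMeasurable (.of_forall fun y => ?_)
    show ‖f y * g y‖ ≤ f y ^ 2 + g y ^ 2
    rw [norm_eq_abs, abs_of_nonneg (by have := f1 y; have := g1 y; positivity)]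
    nlinarith [sq_nonneg (f y - g y), sq_nonneg (f y), sq_nonneg (g y)]
  have hfg1 : 1 ≤ ∫ y, f y * g y ∂gs := by
    have := integral_mono (μ := gs) (integrable_const (1:ℝ)) fgi fun y => one_le_mul_of_one_le_of_one_le (f1 y) (g1 y)
    simpa using this
  rw [integral_const_mul]
  have h2n : 1 ≤ (2:ℝ) ^ n := one_le_rpow (by norm_num) hn
  refine ⟨log_nonneg (one_le_mul_of_one_le_of_one_le h2n hfg1), ?_⟩
  rw [log_mul (by positivity) (by linarith), log_rpow (by norm_num)]
  have hA := coshpow_ge hn a1 C1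
  have hB := coshpow_ge hn a2 C2
  set A := ∫ y, cosh (a1 + C1 * y) ^ n ∂gs with hAd
  set B := ∫ y, cosh (a2 + C2 * y) ^ n ∂gs with hBd
  -- Cauchy-Schwarz via a scaled AM-GM
  have hcs : ∫ y, f y * g y ∂gs ≤ √A * √B := by
    have hA0 : 0 < √A := sqrt_pos.2 (by linarith)
    have hB0 : 0 < √B := sqrt_pos.2 (by linarith)
    have hsA := sq_sqrt (by linarith : 0 ≤ A)
    have hsB := sq_sqrt (by linarith : 0 ≤ B)
    have i1 : Integrable (fun y => (√B / √A / 2) * f y ^ 2) gs := fi.const_mul _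
    have i2 : Integrable (fun y => (√A / √B / 2) * g y ^ 2) gs := gi.const_mul _
    have i3 : Integrable (fun y => (√B / √A / 2) * f y ^ 2 + (√A / √B / 2) * g y ^ 2) gs := i1.add i2
    have hm := integral_mono fgi i3 fun y => by
      show f y * g y ≤ (√B / √A / 2) * f y ^ 2 + (√A / √B / 2) * g y ^ 2
      have : (√B / √A / 2) * f y ^ 2 + (√A / √B / 2) * g y ^ 2 - f y * g y = (√B * f y - √A * g y) ^ 2 / (2 * √A * √B) := by
        field_simp; ring
      have h3 : 0 ≤ (√B * f y - √A * g y) ^ 2 / (2 * √A * √B) := by positivity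
      linarith
    have hadd : ∫ y, ((√B / √A / 2) * f y ^ 2 + (√A / √B / 2) * g y ^ 2) ∂gs = √A * √B := by
      rw [integral_add i1 i2, integral_const_mul, integral_const_mul]
      simp only [f2, g2]
      rw [← hAd, ← hBd]
      generalize √A = a' at *
      generalize √B = b' at *
      rw [← hsA, ← hsB]
      field_simp; ring
    rwa [hadd] at hm
  have : log (√A * √B) = 1 / 2 * (Lc n a1 C1 + Lc n a2 C2) := by
    rw [log_mul (sqrt_pos.2 (by linarith)).ne' (sqrt_pos.2 (by linarith)).ne', log_sqrt (by linarith), log_sqrt (by linarith)]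
    unfold Lc; ring
  have h3 := log_le_log (by linarith) hcs
  linarith

lemma Efun_DE {β h q P R C ε n : ℝ} (hq0 : 0 ≤ q) (hε : ε = 1 ∨ ε = -1) (h1 : P ^ 2 + R ^ 2 = β ^ 2 * q) (hn : 0 < n) :
    (1 / (n / 2)) * Efun P R C ε h 0 (n / 2) ≤ 2 * log 2 + (2 / n) * ∫ z, Lc n (fd β h q z) C ∂gs := by
  have hLe : ∀ a, Lc n a (ε * C) = Lc n a C := fun a => by
    rcases hε with h | h
    · rw [h, one_mul]
    · rw [h, neg_one_mul, Lc_neg]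
  have hI : ∀ R : ℝ, P ^ 2 + R ^ 2 = β ^ 2 * q → ∫ x : Bool → ℝ, Lc n (h + P * x true + R * x false) C ∂gp Bool = ∫ z, Lc n (fd β h q z) C ∂gs :=
    fun R hR => gpB_lin (f := fun a => Lc n a C) (Lc_meas hn.le C) h P R hq0 hR
  have hLi : ∀ R : ℝ, Integrable (fun x : Bool → ℝ => Lc n (h + P * x true + R * x false) C) (gp Bool) := by
    intro R
    refine gp_integrable_of_bd (C := n * |h| + log (Kc n |C|)) (D := n * (|P| + |R|)) ((Lc_meas hn.le C).comp (by fun_prop : Measurable (fun x : Bool → ℝ => h + P * x true + R * x false))) fun x => ?_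
    show |Lc n (h + P * x true + R * x false) C| ≤ _
    rw [abs_of_nonneg (Lc_nonneg hn.le _ _)]
    refine (Lc_le hn.le _ le_rfl).trans ?_
    have h1 := abs_add_le (h + P * x true) (R * x false)
    have h2 := abs_add_le h (P * x true)
    rw [abs_mul] at h1 h2
    simp only [sum_bool]
    have h3 : |h + P * x true + R * x false| ≤ |h| + (|P| + |R|) * (|x true| + |x false|) := by
      nlinarith [mul_nonneg (abs_nonneg P) (abs_nonneg (x false)), mul_nonneg (abs_nonneg R) (abs_nonneg (x true))]
    nlinarith [mul_le_l h3 hn.le]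
  have hR2 : P ^ 2 + (-R) ^ 2 = β ^ 2 * q := by rw [neg_sq]; exact h1
  have i1 : Integrable (fun x : Bool → ℝ => Lc n (h + P * x true + R * x false) C + Lc n (h + P * x true + (-R) * x false) C) (gp Bool) := (hLi R).add (hLi (-R))
  have i2 : Integrable (fun x : Bool → ℝ => n * log 2 + 1 / 2 * (Lc n (h + P * x true + R * x false) C + Lc n (h + P * x true + (-R) * x false) C)) (gp Bool) :=
    (integrable_const _).add (i1.const_mul _)
  have hE : Efun P R C ε h 0 (n / 2) ≤ n * log 2 + ∫ z, Lc n (fd β h q z) C ∂gs := by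
    unfold Efun
    refine (integral_mono_of_nonneg (.of_forall fun x => (cs_log hn.le _ _ C (ε * C)).1) i2 (.of_forall fun x => ?_)).trans (le_of_eq ?_)
    · have := (cs_log hn.le (h + P * x true + R * x false) (h + P * x true - R * x false) C (ε * C)).2
      rw [hLe] at this
      have e : h + P * x true + (-R) * x false = h + P * x true - R * x false := by ring
      simp only; rw [e]; exact this
    · rw [integral_add (integrable_const _) (i1.const_mul _), integral_const_mul (1 / 2 : ℝ), integral_add (hLi R) (hLi (-R)), hI R h1, hI (-R) hR2]
      simp; ring
  have : 1 / (n / 2) * (n * log 2 + ∫ z, Lc n (fd β h q z) C ∂gs) = 2 * log 2 + (2 / n) * ∫ z, Lc n (fd β h q z) C ∂gs := by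
    field_simp
  rw [← this]
  exact mul_le_l hE (by positivity)
end

section
lemma coshpow_int_cont {n : ℝ} (hn : 0 ≤ n) (a : ℝ) : Continuous fun C => ∫ y, cosh (a + C * y) ^ n ∂gs := by
  refine continuous_iff_continuousAt.2 fun C1 => ?_
  refine continuousAt_of_dominated (bound := fun y => exp (n * |a|) * exp (n * (|C1| + 1) * |y|)) ?_ ?_ ?_ ?_
  · exact Eventually.of_forall fun C => ((coshpow_cont hn).comp (by fun_prop : Continuous fun y : ℝ => a + C * y)).aestronglyMeasurable
  · have : ∀ᶠ C in nhds C1, |C| < |C1| + 1 := (continuous_abs.tendsto C1).eventually (gt_mem_nhds (by linarith))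
    filter_upwards [this] with C hC
    refine Eventually.of_forall fun y => ?_
    rw [norm_eq_abs, abs_of_nonneg (rpow_nonneg (cosh_pos _).le _)]
    refine (coshpow_bd hn).trans ?_
    gcongr
  · exact (gs_integrable_exp _).const_mul _
  · exact Eventually.of_forall fun y => ((coshpow_cont hn).comp (by fun_prop : Continuous fun C : ℝ => a + C * y)).continuousAt

lemma Lc_cont {n : ℝ} (hn : 0 ≤ n) (a : ℝ) : Continuous fun C => Lc n a C :=
  (coshpow_int_cont hn a).log fun C => (by have := coshpow_ge hn a C; positivity)

lemma Lc_int_cont {n : ℝ} (hn : 0 ≤ n) (β h q : ℝ) : Continuous fun C => ∫ z, Lc n (fd β h q z) C ∂gs := by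
  refine continuous_iff_continuousAt.2 fun C1 => ?_
  refine continuousAt_of_dominated (bound := fun z => n * |h| + log (Kc n (|C1| + 1)) + n * |β * √q| * exp (1 * |z|)) ?_ ?_ ?_ ?_
  · exact Eventually.of_forall fun C => ((Lc_meas hn C).comp (fd_cont β h q).measurable).aestronglyMeasurable
  · have : ∀ᶠ C in nhds C1, |C| < |C1| + 1 := (continuous_abs.tendsto C1).eventually (gt_mem_nhds (by linarith))
    filter_upwards [this] with C hC
    refine Eventually.of_forall fun z => ?_
    rw [norm_eq_abs, abs_of_nonneg (Lc_nonneg hn _ _)]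
    refine (Lc_le hn _ hC.le).trans ?_
    have : |fd β h q z| ≤ |h| + |β * √q| * |z| := by unfold fd; rw [← abs_mul]; exact abs_add_le _ _
    have h2 : |z| ≤ exp (1 * |z|) := by have := add_one_le_exp (1 * |z|); linarith
    have h3 : |β * √q| * |z| ≤ |β * √q| * exp (1 * |z|) := by gcongr
    nlinarith
  · exact (integrable_const _).add ((gs_integrable_exp 1).const_mul _)
  · exact Eventually.of_forall fun z => (Lc_cont hn _).continuousAt

lemma Phi_eq (β h q n w : ℝ) : Phi β h q n (q + w) = log 2 + β ^ 2 / 4 * (1 - (q + w)) ^ 2 - β ^ 2 / 4 * n * ((q + w) ^ 2 - q ^ 2)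
    + (1 / n) * ∫ z, Lc n (fd β h q z) (β * √w) ∂gs := by
  unfold Phi Lc fd
  rw [add_sub_cancel_left]; rfl

lemma Phi_cont (β h q : ℝ) {n : ℝ} (hn : 0 ≤ n) : Continuous fun w => Phi β h q n (q + w) := by
  simp only [Phi_eq]
  have h1 : Continuous fun w => ∫ z, Lc n (fd β h q z) (β * √w) ∂gs := (Lc_int_cont hn β h q).comp (by fun_prop : Continuous fun w : ℝ => β * √w)
  fun_prop

lemma Phi_one (β h q : ℝ) {w : ℝ} (hw : 0 ≤ w) : Phi β h q 1 (q + w) = RS β h q 1 := by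
  rw [Phi_eq]
  have : ∀ z, Lc 1 (fd β h q z) (β * √w) = β ^ 2 * w / 2 + log (cosh (fd β h q z)) := fun z => by
    unfold Lc; simp only [rpow_one]
    rw [cosh_add_integral, log_mul (exp_pos _).ne' (cosh_pos _).ne', log_exp, mul_pow, sq_sqrt hw]
  simp only [this]
  rw [integral_add (integrable_const _) (fd_lc_int β h q)]
  simp [RS, lc]; ring

lemma scal1 {t a b : ℝ} (h0 : 0 ≤ t) (h1 : t ≤ 1) (ha : 0 ≤ a) (hab : a ≤ b) : t * a ≤ b :=
  (mul_le_of_le_one_left ha h1).trans hab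

lemma exists_n {β h q : ℝ} (hA : ATplus β h q) {w : ℝ} (hw0 : 0 < w) (hw1 : w ≤ 1 - q) :
    ∃ n, 1 < n ∧ n ≤ 2 ∧ Phi β h q n (q + w) < RS β h q 1 := by
  have hd := hA (q + w) (by linarith) (by linarith)
  have hda : DifferentiableAt ℝ (fun m => Phi β h q m (q + w)) 1 := by
    by_contra hc; rw [deriv_zero_of_not_differentiableAt hc] at hd; exact lt_irrefl _ hd
  have hs := hda.hasDerivAt.tendsto_slope.mono_left (nhdsWithin_mono 1 (fun x hx => ne_of_gt hx : Set.Ioi (1:ℝ) ⊆ {1}ᶜ))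
  have he := hs.eventually (gt_mem_nhds hd)
  have h2 : ∀ᶠ n in nhdsWithin (1:ℝ) (Set.Ioi 1), n < 2 := nhdsWithin_le_nhds (gt_mem_nhds (by norm_num))
  have h3 : ∀ᶠ n in nhdsWithin (1:ℝ) (Set.Ioi 1), n ∈ Set.Ioi (1:ℝ) := self_mem_nhdsWithin
  obtain ⟨n, hn, hn1, hn2⟩ := (he.and (h3.and h2)).exists
  refine ⟨n, hn1, hn2.le, ?_⟩
  rw [slope_def_field, div_neg_iff] at hn
  rw [← Phi_one β h q hw0.le]
  have hn1' : 1 < n := hn1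
  rcases hn with h | h <;> linarith

lemma phi_gap {β h q : ℝ} (hA : ATplus β h q) {w0 : ℝ} (hw0 : 0 < w0) :
    ∃ κ > 0, ∀ w ∈ Set.Icc w0 (1 - q), ∃ n, 1 < n ∧ n ≤ 2 ∧ Phi β h q n (q + w) ≤ RS β h q 1 - κ := by
  refine IsCompact.induction_on (p := fun s => ∃ κ > 0, ∀ w ∈ s, ∃ n, 1 < n ∧ n ≤ 2 ∧ Phi β h q n (q + w) ≤ RS β h q 1 - κ) isCompact_Icc ?_ ?_ ?_ ?_
  · exact ⟨1, one_pos, by simp⟩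
  · rintro s t hst ⟨κ, hκ, h⟩; exact ⟨κ, hκ, fun w hw => h w (hst hw)⟩
  · rintro s t ⟨κ, hκ, h1⟩ ⟨κ', hκ', h2⟩
    refine ⟨min κ κ', lt_min hκ hκ', ?_⟩
    rintro w (hw | hw)
    · obtain ⟨n, a, b, c⟩ := h1 w hw; exact ⟨n, a, b, c.trans (by have := min_le_left κ κ'; linarith)⟩
    · obtain ⟨n, a, b, c⟩ := h2 w hw; exact ⟨n, a, b, c.trans (by have := min_le_right κ κ'; linarith)⟩
  · intro w hw
    obtain ⟨n, h1, h2, h3⟩ := exists_n hA (hw0.trans_le hw.1) hw.2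
    obtain ⟨κ, hκ⟩ : ∃ κ, κ = (RS β h q 1 - Phi β h q n (q + w)) / 2 := ⟨_, rfl⟩
    have hev : ∀ᶠ w' in nhds w, Phi β h q n (q + w') < RS β h q 1 - κ :=
      ((Phi_cont β h q (by linarith : 0 ≤ n)).tendsto w).eventually (gt_mem_nhds (by linarith))
    exact ⟨_, nhdsWithin_le_nhds hev, κ, by linarith, fun w' hw' => ⟨n, h1, h2, le_of_lt hw'⟩⟩

lemma finDE {n L I PH β t d q E v L0 S : ℝ} (hn : 1 ≤ n) (hn0 : n ≠ 0) (ht0 : 0 ≤ t) (ht1 : t ≤ 1)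
    (hPH : PH = L + β ^ 2 / 4 * (1 - (q + t * d)) ^ 2 - β ^ 2 / 4 * n * ((q + t * d) ^ 2 - q ^ 2) + (1 / n) * I)
    (hE : (1 / (n / 2)) * E ≤ 2 * L + (2 / n) * I) (hv : v ^ 2 = (q + d) ^ 2) {v' : ℝ} (hv' : v' ^ 2 = q ^ 2) (hS : S = 0) :
    (1 / (n / 2)) * E + t * β ^ 2 / 2 * ((1 - q - d) ^ 2 - n / 2 * ((q + d) ^ 2 + v ^ 2 - q ^ 2 - v' ^ 2)) + S
     ≤ 2 * (L + L0 + β ^ 2 / 4 * t * (1 - q) ^ 2) + 2 * (PH - (L + L0 + β ^ 2 / 4 * 1 * (1 - q) ^ 2)) := by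
  have h1 : 0 ≤ (n - 1) * (t * d ^ 2 * (1 - t)) := by
    have : 0 ≤ 1 - t := by linarith
    have : 0 ≤ n - 1 := by linarith
    positivity
  have h2 : (2 / n) * I = 2 * (1 / n * I) := by ring
  rw [hv, hv', hS, hPH]
  have h3 := mul_nonneg (sq_nonneg β) h1
  rw [h2] at hE
  generalize 1 / n * I = J at *
  nlinarith

section
variable {N : ℕ} {β h q : ℝ}

lemma caseD (hN : 0 < N) (hq0 : 0 ≤ q) {t u Λ n : ℝ} (ht0 : 0 ≤ t) (ht1 : t ≤ 1) (hΛ : β ^ 2 / 2 + 1 ≤ Λ)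
    (hn1 : 1 < n) (hn2 : n ≤ 2) (hu0 : q ≤ u) :
    LL N β h q t Λ u ≤ N * (2 * RS β h q t + 2 * (Phi β h q n (q + t * (u - q)) - RS β h q 1)) := by
  have hp : √q ^ 2 = q := sq_sqrt hq0
  obtain ⟨d, hd⟩ : ∃ d, d = u - q := ⟨_, rfl⟩
  have hd0 : 0 ≤ d := by linarith
  have hc : √d ^ 2 = d := sq_sqrt hd0
  have hP : (β * √q) ^ 2 = β ^ 2 * q := by rw [mul_pow, hp]
  have hE := Efun_DE (β := β) (h := h) (q := q) (P := β * √q) (R := 0) (C := √t * β * √d) (ε := 1) hq0 (Or.inl rfl) (by rw [hP]; ring) (by linarith : 0 < n)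
  have key := coupled_main hN β h 0 (q := q) (t := t) (m := n/2) (p := √q) (r := 0) (c := √d) (ε := 1) (P := β * √q) (R := 0) (Λ := Λ) (u := u)
    hq0 ht0 ht1 (by linarith) (by linarith) (by norm_num) (by rw [hp]; ring) (by rw [hP, hp]; ring) (by ring) (by linarith)
  rw [hp, hc] at key
  refine key.trans (mul_le_l ?_ (Nat.cast_nonneg N))
  rw [← hd]
  have hCe : √t * β * √d = β * √(t * d) := by rw [sqrt_mul ht0]; ring
  rw [hCe] at hE ⊢
  have hu : u = q + d := by linarith
  refine finDE hn1.le (by linarith) ht0 ht1 (Phi_eq β h q n (t * d)) hE (by ring) (by ring) ?_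
  rw [hu]; ring

lemma caseE (hN : 0 < N) (hq0 : 0 ≤ q) {t u Λ n : ℝ} (ht0 : 0 ≤ t) (ht1 : t ≤ 1) (hΛ : β ^ 2 / 2 + 1 ≤ Λ)
    (hn1 : 1 < n) (hn2 : n ≤ 2) (hu0 : u ≤ -q) :
    LL N β h q t Λ u ≤ N * (2 * RS β h q t + 2 * (Phi β h q n (q + t * (- u - q)) - RS β h q 1)) := by
  have hp : √q ^ 2 = q := sq_sqrt hq0
  obtain ⟨d, hd⟩ : ∃ d, d = - u - q := ⟨_, rfl⟩
  have hd0 : 0 ≤ d := by linarith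
  have hc : √d ^ 2 = d := sq_sqrt hd0
  have hP : (β * √((1 - t) * q)) ^ 2 = β ^ 2 * ((1 - t) * q) := by rw [mul_pow, sq_sqrt (mul_nonneg (by linarith) hq0)]
  have hR : (β * √(t * q)) ^ 2 = β ^ 2 * (t * q) := by rw [mul_pow, sq_sqrt (mul_nonneg ht0 hq0)]
  have hE := Efun_DE (β := β) (h := h) (q := q) (P := β * √((1 - t) * q)) (R := β * √(t * q)) (C := √t * β * √d) (ε := -1) hq0 (Or.inr rfl) (by rw [hP, hR]; ring) (by linarith : 0 < n)
  have key := coupled_main hN β h 0 (q := q) (t := t) (m := n/2) (p := 0) (r := √q) (c := √d) (ε := -1) (P := β * √((1 - t) * q)) (R := β * √(t * q)) (Λ := Λ) (u := u)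
    hq0 ht0 ht1 (by linarith) (by linarith) (by norm_num) (by rw [hp]; ring) (by rw [hP]; ring) (by rw [hR, hp]; ring) (by linarith)
  rw [hp, hc] at key
  refine key.trans (mul_le_l ?_ (Nat.cast_nonneg N))
  rw [← hd]
  have hCe : √t * β * √d = β * √(t * d) := by rw [sqrt_mul ht0]; ring
  rw [hCe] at hE ⊢
  have hu : u = - q - d := by linarith
  refine finDE hn1.le (by linarith) ht0 ht1 (Phi_eq β h q n (t * d)) hE (by ring) (by ring) ?_
  rw [hu]; ring

/-- quadratic coupling bound, uniform in everything -/
lemma coupled_all (hβ : 0 < β) (hfix : isFixedq β h q) (hAT : ATcond β h q) (hA : ATplus β h q) :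
    ∃ κ > 0, ∃ Λ > 0, ∀ N : ℕ, 0 < N → ∀ t, 0 ≤ t → t ≤ 1 → ∀ u, -1 ≤ u → u ≤ 1 →
      LL N β h q t Λ u ≤ N * (2 * RS β h q t - κ * (u - q) ^ 2) := by
  obtain ⟨hq0, hq1, hqf⟩ := hfix
  have hqf' : q = ∫ z, tanh (fd β h q z) ^ 2 ∂gs := hqf
  obtain ⟨α, hαd⟩ : ∃ α, β ^ 2 * s4 β h q = α := ⟨_, rfl⟩
  have hα0 : 0 ≤ α := by rw [← hαd]; exact mul_nonneg (sq_nonneg _) (s4_nonneg _ _ _)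
  have hα : α < 1 := by
    rw [← hαd]; unfold s4 sc fd; unfold ATcond at hAT
    refine lt_of_eq_of_lt ?_ hAT
    congr 2; ext z; rw [← pow_mul]
  obtain ⟨w0, hw0, hwa, hwb, hwc⟩ : ∃ w0 > 0, β ^ 2 * w0 ≤ q * (1 - α) ∧ 4 * (β ^ 2 * w0) ≤ 1 ∧ 21 * β ^ 4 * w0 ≤ (1 - α) / 2 := by
    have hp : 0 < q * (1 - α) := mul_pos hq0 (by linarith)
    have h1 : 0 < q * (1 - α) / β ^ 2 := by positivity
    have h2 : 0 < 1 / (4 * β ^ 2) := by positivity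
    have h3 : 0 < (1 - α) / 2 / (21 * β ^ 4) := by have : 0 < 1 - α := by linarith
                                                   positivity
    refine ⟨min (q * (1 - α) / β ^ 2) (min (1 / (4 * β ^ 2)) ((1 - α) / 2 / (21 * β ^ 4))), by positivity, ?_, ?_, ?_⟩
    · have := min_le_left (q * (1 - α) / β ^ 2) (min (1 / (4 * β ^ 2)) ((1 - α) / 2 / (21 * β ^ 4)))
      rw [le_div_iff₀ (by positivity)] at this; linarith
    · have := (min_le_right (q * (1 - α) / β ^ 2) (min (1 / (4 * β ^ 2)) ((1 - α) / 2 / (21 * β ^ 4)))).trans (min_le_left _ _)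
      rw [le_div_iff₀ (by positivity)] at this; linarith
    · have := (min_le_right (q * (1 - α) / β ^ 2) (min (1 / (4 * β ^ 2)) ((1 - α) / 2 / (21 * β ^ 4)))).trans (min_le_right _ _)
      rw [le_div_iff₀ (by positivity)] at this; linarith
  obtain ⟨κD, hκD, hgap⟩ := phi_gap hA hw0
  obtain ⟨y, hy⟩ : ∃ y, y = 2 * q * (1 - α) := ⟨_, rfl⟩
  have hy0 : 0 < y := by rw [hy]; exact mul_pos (by linarith) (by linarith)
  obtain ⟨Λ, hΛ⟩ : ∃ Λ, Λ = β ^ 2 / 2 + (1 + 4 * (1 + β ^ 2) ^ 2 / y ^ 2) := ⟨_, rfl⟩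
  have hx0 : 0 ≤ 4 * (1 + β ^ 2) ^ 2 / y ^ 2 := by positivity
  have hΛ1 : β ^ 2 / 2 + 1 ≤ Λ := by rw [hΛ]; linarith
  have hΛ2 : (1 + β ^ 2) ^ 2 / (4 * (Λ - β ^ 2 / 2)) ≤ y ^ 2 / 16 := by
    rw [hΛ, add_sub_cancel_left, div_le_div_iff₀ (by linarith) (by norm_num)]
    have : y ^ 2 * (4 * (1 + 4 * (1 + β ^ 2) ^ 2 / y ^ 2)) = 4 * y ^ 2 + 16 * (1 + β ^ 2) ^ 2 := by field_simp; ring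
    rw [this]; nlinarith
  obtain ⟨κ, hκ0, hκ1, hκ2, hκ3⟩ : ∃ κ > 0, κ ≤ (1 - α) ^ 2 / 32 ∧ 4 * κ ≤ y ^ 2 / 16 ∧ 4 * κ ≤ 2 * κD := by
    have h1 : 0 < (1 - α) ^ 2 / 32 := by have : 0 < 1 - α := by linarith
                                         positivity
    refine ⟨min ((1 - α) ^ 2 / 32) (min (y ^ 2 / 64) (κD / 2)), by positivity, min_le_left _ _, ?_, ?_⟩
    · have := (min_le_right ((1 - α) ^ 2 / 32) (min (y ^ 2 / 64) (κD / 2))).trans (min_le_left _ _)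
      linarith
    · have := (min_le_right ((1 - α) ^ 2 / 32) (min (y ^ 2 / 64) (κD / 2))).trans (min_le_right _ _)
      linarith
  refine ⟨κ, hκ0, Λ, by nlinarith [sq_nonneg β], ?_⟩
  intro N hN t ht0 ht1 u hu0 hu1
  have hN0 : (0:ℝ) ≤ N := Nat.cast_nonneg N
  have hsq4 : (u - q) ^ 2 ≤ 4 := by nlinarith
  have hsq0 := sq_nonneg (u - q)
  have hκ4 : κ * (u - q) ^ 2 ≤ 4 * κ := by nlinarith
  have hκ32 : κ * (u - q) ^ 2 ≤ (1 - α) ^ 2 / 32 * (u - q) ^ 2 := by gcongr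
  rcases le_total u (-q) with h1 | h1
  · rcases le_total (t * (- u - q)) w0 with h2 | h2
    · refine (caseB hN hq0.le hqf' hα.le hαd ht0 ht1 hΛ1 (by rw [← hy]; exact hΛ2) hwa hu0 h1 h2).trans (mul_le_l ?_ hN0)
      rw [← hy]; linarith
    · obtain ⟨n, a, b, c⟩ := hgap (t * (- u - q)) ⟨h2, scal1 ht0 ht1 (by linarith) (by linarith)⟩
      refine (caseE hN hq0.le ht0 ht1 hΛ1 a b h1).trans (mul_le_l ?_ hN0)
      linarith
  · rcases le_total u q with h3 | h3
    · refine (caseA hN hq0.le hqf' hα.le hαd ht0 ht1 hΛ1 hu0 hu1 h1 h3).trans (mul_le_l ?_ hN0)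
      nlinarith
    · rcases le_total (t * (u - q)) w0 with h2 | h2
      · exact (caseC hN hq0.le hqf' hα.le hαd ht0 ht1 hΛ1 hwb hwc h3 hu1 h2).trans (mul_le_l (by linarith) hN0)
      · obtain ⟨n, a, b, c⟩ := hgap (t * (u - q)) ⟨h2, scal1 ht0 ht1 (by linarith) (by linarith)⟩
        refine (caseD hN hq0.le ht0 ht1 hΛ1 a b h3).trans (mul_le_l ?_ hN0)
        linarith
end
end

section
section gen
variable {S : Type*} [Fintype S] [Nonempty S]
/-- Gibbs weights -/
def gw (x : S → ℝ) (s : S) : ℝ := exp (x s) / ∑ s, exp (x s)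
lemma gw_pos (x : S → ℝ) (s : S) : 0 < gw x s := div_pos (exp_pos _) (lse_sum_pos x)
lemma gw_sum (x : S → ℝ) : ∑ s, gw x s = 1 := by
  unfold gw; rw [← sum_div]; exact div_self (lse_sum_pos x).ne'
lemma gw_cont (s : S) : Continuous (fun x : S → ℝ => gw x s) := by
  unfold gw; exact Continuous.div (by fun_prop) (by fun_prop) (fun x => (lse_sum_pos x).ne')
lemma gw_avg_le (x f : S → ℝ) {C : ℝ} (h : ∀ s, f s ≤ C) : ∑ s, gw x s * f s ≤ C := by
  calc ∑ s, gw x s * f s ≤ ∑ s, gw x s * C := sum_le_sum fun s _ => mul_le_l (h s) (gw_pos x s).le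
    _ = C := by rw [← sum_mul, gw_sum, one_mul]

/-- Jensen for log-sum-exp -/
lemma lse_jensen (x f : S → ℝ) : lse x + ∑ s, gw x s * f s ≤ lse (fun s => x s + f s) := by
  set a := ∑ s, gw x s * f s with ha
  have h1 : exp a ≤ ∑ s, gw x s * exp (f s) := by
    have := convexOn_exp.map_sum_le (t := Finset.univ) (w := gw x) (p := f) (fun s _ => (gw_pos x s).le) (gw_sum x) (fun _ _ => Set.mem_univ _)
    simpa [smul_eq_mul] using this
  have h2 : ∑ s, exp (x s + f s) = (∑ s, exp (x s)) * ∑ s, gw x s * exp (f s) := by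
    rw [mul_sum]
    refine scg fun s _ => ?_
    unfold gw; have := (lse_sum_pos x).ne'
    rw [exp_add]; field_simp
  have h3 : 0 < ∑ s, gw x s * exp (f s) := (exp_pos a).trans_le h1
  unfold lse
  rw [h2, log_mul (lse_sum_pos x).ne' h3.ne']
  have := (le_log_iff_exp_le h3).2 h1
  linarith
end gen

variable {N : ℕ}

/-- interpolating SK field -/
def XH (N : ℕ) (β h q t : ℝ) (g : Edg N ⊕ Fin N → ℝ) (s : Cfg N) : ℝ :=
  lf (HA N β q t) g s + h * ∑ i, sp (s i)

/-- Gibbs average of squared overlap deviation -/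
def Q2 (q : ℝ) (x : Cfg N → ℝ) : ℝ := ∑ s, ∑ s', gw x s * gw x s' * (ov s s' / N - q) ^ 2

lemma Q2_nonneg (q : ℝ) (x : Cfg N → ℝ) : 0 ≤ Q2 q x :=
  sum_nonneg fun s _ => sum_nonneg fun s' _ => mul_nonneg (mul_nonneg (gw_pos x s).le (gw_pos x s').le) (sq_nonneg _)

lemma Q2_cont (q : ℝ) : Continuous (Q2 (N := N) q) := by
  unfold Q2
  exact continuous_finsetSum _ fun s _ => continuous_finsetSum _ fun s' _ => ((gw_cont s).mul (gw_cont s')).mul continuous_const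

lemma XH_integrable (β h q t : ℝ) (s : Cfg N) : Integrable (fun g => XH N β h q t g s) (gp (Edg N ⊕ Fin N)) :=
  lf_add_integrable (HA N β q t) (fun s => h * ∑ i, sp (s i)) s

lemma XH_cont (β h q t : ℝ) : Continuous (XH N β h q t) := by
  unfold XH; exact continuous_pi fun s => (lf_cont _ s).add continuous_const

lemma ovN_abs (s s' : Cfg N) : |ov s s' / N| ≤ 1 := by
  rw [abs_div, Nat.abs_cast]; exact div_le_one_of_le₀ (ov_abs s s') (Nat.cast_nonneg _)

lemma Q2_le {q : ℝ} (hq0 : 0 ≤ q) (hq1 : q ≤ 1) (x : Cfg N → ℝ) : Q2 q x ≤ 4 := by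
  unfold Q2
  simp_rw [mul_assoc, ← mul_sum]
  refine gw_avg_le x _ fun s => gw_avg_le x _ fun s' => ?_
  have := abs_le.1 (ovN_abs s s')
  nlinarith

lemma Q2_integrable {α : Type*} [MeasurableSpace α] {μ : Measure α} [IsProbabilityMeasure μ] {q : ℝ} (hq0 : 0 ≤ q) (hq1 : q ≤ 1)
    {X : α → Cfg N → ℝ} (hX : Measurable X) : Integrable (fun a => Q2 q (X a)) μ := by
  refine (integrable_const (4:ℝ)).mono' ((Q2_cont q).measurable.comp hX).aestronglyMeasurable ?_
  filter_upwards with a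
  rw [norm_eq_abs, abs_of_nonneg (Q2_nonneg _ _)]; exact Q2_le hq0 hq1 _

/-- free energy (not normalized) -/
def pN (N : ℕ) (β h q t : ℝ) : ℝ := ∫ g, lse (XH N β h q t g) ∂gp (Edg N ⊕ Fin N)

lemma Fm_one_unit {J : Type*} [Fintype J] [Nonempty J] (x : Unit × J → ℝ) : Fm 1 x = lse (fun j => x ((), j)) := by
  simp [Fm, Zout, Zin, lse]

lemma Ww_one_unit {J : Type*} [Fintype J] [Nonempty J] (x : Unit × J → ℝ) (j : J) : Ww 1 ((), j) x = gw (fun j => x ((), j)) j := by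
  have := (Zin_pos x ()).ne'
  simp only [Ww, pw, muw, Zout, Finset.univ_unique, Finset.sum_singleton, rpow_one, PUnit.default_eq_unit]
  rw [div_self this, one_mul]; rfl

lemma HA_split (β q t : ℝ) (s : Cfg N) (k) : HA N β q t s k = √t * HA N β q 1 s k + √(1 - t) * HA N β q 0 s k := by
  rcases k with p | i <;> simp [HA] <;> ring

lemma Xt_HA (β h q t : ℝ) (g : Edg N ⊕ Fin N → ℝ) (s : Cfg N) :
    Xt (fun s : Unit × Cfg N => HA N β q 1 s.2) (fun s => HA N β q 0 s.2) (fun s => h * ∑ i, sp (s.2 i)) 0 t g ((), s) = XH N β h q t g s := by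
  unfold Xt XH lf
  simp only [HA_split β q t, Pi.zero_apply, mul_zero, add_zero, add_mul, sum_add_distrib, mul_sum, mul_assoc]

lemma pN_deriv (hN : 0 < N) (β h : ℝ) {q t : ℝ} (hq : 0 ≤ q) (ht0 : 0 < t) (ht1 : t < 1) :
    HasDerivAt (pN N β h q) (∫ g, N * (β ^ 2 / 4) * ((1 - q) ^ 2 - Q2 q (XH N β h q t g)) ∂gp (Edg N ⊕ Fin N)) t := by
  have hNr : (0:ℝ) < N := by exact_mod_cast hN
  have key := (Fm_smooth (K := Unit) (J := Cfg N) one_pos).hasDerivAt (fun s => HA N β q 1 s.2) (fun s => HA N β q 0 s.2)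
    (fun s => h * ∑ i, sp (s.2 i)) 0 (fun s s' => N * (β ^ 2 / 2) * ((ov s.2 s'.2 / N - q) ^ 2 - q ^ 2 - 1 / N))
    (by intro s s'; simp [HA]) (by
      intro s s'
      rw [HA_cov hN β hq zero_le_one le_rfl, HA_cov hN β hq le_rfl zero_le_one]
      field_simp; ring) ht0 ht1
  have e1 : (fun t => ∫ g, Fm 1 (Xt (fun s : Unit × Cfg N => HA N β q 1 s.2) (fun s => HA N β q 0 s.2) (fun s => h * ∑ i, sp (s.2 i)) 0 t g) ∂gp (Edg N ⊕ Fin N)) = pN N β h q := by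
    ext t; unfold pN; congr 1; ext g; rw [Fm_one_unit]; simp_rw [Xt_HA]
  rw [e1] at key
  refine key.congr_deriv ?_
  congr 1; ext g
  rw [Fm_Dexp]
  simp only [sum_prod_type, Finset.univ_unique, Finset.sum_singleton, PUnit.default_eq_unit, Ww_one_unit, Xt_HA,
    Pi.zero_apply, mul_zero, sum_const_zero, sub_self, zero_mul, sub_zero, one_mul, zero_add]
  change 1 / 2 * (∑ s, gw (XH N β h q t g) s * _ - ∑ s, ∑ s', gw (XH N β h q t g) s * gw (XH N β h q t g) s' * _) = _
  have h1 : ∑ s, gw (XH N β h q t g) s * (N * (β ^ 2 / 2) * ((ov s s / N - q) ^ 2 - q ^ 2 - 1 / N)) = N * (β ^ 2 / 2) * ((1 - q) ^ 2 - q ^ 2 - 1 / N) := by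
    simp_rw [ov_self, div_self hNr.ne']
    rw [← sum_mul, gw_sum, one_mul]
  have h2 : ∑ s, ∑ s', gw (XH N β h q t g) s * gw (XH N β h q t g) s' * (N * (β ^ 2 / 2) * ((ov s s' / N - q) ^ 2 - q ^ 2 - 1 / N))
      = N * (β ^ 2 / 2) * (Q2 q (XH N β h q t g) - (q ^ 2 + 1 / N)) := by
    have h3 : (q ^ 2 + 1 / (N:ℝ)) = ∑ s, ∑ s', gw (XH N β h q t g) s * gw (XH N β h q t g) s' * (q ^ 2 + 1 / N) := by
      simp_rw [← sum_mul, ← mul_sum, gw_sum, mul_one, gw_sum, one_mul]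
    rw [h3]; unfold Q2
    rw [← sum_sub_distrib, mul_sum]
    refine scg fun s _ => ?_
    rw [← sum_sub_distrib, mul_sum]
    refine scg fun s' _ => ?_
    ring
  rw [h1, h2]; ring

lemma pN_contOn (β h q : ℝ) : ContinuousOn (pN N β h q) (Set.Icc 0 1) := by
  have key := (Fm_smooth (K := Unit) (J := Cfg N) one_pos).continuousOn (fun s => HA N β q 1 s.2) (fun s => HA N β q 0 s.2)
    (fun s => h * ∑ i, sp (s.2 i)) 0
  refine key.congr fun t _ => ?_
  unfold pN; congr 1; ext g; rw [Fm_one_unit]; simp_rw [Xt_HA]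

lemma pN_zero (β h q : ℝ) : pN N β h q 0 = N * RS β h q 0 := by
  unfold pN RS
  have h1 : ∀ g, lse (XH N β h q 0 g) = ∑ i, (log 2 + log (cosh (fd β h q (g (Sum.inr i))))) := by
    intro g
    have e : ∀ s, XH N β h q 0 g s = ∑ i, sp (s i) * fd β h q (g (Sum.inr i)) := by
      intro s
      simp only [XH, lf, HA, sum_sum_type, Sum.elim_inl, Sum.elim_inr, sqrt_zero, zero_mul, zero_div, sum_const_zero,
        zero_add, sub_zero, sqrt_one, one_mul, mul_sum, ← sum_add_distrib, fd]
      exact scg fun i _ => by ring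
    unfold lse
    simp_rw [e, exp_sum]
    rw [← Fintype.prod_sum (fun i b => exp (sp b * fd β h q (g (Sum.inr i)))), log_prod]
    · refine scg fun i _ => ?_
      rw [← log_mul two_ne_zero (cosh_pos _).ne', cosh_eq]
      congr 1; simp [sp]; ring
    · intro i _; simp only [sum_bool]; positivity
  simp_rw [h1]
  have hi : Integrable (fun z => log 2 + log (cosh (fd β h q z))) gs := (integrable_const _).add (fd_lc_int β h q)
  have hm : Measurable (fun z => log 2 + log (cosh (fd β h q z))) :=
    (continuous_const.add (logcosh_cont.comp (fd_cont β h q))).measurable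
  have hi2 : ∀ i : Fin N, Integrable (fun g : Edg N ⊕ Fin N → ℝ => log 2 + log (cosh (fd β h q (g (Sum.inr i))))) (gp (Edg N ⊕ Fin N)) :=
    fun i => (gp_eval (Sum.inr i)).integrable_comp_of_integrable hi
  rw [integral_finsetSum _ (fun i _ => hi2 i)]
  have h2 : ∀ i : Fin N, ∫ g : Edg N ⊕ Fin N → ℝ, (log 2 + log (cosh (fd β h q (g (Sum.inr i))))) ∂gp (Edg N ⊕ Fin N) = log 2 + lc β h q := by
    intro i
    rw [gp_integral_eval (ι := Edg N ⊕ Fin N) (Sum.inr i) hm, integral_add (integrable_const _) (fd_lc_int β h q)]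
    simp [lc]
  simp_rw [h2]
  simp; ring
end

section
variable {N : ℕ}

lemma grid_exists {M : ℕ} (hM : 0 < M) {R : ℝ} (h0 : -1 ≤ R) (h1 : R ≤ 1) :
    ∃ b : Fin (M + 1), |R - (-1 + 2 * (b:ℕ) / M)| ≤ 2 / M := by
  have hMr : (0:ℝ) < M := by exact_mod_cast hM
  have h2 : 0 ≤ (R + 1) / 2 * M := by have : 0 ≤ R + 1 := by linarith
                                      positivity
  have h3 : (R + 1) / 2 * M ≤ M := by nlinarith
  refine ⟨⟨⌊(R + 1) / 2 * M⌋₊, ?_⟩, ?_⟩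
  · have := Nat.floor_le_floor h3; rw [Nat.floor_natCast] at this; omega
  · have a := Nat.floor_le h2
    have b := Nat.lt_floor_add_one ((R + 1) / 2 * M)
    simp only
    generalize (⌊(R + 1) / 2 * (M:ℝ)⌋₊ : ℝ) = n at a b
    have e : R - (-1 + 2 * n / M) = 2 * ((R + 1) / 2 * M - n) / M := by field_simp; ring
    rw [e, abs_of_nonneg (by apply div_nonneg _ hMr.le; linarith)]
    gcongr; linarith

/-- pair field -/
def XP (N : ℕ) (β h q t : ℝ) (g : Edg N ⊕ Fin N → ℝ) (w : Cfg N × Cfg N) : ℝ := XH N β h q t g w.1 + XH N β h q t g w.2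

lemma XP_eq (β h q t : ℝ) (g : Edg N ⊕ Fin N → ℝ) (w : Cfg N × Cfg N) : XP N β h q t g w = lf (HA2 β q t) g w + cc h 0 w := by
  unfold XP XH lf cc HA2
  simp only [add_mul, sum_add_distrib]; ring

lemma lse_pair (x : Cfg N → ℝ) : lse (fun w : Cfg N × Cfg N => x w.1 + x w.2) = 2 * lse x := by
  unfold lse
  rw [sum_prod_type]
  simp_rw [exp_add, ← mul_sum]
  rw [← sum_mul, log_mul (lse_sum_pos x).ne' (lse_sum_pos x).ne']; ring

lemma gw_pair (x : Cfg N → ℝ) (w : Cfg N × Cfg N) : gw (fun w : Cfg N × Cfg N => x w.1 + x w.2) w = gw x w.1 * gw x w.2 := by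
  unfold gw
  rw [sum_prod_type]
  simp_rw [exp_add, ← mul_sum]
  rw [← sum_mul, div_mul_div_comm]

lemma pair_lower (q κ : ℝ) (x : Cfg N → ℝ) :
    2 * lse x + N * κ * Q2 q x ≤ lse (fun w : Cfg N × Cfg N => (x w.1 + x w.2) + N * κ * (ov w.1 w.2 / N - q) ^ 2) := by
  have := lse_jensen (fun w : Cfg N × Cfg N => x w.1 + x w.2) (fun w => N * κ * (ov w.1 w.2 / N - q) ^ 2)
  rw [lse_pair] at this
  refine le_trans (le_of_eq ?_) this
  congr 1
  rw [sum_prod_type]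
  unfold Q2
  rw [mul_sum]
  refine scg fun s _ => ?_
  rw [mul_sum]
  refine scg fun s' _ => ?_
  rw [gw_pair]; ring

lemma grid_ineq {κ Λ R u q M : ℝ} (hκ : 0 ≤ κ) (hΛ : 0 ≤ Λ) (hM : 1 ≤ M) (hR : |R| ≤ 1) (hu : |u| ≤ 1) (hq : |q| ≤ 1) (h : |R - u| ≤ 2 / M) :
    κ * (R - q) ^ 2 ≤ κ * (u - q) ^ 2 + (8 * κ + 4 * Λ) / M - Λ * (R - u) ^ 2 := by
  have h1 : (R - q) ^ 2 - (u - q) ^ 2 ≤ 8 / M := by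
    have e : (R - q) ^ 2 - (u - q) ^ 2 = (R - u) * (R + u - 2 * q) := by ring
    rw [e]
    have : |R + u - 2 * q| ≤ 4 := by
      rw [abs_le] at *; constructor <;> linarith [hR.1, hR.2, hu.1, hu.2, hq.1, hq.2]
    calc _ ≤ |(R - u) * (R + u - 2 * q)| := le_abs_self _
      _ = |R - u| * |R + u - 2 * q| := abs_mul _ _
      _ ≤ 2 / M * 4 := by gcongr
      _ = 8 / M := by ring
  have h2 : (R - u) ^ 2 ≤ 4 / M := by
    rw [← sq_abs]
    calc _ ≤ (2 / M) ^ 2 := by gcongr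
      _ = 4 / M * (1 / M) := by ring
      _ ≤ 4 / M * 1 := by gcongr; exact div_le_one_of_le₀ hM (by linarith)
      _ = _ := mul_one _
  have h3 := mul_le_l h1 hκ
  have h4 := mul_le_l h2 hΛ
  have e : (8 * κ + 4 * Λ) / M = κ * (8 / M) + Λ * (4 / M) := by ring
  rw [e]; linarith

/-- pinned pair free energy -/
def LP (N : ℕ) (β h q t Λ u : ℝ) (g : Edg N ⊕ Fin N → ℝ) : ℝ :=
  lse (fun w : Cfg N × Cfg N => lf (HA2 β q t) g w + (cc h 0 w - N * Λ * (ov w.1 w.2 / N - u) ^ 2))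

lemma pair_upper {β h q t κ Λ : ℝ} (hκ : 0 ≤ κ) (hΛ : 0 ≤ Λ) (hq : |q| ≤ 1) {M : ℕ} (hM : 0 < M) (g : Edg N ⊕ Fin N → ℝ)
    (B : ℝ) (L : Fin (M + 1) → ℝ) (hL : ∀ b : Fin (M + 1), L b ≤ N * (B - κ * ((-1 + 2 * (b:ℕ) / M) - q) ^ 2)) :
    lse (fun w : Cfg N × Cfg N => (XH N β h q t g w.1 + XH N β h q t g w.2) + N * κ * (ov w.1 w.2 / N - q) ^ 2)
      ≤ N * B + N * ((8 * κ + 4 * Λ) / M) + log (M + 1) + ∑ b : Fin (M + 1), |LP N β h q t Λ (-1 + 2 * (b:ℕ) / M) g - L b| := by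
  have hMr : (1:ℝ) ≤ M := by exact_mod_cast hM
  have hN0 : (0:ℝ) ≤ N := Nat.cast_nonneg _
  set E := N * B + N * ((8 * κ + 4 * Λ) / M) + ∑ b : Fin (M + 1), |LP N β h q t Λ (-1 + 2 * (b:ℕ) / M) g - L b| with hE
  have hu : ∀ b : Fin (M + 1), |(-1 + 2 * (b:ℕ) / M : ℝ)| ≤ 1 := by
    intro b
    have hb : ((b:ℕ):ℝ) ≤ M := by exact_mod_cast Nat.lt_succ_iff.1 b.2
    have h1 : 2 * ((b:ℕ):ℝ) / M ≤ 2 := by rw [div_le_iff₀ (by linarith)]; linarith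
    have h2 : 0 ≤ 2 * ((b:ℕ):ℝ) / M := by positivity
    rw [abs_le]; constructor <;> linarith
  have h1 : ∑ w : Cfg N × Cfg N, exp ((XH N β h q t g w.1 + XH N β h q t g w.2) + N * κ * (ov w.1 w.2 / N - q) ^ 2)
      ≤ ∑ b : Fin (M + 1), exp E := by
    calc _ ≤ ∑ w : Cfg N × Cfg N, ∑ b : Fin (M + 1), exp ((lf (HA2 β q t) g w + (cc h 0 w - N * Λ * (ov w.1 w.2 / N - (-1 + 2 * (b:ℕ) / M)) ^ 2)) +
          N * (κ * ((-1 + 2 * (b:ℕ) / M) - q) ^ 2 + (8 * κ + 4 * Λ) / M)) := by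
            refine sum_le_sum fun w _ => ?_
            have hR := ovN_abs w.1 w.2
            obtain ⟨b, hb⟩ := grid_exists hM (abs_le.1 hR).1 (abs_le.1 hR).2
            refine le_trans ?_ (single_le_sum (fun b _ => (exp_pos _).le) (mem_univ b))
            rw [exp_le_exp]
            have := mul_le_l (grid_ineq hκ hΛ hMr hR (hu b) hq hb) hN0
            have e := XP_eq β h q t g w
            unfold XP at e
            rw [e]; linarith
      _ = ∑ b : Fin (M + 1), exp (LP N β h q t Λ (-1 + 2 * (b:ℕ) / M) g + N * (κ * ((-1 + 2 * (b:ℕ) / M) - q) ^ 2 + (8 * κ + 4 * Λ) / M)) := by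
            rw [sum_comm]
            refine scg fun b _ => ?_
            simp_rw [exp_add _ (N * (κ * ((-1 + 2 * ((b:ℕ):ℝ) / M) - q) ^ 2 + (8 * κ + 4 * Λ) / M))]
            rw [← sum_mul]
            unfold LP lse
            rw [exp_log (lse_sum_pos _)]
      _ ≤ _ := by
            refine sum_le_sum fun b _ => exp_le_exp.2 ?_
            have a1 := hL b
            have a2 : |LP N β h q t Λ (-1 + 2 * (b:ℕ) / M) g - L b| ≤ _ := single_le_sum (f := fun b : Fin (M + 1) => |LP N β h q t Λ (-1 + 2 * (b:ℕ) / M) g - L b|) (fun _ _ => abs_nonneg _) (mem_univ b)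
            have a3 := le_abs_self (LP N β h q t Λ (-1 + 2 * (b:ℕ) / M) g - L b)
            rw [hE]; linarith
  have h2 : ∑ b : Fin (M + 1), exp E = (M + 1) * exp E := by simp
  rw [h2] at h1
  have h3 := log_le_log (lse_sum_pos _) h1
  rw [log_mul (by positivity) (exp_pos _).ne', log_exp] at h3
  refine h3.trans (le_of_eq ?_)
  rw [hE]; ring

lemma HA2_cov_le (hN : 0 < N) (β : ℝ) {q t : ℝ} (hq : 0 ≤ q) (hq1 : q ≤ 1) (ht0 : 0 ≤ t) (ht1 : t ≤ 1) (w w' : Cfg N × Cfg N) :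
    ∑ k, HA2 β q t w k * HA2 β q t w' k ≤ 6 * β ^ 2 * N + 1 := by
  have hNr : (0:ℝ) < N := by exact_mod_cast hN
  rw [HA2_cov hN β hq ht0 ht1]
  have hs : ∀ s s' : Cfg N, ov s s' ^ 2 ≤ N ^ 2 := fun s s' => by rw [← sq_abs]; exact pow_le_pow_left₀ (abs_nonneg _) (ov_abs s s') 2
  have ho : ∀ s s' : Cfg N, ov s s' ≤ N := fun s s' => (le_abs_self _).trans (ov_abs s s')
  have h1 : (ov w.1 w'.1 ^ 2 + ov w.1 w'.2 ^ 2 + ov w.2 w'.1 ^ 2 + ov w.2 w'.2 ^ 2) / N - 4 ≤ 4 * N := by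
    have : (ov w.1 w'.1 ^ 2 + ov w.1 w'.2 ^ 2 + ov w.2 w'.1 ^ 2 + ov w.2 w'.2 ^ 2) / N ≤ 4 * N := by
      rw [div_le_iff₀ hNr]; nlinarith [hs w.1 w'.1, hs w.1 w'.2, hs w.2 w'.1, hs w.2 w'.2]
    linarith
  have h2 : ov w.1 w'.1 + ov w.1 w'.2 + ov w.2 w'.1 + ov w.2 w'.2 ≤ 4 * N := by linarith [ho w.1 w'.1, ho w.1 w'.2, ho w.2 w'.1, ho w.2 w'.2]
  have h3 : t * β ^ 2 / 2 * ((ov w.1 w'.1 ^ 2 + ov w.1 w'.2 ^ 2 + ov w.2 w'.1 ^ 2 + ov w.2 w'.2 ^ 2) / N - 4) ≤ t * β ^ 2 / 2 * (4 * N) := by gcongr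
  have h4 : (1 - t) * β ^ 2 * q * (ov w.1 w'.1 + ov w.1 w'.2 + ov w.2 w'.1 + ov w.2 w'.2) ≤ (1 - t) * β ^ 2 * q * (4 * N) := by
    have : 0 ≤ 1 - t := by linarith
    gcongr
  have h5 : (1 - t) * β ^ 2 * q * (4 * N) ≤ (1 - t) * β ^ 2 * 1 * (4 * N) := by
    have : 0 ≤ 1 - t := by linarith
    gcongr
  have h6 : 0 ≤ β ^ 2 * N := by positivity
  nlinarith

lemma Q2_main_raw (hN : 0 < N) {β h q κ Λ t : ℝ} (hq0 : 0 ≤ q) (hq1 : q ≤ 1) (hκ : 0 ≤ κ) (hΛ : 0 ≤ Λ) (ht0 : 0 ≤ t) (ht1 : t ≤ 1)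
    (hLL : ∀ u, -1 ≤ u → u ≤ 1 → LL N β h q t Λ u ≤ N * (2 * RS β h q t - κ * (u - q) ^ 2)) {M : ℕ} (hM : 0 < M) :
    2 * pN N β h q t + N * κ * ∫ g, Q2 q (XH N β h q t g) ∂gp (Edg N ⊕ Fin N)
      ≤ N * (2 * RS β h q t) + N * ((8 * κ + 4 * Λ) / M) + log (M + 1) + (M + 1) * (3 * √(6 * β ^ 2 * N + 1)) := by
  have hqa : |q| ≤ 1 := by rw [abs_of_nonneg hq0]; exact hq1
  have hMr : (1:ℝ) ≤ M := by exact_mod_cast hM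
  have hLi : ∀ u, Integrable (LP N β h q t Λ u) (gp (Edg N ⊕ Fin N)) := fun u => lse_integrable (lf_add_integrable _ _)
  have hLe : ∀ u, ∫ g, LP N β h q t Λ u g ∂gp (Edg N ⊕ Fin N) = LL N β h q t Λ u := by
    intro u; unfold LP LL; congr 1; ext g; congr 1; ext w; ring
  have hV : (1:ℝ) ≤ 6 * β ^ 2 * N + 1 := by have : (0:ℝ) ≤ 6 * β ^ 2 * N := by positivity
                                            linarith
  have hconc : ∀ u, ∫ g, |LP N β h q t Λ u g - LL N β h q t Λ u| ∂gp (Edg N ⊕ Fin N) ≤ 3 * √(6 * β ^ 2 * N + 1) := by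
    intro u
    rw [← hLe u]
    exact concentration (HA2 β q t) (fun w => cc h 0 w - N * Λ * (ov w.1 w.2 / N - u) ^ 2) hV (HA2_cov_le hN β hq0 hq1 ht0 ht1)
  have hai : ∀ b : Fin (M + 1), Integrable (fun g => |LP N β h q t Λ (-1 + 2 * (b:ℕ) / M) g - LL N β h q t Λ (-1 + 2 * (b:ℕ) / M)|) (gp (Edg N ⊕ Fin N)) :=
    fun b => ((hLi _).sub (integrable_const _)).abs
  have hli : Integrable (fun g => lse (XH N β h q t g)) (gp (Edg N ⊕ Fin N)) := lse_integrable (XH_integrable β h q t)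
  have hQi : Integrable (fun g => Q2 q (XH N β h q t g)) (gp (Edg N ⊕ Fin N)) := Q2_integrable hq0 hq1 (XH_cont β h q t).measurable
  have key : ∀ g, 2 * lse (XH N β h q t g) + N * κ * Q2 q (XH N β h q t g) ≤
      N * (2 * RS β h q t) + N * ((8 * κ + 4 * Λ) / M) + log (M + 1) + ∑ b : Fin (M + 1), |LP N β h q t Λ (-1 + 2 * (b:ℕ) / M) g - LL N β h q t Λ (-1 + 2 * (b:ℕ) / M)| := by
    intro g
    refine (pair_lower q κ _).trans (pair_upper hκ hΛ hqa hM g _ _ fun b => hLL _ ?_ ?_)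
    · have : (0:ℝ) ≤ 2 * ((b:ℕ):ℝ) / M := by positivity
      linarith
    · have hb : ((b:ℕ):ℝ) ≤ M := by exact_mod_cast Nat.lt_succ_iff.1 b.2
      have h1 : 2 * ((b:ℕ):ℝ) / M ≤ 2 := by rw [div_le_iff₀ (by linarith)]; linarith
      linarith
  have hinte := integral_mono (μ := gp (Edg N ⊕ Fin N)) ((hli.const_mul 2).add (hQi.const_mul (N * κ)))
    ((integrable_const (N * (2 * RS β h q t) + N * ((8 * κ + 4 * Λ) / M) + log (M + 1))).add (integrable_finsetSum Finset.univ fun b _ => hai b)) key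
  simp only [Pi.add_apply] at hinte
  rw [integral_add (hli.const_mul 2) (hQi.const_mul (N * κ)), integral_const_mul, integral_const_mul,
    integral_add (integrable_const _) (integrable_finsetSum Finset.univ fun b _ => hai b), integral_finsetSum _ (fun b _ => hai b), integral_const, probReal_univ, one_smul] at hinte
  have hs : ∑ b : Fin (M + 1), ∫ g, |LP N β h q t Λ (-1 + 2 * (b:ℕ) / M) g - LL N β h q t Λ (-1 + 2 * (b:ℕ) / M)| ∂gp (Edg N ⊕ Fin N) ≤ (M + 1) * (3 * √(6 * β ^ 2 * N + 1)) := by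
    refine (sum_le_sum fun b _ => hconc _).trans (le_of_eq ?_)
    simp
  change 2 * pN N β h q t + _ ≤ _ at hinte
  linarith

lemma err_small (C D ε : ℝ) (hε : 0 < ε) (hD : 0 ≤ D) : ∃ M : ℕ, 0 < M ∧ ∃ N0 : ℕ, ∀ N : ℕ, N0 ≤ N → 0 < N →
    N * (C / M) + log (M + 1) + (M + 1) * (3 * √(D * N + 1)) ≤ N * ε := by
  obtain ⟨M, hM⟩ := exists_nat_gt (max (2 * C / ε) 1)
  have hM1 : 1 < (M:ℝ) := (le_max_right _ _).trans_lt hM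
  have hM2 : 2 * C / ε < M := (le_max_left _ _).trans_lt hM
  have hMpos : 0 < M := by by_contra hc; push Not at hc; interval_cases M; norm_num at hM1
  refine ⟨M, hMpos, ?_⟩
  have hC : C / M ≤ ε / 2 := by
    rw [div_lt_iff₀ hε] at hM2
    rw [div_le_iff₀ (by linarith)]; linarith
  have t1 : Tendsto (fun N : ℕ => log (M + 1) / (N:ℝ)) atTop (nhds 0) := tendsto_const_div_atTop_nhds_zero_nat _
  have t2 : Tendsto (fun N : ℕ => (M + 1) * (3 * √(D / N + 1 / N * (1 / N)))) atTop (nhds ((M + 1) * (3 * √(0 + 0 * 0)))) := by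
    have a := tendsto_const_div_atTop_nhds_zero_nat D
    have b := tendsto_const_div_atTop_nhds_zero_nat (1:ℝ)
    exact ((((a.add (b.mul b)).sqrt).const_mul 3).const_mul _)
  have t3 := t1.add t2
  simp only [mul_zero, add_zero, sqrt_zero] at t3
  obtain ⟨N0, hN0⟩ := eventually_atTop.1 (t3.eventually (gt_mem_nhds (half_pos hε)))
  refine ⟨N0, fun N hN hNp => ?_⟩
  have hNr : (0:ℝ) < N := by exact_mod_cast hNp
  have := hN0 N hN
  have e : √(D * N + 1) = N * √(D / N + 1 / N * (1 / N)) := by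
    conv_rhs => rw [← sqrt_sq hNr.le]
    rw [← sqrt_mul (sq_nonneg _), sqrt_sq hNr.le]
    congr 1; field_simp
  rw [e]
  have h1 : (N:ℝ) * (log (M + 1) / N) = log (M + 1) := by field_simp
  have h2 := mul_le_l this.le hNr.le
  have h3 := mul_le_l hC hNr.le
  rw [mul_add, h1] at h2
  linarith

/-- Part 1: replica symmetry under AT+. -/
lemma RS_main {β h q : ℝ} (hβ : 0 < β) (hfix : isFixedq β h q) (hAT : ATcond β h q) (hA : ATplus β h q) {ε : ℝ} (hε : 0 < ε) :
    ∃ N0 : ℕ, ∀ N : ℕ, N0 ≤ N → 0 < N → N * RS β h q 1 - pN N β h q 1 ≤ N * ε ∧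
      ∫ g, Q2 q (XH N β h q 1 g) ∂gp (Edg N ⊕ Fin N) ≤ ε := by
  obtain ⟨κ, hκ, Λ, hΛ, hLL⟩ := coupled_all hβ hfix hAT hA
  obtain ⟨hq0, hq1, hqf⟩ := hfix
  obtain ⟨K, hK⟩ : ∃ K, K = β ^ 2 / (2 * κ) := ⟨_, rfl⟩
  have hKp : 0 < K := by rw [hK]; positivity
  obtain ⟨η, hη, h1, h2⟩ : ∃ η > 0, η / 2 * exp K ≤ ε ∧ (η * exp K + η) / κ ≤ ε := by
    refine ⟨min ε (κ * ε) / (exp K + 1), by positivity, ?_, ?_⟩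
    · have e := exp_pos K
      rw [div_div, div_mul_eq_mul_div, div_le_iff₀ (by positivity)]
      have := min_le_left ε (κ * ε)
      nlinarith
    · have e := exp_pos K
      have : min ε (κ * ε) / (exp K + 1) * exp K + min ε (κ * ε) / (exp K + 1) = min ε (κ * ε) := by field_simp
      rw [this, div_le_iff₀ hκ]
      have := min_le_right ε (κ * ε)
      linarith
  obtain ⟨M, hM, N0, hN0⟩ := err_small (8 * κ + 4 * Λ) (6 * β ^ 2) η hη (by positivity)
  refine ⟨N0, fun N hN hNp => ?_⟩
  have hNr : (0:ℝ) < N := by exact_mod_cast hNp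
  set δ : ℝ → ℝ := fun t => N * RS β h q t - pN N β h q t with hδ
  have hb : ∀ t, 0 ≤ t → t ≤ 1 → N * κ * ∫ g, Q2 q (XH N β h q t g) ∂gp (Edg N ⊕ Fin N) ≤ 2 * δ t + N * η := by
    intro t ht0 ht1
    have a := Q2_main_raw hNp hq0.le hq1.le hκ.le hΛ.le ht0 ht1 (fun u hu0 hu1 => hLL N hNp t ht0 ht1 u hu0 hu1) hM
    have b := hN0 N hN hNp
    simp only [hδ]; linarith
  have hδ' : ∀ t, 0 < t → t < 1 → HasDerivAt δ (N * (β ^ 2 / 4) * ∫ g, Q2 q (XH N β h q t g) ∂gp (Edg N ⊕ Fin N)) t := by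
    intro t ht0 ht1
    have a := pN_deriv hNp β h hq0.le ht0 ht1
    have hQi : Integrable (fun g => Q2 q (XH N β h q t g)) (gp (Edg N ⊕ Fin N)) := Q2_integrable hq0.le hq1.le (XH_cont β h q t).measurable
    rw [integral_const_mul, integral_sub (integrable_const _) hQi, integral_const, probReal_univ, one_smul] at a
    have b : HasDerivAt (fun t => N * RS β h q t) (N * (β ^ 2 / 4 * (1 - q) ^ 2)) t := by
      unfold RS
      have := (((hasDerivAt_id t).const_mul (β ^ 2 / 4)).mul_const ((1 - q) ^ 2)).const_add (log 2 + lc β h q)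
      simpa using this.const_mul (N:ℝ)
    refine (b.sub a).congr_deriv ?_
    ring
  have hδc : ContinuousOn δ (Set.Icc 0 1) := by
    refine ContinuousOn.sub ?_ (pN_contOn β h q)
    unfold RS; fun_prop
  have hδ0 : δ 0 = 0 := by simp only [hδ, pN_zero]; ring
  set f : ℝ → ℝ := fun t => (δ t + N * η / 2) * exp (-K * t) with hf
  have hanti : AntitoneOn f (Set.Icc 0 1) := by
    have hfd : ∀ t ∈ interior (Set.Icc (0:ℝ) 1), HasDerivAt f ((N * (β ^ 2 / 4) * ∫ g, Q2 q (XH N β h q t g) ∂gp (Edg N ⊕ Fin N)) * exp (-K * t) + (δ t + N * η / 2) * (exp (-K * t) * (-K))) t := by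
      intro t ht
      rw [interior_Icc] at ht
      have a := (hδ' t ht.1 ht.2).add_const (N * η / 2)
      have b : HasDerivAt (fun t => exp (-K * t)) (exp (-K * t) * (-K)) t := by
        simpa using ((hasDerivAt_id t).const_mul (-K)).exp
      exact a.mul b
    refine antitoneOn_of_deriv_nonpos (convex_Icc 0 1) ?_ (fun t ht => (hfd t ht).differentiableAt.differentiableWithinAt) ?_
    · exact (hδc.add continuousOn_const).mul (by fun_prop)
    · intro t ht
      rw [(hfd t ht).deriv]
      rw [interior_Icc] at ht
      have a := hb t ht.1.le ht.2.le
      generalize (∫ g, Q2 q (XH N β h q t g) ∂gp (Edg N ⊕ Fin N)) = I at a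
      have e : N * (β ^ 2 / 4) * I * exp (-K * t) + (δ t + N * η / 2) * (exp (-K * t) * -K) = exp (-K * t) * (K / 2) * (N * κ * I - (2 * δ t + N * η)) := by
        rw [hK]; field_simp; ring
      rw [e]
      exact mul_nonpos_of_nonneg_of_nonpos (by positivity) (by linarith)
  have hf1 := hanti (Set.left_mem_Icc.2 zero_le_one) (Set.right_mem_Icc.2 zero_le_one) zero_le_one
  simp only [hf, hδ0, mul_one, mul_zero, exp_zero, zero_add, exp_neg] at hf1
  have hf2 : δ 1 + N * η / 2 ≤ N * η / 2 * exp K := by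
    rwa [← div_eq_mul_inv, div_le_iff₀ (exp_pos K)] at hf1
  constructor
  · have : N * (η / 2 * exp K) ≤ N * ε := by gcongr
    have h3 : 0 ≤ N * η := by positivity
    change δ 1 ≤ _
    linarith
  · have a := hb 1 zero_le_one le_rfl
    generalize (∫ g, Q2 q (XH N β h q 1 g) ∂gp (Edg N ⊕ Fin N)) = I at a ⊢
    refine le_trans ?_ h2
    rw [le_div_iff₀ hκ]
    have h3 : 0 ≤ N * η := by positivity
    have : N * (I * κ) ≤ N * (η * exp K + η) := by nlinarith
    exact le_of_mul_le_mul_left this hNr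
end

section
variable {N : ℕ}

/-- normalized projection on a direction -/
def yy (u : Fin N → ℝ) (s : Cfg N) : ℝ := (∑ i, u i * sp (s i)) / √N

/-- coefficients of the quadratic form `β u G u` -/
def AU (N : ℕ) (β : ℝ) (u : Fin N → ℝ) : Edg N ⊕ Fin N → ℝ :=
  Sum.elim (fun p => 2 * β / √N * (u p.1.1 * u p.1.2)) 0

/-- decoupled field -/
def HB (N : ℕ) (β q : ℝ) (s : Cfg N) : Fin N ⊕ Fin N → ℝ := Sum.elim (fun i => β * √q * sp (s i)) 0

/-- decoupled direction field -/
def BU (N : ℕ) (β ρ : ℝ) (u : Fin N → ℝ) : Fin N ⊕ Fin N → ℝ :=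
  Sum.elim (fun i => 2 * β / √N * ρ * u i) (fun i => 2 * β / √N * √(1 - ρ ^ 2) * u i)

lemma AU_HA (hN : 0 < N) (β q : ℝ) (u : Fin N → ℝ) (s : Cfg N) :
    ∑ k, AU N β u k * HA N β q 1 s k = β ^ 2 * (yy u s ^ 2 - (∑ i, u i ^ 2) / N) := by
  have hNr : (0:ℝ) < N := by exact_mod_cast hN
  have hs : √(N:ℝ) ^ 2 = N := sq_sqrt hNr.le
  have hs0 : √(N:ℝ) ≠ 0 := (sqrt_pos.2 hNr).ne'
  unfold AU HA yy
  simp only [sum_sum_type, Sum.elim_inl, Sum.elim_inr, Pi.zero_apply, zero_mul, sum_const_zero, add_zero, sqrt_one, one_mul]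
  have e : ∀ p : Edg N, 2 * β / √N * (u p.1.1 * u p.1.2) * (β / √N * (sp (s p.1.1) * sp (s p.1.2)))
      = 2 * β ^ 2 / √N ^ 2 * ((fun i => u i * sp (s i)) p.1.1 * (fun i => u i * sp (s i)) p.1.2) := by
    intro p; field_simp
  have e2 := sum_edg_mul N (fun i => u i * sp (s i))
  rw [scg fun p _ => e p, ← mul_sum, e2, div_pow, hs]
  simp only [mul_pow, sp_sq, mul_one]
  field_simp

lemma AU_AU (hN : 0 < N) (β : ℝ) (u v : Fin N → ℝ) :
    ∑ k, AU N β u k * AU N β v k = 2 * β ^ 2 / N * ((∑ i, u i * v i) ^ 2 - ∑ i, u i ^ 2 * v i ^ 2) := by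
  have hNr : (0:ℝ) < N := by exact_mod_cast hN
  have hs : √(N:ℝ) ^ 2 = N := sq_sqrt hNr.le
  have hs0 : √(N:ℝ) ≠ 0 := (sqrt_pos.2 hNr).ne'
  unfold AU
  simp only [sum_sum_type, Sum.elim_inl, Sum.elim_inr, Pi.zero_apply, zero_mul, sum_const_zero, add_zero]
  have e : ∀ p : Edg N, 2 * β / √N * (u p.1.1 * u p.1.2) * (2 * β / √N * (v p.1.1 * v p.1.2))
      = 4 * β ^ 2 / √N ^ 2 * ((fun i => u i * v i) p.1.1 * (fun i => u i * v i) p.1.2) := by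
    intro p; field_simp; ring
  have e2 := sum_edg_mul N (fun i => u i * v i)
  rw [scg fun p _ => e p, ← mul_sum, e2, hs]
  simp only [mul_pow]
  ring

lemma HB_HB (β : ℝ) {q : ℝ} (hq : 0 ≤ q) (s s' : Cfg N) : ∑ k, HB N β q s k * HB N β q s' k = β ^ 2 * q * ov s s' := by
  unfold HB ov
  simp only [sum_sum_type, Sum.elim_inl, Sum.elim_inr, Pi.zero_apply, zero_mul, sum_const_zero, add_zero, mul_sum]
  exact scg fun i _ => by linear_combination (β ^ 2 * sp (s i) * sp (s' i)) * sq_sqrt hq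

lemma BU_HB (hN : 0 < N) (β q ρ : ℝ) (u : Fin N → ℝ) (s : Cfg N) :
    ∑ k, BU N β ρ u k * HB N β q s k = 2 * β ^ 2 * (√q * ρ) * yy u s := by
  unfold HB BU yy
  simp only [sum_sum_type, Sum.elim_inl, Sum.elim_inr, Pi.zero_apply, mul_zero, sum_const_zero, add_zero]
  rw [mul_div_assoc', mul_sum, sum_div]
  exact scg fun i _ => by ring

lemma BU_BU (hN : 0 < N) (β : ℝ) {ρ : ℝ} (hρ : ρ ^ 2 ≤ 1) (u v : Fin N → ℝ) :
    ∑ k, BU N β ρ u k * BU N β ρ v k = 4 * β ^ 2 / N * ∑ i, u i * v i := by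
  have hNr : (0:ℝ) < N := by exact_mod_cast hN
  have hs : √(N:ℝ) ^ 2 = N := sq_sqrt hNr.le
  have hs0 : √(N:ℝ) ≠ 0 := (sqrt_pos.2 hNr).ne'
  have h1 : √(1 - ρ ^ 2) ^ 2 = 1 - ρ ^ 2 := sq_sqrt (by linarith)
  unfold BU
  simp only [sum_sum_type, Sum.elim_inl, Sum.elim_inr]
  rw [← sum_add_distrib, mul_sum]
  refine scg fun i _ => ?_
  have h2 : (4 * β ^ 2 / N : ℝ) = 4 * β ^ 2 / √(N:ℝ) ^ 2 := by rw [hs]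
  rw [h2]
  generalize √(N:ℝ) = w at hs0
  field_simp
  linear_combination (β ^ 2 * u i * v i * 4) * h1

section
variable {J : Type*} [Fintype J] [Nonempty J] {n : ℕ}

/-- full Gaussian coefficients at time one -/
def GA (N n : ℕ) {J : Type*} (β q m θ : ℝ) (U : J → Fin N → ℝ) (s : (Fin n → Cfg N) × J) (k : Edg N ⊕ Fin N) : ℝ :=
  (1 / m) * ∑ l, HA N β q 1 (s.1 l) k + θ * N * AU N β (U s.2) k
/-- full Gaussian coefficients at time zero -/
def GB (N n : ℕ) {J : Type*} (β q ρ m θ : ℝ) (U : J → Fin N → ℝ) (s : (Fin n → Cfg N) × J) (k : Fin N ⊕ Fin N) : ℝ :=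
  (1 / m) * ∑ l, HB N β q (s.1 l) k + θ * N * BU N β ρ (U s.2) k

lemma bilin {κ : Type*} [Fintype κ] (m t : ℝ) (f f' : Fin n → κ → ℝ) (a a' : κ → ℝ) :
    ∑ k, ((1 / m) * ∑ l, f l k + t * a k) * ((1 / m) * ∑ l, f' l k + t * a' k)
      = (1 / m) ^ 2 * ∑ l, ∑ l', ∑ k, f l k * f' l' k + t / m * (∑ l, ∑ k, a' k * f l k + ∑ l, ∑ k, a k * f' l k) + t ^ 2 * ∑ k, a k * a' k := by
  have e1 : ∑ l, ∑ l', ∑ k, f l k * f' l' k = ∑ k, (∑ l, f l k) * ∑ l', f' l' k := by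
    have h1 : ∀ k, (∑ l, f l k) * ∑ l', f' l' k = ∑ l, ∑ l', f l k * f' l' k := fun k => sum_mul_sum _ _ _ _
    calc ∑ l, ∑ l', ∑ k, f l k * f' l' k = ∑ l, ∑ k, ∑ l', f l k * f' l' k := by
          congr 1; ext l; rw [sum_comm]
      _ = ∑ k, ∑ l, ∑ l', f l k * f' l' k := by rw [sum_comm]
      _ = _ := by congr 1; ext k; rw [h1]
  have e2 : ∑ l, ∑ k, a' k * f l k = ∑ k, a' k * ∑ l, f l k := by rw [sum_comm]; simp_rw [mul_sum]
  have e3 : ∑ l, ∑ k, a k * f' l k = ∑ k, a k * ∑ l, f' l k := by rw [sum_comm]; simp_rw [mul_sum]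
  rw [e1, e2, e3, ← sum_add_distrib]
  simp only [mul_sum (s := (Finset.univ : Finset κ))]
  rw [← sum_add_distrib, ← sum_add_distrib]
  refine scg fun k _ => ?_
  ring

/-- sum of squared overlap deviations -/
def PP (q : ℝ) (s s' : Fin n → Cfg N) : ℝ := ∑ l, ∑ l', (ov (s l) (s' l') / N - q) ^ 2
/-- deviation of projection -/
def YY (r : ℝ) (u : Fin N → ℝ) (s : Fin n → Cfg N) : ℝ := ∑ l, (yy u (s l) ^ 2 - 2 * r * yy u (s l))

lemma interp2 (hN : 0 < N) {β q r ρ m θ : ℝ} (hq : 0 ≤ q) (hρ : ρ ^ 2 ≤ 1) (hr : √q * ρ = r) (hm : 0 < m) (hm1 : m ≤ 1) (hθ : 0 ≤ θ)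
    (U : J → Fin N → ℝ) (hU : ∀ j, U j = 0 ∨ ∑ i, U j i ^ 2 = 1) (c : (Fin n → Cfg N) × J → ℝ) :
    ∫ g, Fm m (fun s => lf (GA N n β q m θ U) g s + c s +
      (- (1 / m) * (N * (β ^ 2 / 4)) * PP q s.1 s.1 - θ * N * β ^ 2 * (YY r (U s.2) s.1 + n * (r ^ 2 * ∑ i, U s.2 i ^ 2)))) ∂gp (Edg N ⊕ Fin N)
    ≤ ∫ g, Fm m (fun s => lf (GB N n β q ρ m θ U) g s + c s) ∂gp (Fin N ⊕ Fin N) := by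
  have hNr : (0:ℝ) < N := by exact_mod_cast hN
  obtain ⟨nn, hnn⟩ : ∃ nn : J → ℝ, ∀ j, nn j = ∑ i, U j i ^ 2 := ⟨_, fun _ => rfl⟩
  obtain ⟨qq, hqq⟩ : ∃ qq : J → ℝ, ∀ j, qq j = ∑ i, U j i ^ 4 := ⟨_, fun _ => rfl⟩
  obtain ⟨δ, hδ⟩ : ∃ δ : J → J → ℝ, ∀ j j', δ j j' = (∑ i, U j i * U j' i) ^ 2 - ∑ i, U j i ^ 2 * U j' i ^ 2 - 2 * ∑ i, U j i * U j' i := ⟨_, fun _ _ => rfl⟩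
  have hδ1 : ∀ j, δ j j = - nn j - qq j := by
    intro j
    rw [hδ, hnn, hqq]
    have e1 : ∑ i, U j i * U j i = ∑ i, U j i ^ 2 := scg fun i _ => by ring
    have e2 : ∑ i, U j i ^ 2 * U j i ^ 2 = ∑ i, U j i ^ 4 := scg fun i _ => by ring
    rw [e1, e2]
    rcases hU j with h | h
    · rw [h]; simp
    · rw [h]; ring
  have hδ2 : ∀ j j', - (nn j + qq j) / 2 - (nn j' + qq j') / 2 ≤ δ j j' := by
    intro j j'
    have e2 : ∑ i, U j i ^ 2 * U j' i ^ 2 ≤ (qq j + qq j') / 2 := by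
      rw [hqq, hqq, ← sum_add_distrib, sum_div]
      exact sum_le_sum fun i _ => by nlinarith [sq_nonneg (U j i ^ 2 - U j' i ^ 2)]
    have e3 : - (nn j + nn j') / 2 ≤ (∑ i, U j i * U j' i) ^ 2 - 2 * ∑ i, U j i * U j' i := by
      rw [hnn, hnn]
      rcases hU j with h | h
      · rw [h]; simp
        have : 0 ≤ ∑ i, U j' i ^ 2 := sum_nonneg fun i _ => sq_nonneg _
        linarith
      · rcases hU j' with h' | h'
        · rw [h']; simp
          have : 0 ≤ ∑ i, U j i ^ 2 := sum_nonneg fun i _ => sq_nonneg _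
          linarith
        · rw [h, h']; nlinarith [sq_nonneg (∑ i, U j i * U j' i - 1)]
    rw [hδ]; linarith
  have hY : ∀ (s : Fin n → Cfg N) j, 0 ≤ YY r (U j) s + n * (r ^ 2 * nn j) := by
    intro s j
    have : YY r (U j) s + n * (r ^ 2 * nn j) = ∑ l, (yy (U j) (s l) ^ 2 - 2 * r * yy (U j) (s l) + r ^ 2 * nn j) := by
      unfold YY; rw [sum_add_distrib]; simp
    rw [this]
    refine sum_nonneg fun l _ => ?_
    rw [hnn]
    rcases hU j with h | h
    · rw [h]; simp [yy]
    · rw [h]; nlinarith [sq_nonneg (yy (U j) (s l) - r)]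
  have hPP : ∀ s s' : Fin n → Cfg N, 0 ≤ PP q s s' := fun s s' => sum_nonneg fun _ _ => sum_nonneg fun _ _ => sq_nonneg _
  have key := Fm_interp (K := Fin n → Cfg N) (J := J) hm hm1 (GA N n β q m θ U) (GB N n β q ρ m θ U) c
    (fun s => - (1 / m) * (N * (β ^ 2 / 4)) * PP q s.1 s.1 - θ * N * β ^ 2 * (YY r (U s.2) s.1 + n * (r ^ 2 * ∑ i, U s.2 i ^ 2)))
    (fun s s' => (1 / m) ^ 2 * (N * (β ^ 2 / 2)) * (PP q s.1 s'.1 - n ^ 2 * (q ^ 2 + 1 / N))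
      + θ * N / m * β ^ 2 * ((YY r (U s'.2) s.1 - n * nn s'.2 / N) + (YY r (U s.2) s'.1 - n * nn s.2 / N))
      + 2 * β ^ 2 * θ ^ 2 * N * δ s.2 s'.2) (by
      intro s s'
      unfold GA GB
      rw [bilin, bilin]
      simp_rw [AU_HA hN, AU_AU hN, BU_HB hN, HB_HB β hq, BU_BU hN β hρ, HA_cov hN β hq zero_le_one le_rfl, hr]
      have e1 : ∑ l, ∑ l', (1 * β ^ 2 / 2 * (ov (s.1 l) (s'.1 l') ^ 2 / N - 1) + (1 - 1) * β ^ 2 * q * ov (s.1 l) (s'.1 l'))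
          = (N * (β ^ 2 / 2)) * (PP q s.1 s'.1 - n ^ 2 * (q ^ 2 + 1 / N)) + ∑ l, ∑ l', β ^ 2 * q * ov (s.1 l) (s'.1 l') := by
        have : (n:ℝ) ^ 2 * (q ^ 2 + 1 / N) = ∑ l : Fin n, ∑ l' : Fin n, (q ^ 2 + 1 / (N:ℝ)) := by simp; ring
        rw [this]; unfold PP
        simp_rw [← sum_sub_distrib, mul_sum, ← sum_add_distrib]
        refine scg fun l _ => scg fun l' _ => ?_
        field_simp; ring
      have e2 : ∀ (a : Fin n → Cfg N) (j : J), ∑ l, β ^ 2 * (yy (U j) (a l) ^ 2 - (∑ i, U j i ^ 2) / N)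
          = β ^ 2 * (YY r (U j) a - n * nn j / N) + ∑ l, 2 * β ^ 2 * r * yy (U j) (a l) := by
        intro a j
        have : n * nn j / (N:ℝ) = ∑ l : Fin n, nn j / N := by simp; ring
        rw [this]; unfold YY
        simp_rw [← sum_sub_distrib, mul_sum, ← sum_add_distrib, ← hnn]
        exact scg fun l _ => by ring
      rw [e1, e2, e2, hδ]
      field_simp
      ring)
    (fun s => (1 / m) ^ 2 * (N * (β ^ 2 / 4)) * (PP q s.1 s.1 - n ^ 2 * (q ^ 2 + 1 / N))
      + θ * N / m * β ^ 2 * (YY r (U s.2) s.1 - n * nn s.2 / N) - β ^ 2 * θ ^ 2 * N * (nn s.2 + qq s.2))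
    (fun s => - ((1 / m) ^ 2 * (N * (β ^ 2 / 4)) * (n ^ 2 * (q ^ 2 + 1 / N)))
      - θ * N / m * β ^ 2 * (n * (r ^ 2 * nn s.2) + n * nn s.2 / N) - β ^ 2 * θ ^ 2 * N * (nn s.2 + qq s.2)) (C₀ := 0) (D := 0)
    (by
      intro k j j'
      have := mul_le_l (hδ2 j j') (by positivity : 0 ≤ 2 * β ^ 2 * θ ^ 2 * N)
      linarith)
    (by
      intro s s'
      have h1 := mul_le_l (hδ2 s.2 s'.2) (by positivity : 0 ≤ 2 * β ^ 2 * θ ^ 2 * N)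
      have h2 := mul_nonneg (by positivity : 0 ≤ (1 / m) ^ 2 * (N * (β ^ 2 / 2))) (hPP s.1 s'.1)
      have h3 := mul_nonneg (by positivity : 0 ≤ θ * N / m * β ^ 2) (hY s.1 s'.2)
      have h4 := mul_nonneg (by positivity : 0 ≤ θ * N / m * β ^ 2) (hY s'.1 s.2)
      linarith)
    (by
      intro s
      refine le_of_eq ?_
      simp only [hδ1, ← hnn]
      field_simp
      ring)
  simpa using key
end
end

section
section
variable {α : Type*} [Fintype α] {n : ℕ}
/-- average under a product of weights -/
def pav (p : α → ℝ) (F : (Fin n → α) → ℝ) : ℝ := ∑ s, (∏ l, p (s l)) * F s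

lemma pav_prod (p : α → ℝ) (f : Fin n → α → ℝ) : pav p (fun s => ∏ l, f l (s l)) = ∏ l, ∑ a, p a * f l a := by
  classical
  unfold pav
  rw [Finset.prod_univ_sum, Fintype.piFinset_univ]
  exact scg fun s _ => by rw [Finset.prod_mul_distrib]

lemma pav_const {p : α → ℝ} (hp : ∑ a, p a = 1) (c : ℝ) : pav (n := n) p (fun _ => c) = c := by
  have := pav_prod (n := n) p (fun _ _ => 1)
  simp only [Finset.prod_const_one, mul_one, hp] at this
  have h2 : pav (n := n) p (fun _ => c) = c * pav (n := n) p (fun _ => 1) := by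
    unfold pav; rw [mul_sum]; exact scg fun s _ => by ring
  rw [h2, this, mul_one]

lemma pav_add (p : α → ℝ) (F G : (Fin n → α) → ℝ) : pav p (fun s => F s + G s) = pav p F + pav p G := by
  unfold pav; simp_rw [mul_add]; exact sum_add_distrib
lemma pav_sub (p : α → ℝ) (F G : (Fin n → α) → ℝ) : pav p (fun s => F s - G s) = pav p F - pav p G := by
  unfold pav; simp_rw [mul_sub]; exact sum_sub_distrib _ _
lemma pav_smul (p : α → ℝ) (c : ℝ) (F : (Fin n → α) → ℝ) : pav p (fun s => c * F s) = c * pav p F := by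
  unfold pav; rw [mul_sum]; exact scg fun s _ => by ring
lemma pav_sum {ι : Type*} (t : Finset ι) (p : α → ℝ) (F : ι → (Fin n → α) → ℝ) : pav p (fun s => ∑ i ∈ t, F i s) = ∑ i ∈ t, pav p (F i) := by
  unfold pav; simp_rw [mul_sum]; exact sum_comm
lemma pav_mono {p : α → ℝ} (hp : ∀ a, 0 ≤ p a) {F G : (Fin n → α) → ℝ} (h : ∀ s, F s ≤ G s) : pav p F ≤ pav p G :=
  sum_le_sum fun s _ => mul_le_l (h s) (Finset.prod_nonneg fun l _ => hp _)

lemma pav_two {p : α → ℝ} (hp : ∑ a, p a = 1) {l0 l1 : Fin n} (hl : l0 ≠ l1) (f g : α → ℝ) :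
    pav p (fun s => f (s l0) * g (s l1)) = (∑ a, p a * f a) * ∑ a, p a * g a := by
  classical
  have h := pav_prod p (fun l a => (if l = l0 then f a else 1) * (if l = l1 then g a else 1))
  have e1 : ∀ s : Fin n → α, ∏ l, ((if l = l0 then f (s l) else 1) * (if l = l1 then g (s l) else 1)) = f (s l0) * g (s l1) := by
    intro s; rw [Finset.prod_mul_distrib]; simp
  simp_rw [e1] at h
  rw [h]
  have e2 : ∀ l, ∑ a, p a * ((if l = l0 then f a else 1) * (if l = l1 then g a else 1))
      = (if l = l0 then ∑ a, p a * f a else 1) * (if l = l1 then ∑ a, p a * g a else 1) := by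
    intro l
    by_cases h0 : l = l0
    · have h1 : l ≠ l1 := h0 ▸ hl
      simp only [if_pos h0, if_neg h1, mul_one]
    · by_cases h1 : l = l1
      · simp only [if_neg h0, if_pos h1, one_mul]
      · simp only [if_neg h0, if_neg h1, mul_one, hp]
  rw [Finset.prod_congr rfl fun l _ => e2 l, Finset.prod_mul_distrib]; simp

lemma pav_one {p : α → ℝ} (hp : ∑ a, p a = 1) (l0 : Fin n) (f : α → ℝ) :
    pav p (fun s => f (s l0)) = ∑ a, p a * f a := by
  classical
  have h := pav_prod p (fun l a => (if l = l0 then f a else 1))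
  have e1 : ∀ s : Fin n → α, ∏ l, (if l = l0 then f (s l) else 1) = f (s l0) := by
    intro s; simp
  simp_rw [e1] at h
  rw [h]
  have e2 : ∀ l, ∑ a, p a * (if l = l0 then f a else 1) = (if l = l0 then ∑ a, p a * f a else 1) := by
    intro l
    by_cases h0 : l = l0
    · simp only [if_pos h0]
    · simp only [if_neg h0, mul_one, hp]
  rw [Finset.prod_congr rfl fun l _ => e2 l]; simp

lemma pav_two' {p : α → ℝ} (hp : ∑ a, p a = 1) {l0 l1 : Fin n} (hl : l0 ≠ l1) (f : α → α → ℝ) :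
    pav p (fun s => f (s l0) (s l1)) = ∑ a, ∑ b, p a * p b * f a b := by
  classical
  have e : ∀ s : Fin n → α, f (s l0) (s l1) = ∑ b, f (s l0) b * (if s l1 = b then 1 else 0) := by
    intro s; simp
  simp_rw [e]
  rw [pav_sum, sum_comm]
  refine scg fun b _ => ?_
  have := pav_two hp hl (fun a => f a b) (fun a => if a = b then 1 else 0)
  rw [this]
  simp only [mul_ite, mul_one, mul_zero, Finset.sum_ite_eq', mem_univ, if_true]
  rw [sum_mul]
  exact scg fun a _ => by ring

lemma pav_var (hn : 0 < n) {p : α → ℝ} (hp0 : ∀ a, 0 ≤ p a) (hp : ∑ a, p a = 1) (f : α → ℝ) (hf : ∀ a, f a ^ 2 ≤ 1) :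
    pav p (fun s : Fin n → α => ((∑ l, f (s l)) / n - ∑ a, p a * f a) ^ 2) ≤ 1 / n := by
  have hnr : (0:ℝ) < n := by exact_mod_cast hn
  obtain ⟨μ, hμ⟩ : ∃ μ, μ = ∑ a, p a * f a := ⟨_, rfl⟩
  rw [← hμ]
  have e : ∀ s : Fin n → α, ((∑ l, f (s l)) / n - μ) ^ 2 = (1 / n ^ 2) * ∑ l, ∑ l', (f (s l) - μ) * (f (s l') - μ) := by
    intro s
    rw [← sum_mul_sum]
    have : ∑ l, (f (s l) - μ) = ∑ l, f (s l) - n * μ := by rw [sum_sub_distrib]; simp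
    rw [this]; field_simp
  simp_rw [e]
  rw [pav_smul, pav_sum]
  have h0 : ∑ a, p a * (f a - μ) = 0 := by
    simp_rw [mul_sub]; rw [sum_sub_distrib, ← sum_mul, hp, ← hμ]; ring
  have h1 : ∑ a, p a * ((f a - μ) * (f a - μ)) ≤ 1 := by
    have : ∑ a, p a * ((f a - μ) * (f a - μ)) = ∑ a, p a * f a ^ 2 - μ ^ 2 := by
      have e : ∀ a, p a * ((f a - μ) * (f a - μ)) = p a * f a ^ 2 - 2 * μ * (p a * f a) + μ ^ 2 * p a := fun a => by ring
      simp_rw [e]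
      rw [sum_add_distrib, sum_sub_distrib, ← mul_sum, ← mul_sum, hp, ← hμ]; ring
    rw [this]
    have : ∑ a, p a * f a ^ 2 ≤ ∑ a, p a * 1 := sum_le_sum fun a _ => mul_le_l (hf a) (hp0 a)
    simp only [mul_one, hp] at this
    nlinarith [sq_nonneg μ]
  have h2 : ∀ l : Fin n, pav p (fun s => ∑ l', (f (s l) - μ) * (f (s l') - μ)) ≤ 1 := by
    intro l
    rw [pav_sum, Finset.sum_eq_single l]
    · rw [pav_one hp l (fun a => (f a - μ) * (f a - μ))]; exact h1
    · intro l' _ hl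
      rw [pav_two hp (Ne.symm hl) (fun a => f a - μ) (fun a => f a - μ), h0, zero_mul]
    · simp
  calc (1 / (n:ℝ) ^ 2) * ∑ l, pav p (fun s : Fin n → α => ∑ l', (f (s l) - μ) * (f (s l') - μ)) ≤ (1 / (n:ℝ) ^ 2) * ∑ l : Fin n, (1:ℝ) :=
        mul_le_l (sum_le_sum fun l _ => h2 l) (by positivity)
    _ = 1 / n := by simp; field_simp

lemma lse_prod [Nonempty α] (x : α → ℝ) : lse (fun s : Fin n → α => ∑ l, x (s l)) = n * lse x := by
  classical
  unfold lse
  simp_rw [exp_sum]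
  have : ∑ s : Fin n → α, ∏ l, exp (x (s l)) = ∏ l : Fin n, ∑ a, exp (x a) := by
    rw [Finset.prod_univ_sum, Fintype.piFinset_univ]
  rw [this]; simp

lemma gw_prod [Nonempty α] (x : α → ℝ) (s : Fin n → α) : gw (fun s : Fin n → α => ∑ l, x (s l)) s = ∏ l, gw x (s l) := by
  classical
  unfold gw
  simp_rw [exp_sum]
  have : ∑ s : Fin n → α, ∏ l, exp (x (s l)) = ∏ l : Fin n, ∑ a, exp (x a) := by
    rw [Finset.prod_univ_sum, Fintype.piFinset_univ]
  rw [this, Finset.prod_div_distrib]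

/-- lower bound for `Fm` by Jensen -/
lemma Fm_lower {J : Type*} [Fintype J] [Nonempty J] [Nonempty α] {m : ℝ} (hm : 0 < m) (x : α → ℝ) (X : (Fin n → α) × J → ℝ) (j : J)
    (f : (Fin n → α) → ℝ) (h : ∀ s, (1 / m) * (∑ l, x (s l) + f s) ≤ X (s, j)) :
    n * lse x + pav (gw x) f ≤ m * Fm m X := by
  have h1 := lse_jensen (fun s : Fin n → α => ∑ l, x (s l)) f
  rw [lse_prod] at h1
  simp_rw [gw_prod] at h1
  refine (show n * lse x + pav (gw x) f ≤ _ from h1).trans ?_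
  unfold Fm lse
  rw [← mul_assoc, mul_one_div_cancel hm.ne', one_mul]
  refine log_le_log (lse_sum_pos _) (sum_le_sum fun s _ => ?_)
  have h2 : exp ((1 / m) * (∑ l, x (s l) + f s)) ≤ Zin X s := by
    refine (exp_le_exp.2 (h s)).trans ?_
    exact single_le_sum (f := fun j => exp (X (s, j))) (fun _ _ => (exp_pos _).le) (mem_univ j)
  calc exp (∑ l, x (s l) + f s) = exp ((1 / m) * (∑ l, x (s l) + f s)) ^ m := by
        rw [← exp_mul]; congr 1; field_simp
    _ ≤ Zin X s ^ m := rpow_le_rpow (exp_pos _).le h2 hm.le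
end
end

section
lemma wjensen {α : Type*} [Fintype α] {p : α → ℝ} (hp0 : ∀ a, 0 ≤ p a) (hp : ∑ a, p a = 1) (f : α → ℝ) : (∑ a, p a * f a) ^ 2 ≤ ∑ a, p a * f a ^ 2 := by
  have h : 0 ≤ ∑ a, p a * (f a - ∑ a, p a * f a) ^ 2 := sum_nonneg fun a _ => mul_nonneg (hp0 a) (sq_nonneg _)
  obtain ⟨μ, hμ⟩ : ∃ μ, μ = ∑ a, p a * f a := ⟨_, rfl⟩
  rw [← hμ] at h ⊢
  have e : ∀ a, p a * (f a - μ) ^ 2 = p a * f a ^ 2 - 2 * μ * (p a * f a) + μ ^ 2 * p a := fun a => by ring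
  simp_rw [e] at h
  rw [sum_add_distrib, sum_sub_distrib, ← mul_sum, ← mul_sum, hp, ← hμ] at h
  linarith

/-- doubly centered kernel -/
lemma dcenter {α : Type*} [Fintype α] {p : α → ℝ} (hp0 : ∀ a, 0 ≤ p a) (hp : ∑ a, p a = 1) (R : α → α → ℝ) (hR : ∀ a b, R a b = R b a) :
    ∑ a, ∑ b, p a * p b * (R a b - ∑ c, p c * R a c - ∑ c, p c * R b c + ∑ d, p d * ∑ c, p c * R d c) ^ 2
      ≤ 16 * ∑ a, ∑ b, p a * p b * R a b ^ 2 := by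
  obtain ⟨ρ, hρ⟩ : ∃ ρ : α → ℝ, ∀ a, ρ a = ∑ c, p c * R a c := ⟨_, fun _ => rfl⟩
  simp_rw [← hρ]
  obtain ⟨w, hw⟩ : ∃ w, w = ∑ d, p d * ρ d := ⟨_, rfl⟩
  rw [← hw]
  obtain ⟨Q, hQ⟩ : ∃ Q, Q = ∑ a, ∑ b, p a * p b * R a b ^ 2 := ⟨_, rfl⟩
  have h1 : ∑ a, p a * ρ a ^ 2 ≤ Q := by
    rw [hQ]
    refine sum_le_sum fun a _ => ?_
    simp_rw [mul_assoc]
    rw [← mul_sum, hρ]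
    exact mul_le_l (wjensen hp0 hp _) (hp0 a)
  have h2 : w ^ 2 ≤ Q := by rw [hw]; exact (wjensen hp0 hp _).trans h1
  rw [← hQ]
  calc ∑ a, ∑ b, p a * p b * (R a b - ρ a - ρ b + w) ^ 2
      ≤ ∑ a, ∑ b, (4 * (p a * p b * R a b ^ 2) + 4 * (p b * (p a * ρ a ^ 2)) + 4 * (p a * (p b * ρ b ^ 2)) + 4 * w ^ 2 * (p a * p b)) := by
        refine sum_le_sum fun a _ => sum_le_sum fun b _ => ?_
        have hpp : 0 ≤ p a * p b := mul_nonneg (hp0 a) (hp0 b)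
        have : (R a b - ρ a - ρ b + w) ^ 2 ≤ 4 * (R a b ^ 2 + ρ a ^ 2 + ρ b ^ 2 + w ^ 2) := by
          nlinarith [sq_nonneg (R a b + ρ a), sq_nonneg (R a b + ρ b), sq_nonneg (R a b - w), sq_nonneg (ρ a - ρ b), sq_nonneg (ρ a + w), sq_nonneg (ρ b + w)]
        nlinarith [mul_le_l this hpp]
    _ = 4 * Q + 4 * ∑ a, p a * ρ a ^ 2 + 4 * ∑ a, p a * ρ a ^ 2 + 4 * w ^ 2 := by
        simp_rw [sum_add_distrib, ← mul_sum]
        rw [← hQ]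
        simp_rw [← sum_mul, ← mul_sum, hp]
        simp only [one_mul, mul_one]
    _ ≤ 16 * Q := by linarith

variable {N : ℕ}
/-- magnetization -/
def mg (x : Cfg N → ℝ) (i : Fin N) : ℝ := ∑ s, gw x s * sp (s i)
/-- magnetization in a direction -/
def Yv (x : Cfg N → ℝ) (u : Fin N → ℝ) : ℝ := (∑ i, u i * mg x i) / √N

lemma Yv_eq (x : Cfg N → ℝ) (u : Fin N → ℝ) : Yv x u = ∑ s, gw x s * yy u s := by
  unfold Yv yy mg
  simp_rw [mul_div_assoc', ← sum_div, mul_sum]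
  rw [sum_comm]
  congr 1
  exact scg fun s _ => scg fun i _ => by ring

lemma mg_sq_sum (x : Cfg N → ℝ) (s : Cfg N) : ∑ i, sp (s i) * mg x i = ∑ s', gw x s' * ov s s' := by
  unfold mg ov
  simp_rw [mul_sum]
  rw [sum_comm]
  exact scg fun s _ => scg fun i _ => by ring

lemma mg_mg (x : Cfg N → ℝ) : ∑ i, mg x i * mg x i = ∑ s, gw x s * ∑ s', gw x s' * ov s s' := by
  simp_rw [← mg_sq_sum, mul_sum]
  rw [sum_comm]
  refine scg fun i _ => ?_
  rw [show mg x i * mg x i = (∑ s, gw x s * sp (s i)) * mg x i from rfl, sum_mul]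
  exact scg fun s _ => by ring

lemma var_le (hN : 0 < N) (q : ℝ) (x : Cfg N → ℝ) (u : Fin N → ℝ) (hu : ∑ i, u i ^ 2 = 1) :
    ∑ s, gw x s * yy u s ^ 2 - Yv x u ^ 2 ≤ 4 * √(Q2 q x) := by
  have hNr : (0:ℝ) < N := by exact_mod_cast hN
  have hs : √(N:ℝ) ^ 2 = N := sq_sqrt hNr.le
  obtain ⟨z, hz⟩ : ∃ z : Cfg N → Fin N → ℝ, ∀ s i, z s i = sp (s i) - mg x i := ⟨_, fun _ _ => rfl⟩
  obtain ⟨C, hC⟩ : ∃ C : Fin N → Fin N → ℝ, ∀ i j, C i j = ∑ s, gw x s * (z s i * z s j) := ⟨_, fun _ _ => rfl⟩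
  have e1 : ∑ s, gw x s * yy u s ^ 2 - Yv x u ^ 2 = (∑ s, gw x s * (∑ i, u i * z s i) ^ 2) / N := by
    have a1 : ∀ s, (∑ i, u i * z s i) = √N * (yy u s - Yv x u) := by
      intro s
      simp_rw [hz, mul_sub]
      rw [sum_sub_distrib]
      unfold yy Yv
      have : √(N:ℝ) ≠ 0 := (sqrt_pos.2 hNr).ne'
      field_simp
    have a2 : ∀ s, gw x s * (∑ i, u i * z s i) ^ 2 = N * (gw x s * yy u s ^ 2 - 2 * Yv x u * (gw x s * yy u s) + Yv x u ^ 2 * gw x s) := by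
      intro s; rw [a1, mul_pow, hs]; ring
    rw [scg fun s _ => a2 s, ← mul_sum, sum_add_distrib, sum_sub_distrib, ← mul_sum, ← mul_sum,
      gw_sum, ← Yv_eq]
    field_simp; ring
  have e2 : ∑ s, gw x s * (∑ i, u i * z s i) ^ 2 = ∑ w : Fin N × Fin N, (u w.1 * u w.2) * C w.1 w.2 := by
    rw [sum_prod_type]
    simp_rw [hC, sq, sum_mul_sum, mul_sum]
    rw [sum_comm]
    refine scg fun i _ => ?_
    rw [sum_comm]
    exact scg fun j _ => scg fun s _ => by ring
  have e3 : ∑ w : Fin N × Fin N, C w.1 w.2 ^ 2 = ∑ s, ∑ s', gw x s * gw x s' * (∑ i, z s i * z s' i) ^ 2 := by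
    rw [sum_prod_type]
    simp_rw [hC, sq, sum_mul_sum, mul_sum]
    calc _ = ∑ i, ∑ s, ∑ j, ∑ s', gw x s * (z s i * z s j) * (gw x s' * (z s' i * z s' j)) := by
          refine scg fun i _ => ?_
          rw [sum_comm]
      _ = ∑ s, ∑ i, ∑ j, ∑ s', gw x s * (z s i * z s j) * (gw x s' * (z s' i * z s' j)) := by rw [sum_comm]
      _ = ∑ s, ∑ i, ∑ s', ∑ j, gw x s * (z s i * z s j) * (gw x s' * (z s' i * z s' j)) := by
          refine scg fun s _ => scg fun i _ => ?_
          rw [sum_comm]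
      _ = ∑ s, ∑ s', ∑ i, ∑ j, gw x s * (z s i * z s j) * (gw x s' * (z s' i * z s' j)) := by
          refine scg fun s _ => ?_
          rw [sum_comm]
      _ = _ := by
          refine scg fun s _ => scg fun s' _ => scg fun i _ => scg fun j _ => ?_
          ring
  have e4 : ∀ s s', ∑ i, z s i * z s' i = N * ((ov s s' / N - q) - ∑ c, gw x c * (ov s c / N - q) - ∑ c, gw x c * (ov s' c / N - q)
      + ∑ d, gw x d * ∑ c, gw x c * (ov d c / N - q)) := by
    intro s s'
    have b1 : ∀ s, ∑ c, gw x c * (ov s c / N - q) = (∑ i, sp (s i) * mg x i) / N - q := by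
      intro s
      rw [mg_sq_sum, sum_div]
      simp_rw [mul_sub]
      rw [sum_sub_distrib, ← sum_mul, gw_sum, one_mul]
      simp_rw [mul_div_assoc]
    have b2 : ∑ d, gw x d * ∑ c, gw x c * (ov d c / N - q) = (∑ i, mg x i * mg x i) / N - q := by
      simp_rw [b1, mul_sub]
      rw [sum_sub_distrib, ← sum_mul, gw_sum, one_mul, mg_mg]
      simp_rw [mul_div_assoc', mg_sq_sum]
      rw [sum_div]
    rw [b1, b1, b2]
    have b3 : ∑ i, z s i * z s' i = ov s s' - ∑ i, sp (s i) * mg x i - ∑ i, sp (s' i) * mg x i + ∑ i, mg x i * mg x i := by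
      simp_rw [hz]
      unfold ov
      rw [← sum_sub_distrib, ← sum_sub_distrib, ← sum_add_distrib]
      exact scg fun i _ => by ring
    rw [b3]; field_simp; ring
  have e5 : ∑ w : Fin N × Fin N, C w.1 w.2 ^ 2 ≤ N ^ 2 * (16 * Q2 q x) := by
    rw [e3]
    simp_rw [e4, mul_pow]
    have := dcenter (fun a => (gw_pos x a).le) (gw_sum x) (fun a b : Cfg N => ov a b / N - q) (fun a b => by rw [ov_comm])
    refine le_trans (le_of_eq ?_) (mul_le_l this (by positivity : (0:ℝ) ≤ N ^ 2))
    simp_rw [mul_sum]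
    refine scg fun s _ => scg fun s' _ => ?_
    ring
  have e6 := Finset.sum_mul_sq_le_sq_mul_sq (Finset.univ : Finset (Fin N × Fin N)) (fun w => u w.1 * u w.2) (fun w => C w.1 w.2)
  have e7 : ∑ w : Fin N × Fin N, (u w.1 * u w.2) ^ 2 = 1 := by
    rw [sum_prod_type]
    simp_rw [mul_pow]
    rw [← sum_mul_sum, hu, one_mul]
  rw [e7, one_mul, ← e2] at e6
  rw [e1, div_le_iff₀ hNr]
  refine abs_le_of_sq_le_sq' ?_ (by positivity) |>.2
  have : (4 * √(Q2 q x) * N) ^ 2 = N ^ 2 * (16 * Q2 q x) := by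
    rw [mul_pow, mul_pow, sq_sqrt (Q2_nonneg _ _)]; ring
  rw [this]; exact e6.trans e5
end

section
variable {N n : ℕ}

/-- regularized inverse variance -/
def phi (η y : ℝ) : ℝ := (1 + η - y ^ 2)⁻¹
/-- replica average of a spin -/
def sbar (s : Fin n → Cfg N) (i : Fin N) : ℝ := (∑ l, sp (s l i)) / n

lemma sbar_abs (s : Fin n → Cfg N) (i : Fin N) : sbar s i ^ 2 ≤ 1 := by
  unfold sbar
  rw [sq_le_one_iff_abs_le_one, abs_div, Nat.abs_cast]
  refine div_le_one_of_le₀ ?_ (Nat.cast_nonneg _)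
  refine (abs_sum_le_sum_abs _ _).trans ?_
  simp [sp_abs]

lemma phi_lip {η : ℝ} (hη : 0 < η) {x y : ℝ} (hx : x ^ 2 ≤ 1) (hy : y ^ 2 ≤ 1) (κ : ℝ) (hκ : 0 < κ) :
    phi η x ≤ phi η y + (1 / η ^ 2) * (κ + (x - y) ^ 2 / κ) := by
  unfold phi
  obtain ⟨A, hA⟩ : ∃ A, A = 1 + η - x ^ 2 := ⟨_, rfl⟩
  obtain ⟨B, hB⟩ : ∃ B, B = 1 + η - y ^ 2 := ⟨_, rfl⟩
  rw [← hA, ← hB]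
  have hA0 : η ≤ A := by linarith
  have hB0 : η ≤ B := by linarith
  have hAp : 0 < A := by linarith
  have hBp : 0 < B := by linarith
  have h1 : A⁻¹ - B⁻¹ = (B - A) / (A * B) := by field_simp
  have h2 : B - A ≤ κ + (x - y) ^ 2 / κ := by
    have e : B - A = (x - y) * (x + y) := by rw [hA, hB]; ring
    have h3 : (x + y) ^ 2 ≤ 4 := by nlinarith [sq_nonneg (x - y)]
    rw [e]
    have : κ + (x - y) ^ 2 / κ = (κ ^ 2 + (x - y) ^ 2) / κ := by field_simp
    rw [this, le_div_iff₀ hκ]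
    nlinarith [sq_nonneg (2 * (x - y) - κ * (x + y)), sq_nonneg κ]
  have h3 : (0:ℝ) ≤ κ + (x - y) ^ 2 / κ := by positivity
  have h4 : (B - A) / (A * B) ≤ (κ + (x - y) ^ 2 / κ) / (η ^ 2) := by
    refine (div_le_div_of_nonneg_right h2 (by positivity)).trans ?_
    refine div_le_div_of_nonneg_left h3 (by positivity) ?_
    nlinarith
  have : (κ + (x - y) ^ 2 / κ) / (η ^ 2) = (1 / η ^ 2) * (κ + (x - y) ^ 2 / κ) := by ring
  linarith

lemma mg_sq (x : Cfg N → ℝ) (i : Fin N) : mg x i ^ 2 ≤ 1 := by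
  have := wjensen (fun a => (gw_pos x a).le) (gw_sum x) (fun s => sp (s i))
  simp_rw [sp_sq, mul_one, gw_sum] at this
  exact this

lemma phi_pav (hn : 0 < n) {η : ℝ} (hη : 0 < η) (x : Cfg N → ℝ) (i : Fin N) :
    pav (gw x) (fun s : Fin n → Cfg N => phi η (sbar s i)) ≤ phi η (mg x i) + 2 / (η ^ 2 * √n) := by
  have hnr : (0:ℝ) < n := by exact_mod_cast hn
  have hs : 0 < √(n:ℝ) := sqrt_pos.2 hnr
  have hs2 : √(n:ℝ) ^ 2 = n := sq_sqrt hnr.le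
  have h0 := pav_mono (n := n) (fun a => (gw_pos x a).le) (F := fun s => phi η (sbar s i))
    (fun s => phi_lip hη (sbar_abs s i) (mg_sq x i) (1 / √n) (by positivity))
  refine h0.trans ?_
  rw [pav_add, pav_const (gw_sum x), pav_smul, pav_add, pav_const (gw_sum x)]
  have h1 := pav_var hn (fun a => (gw_pos x a).le) (gw_sum x) (fun s => sp (s i)) (fun s => (sp_sq _).le)
  have h2 : pav (gw x) (fun s : Fin n → Cfg N => (sbar s i - mg x i) ^ 2 / (1 / √n)) = √n * pav (gw x) (fun s : Fin n → Cfg N => (sbar s i - mg x i) ^ 2) := by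
    rw [← pav_smul]; congr 1; ext s; field_simp
  rw [h2]
  have h3 : √n * pav (gw x) (fun s : Fin n → Cfg N => (sbar s i - mg x i) ^ 2) ≤ √n * (1 / n) := mul_le_l h1 hs.le
  have h4 : √(n:ℝ) * (1 / n) = 1 / √n := by
    have : (1 / n : ℝ) = 1 / √n ^ 2 := by rw [hs2]
    rw [this]; field_simp
  have h5 : 2 / (η ^ 2 * √(n:ℝ)) = (1 / η ^ 2) * (1 / √n + 1 / √n) := by field_simp; ring
  rw [h5]
  have := mul_le_l (add_le_add_right (h3.trans h4.le) (1 / √(n:ℝ))) (by positivity : 0 ≤ 1 / η ^ 2)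
  linarith

/-- direction-dependent deterministic potential -/
def wu (η β r : ℝ) (u : Fin N → ℝ) (s : Fin n → Cfg N) : ℝ :=
  - ∑ i, phi η (sbar s i) * u i ^ 2 + 2 * β ^ 2 * r ^ 2 + 4 * β ^ 2 * r * ((∑ i, u i * sbar s i) / √N - r)

/-- lower bound for the averaged functional -/
def BB (η β r L q : ℝ) (n : ℕ) (x : Cfg N → ℝ) (u : Fin N → ℝ) : ℝ :=
  - ∑ i, phi η (mg x i) * u i ^ 2 + 2 * β ^ 2 * Yv x u ^ 2 - (2 + n) * β ^ 2 * (Yv x u - r) ^ 2 - L - 4 * n * β ^ 2 * √(Q2 q x)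

lemma wu_pav (hN : 0 < N) (hn : 0 < n) {η : ℝ} (hη : 0 < η) (β r q : ℝ) (x : Cfg N → ℝ) (u : Fin N → ℝ) (hu : ∑ i, u i ^ 2 = 1) :
    BB η β r (2 / (η ^ 2 * √n)) q n x u ≤ pav (gw x) (fun s : Fin n → Cfg N => wu η β r u s - β ^ 2 * (YY r u s + n * (r ^ 2 * ∑ i, u i ^ 2))) := by
  have hnr : (0:ℝ) < n := by exact_mod_cast hn
  have hg := gw_sum x
  have a1 : pav (gw x) (fun s : Fin n → Cfg N => ∑ i, phi η (sbar s i) * u i ^ 2) ≤ ∑ i, phi η (mg x i) * u i ^ 2 + 2 / (η ^ 2 * √n) := by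
    rw [pav_sum]
    calc _ = ∑ i, u i ^ 2 * pav (gw x) (fun s : Fin n → Cfg N => phi η (sbar s i)) := by
          refine scg fun i _ => ?_
          rw [← pav_smul]; congr 1; ext s; ring
      _ ≤ ∑ i, u i ^ 2 * (phi η (mg x i) + 2 / (η ^ 2 * √n)) := sum_le_sum fun i _ => mul_le_l (phi_pav hn hη x i) (sq_nonneg _)
      _ = _ := by
          simp_rw [mul_add]; rw [sum_add_distrib, ← sum_mul, hu, one_mul]
          congr 1; exact scg fun i _ => by ring
  have a2 : pav (gw x) (fun s : Fin n → Cfg N => (∑ i, u i * sbar s i) / √N) = Yv x u := by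
    have e : ∀ s : Fin n → Cfg N, (∑ i, u i * sbar s i) / √N = ∑ l, (1 / n) * yy u (s l) := by
      intro s
      unfold sbar yy
      simp_rw [← mul_sum, ← sum_div, mul_div_assoc', ← sum_div]
      simp_rw [mul_sum]
      rw [sum_comm]
      simp only [sum_div, mul_sum]
      exact scg fun l _ => scg fun i _ => by ring
    simp_rw [e]
    rw [pav_sum]
    simp_rw [pav_smul]
    have : ∀ l : Fin n, pav (gw x) (fun s : Fin n → Cfg N => yy u (s l)) = Yv x u := fun l => by
      rw [pav_one hg l (fun a => yy u a), Yv_eq]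
    simp_rw [this]
    simp; field_simp
  have a3 : pav (gw x) (fun s : Fin n → Cfg N => YY r u s) = n * (∑ s, gw x s * yy u s ^ 2 - 2 * r * Yv x u) := by
    unfold YY
    rw [pav_sum]
    have : ∀ l : Fin n, pav (gw x) (fun s : Fin n → Cfg N => yy u (s l) ^ 2 - 2 * r * yy u (s l)) = ∑ s, gw x s * yy u s ^ 2 - 2 * r * Yv x u := fun l => by
      rw [pav_one hg l (fun a => yy u a ^ 2 - 2 * r * yy u a), Yv_eq]
      simp_rw [mul_sub]
      rw [sum_sub_distrib, mul_sum]
      congr 1; exact scg fun i _ => by ring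
    simp_rw [this]; simp; ring
  have a4 := var_le hN q x u hu
  have e : ∀ s : Fin n → Cfg N, wu η β r u s - β ^ 2 * (YY r u s + n * (r ^ 2 * ∑ i, u i ^ 2))
      = (2 * β ^ 2 * r ^ 2 - 4 * β ^ 2 * r ^ 2 - β ^ 2 * n * r ^ 2) + (4 * β ^ 2 * r * ((∑ i, u i * sbar s i) / √N) - (β ^ 2 * YY r u s + ∑ i, phi η (sbar s i) * u i ^ 2)) := by
    intro s; unfold wu; rw [hu]; ring
  simp_rw [e]
  rw [pav_add, pav_const hg, pav_sub, pav_smul, a2, pav_add, pav_smul, a3]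
  unfold BB
  have := mul_le_l a4 (by positivity : 0 ≤ n * β ^ 2)
  nlinarith [a1, this]

lemma PP_pav (hN : 0 < N) (q : ℝ) (x : Cfg N → ℝ) : pav (gw x) (fun s : Fin n → Cfg N => PP q s s) ≤ n * (1 - q) ^ 2 + n ^ 2 * Q2 q x := by
  have hNr : (0:ℝ) < N := by exact_mod_cast hN
  unfold PP
  rw [pav_sum]
  have : ∀ l : Fin n, pav (gw x) (fun s : Fin n → Cfg N => ∑ l', (ov (s l) (s l') / N - q) ^ 2) ≤ (1 - q) ^ 2 + n * Q2 q x := by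
    intro l
    rw [pav_sum]
    calc _ ≤ ∑ l' : Fin n, ((if l' = l then (1 - q) ^ 2 else 0) + Q2 q x) := by
          refine sum_le_sum fun l' _ => ?_
          by_cases h : l' = l
          · rw [if_pos h, h]
            simp_rw [ov_self, div_self hNr.ne']
            rw [pav_const (gw_sum x)]; linarith [Q2_nonneg q x]
          · rw [if_neg h, zero_add, pav_two' (gw_sum x) (Ne.symm h) (fun a b => (ov a b / N - q) ^ 2)]
            exact le_rfl
      _ = _ := by rw [sum_add_distrib]; simp
  calc _ ≤ ∑ l : Fin n, ((1 - q) ^ 2 + n * Q2 q x) := sum_le_sum fun l _ => this l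
    _ = _ := by simp; ring

section
variable {V : Type*} [Fintype V]
/-- directions, including the zero direction -/
def UU (u : V → Fin N → ℝ) : Option V → Fin N → ℝ := fun j => j.elim 0 u
/-- deterministic part -/
def c2 (N n : ℕ) (β h η r a m θ : ℝ) (u : V → Fin N → ℝ) (s : (Fin n → Cfg N) × Option V) : ℝ :=
  (1 / m) * ∑ l, h * ∑ i, sp (s.1 l i) + θ * N * (s.2.elim a (fun v => wu η β r (u v) s.1))
/-- deterministic correction -/
def d2 (N n : ℕ) (β q r m θ : ℝ) (U : Option V → Fin N → ℝ) (s : (Fin n → Cfg N) × Option V) : ℝ :=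
  - (1 / m) * (N * (β ^ 2 / 4)) * PP q s.1 s.1 - θ * N * β ^ 2 * (YY r (U s.2) s.1 + n * (r ^ 2 * ∑ i, U s.2 i ^ 2))

lemma GA_lf (β h q m θ : ℝ) (U : Option V → Fin N → ℝ) (g : Edg N ⊕ Fin N → ℝ) (s : (Fin n → Cfg N) × Option V) :
    lf (GA N n β q m θ U) g s + (1 / m) * ∑ l, h * ∑ i, sp (s.1 l i) = (1 / m) * ∑ l, XH N β h q 1 g (s.1 l) + θ * N * ∑ k, AU N β (U s.2) k * g k := by
  unfold lf GA XH lf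
  simp_rw [add_mul]
  rw [sum_add_distrib, sum_add_distrib, mul_add]
  have : ∑ k, (1 / m) * (∑ l, HA N β q 1 (s.1 l) k) * g k = (1 / m) * ∑ l, ∑ k, HA N β q 1 (s.1 l) k * g k := by
    rw [sum_comm]
    simp_rw [mul_sum, sum_mul, mul_assoc]
  rw [this, mul_sum (s := Finset.univ) (a := θ * N)]
  simp_rw [mul_assoc]
  ring

lemma t1_low (hN : 0 < N) (hn : 0 < n) {β h q r a m θ η : ℝ} (hm : 0 < m) (hθ : 0 ≤ θ) (hη : 0 < η) (u : V → Fin N → ℝ) (hu : ∀ v, ∑ i, u v i ^ 2 = 1)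
    (g : Edg N ⊕ Fin N → ℝ) {δ : ℝ} (hδ : δ = 0 ∨ ∃ v, a + δ ≤ ∑ k, AU N β (u v) k * g k + BB η β r (2 / (η ^ 2 * √n)) q n (XH N β h q 1 g) (u v)) :
    n * lse (XH N β h q 1 g) - N * (β ^ 2 / 4) * (n * (1 - q) ^ 2 + n ^ 2 * Q2 q (XH N β h q 1 g)) + m * θ * N * (a + δ)
      ≤ m * Fm m (fun s => lf (GA N n β q m θ (UU u)) g s + c2 N n β h η r a m θ u s + d2 N n β q r m θ (UU u) s) := by
  have hNr : (0:ℝ) < N := by exact_mod_cast hN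
  obtain ⟨x, hx⟩ : ∃ x, x = XH N β h q 1 g := ⟨_, rfl⟩
  have hP := mul_le_l (PP_pav (n := n) hN q x) (by positivity : 0 ≤ N * (β ^ 2 / 4))
  rcases hδ with h0 | ⟨v, hv⟩
  · have key := Fm_lower (n := n) hm x (fun s => lf (GA N n β q m θ (UU u)) g s + c2 N n β h η r a m θ u s + d2 N n β q r m θ (UU u) s) none
      (fun s => m * θ * N * a - N * (β ^ 2 / 4) * PP q s s) (by
        intro s
        refine le_of_eq ?_
        have := GA_lf β h q m θ (UU u) g (s, none)
        unfold c2 d2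
        rw [← add_assoc, this, hx]
        simp only [UU, Option.elim_none, AU, YY, yy, Pi.zero_apply, zero_mul, sum_const_zero, zero_div]
        have e : ∀ k : Edg N ⊕ Fin N, (Sum.elim (fun p : Edg N => 2 * β / √(N:ℝ) * 0) (0 : Fin N → ℝ) k) = 0 := by intro k; cases k <;> simp
        simp only [mul_zero] at e
        simp [e]
        field_simp
        ring)
    rw [pav_sub, pav_const (gw_sum x), pav_smul] at key
    rw [h0, ← hx]
    refine le_trans ?_ key
    linarith
  · have key := Fm_lower (n := n) hm x (fun s => lf (GA N n β q m θ (UU u)) g s + c2 N n β h η r a m θ u s + d2 N n β q r m θ (UU u) s) (some v)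
      (fun s => m * θ * N * ((∑ k, AU N β (u v) k * g k) + (wu η β r (u v) s - β ^ 2 * (YY r (u v) s + n * (r ^ 2 * ∑ i, u v i ^ 2)))) - N * (β ^ 2 / 4) * PP q s s) (by
        intro s
        refine le_of_eq ?_
        have := GA_lf β h q m θ (UU u) g (s, some v)
        unfold c2 d2
        rw [← add_assoc, this, hx]
        simp only [UU, Option.elim_some]
        field_simp
        ring)
    rw [pav_sub, pav_smul, pav_smul, pav_add, pav_const (gw_sum x)] at key
    have hw := wu_pav hN hn hη β r q x (u v) (hu v)
    rw [← hx] at hv ⊢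
    refine le_trans ?_ key
    have := mul_le_l (hv.trans (add_le_add_right hw _)) (by positivity : 0 ≤ m * θ * N)
    linarith
end
end

section
variable {N n : ℕ}

/-- resolvent bound -/
def Kf (η y s : ℝ) : ℝ := (1 + η - s ^ 2) + y * (1 + η - s ^ 2) ^ 2 + 16 * y ^ 2
/-- site functional -/
def psi (η y β μ ξ s : ℝ) : ℝ := (β * ξ + μ * s) ^ 2 * Kf η y s
/-- replica average at one site -/
def tbar (τ : Fin n → Bool) : ℝ := (∑ l, sp (τ l)) / n
/-- one spin field -/
def xb (y : ℝ) (b : Bool) : ℝ := sp b * y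

lemma quad_bound {S y : ℝ} (hS0 : 0 < S) (hS : S ≤ 2) (hy0 : 0 ≤ y) (hy : y ≤ 1 / 4) (v b : ℝ) :
    2 * (v * b) - (S⁻¹ - y) * v ^ 2 ≤ b ^ 2 * (S + y * S ^ 2 + 16 * y ^ 2) := by
  have h1 : y * S ≤ 1 / 2 := by nlinarith
  have h1' : 0 ≤ y * S := by positivity
  have h2 : 0 < 1 - y * S := by linarith
  obtain ⟨k, hk⟩ : ∃ k, k = S / (1 - y * S) := ⟨_, rfl⟩
  have hk0 : 0 < k := by rw [hk]; positivity
  have h3 : S⁻¹ - y = k⁻¹ := by rw [hk]; field_simp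
  have h4 : k ≤ S + y * S ^ 2 + 16 * y ^ 2 := by
    rw [hk, div_le_iff₀ h2]
    have : S ≤ (S + y * S ^ 2 + 2 * y ^ 2 * S ^ 3) * (1 - y * S) := by
      have : (S + y * S ^ 2 + 2 * y ^ 2 * S ^ 3) * (1 - y * S) = S + (y * S) ^ 2 * S * (1 - 2 * (y * S)) := by ring
      rw [this]
      have : 0 ≤ (y * S) ^ 2 * S * (1 - 2 * (y * S)) := mul_nonneg (by positivity) (by linarith)
      linarith
    refine this.trans (mul_le_r ?_ h2.le)
    have : S ^ 3 ≤ 8 := by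
      calc S ^ 3 ≤ 2 ^ 3 := pow_le_pow_left₀ hS0.le hS 3
        _ = 8 := by norm_num
    nlinarith [sq_nonneg y]
  rw [h3]
  have h5 : 2 * (v * b) - k⁻¹ * v ^ 2 ≤ b ^ 2 * k := by
    have : b ^ 2 * k - (2 * (v * b) - k⁻¹ * v ^ 2) = (v - k * b) ^ 2 * k⁻¹ := by field_simp; ring
    have h6 : 0 ≤ (v - k * b) ^ 2 * k⁻¹ := by positivity
    linarith
  exact h5.trans (mul_le_l h4 (sq_nonneg b))

lemma W0_le (hN : 0 < N) {η y β r ρ : ℝ} (hη : 0 < η) (hη1 : η ≤ 1) (hy0 : 0 ≤ y) (hy : y ≤ 1 / 4) (u : Fin N → ℝ) (hu : ∑ i, u i ^ 2 = 1)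
    (g : Fin N ⊕ Fin N → ℝ) (s : Fin n → Cfg N) :
    ∑ k, BU N β ρ u k * g k + wu η β r u s ≤
      (∑ i, (- y - 2 * β ^ 2 * r ^ 2 + psi η y β (2 * β ^ 2 * r) (ρ * g (Sum.inl i) + √(1 - ρ ^ 2) * g (Sum.inr i)) (sbar s i))) / N := by
  have hNr : (0:ℝ) < N := by exact_mod_cast hN
  have hs : √(N:ℝ) ^ 2 = N := sq_sqrt hNr.le
  have hs0 : 0 < √(N:ℝ) := sqrt_pos.2 hNr
  have h1 : ∑ k, BU N β ρ u k * g k = ∑ i, 2 * (u i * (β * (ρ * g (Sum.inl i) + √(1 - ρ ^ 2) * g (Sum.inr i)) / √N)) := by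
    simp only [BU, sum_sum_type, Sum.elim_inl, Sum.elim_inr]
    rw [← sum_add_distrib]
    exact scg fun i _ => by ring
  have h2 : ∀ i, 2 * (u i * (β * (ρ * g (Sum.inl i) + √(1 - ρ ^ 2) * g (Sum.inr i)) / √N)) + 2 * (u i * (2 * β ^ 2 * r * sbar s i / √N)) - (phi η (sbar s i) - y) * u i ^ 2
      ≤ psi η y β (2 * β ^ 2 * r) (ρ * g (Sum.inl i) + √(1 - ρ ^ 2) * g (Sum.inr i)) (sbar s i) / N := by
    intro i
    have hb := sbar_abs s i
    have := quad_bound (S := 1 + η - sbar s i ^ 2) (by linarith) (by linarith [sq_nonneg (sbar s i)]) hy0 hy (u i)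
      ((β * (ρ * g (Sum.inl i) + √(1 - ρ ^ 2) * g (Sum.inr i)) + 2 * β ^ 2 * r * sbar s i) / √N)
    rw [div_pow, hs] at this
    unfold phi psi Kf
    calc _ = _ := by ring
      _ ≤ _ := this
      _ = _ := by ring
  have h3 := sum_le_sum fun i (_ : i ∈ Finset.univ) => h2 i
  rw [sum_sub_distrib, sum_add_distrib, ← h1, ← sum_div] at h3
  have h4 : ∑ i, 2 * (u i * (2 * β ^ 2 * r * sbar s i / √N)) = 4 * β ^ 2 * r * ((∑ i, u i * sbar s i) / √N) := by
    rw [sum_div, mul_sum]; exact scg fun i _ => by ring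
  have h5 : ∑ i, (phi η (sbar s i) - y) * u i ^ 2 = ∑ i, phi η (sbar s i) * u i ^ 2 - y := by
    simp_rw [sub_mul]; rw [sum_sub_distrib, ← mul_sum, hu, mul_one]
  rw [h4, h5] at h3
  rw [sum_add_distrib, add_div]
  have h6 : (∑ i : Fin N, (- y - 2 * β ^ 2 * r ^ 2)) / (N:ℝ) = - y - 2 * β ^ 2 * r ^ 2 := by simp; field_simp
  rw [h6]; unfold wu; linarith

lemma site_sum (y : Fin N → ℝ) (F : Fin N → (Fin n → Bool) → ℝ) :
    ∑ s : Fin n → Cfg N, exp (∑ l, ∑ i, sp (s l i) * y i) * ∏ i, F i (fun l => s l i)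
      = exp (n * ∑ i, lse (xb (y i))) * ∏ i, pav (gw (xb (y i))) (F i) := by
  classical
  have h1 : ∑ s : Fin n → Cfg N, exp (∑ l, ∑ i, sp (s l i) * y i) * ∏ i, F i (fun l => s l i)
      = ∑ t : Fin N → Fin n → Bool, ∏ i, (exp (∑ l, sp (t i l) * y i) * F i (t i)) := by
    rw [← (Equiv.piComm (fun (_ : Fin n) (_ : Fin N) => Bool)).sum_comp]
    refine scg fun s _ => ?_
    rw [Finset.prod_mul_distrib, ← exp_sum, sum_comm]
    rfl
  rw [h1]
  have h2 := Finset.prod_univ_sum (fun _ : Fin N => (Finset.univ : Finset (Fin n → Bool))) (fun i t => exp (∑ l, sp (t l) * y i) * F i t)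
  rw [Fintype.piFinset_univ] at h2
  rw [← h2, mul_sum, exp_sum, ← Finset.prod_mul_distrib]
  refine Finset.prod_congr rfl fun i _ => ?_
  have h3 : exp (n * lse (xb (y i))) = ∑ t : Fin n → Bool, exp (∑ l, xb (y i) (t l)) := by
    rw [← lse_prod, lse, exp_log (lse_sum_pos _)]
  unfold pav
  rw [mul_sum]
  refine scg fun t _ => ?_
  rw [← gw_prod, h3]
  unfold gw
  have := (lse_sum_pos (fun t : Fin n → Bool => ∑ l, xb (y i) (t l))).ne'
  rw [← mul_assoc, mul_div_cancel₀ _ this]; rfl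

lemma lse_xb (y : ℝ) : lse (xb y) = log 2 + log (cosh y) := by
  unfold lse xb
  rw [← log_mul two_ne_zero (cosh_pos _).ne', cosh_eq]
  congr 1; simp [sp]; ring

lemma gw_xb_mean (y : ℝ) : ∑ b, gw (xb y) b * sp b = tanh y := by
  unfold gw xb
  rw [tanh_eq_sinh_div_cosh, sinh_eq, cosh_eq]
  simp [sp]
  have h1 := exp_pos y
  have h2 := exp_pos (-y)
  field_simp
  ring

/-- site partition function -/
def TTs (n : ℕ) (β h q η y r ρ ε : ℝ) (w : ℝ × ℝ) : ℝ :=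
  pav (gw (xb (fd β h q w.1))) (fun τ : Fin n → Bool => exp (ε * (- y - 2 * β ^ 2 * r ^ 2 + psi η y β (2 * β ^ 2 * r) (ρ * w.1 + √(1 - ρ ^ 2) * w.2) (tbar τ))))

lemma GB_lf {V : Type*} [Fintype V] (β q ρ m θ : ℝ) (U : Option V → Fin N → ℝ) (g : Fin N ⊕ Fin N → ℝ) (s : (Fin n → Cfg N) × Option V) :
    lf (GB N n β q ρ m θ U) g s = (1 / m) * ∑ l, ∑ i, sp (s.1 l i) * (β * √q * g (Sum.inl i)) + θ * N * ∑ k, BU N β ρ (U s.2) k * g k := by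
  unfold lf GB
  simp_rw [add_mul]
  rw [sum_add_distrib]
  have h1 : ∑ k, (1 / m) * (∑ l, HB N β q (s.1 l) k) * g k = (1 / m) * ∑ l, ∑ i, sp (s.1 l i) * (β * √q * g (Sum.inl i)) := by
    have : ∀ l, ∑ i, sp (s.1 l i) * (β * √q * g (Sum.inl i)) = ∑ k, HB N β q (s.1 l) k * g k := by
      intro l
      simp only [HB, sum_sum_type, Sum.elim_inl, Sum.elim_inr, Pi.zero_apply, zero_mul, sum_const_zero, add_zero]
      exact scg fun i _ => by ring
    simp_rw [this]
    rw [sum_comm]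
    simp_rw [mul_sum, sum_mul, mul_assoc]
  rw [h1, mul_sum (s := Finset.univ) (a := θ * N)]
  simp_rw [mul_assoc]

lemma t0_pt (hN : 0 < N) {V : Type*} [Fintype V] {β h q r ρ a m θ η y : ℝ} (hm : 0 < m) (hθ : 0 ≤ θ) (hη : 0 < η) (hη1 : η ≤ 1) (hy0 : 0 ≤ y) (hy : y ≤ 1 / 4)
    (u : V → Fin N → ℝ) (hu : ∀ v, ∑ i, u v i ^ 2 = 1) (g : Fin N ⊕ Fin N → ℝ) :
    m * Fm m (fun s => lf (GB N n β q ρ m θ (UU u)) g s + c2 N n β h η r a m θ u s)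
      ≤ m * log (Fintype.card V + 1) + n * ∑ i, (log 2 + log (cosh (fd β h q (g (Sum.inl i)))))
        + log (exp (m * θ * N * a) + ∏ i, TTs n β h q η y r ρ (m * θ) (g (Sum.inl i), g (Sum.inr i))) := by
  have hNr : (0:ℝ) < N := by exact_mod_cast hN
  obtain ⟨A, hA⟩ : ∃ A : (Fin n → Cfg N) → ℝ, ∀ s, A s = ∑ l, ∑ i, sp (s l i) * fd β h q (g (Sum.inl i)) := ⟨_, fun _ => rfl⟩
  obtain ⟨f, hf⟩ : ∃ f : Fin N → (Fin n → Bool) → ℝ, ∀ i τ, f i τ = - y - 2 * β ^ 2 * r ^ 2 + psi η y β (2 * β ^ 2 * r) (ρ * g (Sum.inl i) + √(1 - ρ ^ 2) * g (Sum.inr i)) (tbar τ) := ⟨_, fun _ _ => rfl⟩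
  have hcard : (0:ℝ) < Fintype.card V + 1 := by positivity
  have hx : ∀ s j, lf (GB N n β q ρ m θ (UU u)) g (s, j) + c2 N n β h η r a m θ u (s, j) ≤ (1 / m) * (A s + max (m * θ * N * a) (∑ i, m * θ * f i (fun l => s l i))) := by
    intro s j
    rw [GB_lf, c2]
    have e : (1 / m) * ∑ l, ∑ i, sp (s l i) * (β * √q * g (Sum.inl i)) + (1 / m) * ∑ l, h * ∑ i, sp (s l i) = (1 / m) * A s := by
      rw [hA, ← mul_add, ← sum_add_distrib]
      congr 1
      refine scg fun l _ => ?_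
      rw [mul_sum, ← sum_add_distrib]
      exact scg fun i _ => by unfold fd; ring
    have key : θ * N * (∑ k, BU N β ρ (UU u j) k * g k + j.elim a (fun v => wu η β r (u v) s)) ≤ (1 / m) * max (m * θ * N * a) (∑ i, m * θ * f i (fun l => s l i)) := by
      rw [one_div, inv_mul_eq_div, le_div_iff₀ hm]
      cases j with
      | none =>
        refine le_trans (le_of_eq ?_) (le_max_left _ _)
        have : ∀ k, BU N β ρ (UU u (none : Option V)) k = 0 := by intro k; cases k <;> simp [BU, UU]
        simp [this]; ring
      | some v =>
        refine le_trans ?_ (le_max_right _ _)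
        have h1 := W0_le (β := β) (r := r) (ρ := ρ) hN hη hη1 hy0 hy (u v) (hu v) g s
        have h2 := mul_le_l h1 (by positivity : 0 ≤ θ * N * m)
        rw [← mul_sum]
        simp_rw [hf]
        refine le_trans (le_of_eq ?_) (h2.trans (le_of_eq ?_))
        · simp only [UU, Option.elim_some]; ring
        · field_simp; rfl
    rw [mul_add (1 / m), ← e]
    simp only at key ⊢
    linarith
  have hZ : ∀ s, Zin (fun s => lf (GB N n β q ρ m θ (UU u)) g s + c2 N n β h η r a m θ u s) s ^ m
      ≤ ((Fintype.card V : ℝ) + 1) ^ m * (exp (A s) * (exp (m * θ * N * a) + ∏ i, exp (m * θ * f i (fun l => s l i)))) := by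
    intro s
    have h1 : Zin (fun s => lf (GB N n β q ρ m θ (UU u)) g s + c2 N n β h η r a m θ u s) s
        ≤ ((Fintype.card V : ℝ) + 1) * exp ((1 / m) * (A s + max (m * θ * N * a) (∑ i, m * θ * f i (fun l => s l i)))) := by
      unfold Zin
      refine (sum_le_sum fun j _ => exp_le_exp.2 (hx s j)).trans (le_of_eq ?_)
      simp
    refine (rpow_le_rpow (Zin_pos _ _).le h1 hm.le).trans ?_
    rw [mul_rpow hcard.le (exp_pos _).le]
    refine mul_le_l ?_ (rpow_nonneg hcard.le _)
    rw [← exp_mul, show (1 / m) * (A s + max (m * θ * N * a) (∑ i, m * θ * f i (fun l => s l i))) * m = A s + max (m * θ * N * a) (∑ i, m * θ * f i (fun l => s l i)) by field_simp, exp_add]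
    refine mul_le_l ?_ (exp_pos _).le
    rw [← exp_sum]
    rcases le_total (m * θ * N * a) (∑ i, m * θ * f i (fun l => s l i)) with h | h
    · rw [max_eq_right h]; linarith [exp_pos (m * θ * N * a)]
    · rw [max_eq_left h]; linarith [exp_pos (∑ i, m * θ * f i (fun l => s l i))]
  have hsum : ∑ s, (exp (A s) * (exp (m * θ * N * a) + ∏ i, exp (m * θ * f i (fun l => s l i))))
      = exp (n * ∑ i, lse (xb (fd β h q (g (Sum.inl i))))) * (exp (m * θ * N * a) + ∏ i, TTs n β h q η y r ρ (m * θ) (g (Sum.inl i), g (Sum.inr i))) := by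
    simp_rw [mul_add]
    rw [sum_add_distrib]
    congr 1
    · rw [← sum_mul]
      congr 1
      have := site_sum (n := n) (fun i => fd β h q (g (Sum.inl i))) (fun _ _ => 1)
      simp only [Finset.prod_const_one, mul_one, pav_const (gw_sum _)] at this
      simp_rw [hA]; exact this
    · have := site_sum (n := n) (fun i => fd β h q (g (Sum.inl i))) (fun i τ => exp (m * θ * f i τ))
      simp_rw [hA]; rw [this]
      unfold TTs
      simp_rw [hf]
  unfold Fm
  rw [← mul_assoc, mul_one_div_cancel hm.ne', one_mul]
  have hT : 0 ≤ ∏ i, TTs n β h q η y r ρ (m * θ) (g (Sum.inl i), g (Sum.inr i)) :=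
    Finset.prod_nonneg fun i _ => sum_nonneg fun s _ => mul_nonneg (Finset.prod_nonneg fun l _ => (gw_pos _ _).le) (exp_pos _).le
  have hp : 0 < exp (m * θ * N * a) + ∏ i, TTs n β h q η y r ρ (m * θ) (g (Sum.inl i), g (Sum.inr i)) := by linarith [exp_pos (m * θ * N * a)]
  refine (log_le_log (Zout_pos _ _) ((sum_le_sum fun s _ => hZ s).trans (le_of_eq (by rw [← mul_sum, hsum])))).trans (le_of_eq ?_)
  rw [log_mul (rpow_pos_of_pos hcard _).ne' (by positivity), log_mul (exp_pos _).ne' hp.ne', log_exp, log_rpow hcard]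
  simp_rw [lse_xb]
  ring
end

section
variable {N n : ℕ}

lemma TTs_nonneg (β h q η y r ρ ε : ℝ) (w : ℝ × ℝ) : 0 ≤ TTs n β h q η y r ρ ε w := by
  unfold TTs pav
  exact sum_nonneg fun s _ => mul_nonneg (Finset.prod_nonneg fun l _ => (gw_pos _ _).le) (exp_pos _).le

lemma pair_mp : MeasurePreserving (fun w : Fin N → ℝ × ℝ => (Sum.elim (fun i => (w i).1) (fun i => (w i).2) : Fin N ⊕ Fin N → ℝ))
    (Measure.pi fun _ => gs.prod gs) (gp (Fin N ⊕ Fin N)) :=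
  gp_sum_mp.comp (measurePreserving_arrowProdEquivProdArrow ℝ ℝ (Fin N) (fun _ => gs) (fun _ => gs))

lemma log_exp_add_le {A p : ℝ} (hp : 0 ≤ p) : log (exp A + p) ≤ A + log 2 + (p * exp (-A) - 1) / 2 := by
  have hA := exp_pos A
  have h1 : exp A + p = exp A * (2 * ((1 + p * exp (-A)) / 2)) := by
    rw [exp_neg]; field_simp
  have h2 : 0 < (1 + p * exp (-A)) / 2 := by positivity
  rw [h1, log_mul hA.ne' (by positivity), log_mul two_ne_zero h2.ne', log_exp]
  have := log_le_sub_one_of_pos h2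
  linarith

lemma t0_up (hN : 0 < N) {V : Type*} [Fintype V] {β h q r ρ a m θ η y : ℝ} (hm : 0 < m) (hθ : 0 ≤ θ) (hη : 0 < η) (hη1 : η ≤ 1) (hy0 : 0 ≤ y) (hy : y ≤ 1 / 4)
    (u : V → Fin N → ℝ) (hu : ∀ v, ∑ i, u v i ^ 2 = 1)
    (hT : Integrable (TTs n β h q η y r ρ (m * θ)) (gs.prod gs)) (hT2 : ∫ w, TTs n β h q η y r ρ (m * θ) w ∂(gs.prod gs) ≤ exp (m * θ * a)) :
    m * ∫ g, Fm m (fun s => lf (GB N n β q ρ m θ (UU u)) g s + c2 N n β h η r a m θ u s) ∂gp (Fin N ⊕ Fin N)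
      ≤ m * log (Fintype.card V + 1) + n * (N * RS β h q 0) + log 2 + m * θ * N * a := by
  obtain ⟨T, hTd⟩ : ∃ T, T = TTs n β h q η y r ρ (m * θ) := ⟨_, rfl⟩
  have hT0 : ∀ w, 0 ≤ T w := fun w => by rw [hTd]; exact TTs_nonneg ..
  have hpt := t0_pt (n := n) (β := β) (h := h) (q := q) (r := r) (ρ := ρ) (a := a) hN hm hθ hη hη1 hy0 hy u hu
  rw [← hTd] at hT hT2 hpt
  have hmp := pair_mp (N := N)
  obtain ⟨Q, hQ⟩ : ∃ Q : (Fin N ⊕ Fin N → ℝ) → ℝ, ∀ g, Q g = ∏ i, T (g (Sum.inl i), g (Sum.inr i)) := ⟨_, fun _ => rfl⟩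
  have hP0 : Integrable (fun w : Fin N → ℝ × ℝ => ∏ i, T (w i)) (Measure.pi fun _ => gs.prod gs) := Integrable.fintype_prod fun _ => hT
  let e : (Fin N → ℝ × ℝ) ≃ᵐ (Fin N ⊕ Fin N → ℝ) := (MeasurableEquiv.arrowProdEquivProdArrow ℝ ℝ (Fin N)).trans (MeasurableEquiv.sumPiEquivProdPi (fun _ : Fin N ⊕ Fin N => ℝ)).symm
  have hemp : MeasurePreserving e (Measure.pi fun _ => gs.prod gs) (gp (Fin N ⊕ Fin N)) := by
    have : (e : (Fin N → ℝ × ℝ) → _) = (fun w : Fin N → ℝ × ℝ => (Sum.elim (fun i => (w i).1) (fun i => (w i).2) : Fin N ⊕ Fin N → ℝ)) := by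
      funext w k; cases k <;> rfl
    rw [this]; exact hmp
  have hQe : ∀ w, Q (e w) = ∏ i, T (w i) := fun w => by rw [hQ]; rfl
  have hQi : Integrable Q (gp (Fin N ⊕ Fin N)) := by
    rw [← hemp.integrable_comp_emb e.measurableEmbedding]
    exact hP0.congr (.of_forall fun w => (hQe w).symm)
  have hQv : ∫ g, Q g ∂gp (Fin N ⊕ Fin N) ≤ exp (m * θ * N * a) := by
    rw [← hemp.integral_comp e.measurableEmbedding]
    simp_rw [hQe]
    rw [integral_fintype_prod_eq_pow (ι := Fin N) T, Fintype.card_fin]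
    refine (pow_le_pow_left₀ (integral_nonneg hT0) hT2 N).trans ?_
    rw [← exp_nat_mul]; apply le_of_eq; congr 1; ring
  have hi : Integrable (fun z => log 2 + log (cosh (fd β h q z))) gs := (integrable_const _).add (fd_lc_int β h q)
  have hmm : Measurable (fun z => log 2 + log (cosh (fd β h q z))) :=
    (continuous_const.add (logcosh_cont.comp (fd_cont β h q))).measurable
  have hi2 : ∀ i : Fin N, Integrable (fun g : Fin N ⊕ Fin N → ℝ => log 2 + log (cosh (fd β h q (g (Sum.inl i))))) (gp (Fin N ⊕ Fin N)) :=
    fun i => (gp_eval (Sum.inl i)).integrable_comp_of_integrable hi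
  have hi3 : Integrable (fun g : Fin N ⊕ Fin N → ℝ => ∑ i, (log 2 + log (cosh (fd β h q (g (Sum.inl i)))))) (gp (Fin N ⊕ Fin N)) :=
    integrable_finsetSum _ fun i _ => hi2 i
  have hv3 : ∫ g : Fin N ⊕ Fin N → ℝ, (∑ i, (log 2 + log (cosh (fd β h q (g (Sum.inl i)))))) ∂gp (Fin N ⊕ Fin N) = N * RS β h q 0 := by
    rw [integral_finsetSum _ (fun i _ => hi2 i)]
    have h2 : ∀ i : Fin N, ∫ g : Fin N ⊕ Fin N → ℝ, (log 2 + log (cosh (fd β h q (g (Sum.inl i))))) ∂gp (Fin N ⊕ Fin N) = log 2 + lc β h q := by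
      intro i
      rw [gp_integral_eval (ι := Fin N ⊕ Fin N) (Sum.inl i) hmm, integral_add (integrable_const _) (fd_lc_int β h q)]
      simp [lc]
    simp_rw [h2]
    simp [RS]; ring
  have hFi : Integrable (fun g => Fm m (fun s => lf (GB N n β q ρ m θ (UU u)) g s + c2 N n β h η r a m θ u s)) (gp (Fin N ⊕ Fin N)) :=
    (Fm_smooth hm).integrable (fun g s => lf (GB N n β q ρ m θ (UU u)) g s + c2 N n β h η r a m θ u s) (fun s => lf_add_integrable _ _ s)
  obtain ⟨A, hA⟩ : ∃ A, A = m * θ * N * a := ⟨_, rfl⟩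
  rw [← hA] at hQv ⊢
  have hbi : Integrable (fun g : Fin N ⊕ Fin N → ℝ => n * ∑ i, (log 2 + log (cosh (fd β h q (g (Sum.inl i))))) + Q g * (exp (-A) / 2)) (gp (Fin N ⊕ Fin N)) :=
    (hi3.const_mul _).add (hQi.mul_const _)
  rw [← integral_const_mul]
  calc _ ≤ ∫ g : Fin N ⊕ Fin N → ℝ, ((m * log (Fintype.card V + 1) + A + log 2 - 1 / 2) + (n * ∑ i, (log 2 + log (cosh (fd β h q (g (Sum.inl i))))) + Q g * (exp (-A) / 2))) ∂gp (Fin N ⊕ Fin N) := by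
        refine integral_mono (hFi.const_mul m) ((integrable_const _).add hbi) fun g => ?_
        beta_reduce
        have h1 := hpt g
        rw [← hQ, ← hA] at h1
        have h2 := log_exp_add_le (A := A) (p := Q g) (by rw [hQ]; exact Finset.prod_nonneg fun i _ => hT0 _)
        linarith
    _ = (m * log (Fintype.card V + 1) + A + log 2 - 1 / 2) + (n * (N * RS β h q 0) + (∫ g, Q g ∂gp (Fin N ⊕ Fin N)) * (exp (-A) / 2)) := by
        rw [integral_add (integrable_const _) hbi, integral_add (hi3.const_mul _) (hQi.mul_const _), integral_const_mul, hv3, integral_mul_const]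
        simp
    _ ≤ _ := by
        have : (∫ g, Q g ∂gp (Fin N ⊕ Fin N)) * (exp (-A) / 2) ≤ exp A * (exp (-A) / 2) := mul_le_r hQv (by positivity)
        have e2 : exp A * (exp (-A) / 2) = 1 / 2 := by rw [exp_neg]; field_simp
        linarith
end

section
variable {N n : ℕ}

lemma Kf_bd {η y s : ℝ} (hη : 0 < η) (hη1 : η ≤ 1) (hy0 : 0 ≤ y) (hy : y ≤ 1 / 4) (hs : s ^ 2 ≤ 1) : 0 ≤ Kf η y s ∧ Kf η y s ≤ 4 := by
  unfold Kf
  obtain ⟨S, hS⟩ : ∃ S, S = 1 + η - s ^ 2 := ⟨_, rfl⟩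
  rw [← hS]
  have h0 : 0 ≤ S := by linarith
  have h2 : S ≤ 2 := by linarith [sq_nonneg s]
  have h4 : S ^ 2 ≤ 4 := by nlinarith
  have h5 : y * S ^ 2 ≤ 1 / 4 * 4 := mul_le_mul hy h4 (sq_nonneg S) (by norm_num)
  have h6 : y ^ 2 ≤ 1 / 16 := by nlinarith
  exact ⟨by positivity, by linarith⟩

lemma Kf_lip {η y s t : ℝ} (hη : 0 < η) (hη1 : η ≤ 1) (hy0 : 0 ≤ y) (hy : y ≤ 1 / 4) (hs : s ^ 2 ≤ 1) (ht : t ^ 2 ≤ 1) :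
    |Kf η y s - Kf η y t| ≤ 4 * |s - t| := by
  have e : Kf η y s - Kf η y t = (t + s) * (1 + y * (2 + 2 * η - s ^ 2 - t ^ 2)) * (t - s) := by unfold Kf; ring
  rw [e, abs_mul, abs_sub_comm t s]
  refine mul_le_r ?_ (abs_nonneg _)
  rw [abs_mul]
  have h1 : |t + s| ≤ 2 := abs_le.2 ⟨by nlinarith [sq_nonneg (t + 1), sq_nonneg (s + 1)], by nlinarith [sq_nonneg (t - 1), sq_nonneg (s - 1)]⟩
  have h3 : 0 ≤ 2 + 2 * η - s ^ 2 - t ^ 2 := by linarith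
  have h4 : y * (2 + 2 * η - s ^ 2 - t ^ 2) ≤ 1 / 4 * 4 := mul_le_mul hy (by linarith [sq_nonneg s, sq_nonneg t]) h3 (by norm_num)
  have h5 : 0 ≤ y * (2 + 2 * η - s ^ 2 - t ^ 2) := mul_nonneg hy0 h3
  have h2 : |1 + y * (2 + 2 * η - s ^ 2 - t ^ 2)| ≤ 2 := abs_le.2 ⟨by linarith, by linarith⟩
  nlinarith [abs_nonneg (t + s), abs_nonneg (1 + y * (2 + 2 * η - s ^ 2 - t ^ 2))]

lemma psi_bd {η y β μ ξ s : ℝ} (hη : 0 < η) (hη1 : η ≤ 1) (hy0 : 0 ≤ y) (hy : y ≤ 1 / 4) (hs : s ^ 2 ≤ 1) :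
    0 ≤ psi η y β μ ξ s ∧ psi η y β μ ξ s ≤ 8 * (β ^ 2 * ξ ^ 2 + μ ^ 2) := by
  obtain ⟨h1, h2⟩ := Kf_bd hη hη1 hy0 hy hs
  unfold psi
  refine ⟨by positivity, ?_⟩
  have h3 : (β * ξ + μ * s) ^ 2 ≤ 2 * (β ^ 2 * ξ ^ 2 + μ ^ 2) := by
    have := mul_le_l hs (sq_nonneg μ)
    nlinarith [sq_nonneg (β * ξ - μ * s)]
  calc _ ≤ (2 * (β ^ 2 * ξ ^ 2 + μ ^ 2)) * 4 := mul_le_mul h3 h2 h1 (by positivity)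
    _ = _ := by ring

lemma psi_lip {η y β μ ξ s t : ℝ} (hη : 0 < η) (hη1 : η ≤ 1) (hy0 : 0 ≤ y) (hy : y ≤ 1 / 4) (hs : s ^ 2 ≤ 1) (ht : t ^ 2 ≤ 1) :
    psi η y β μ ξ s - psi η y β μ ξ t ≤ 24 * (β ^ 2 * ξ ^ 2 + μ ^ 2) * |s - t| := by
  obtain ⟨h1, h2⟩ := Kf_bd hη hη1 hy0 hy hs
  have h3 := Kf_lip hη hη1 hy0 hy hs ht
  have e : psi η y β μ ξ s - psi η y β μ ξ t = (2 * β * ξ * μ + μ ^ 2 * (s + t)) * (s - t) * Kf η y s + (β * ξ + μ * t) ^ 2 * (Kf η y s - Kf η y t) := by unfold psi; ring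
  have h4 : (β * ξ + μ * t) ^ 2 ≤ 2 * (β ^ 2 * ξ ^ 2 + μ ^ 2) := by
    have := mul_le_l ht (sq_nonneg μ)
    nlinarith [sq_nonneg (β * ξ - μ * t)]
  have h5 : |2 * β * ξ * μ + μ ^ 2 * (s + t)| ≤ 3 * (β ^ 2 * ξ ^ 2 + μ ^ 2) := by
    have hst : |s + t| ≤ 2 := abs_le.2 ⟨by nlinarith [sq_nonneg (t + 1), sq_nonneg (s + 1)], by nlinarith [sq_nonneg (t - 1), sq_nonneg (s - 1)]⟩
    obtain ⟨a, b⟩ := abs_le.1 hst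
    have b1 := mul_le_l b (sq_nonneg μ)
    have b2 := mul_le_l a (sq_nonneg μ)
    refine abs_le.2 ⟨by nlinarith [sq_nonneg (β * ξ + μ), sq_nonneg (β * ξ)], by nlinarith [sq_nonneg (β * ξ - μ), sq_nonneg (β * ξ)]⟩
  rw [e]
  obtain ⟨D, hD⟩ : ∃ D, D = β ^ 2 * ξ ^ 2 + μ ^ 2 := ⟨_, rfl⟩
  rw [← hD] at h4 h5 ⊢
  have hD0 : 0 ≤ D := by rw [hD]; positivity
  have h6 : (2 * β * ξ * μ + μ ^ 2 * (s + t)) * (s - t) * Kf η y s ≤ (3 * D * |s - t|) * 4 := by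
    refine (le_abs_self _).trans ?_
    rw [abs_mul, abs_mul, abs_of_nonneg h1]
    exact mul_le_mul (mul_le_r h5 (abs_nonneg _)) h2 h1 (by positivity)
  have h7 : (β * ξ + μ * t) ^ 2 * (Kf η y s - Kf η y t) ≤ 2 * D * (4 * |s - t|) :=
    (mul_le_l ((le_abs_self _).trans h3) (sq_nonneg _)).trans (mul_le_r h4 (by positivity))
  nlinarith [mul_nonneg hD0 (abs_nonneg (s - t))]

lemma exp_quad {t B : ℝ} (h : |t| ≤ B) : exp t ≤ 1 + t + B ^ 2 * exp B := by
  have hB : 0 ≤ B := (abs_nonneg t).trans h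
  have h1 : exp t * (1 - t) ≤ 1 := by
    have := add_one_le_exp (-t)
    calc exp t * (1 - t) ≤ exp t * exp (-t) := mul_le_l (by linarith) (exp_pos t).le
      _ = 1 := by rw [← exp_add]; simp
  have h2 : t ^ 2 ≤ B ^ 2 := sq_le_sq' (by linarith [(abs_le.1 h).1]) (abs_le.1 h).2
  have h3 : exp t ≤ exp B := exp_le_exp.2 (abs_le.1 h).2
  have h4 : 1 ≤ exp B := one_le_exp hB
  have h5 : t ^ 2 * exp t ≤ B ^ 2 * exp B := mul_le_mul h2 h3 (exp_pos _).le (sq_nonneg B)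
  have h6 : t ^ 2 ≤ B ^ 2 * exp B := by nlinarith [sq_nonneg B]
  rcases le_total 0 t with ht | ht
  · nlinarith
  · nlinarith [add_one_le_exp t]

lemma tbar_sq (τ : Fin n → Bool) : tbar τ ^ 2 ≤ 1 := by
  rcases Nat.eq_zero_or_pos n with h0 | hn
  · subst h0; simp [tbar]
  have hnr : (0:ℝ) < n := by exact_mod_cast hn
  have h : |tbar τ| ≤ 1 := by
    unfold tbar
    rw [abs_div, abs_of_pos hnr, div_le_one hnr]
    refine (abs_sum_le_sum_abs _ _).trans ?_
    simp [sp_abs]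
  rw [← sq_abs]; nlinarith [abs_nonneg (tbar τ)]

lemma tbar_dev (hn : 0 < n) (x : ℝ) : pav (gw (xb x)) (fun τ : Fin n → Bool => |tbar τ - tanh x|) ≤ 2 / √n := by
  have hnr : (0:ℝ) < n := by exact_mod_cast hn
  have hs : 0 < √(n:ℝ) := sqrt_pos.2 hnr
  have hv := pav_var hn (fun a => (gw_pos (xb x) a).le) (gw_sum (xb x)) sp (fun a => (sp_sq a).le)
  rw [gw_xb_mean] at hv
  have h1 : ∀ τ : Fin n → Bool, |tbar τ - tanh x| ≤ 1 / √n + √n * ((∑ l, sp (τ l)) / n - tanh x) ^ 2 := by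
    intro τ
    change |tbar τ - tanh x| ≤ 1 / √n + √n * (tbar τ - tanh x) ^ 2
    rw [← sq_abs (tbar τ - tanh x)]
    obtain ⟨d, hd⟩ : ∃ d, d = |tbar τ - tanh x| := ⟨_, rfl⟩
    rw [← hd]
    have h0 : 0 ≤ d := by rw [hd]; positivity
    have : 1 / √n + √n * d ^ 2 - d = (1 / √(n:ℝ)) * (1 - √n * d + (√n * d) ^ 2) := by field_simp; ring
    have h2 : 0 ≤ (1 / √(n:ℝ)) * (1 - √n * d + (√n * d) ^ 2) := mul_nonneg (by positivity) (by nlinarith [sq_nonneg (√n * d - 1)])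
    linarith
  refine (pav_mono (fun a => (gw_pos (xb x) a).le) h1).trans ?_
  rw [pav_add, pav_const (gw_sum _), pav_smul]
  have h3 := mul_le_l hv hs.le
  have h4 : √(n:ℝ) * (1 / n) = 1 / √n := by
    have := sq_sqrt hnr.le
    field_simp; linarith
  rw [h4] at h3
  have : 2 / √(n:ℝ) = 1 / √n + 1 / √n := by ring
  linarith

lemma TTs_cont (β h q η y r ρ ε : ℝ) : Continuous (TTs n β h q η y r ρ ε) := by
  unfold TTs pav psi Kf
  refine continuous_finsetSum _ fun s _ => Continuous.mul (continuous_finsetProd _ fun l _ => ?_) (by fun_prop)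
  refine (gw_cont (s l)).comp (continuous_pi fun b => ?_)
  unfold xb
  exact continuous_const.mul ((fd_cont β h q).comp continuous_fst)

/-- limiting site energy -/
def psiT (β h q η y r ρ : ℝ) (w : ℝ × ℝ) : ℝ := psi η y β (2 * β ^ 2 * r) (ρ * w.1 + √(1 - ρ ^ 2) * w.2) (tanh (fd β h q w.1))

lemma xi_sq {ρ : ℝ} (hρ : ρ ^ 2 ≤ 1) (x z : ℝ) : (ρ * x + √(1 - ρ ^ 2) * z) ^ 2 ≤ x ^ 2 + z ^ 2 := by
  have h := sq_sqrt (show 0 ≤ 1 - ρ ^ 2 by linarith)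
  obtain ⟨c, hc⟩ : ∃ c, c = √(1 - ρ ^ 2) := ⟨_, rfl⟩
  rw [← hc] at h ⊢
  have : x ^ 2 + z ^ 2 = (ρ * x + c * z) ^ 2 + (c * x - ρ * z) ^ 2 := by
    have : (ρ * x + c * z) ^ 2 + (c * x - ρ * z) ^ 2 = (ρ ^ 2 + c ^ 2) * (x ^ 2 + z ^ 2) := by ring
    rw [this, h]; ring
  nlinarith [sq_nonneg (c * x - ρ * z)]

lemma TTs_pt (hn : 0 < n) {β h q ε η y r ρ C1 D C0 : ℝ} (hC1 : 0 < C1) (hD : D = β ^ 2 + 4 * β ^ 4) (hC0 : C0 = 8 * D + 1 + 2 * β ^ 2)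
    (hε : 0 < ε) (hε0 : ε * C0 ≤ C1 / 2) (hη : 0 < η) (hη1 : η ≤ 1) (hy0 : 0 ≤ y) (hy : y ≤ 1 / 4) (hr : r ^ 2 ≤ 1) (hρ : ρ ^ 2 ≤ 1) (w : ℝ × ℝ) :
    TTs n β h q η y r ρ ε w ≤ 1 + ε * (- y - 2 * β ^ 2 * r ^ 2 + psiT β h q η y r ρ w) + ε * (48 * D / C1 / √n + ε * (C0 ^ 2 * (8 / C1 ^ 2))) * exp (C1 * (1 + w.1 ^ 2 + w.2 ^ 2)) := by
  obtain ⟨p, hp⟩ : ∃ p, p = 1 + w.1 ^ 2 + w.2 ^ 2 := ⟨_, rfl⟩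
  rw [← hp]
  have hD0 : 0 ≤ D := by rw [hD]; positivity
  have hC00 : 0 < C0 := by rw [hC0]; positivity
  have hp1 : 1 ≤ p := by rw [hp]; nlinarith [sq_nonneg w.1, sq_nonneg w.2]
  obtain ⟨ξ, hξ⟩ : ∃ ξ, ξ = ρ * w.1 + √(1 - ρ ^ 2) * w.2 := ⟨_, rfl⟩
  have hξ2 : ξ ^ 2 ≤ p - 1 := by rw [hξ, hp]; linarith [xi_sq hρ w.1 w.2]
  have hDp : β ^ 2 * ξ ^ 2 + (2 * β ^ 2 * r) ^ 2 ≤ D * p := by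
    have h1 : (2 * β ^ 2 * r) ^ 2 ≤ 4 * β ^ 4 * p := by
      have : (2 * β ^ 2 * r) ^ 2 = 4 * β ^ 4 * r ^ 2 := by ring
      rw [this]; exact mul_le_l (by linarith) (by positivity)
    have h2 : β ^ 2 * ξ ^ 2 ≤ β ^ 2 * p := mul_le_l (by linarith) (sq_nonneg β)
    rw [hD]; linarith
  have hnr : (0:ℝ) < n := by exact_mod_cast hn
  have hsn : 0 < √(n:ℝ) := sqrt_pos.2 hnr
  unfold TTs psiT
  rw [← hξ]
  obtain ⟨f, hf⟩ : ∃ f : ℝ → ℝ, ∀ s, f s = psi η y β (2 * β ^ 2 * r) ξ s := ⟨_, fun _ => rfl⟩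
  simp_rw [← hf]
  have hfb : ∀ s : ℝ, s ^ 2 ≤ 1 → |- y - 2 * β ^ 2 * r ^ 2 + f s| ≤ C0 * p := by
    intro s hs
    obtain ⟨h1, h2⟩ := psi_bd (β := β) (μ := 2 * β ^ 2 * r) (ξ := ξ) hη hη1 hy0 hy hs
    rw [← hf] at h1 h2
    have h3 : 2 * β ^ 2 * r ^ 2 ≤ 2 * β ^ 2 * p := mul_le_l (by linarith) (by positivity)
    have h4 : 0 ≤ 2 * β ^ 2 * r ^ 2 := by positivity
    have h5 : 0 ≤ D * p := by positivity
    have e : C0 * p = 8 * (D * p) + p + 2 * β ^ 2 * p := by rw [hC0]; ring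
    rw [e]
    exact abs_le.2 ⟨by linarith, by linarith⟩
  have hth : tanh (fd β h q w.1) ^ 2 ≤ 1 := (tanh_sq_lt _).le
  obtain ⟨x, hx⟩ : ∃ x, x = fd β h q w.1 := ⟨_, rfl⟩
  rw [← hx] at hth ⊢
  obtain ⟨E, hE⟩ : ∃ E, E = exp (C1 * p) := ⟨_, rfl⟩
  rw [← hE]
  have hpE : p ≤ E / C1 := by
    rw [le_div_iff₀ hC1, hE]; linarith [add_one_le_exp (C1 * p)]
  have hquad : (ε * (C0 * p)) ^ 2 * exp (ε * (C0 * p)) ≤ ε ^ 2 * (C0 ^ 2 * (8 / C1 ^ 2)) * E := by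
    have h1 : exp (ε * (C0 * p)) ≤ exp (C1 * p / 2) := exp_le_exp.2 (by nlinarith)
    have h2 : p ^ 2 ≤ 8 / C1 ^ 2 * exp (C1 * p / 2) := by
      have h0 : 0 ≤ C1 * p / 2 := by positivity
      have := quadratic_le_exp_of_nonneg h0
      rw [div_mul_eq_mul_div, le_div_iff₀ (by positivity)]; nlinarith
    have h3 : exp (C1 * p / 2) * exp (C1 * p / 2) = E := by rw [← exp_add, hE]; congr 1; ring
    calc _ = ε ^ 2 * C0 ^ 2 * (p ^ 2 * exp (ε * (C0 * p))) := by ring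
      _ ≤ ε ^ 2 * C0 ^ 2 * ((8 / C1 ^ 2 * exp (C1 * p / 2)) * exp (C1 * p / 2)) :=
        mul_le_l (mul_le_mul h2 h1 (exp_pos _).le (by positivity)) (by positivity)
      _ = _ := by rw [mul_assoc (8 / C1 ^ 2), h3]; ring
  have hg0 : ∀ a, 0 ≤ gw (xb x) a := fun a => (gw_pos _ a).le
  have hpt : ∀ τ : Fin n → Bool, exp (ε * (- y - 2 * β ^ 2 * r ^ 2 + f (tbar τ))) ≤
      (1 + ε * (- y - 2 * β ^ 2 * r ^ 2 + f (tanh x)) + ε ^ 2 * (C0 ^ 2 * (8 / C1 ^ 2)) * E) + (ε * (24 * (D * p))) * |tbar τ - tanh x| := by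
    intro τ
    have ht := tbar_sq τ
    have h1 := hfb _ ht
    have h2 : |ε * (- y - 2 * β ^ 2 * r ^ 2 + f (tbar τ))| ≤ ε * (C0 * p) := by
      rw [abs_mul, abs_of_pos hε]; exact mul_le_l h1 hε.le
    have h3 := exp_quad h2
    have h4 := psi_lip (β := β) (μ := 2 * β ^ 2 * r) (ξ := ξ) hη hη1 hy0 hy ht hth
    rw [← hf, ← hf] at h4
    have h5 : f (tbar τ) - f (tanh x) ≤ 24 * (D * p) * |tbar τ - tanh x| := h4.trans (mul_le_r (by linarith) (abs_nonneg _))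
    have h6 := mul_le_l h5 hε.le
    linarith
  refine (pav_mono hg0 hpt).trans ?_
  rw [pav_add, pav_const (gw_sum _), pav_smul]
  have h7 : ε * (24 * (D * p)) * pav (gw (xb x)) (fun τ : Fin n → Bool => |tbar τ - tanh x|) ≤ ε * (48 * D / C1 / √n) * E := by
    calc _ ≤ ε * (24 * (D * (E / C1))) * (2 / √n) := by
          refine mul_le_mul ?_ (tbar_dev hn x) (sum_nonneg fun s _ => mul_nonneg (Finset.prod_nonneg fun l _ => hg0 _) (abs_nonneg _)) ?_
          · gcongr
          · have : 0 ≤ E := by rw [hE]; positivity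
            positivity
      _ = _ := by ring
  have e3 : ε * (48 * D / C1 / √n + ε * (C0 ^ 2 * (8 / C1 ^ 2))) * E = ε * (48 * D / C1 / √n) * E + ε ^ 2 * (C0 ^ 2 * (8 / C1 ^ 2)) * E := by ring
  rw [e3]; linarith

lemma psiT_cont (β h q η y r ρ : ℝ) : Continuous (psiT β h q η y r ρ) := by
  have h1 : Continuous fun w : ℝ × ℝ => tanh (fd β h q w.1) := tanh_cont.comp ((fd_cont β h q).comp continuous_fst)
  unfold psiT psi Kf
  fun_prop

lemma exp_int : ∃ C1 > 0, Integrable (fun w : ℝ × ℝ => exp (C1 * (1 + w.1 ^ 2 + w.2 ^ 2))) (gs.prod gs) := by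
  have : IsGaussian gs := by unfold gs; infer_instance
  obtain ⟨C, hC, hi⟩ := IsGaussian.exists_integrable_exp_sq gs
  refine ⟨C, hC, ?_⟩
  have := (Integrable.mul_prod hi hi).const_mul (exp C)
  refine this.congr (.of_forall fun w => ?_)
  simp only [norm_eq_abs, sq_abs]
  rw [← exp_add, ← exp_add]; congr 1; ring

lemma TTs_bd (β : ℝ) : ∃ C > 0, ∃ ε0 > 0, ∀ (n : ℕ) (h q ε η y r ρ : ℝ), 0 < n → 0 < ε → ε ≤ ε0 → 0 < η → η ≤ 1 → 0 ≤ y → y ≤ 1 / 4 → r ^ 2 ≤ 1 → ρ ^ 2 ≤ 1 →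
    Integrable (psiT β h q η y r ρ) (gs.prod gs) ∧ Integrable (TTs n β h q η y r ρ ε) (gs.prod gs) ∧
    ∫ w, TTs n β h q η y r ρ ε w ∂(gs.prod gs) ≤ exp (ε * (- y - 2 * β ^ 2 * r ^ 2 + ∫ w, psiT β h q η y r ρ w ∂(gs.prod gs) + C * ε + C / √n)) := by
  obtain ⟨C1, hC1, hi⟩ := exp_int
  obtain ⟨E, hE⟩ : ∃ E, E = ∫ w : ℝ × ℝ, exp (C1 * (1 + w.1 ^ 2 + w.2 ^ 2)) ∂(gs.prod gs) := ⟨_, rfl⟩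
  have hE0 : 0 ≤ E := by rw [hE]; exact integral_nonneg fun w => (exp_pos _).le
  obtain ⟨D, hD⟩ : ∃ D, D = β ^ 2 + 4 * β ^ 4 := ⟨_, rfl⟩
  obtain ⟨C0, hC0⟩ : ∃ C0, C0 = 8 * D + 1 + 2 * β ^ 2 := ⟨_, rfl⟩
  have hD0 : 0 ≤ D := by rw [hD]; positivity
  have hC00 : 0 < C0 := by rw [hC0]; positivity
  refine ⟨1 + E * (C0 ^ 2 * (8 / C1 ^ 2)) + E * (48 * D / C1), by positivity, C1 / (2 * C0), by positivity, ?_⟩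
  intro n h q ε η y r ρ hn hε hε0 hη hη1 hy0 hy hr hρ
  have hε1 : ε * C0 ≤ C1 / 2 := by
    calc ε * C0 ≤ C1 / (2 * C0) * C0 := mul_le_r hε0 hC00.le
      _ = _ := by field_simp
  have hpt := TTs_pt (h := h) (q := q) hn hC1 hD hC0 hε hε1 hη hη1 hy0 hy hr hρ
  have hψ : Integrable (psiT β h q η y r ρ) (gs.prod gs) := by
    refine (hi.const_mul (8 * (D / C1))).mono' (psiT_cont ..).aestronglyMeasurable (.of_forall fun w => ?_)
    obtain ⟨h1, h2⟩ := psi_bd (β := β) (μ := 2 * β ^ 2 * r) (ξ := ρ * w.1 + √(1 - ρ ^ 2) * w.2) hη hη1 hy0 hy (tanh_sq_lt (fd β h q w.1)).le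
    unfold psiT
    rw [norm_eq_abs, abs_of_nonneg h1]
    refine h2.trans ?_
    have hx := xi_sq hρ w.1 w.2
    have hp : 1 + w.1 ^ 2 + w.2 ^ 2 ≤ exp (C1 * (1 + w.1 ^ 2 + w.2 ^ 2)) / C1 := by
      rw [le_div_iff₀ hC1]; linarith [add_one_le_exp (C1 * (1 + w.1 ^ 2 + w.2 ^ 2))]
    have hDp : β ^ 2 * (ρ * w.1 + √(1 - ρ ^ 2) * w.2) ^ 2 + (2 * β ^ 2 * r) ^ 2 ≤ D * (1 + w.1 ^ 2 + w.2 ^ 2) := by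
      have e : (2 * β ^ 2 * r) ^ 2 = 4 * β ^ 4 * r ^ 2 := by ring
      have h1 : 4 * β ^ 4 * r ^ 2 ≤ 4 * β ^ 4 * (1 + w.1 ^ 2 + w.2 ^ 2) := mul_le_l (by nlinarith [sq_nonneg w.1, sq_nonneg w.2]) (by positivity)
      have h2 : β ^ 2 * (ρ * w.1 + √(1 - ρ ^ 2) * w.2) ^ 2 ≤ β ^ 2 * (1 + w.1 ^ 2 + w.2 ^ 2) := mul_le_l (by linarith) (sq_nonneg β)
      rw [e, hD]; linarith
    have := mul_le_l hp hD0
    calc _ ≤ 8 * (D * (exp (C1 * (1 + w.1 ^ 2 + w.2 ^ 2)) / C1)) := by linarith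
      _ = _ := by ring
  obtain ⟨K, hK⟩ : ∃ K, K = ε * (48 * D / C1 / √n + ε * (C0 ^ 2 * (8 / C1 ^ 2))) := ⟨_, rfl⟩
  rw [← hK] at hpt
  obtain ⟨c, hc⟩ : ∃ c, c = - y - 2 * β ^ 2 * r ^ 2 := ⟨_, rfl⟩
  rw [← hc] at hpt ⊢
  have hi0 : Integrable (fun w => ε * (c + psiT β h q η y r ρ w)) (gs.prod gs) := ((integrable_const _).add hψ).const_mul ε
  have hi1 : Integrable (fun w => 1 + ε * (c + psiT β h q η y r ρ w)) (gs.prod gs) := (integrable_const _).add (((integrable_const _).add hψ).const_mul ε)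
  have hib : Integrable (fun w : ℝ × ℝ => 1 + ε * (c + psiT β h q η y r ρ w) + K * exp (C1 * (1 + w.1 ^ 2 + w.2 ^ 2))) (gs.prod gs) := hi1.add (hi.const_mul K)
  have hTi : Integrable (TTs n β h q η y r ρ ε) (gs.prod gs) := by
    refine hib.mono' (TTs_cont ..).aestronglyMeasurable (.of_forall fun w => ?_)
    rw [norm_eq_abs, abs_of_nonneg (TTs_nonneg ..)]; exact hpt w
  refine ⟨hψ, hTi, ?_⟩
  refine (integral_mono hTi hib hpt).trans ?_
  rw [integral_add hi1 (hi.const_mul K), integral_add (integrable_const _) hi0, integral_const_mul, integral_const_mul, integral_add (integrable_const _) hψ, ← hE]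
  simp only [integral_const, probReal_univ, smul_eq_mul, one_mul]
  have hnr : (0:ℝ) < n := by exact_mod_cast hn
  have hsn : 0 < √(n:ℝ) := sqrt_pos.2 hnr
  refine le_trans ?_ (add_one_le_exp _)
  have h1 : 0 ≤ (1 + E * (48 * D / C1)) * ε := by positivity
  have h2 : 0 ≤ (1 + E * (C0 ^ 2 * (8 / C1 ^ 2))) / √n := by positivity
  have : K * E ≤ ε * ((1 + E * (C0 ^ 2 * (8 / C1 ^ 2)) + E * (48 * D / C1)) * ε + (1 + E * (C0 ^ 2 * (8 / C1 ^ 2)) + E * (48 * D / C1)) / √n) := by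
    have e : ε * ((1 + E * (C0 ^ 2 * (8 / C1 ^ 2)) + E * (48 * D / C1)) * ε + (1 + E * (C0 ^ 2 * (8 / C1 ^ 2)) + E * (48 * D / C1)) / √n) = K * E + ε * ((1 + E * (48 * D / C1)) * ε + (1 + E * (C0 ^ 2 * (8 / C1 ^ 2))) / √n) := by
      rw [hK]; ring
    rw [e]; have := mul_nonneg hε.le (add_nonneg h1 h2); linarith
  linarith
end

section
lemma gs_z : ∫ z, z ∂gs = 0 := by unfold gs; exact integral_id_gaussianReal
lemma gs_z_int : Integrable (fun z : ℝ => z) gs := by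
  unfold gs; exact (memLp_id_gaussianReal 1).integrable (by norm_num)
lemma gs_z2_int : Integrable (fun z : ℝ => z ^ 2) gs := by
  unfold gs; exact (memLp_id_gaussianReal 2).integrable_sq
lemma gs_z2 : ∫ z, z ^ 2 ∂gs = 1 := by
  have h := variance_fun_id_gaussianReal (μ := 0) (v := 1)
  rw [variance_of_integral_eq_zero (by fun_prop) integral_id_gaussianReal] at h
  unfold gs; simpa using h

lemma gs_quad_int (A B : ℝ) : ∫ z, (A + B * z) ^ 2 ∂gs = A ^ 2 + B ^ 2 := by
  have e : ∀ z : ℝ, (A + B * z) ^ 2 = (A ^ 2 + (2 * A * B) * z) + B ^ 2 * z ^ 2 := fun z => by ring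
  simp_rw [e]
  have h1 : Integrable (fun z : ℝ => A ^ 2 + (2 * A * B) * z) gs := (integrable_const _).add (gs_z_int.const_mul _)
  rw [integral_add h1 (gs_z2_int.const_mul _), integral_add (integrable_const _) (gs_z_int.const_mul _), integral_const_mul, integral_const_mul, gs_z, gs_z2]
  simp

/-- integrability of polynomially growing functions -/
lemma gs_int_quad {f : ℝ → ℝ} (hf : Continuous f) {C : ℝ} (h : ∀ x, |f x| ≤ C * (1 + x ^ 2)) : Integrable f gs :=
  (((integrable_const 1).add gs_z2_int).const_mul C).mono' hf.aestronglyMeasurable (.of_forall h)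

lemma x_sc (x : ℝ) : |x| * sc x ≤ 1 := by
  have h1 : |x| ≤ cosh x ^ 2 := by
    rw [cosh_sq]
    have h2 : |x| ≤ |sinh x| := by
      rw [abs_sinh]; exact self_le_sinh_iff.2 (abs_nonneg x)
    have h3 : |sinh x| ^ 2 = sinh x ^ 2 := sq_abs _
    nlinarith [sq_nonneg (|sinh x| - 1)]
  unfold sc
  rw [inv_pow, ← div_eq_mul_inv, div_le_one (by have := cosh_pos x; positivity)]
  exact h1

section
variable {β h q : ℝ}

lemma fd_deriv (z : ℝ) : HasDerivAt (fd β h q) (β * √q) z := by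
  unfold fd
  refine (((hasDerivAt_id z).const_mul (β * √q)).const_add h).congr_deriv ?_
  simp

lemma st1 : ∫ z, z * (tanh (fd β h q z) * sc (fd β h q z)) ∂gs
    = β * √q * (s4 β h q - 2 * ∫ z, tanh (fd β h q z) ^ 2 * sc (fd β h q z) ∂gs) := by
  have hc1 := tanh_cont.comp (fd_cont β h q)
  have hc2 := sc_cont.comp (fd_cont β h q)
  simp only [Function.comp_def] at hc1 hc2
  have hd : ∀ z, HasDerivAt (fun z => tanh (fd β h q z) * sc (fd β h q z)) (β * √q * (sc (fd β h q z) ^ 2 - 2 * (tanh (fd β h q z) ^ 2 * sc (fd β h q z)))) z := by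
    intro z
    have h1 := (hasDerivAt_tanh (fd β h q z)).comp z (fd_deriv z)
    have h2 := (hasDerivAt_sc (fd β h q z)).comp z (fd_deriv z)
    refine (h1.mul h2).congr_deriv ?_
    simp only [Function.comp]; ring
  have b1 : ∀ z, |tanh (fd β h q z) * sc (fd β h q z)| ≤ 1 := fun z => by
    rw [abs_mul]; exact mul_le_one₀ (tanh_abs _) (abs_nonneg _) (sc_abs _)
  have b3 : ∀ z, |sc (fd β h q z) ^ 2| ≤ 1 := fun z => by
    rw [abs_pow]; exact pow_le_one₀ (abs_nonneg _) (sc_abs _)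
  have b4 : ∀ z, |tanh (fd β h q z) ^ 2 * sc (fd β h q z)| ≤ 1 := fun z => by
    rw [abs_mul, abs_pow]; exact mul_le_one₀ (pow_le_one₀ (abs_nonneg _) (tanh_abs _)) (abs_nonneg _) (sc_abs _)
  have b2 : ∀ z, |β * √q * (sc (fd β h q z) ^ 2 - 2 * (tanh (fd β h q z) ^ 2 * sc (fd β h q z)))| ≤ |β * √q| * 3 := fun z => by
    rw [abs_mul]
    refine mul_le_l ?_ (abs_nonneg _)
    have := abs_le.1 (b3 z); have := abs_le.1 (b4 z)
    exact abs_le.2 ⟨by linarith, by linarith⟩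
  rw [gs_stein hd (C := 1 + |β * √q| * 3) (fun z => (b1 z).trans (by linarith [abs_nonneg (β * √q)])) (fun z => (b2 z).trans (by linarith)) (by fun_prop)]
  have i1 : Integrable (fun z => sc (fd β h q z) ^ 2) gs := gs_int_bd (by fun_prop) b3
  have i2 : Integrable (fun z => 2 * (tanh (fd β h q z) ^ 2 * sc (fd β h q z))) gs := (gs_int_bd (by fun_prop) b4).const_mul 2
  rw [integral_const_mul, integral_sub i1 i2, integral_const_mul, s4]

lemma st2 (hβ : 0 < β) (hq : 0 < q) : ∫ z, z ^ 2 * sc (fd β h q z) ∂gs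
    = ∫ z, sc (fd β h q z) ∂gs - 2 * (β * √q) * ∫ z, z * (tanh (fd β h q z) * sc (fd β h q z)) ∂gs := by
  have hb : 0 < β * √q := mul_pos hβ (sqrt_pos.2 hq)
  have hc1 := tanh_cont.comp (fd_cont β h q)
  have hc2 := sc_cont.comp (fd_cont β h q)
  simp only [Function.comp_def] at hc1 hc2
  have hd : ∀ z, HasDerivAt (fun z => z * sc (fd β h q z)) (sc (fd β h q z) - 2 * (β * √q) * (z * (tanh (fd β h q z) * sc (fd β h q z)))) z := by
    intro z
    have h2 := (hasDerivAt_sc (fd β h q z)).comp z (fd_deriv z)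
    refine ((hasDerivAt_id z).mul h2).congr_deriv ?_
    simp only [Function.comp, id]; ring
  obtain ⟨C, hC⟩ : ∃ C, C = (1 + |h|) / (β * √q) := ⟨_, rfl⟩
  have hC0 : 0 ≤ C := by rw [hC]; positivity
  have b1 : ∀ z, |z * sc (fd β h q z)| ≤ C := fun z => by
    rw [abs_mul, abs_of_pos (sc_pos _), hC, le_div_iff₀ hb]
    have h1 : |z| * (β * √q) ≤ |fd β h q z| + |h| := by
      have : |z| * (β * √q) = |fd β h q z - h| := by unfold fd; rw [add_sub_cancel_left, abs_mul, abs_of_pos hb, mul_comm]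
      rw [this]; exact abs_sub _ _
    have h2 := x_sc (fd β h q z)
    have h3 := sc_pos (fd β h q z)
    have h4 := sc_le (fd β h q z)
    have h5 := mul_le_r h1 h3.le
    nlinarith [abs_nonneg h]
  have b2 : ∀ z, |sc (fd β h q z) - 2 * (β * √q) * (z * (tanh (fd β h q z) * sc (fd β h q z)))| ≤ 1 + 2 * (β * √q) * C := fun z => by
    refine (abs_sub _ _).trans (add_le_add (sc_abs _) ?_)
    rw [abs_mul, abs_of_pos (by positivity : 0 < 2 * (β * √q))]
    refine mul_le_l ?_ (by positivity)
    have : z * (tanh (fd β h q z) * sc (fd β h q z)) = (z * sc (fd β h q z)) * tanh (fd β h q z) := by ring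
    rw [this, abs_mul]
    exact (mul_le_of_le_one_right (abs_nonneg _) (tanh_abs _)).trans (b1 z)
  have hC1 : 0 ≤ 2 * (β * √q) * C := by positivity
  have hs := gs_stein hd (C := C + (1 + 2 * (β * √q) * C)) (fun z => (b1 z).trans (by linarith)) (fun z => (b2 z).trans (by linarith)) (by fun_prop)
  have e : ∀ z, z ^ 2 * sc (fd β h q z) = z * (z * sc (fd β h q z)) := fun z => by ring
  simp_rw [e, hs]
  have i1 : Integrable (fun z => sc (fd β h q z)) gs := gs_int_bd (by fun_prop) (fun z => sc_abs _)
  have i2 : Integrable (fun z => 2 * (β * √q) * (z * (tanh (fd β h q z) * sc (fd β h q z)))) gs := by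
    refine Integrable.const_mul (gs_int_bd (C := C) (by fun_prop) fun z => ?_) _
    have : z * (tanh (fd β h q z) * sc (fd β h q z)) = (z * sc (fd β h q z)) * tanh (fd β h q z) := by ring
    rw [this, abs_mul]
    exact (mul_le_of_le_one_right (abs_nonneg _) (tanh_abs _)).trans (b1 z)
  rw [integral_sub i1 i2, integral_const_mul]

/-- effective squared field -/
def b2f (β h q r ρ z : ℝ) : ℝ := (β * ρ * z + 2 * β ^ 2 * r * tanh (fd β h q z)) ^ 2 + β ^ 2 * (1 - ρ ^ 2)

lemma b2f_cont (r ρ : ℝ) : Continuous (b2f β h q r ρ) := by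
  have hc1 := tanh_cont.comp (fd_cont β h q)
  simp only [Function.comp_def] at hc1
  unfold b2f; fun_prop

lemma sq_two (r ρ z : ℝ) : (β * ρ * z + 2 * β ^ 2 * r * tanh (fd β h q z)) ^ 2 ≤ 2 * β ^ 2 * ρ ^ 2 * z ^ 2 + 8 * β ^ 4 * r ^ 2 := by
  have ht := (tanh_sq_lt (fd β h q z)).le
  generalize tanh (fd β h q z) = t at *
  have := mul_le_l ht (by positivity : 0 ≤ 8 * β ^ 4 * r ^ 2)
  nlinarith [sq_nonneg (β * ρ * z - 2 * β ^ 2 * r * t)]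

lemma main_int (hβ : 0 < β) (hq : 0 < q) (hqf : q = ∫ z, tanh (fd β h q z) ^ 2 ∂gs) {r ρ : ℝ} (hr : √q * ρ = r) :
    ∫ z, b2f β h q r ρ z * sc (fd β h q z) ∂gs = β ^ 2 * (1 - q) + 2 * β ^ 4 * r ^ 2 * s4 β h q := by
  have hc1 := tanh_cont.comp (fd_cont β h q)
  have hc2 := sc_cont.comp (fd_cont β h q)
  simp only [Function.comp_def] at hc1 hc2
  have e : ∀ z, b2f β h q r ρ z * sc (fd β h q z) = ((β ^ 2 * ρ ^ 2) * (z ^ 2 * sc (fd β h q z)) + (4 * β ^ 3 * r * ρ) * (z * (tanh (fd β h q z) * sc (fd β h q z))))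
      + ((4 * β ^ 4 * r ^ 2) * (tanh (fd β h q z) ^ 2 * sc (fd β h q z)) + (β ^ 2 * (1 - ρ ^ 2)) * sc (fd β h q z)) := fun z => by unfold b2f; ring
  have b4 : ∀ z, |tanh (fd β h q z) ^ 2 * sc (fd β h q z)| ≤ 1 := fun z => by
    rw [abs_mul, abs_pow]; exact mul_le_one₀ (pow_le_one₀ (abs_nonneg _) (tanh_abs _)) (abs_nonneg _) (sc_abs _)
  have i1 : Integrable (fun z => (β ^ 2 * ρ ^ 2) * (z ^ 2 * sc (fd β h q z))) gs := (gs_int_quad (C := 1) (by fun_prop) fun z => by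
    rw [abs_mul, abs_pow, sq_abs]; have := sc_abs (fd β h q z); nlinarith [sq_nonneg z]).const_mul _
  have i2 : Integrable (fun z => (4 * β ^ 3 * r * ρ) * (z * (tanh (fd β h q z) * sc (fd β h q z)))) gs := (gs_int_quad (C := 1) (by fun_prop) fun z => by
    rw [abs_mul, abs_mul]
    have h1 : |tanh (fd β h q z)| * |sc (fd β h q z)| ≤ 1 := mul_le_one₀ (tanh_abs _) (abs_nonneg _) (sc_abs _)
    have := mul_le_of_le_one_right (abs_nonneg z) h1
    nlinarith [sq_abs z, sq_nonneg (|z| - 1)]).const_mul _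
  have i3 : Integrable (fun z => (4 * β ^ 4 * r ^ 2) * (tanh (fd β h q z) ^ 2 * sc (fd β h q z))) gs := (gs_int_bd (by fun_prop) b4).const_mul _
  have i4' : Integrable (fun z => sc (fd β h q z)) gs := gs_int_bd (by fun_prop) (fun z => sc_abs _)
  have i4 : Integrable (fun z => (β ^ 2 * (1 - ρ ^ 2)) * sc (fd β h q z)) gs := i4'.const_mul _
  simp_rw [e]
  have i12 : Integrable (fun z => (β ^ 2 * ρ ^ 2) * (z ^ 2 * sc (fd β h q z)) + (4 * β ^ 3 * r * ρ) * (z * (tanh (fd β h q z) * sc (fd β h q z)))) gs := i1.add i2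
  have i34 : Integrable (fun z => (4 * β ^ 4 * r ^ 2) * (tanh (fd β h q z) ^ 2 * sc (fd β h q z)) + (β ^ 2 * (1 - ρ ^ 2)) * sc (fd β h q z)) gs := i3.add i4
  rw [integral_add i12 i34]
  rw [integral_add i1 i2, integral_add i3 i4, integral_const_mul, integral_const_mul, integral_const_mul, integral_const_mul, st2 hβ hq, st1]
  have es : ∫ z, sc (fd β h q z) ∂gs = 1 - q := by
    simp_rw [sc_eq]
    rw [integral_sub (integrable_const _) (gs_int_bd (C := 1) (by fun_prop) fun z => by rw [abs_pow]; exact pow_le_one₀ (abs_nonneg _) (tanh_abs _)), ← hqf]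
    simp
  rw [es]
  generalize (∫ z, tanh (fd β h q z) ^ 2 * sc (fd β h q z) ∂gs) = B
  have hsq := sq_sqrt hq.le
  obtain ⟨k, hk⟩ : ∃ k, k = √q := ⟨_, rfl⟩
  rw [← hk] at hr hsq ⊢
  subst hr
  ring

lemma gap_int (hβ : 0 < β) (hq : 0 < q) (hqf : q = ∫ z, tanh (fd β h q z) ^ 2 ∂gs) {r ρ y : ℝ} (hr : √q * ρ = r) (hρ : ρ ^ 2 ≤ 1)
    (hy0 : 0 ≤ y) (hy : y ≤ 1 / 4) (hr1 : r ^ 2 ≤ 1) :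
    ∫ z, b2f β h q r ρ z * Kf (y ^ 2) y (tanh (fd β h q z)) ∂gs ≤ β ^ 2 * (1 - q) + 2 * β ^ 4 * r ^ 2 * s4 β h q
      + y * (β ^ 2 * s4 β h q + (2 * β ^ 2 / q + 8 * β ^ 4) * r ^ 2) + 40 * y ^ 2 * (β ^ 2 + 4 * β ^ 4) := by
  have hc1 := tanh_cont.comp (fd_cont β h q)
  have hc2 := sc_cont.comp (fd_cont β h q)
  simp only [Function.comp_def] at hc1 hc2
  have hb := b2f_cont (β := β) (h := h) (q := q) r ρ
  have hσ : 0 ≤ β ^ 2 * (1 - ρ ^ 2) := mul_nonneg (sq_nonneg _) (by linarith)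
  have hb0 : ∀ z, 0 ≤ b2f β h q r ρ z := fun z => by unfold b2f; nlinarith [sq_nonneg (β * ρ * z + 2 * β ^ 2 * r * tanh (fd β h q z))]
  obtain ⟨M, hM⟩ : ∃ M, M = 2 * β ^ 2 * ρ ^ 2 + 8 * β ^ 4 * r ^ 2 + β ^ 2 * (1 - ρ ^ 2) := ⟨_, rfl⟩
  have hbM : ∀ z, b2f β h q r ρ z ≤ M * (1 + z ^ 2) := fun z => by
    have := sq_two (β := β) (h := h) (q := q) r ρ z
    unfold b2f
    have e1 : 0 ≤ 2 * β ^ 2 * ρ ^ 2 := by positivity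
    have e2 : 0 ≤ 8 * β ^ 4 * r ^ 2 * z ^ 2 := by positivity
    have e3 : 0 ≤ β ^ 2 * (1 - ρ ^ 2) * z ^ 2 := mul_nonneg hσ (sq_nonneg z)
    rw [hM]; nlinarith
  have hbi : ∀ f : ℝ → ℝ, Continuous f → (∀ z, |f z| ≤ 4) → Integrable (fun z => b2f β h q r ρ z * f z) gs := fun f hf h4 =>
    gs_int_quad (C := M * 4) (hb.mul hf) fun z => by
      rw [abs_mul, abs_of_nonneg (hb0 z)]
      calc _ ≤ M * (1 + z ^ 2) * 4 := mul_le_mul (hbM z) (h4 z) (abs_nonneg _) ((hb0 z).trans (hbM z))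
        _ = _ := by ring
  have hη1 : y ^ 2 ≤ 1 := by nlinarith
  have hK : ∀ z, 0 ≤ Kf (y ^ 2) y (tanh (fd β h q z)) ∧ Kf (y ^ 2) y (tanh (fd β h q z)) ≤ sc (fd β h q z) + y * sc (fd β h q z) ^ 2 + 20 * y ^ 2 := by
    intro z
    have h0 := sc_pos (fd β h q z)
    have h1 := sc_le (fd β h q z)
    have e : 1 + y ^ 2 - tanh (fd β h q z) ^ 2 = sc (fd β h q z) + y ^ 2 := by rw [sc_eq]; ring
    unfold Kf
    rw [e]
    generalize sc (fd β h q z) = s at *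
    refine ⟨by positivity, ?_⟩
    have h2 : y * y ^ 2 ≤ 1 / 4 * y ^ 2 := mul_le_r hy (sq_nonneg y)
    have h3 : y * (s + y ^ 2) ^ 2 = y * s ^ 2 + (y * y ^ 2) * (2 * s + y ^ 2) := by ring
    have h4 : (y * y ^ 2) * (2 * s + y ^ 2) ≤ (1 / 4 * y ^ 2) * 3 := mul_le_mul h2 (by linarith) (by positivity) (by positivity)
    rw [h3]; nlinarith [sq_nonneg y]
  have i1 := hbi _ hc2 (fun z => (sc_abs _).trans (by norm_num))
  have i2 : Integrable (fun z => b2f β h q r ρ z * sc (fd β h q z) ^ 2) gs := hbi (fun z => sc (fd β h q z) ^ 2) (by fun_prop) (fun z => by rw [abs_pow]; exact (pow_le_one₀ (abs_nonneg _) (sc_abs _)).trans (by norm_num))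
  have i3 : Integrable (fun z => b2f β h q r ρ z) gs := by simpa using hbi (fun _ => 1) continuous_const (fun z => by norm_num)
  have i12 : Integrable (fun z => b2f β h q r ρ z * sc (fd β h q z) + y * (b2f β h q r ρ z * sc (fd β h q z) ^ 2)) gs := i1.add (i2.const_mul y)
  have i123 : Integrable (fun z => (b2f β h q r ρ z * sc (fd β h q z) + y * (b2f β h q r ρ z * sc (fd β h q z) ^ 2)) + 20 * y ^ 2 * b2f β h q r ρ z) gs := i12.add (i3.const_mul _)
  have hz : ∀ a b : ℝ, Integrable (fun z : ℝ => a * z ^ 2 + b) gs := fun a b => (gs_z2_int.const_mul a).add (integrable_const b)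
  have hzv : ∀ a b : ℝ, ∫ z, (a * z ^ 2 + b) ∂gs = a + b := fun a b => by
    rw [integral_add (gs_z2_int.const_mul a) (integrable_const b), integral_const_mul, gs_z2]; simp
  have m0 : ∫ z, b2f β h q r ρ z ∂gs ≤ 2 * (β ^ 2 + 4 * β ^ 4) := by
    calc _ ≤ ∫ z, (2 * β ^ 2 * ρ ^ 2 * z ^ 2 + (8 * β ^ 4 * r ^ 2 + β ^ 2 * (1 - ρ ^ 2))) ∂gs :=
          integral_mono i3 (hz _ _) fun z => by
            have := sq_two (β := β) (h := h) (q := q) r ρ z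
            unfold b2f; linarith
      _ = _ := hzv _ _
      _ ≤ _ := by
        have h1 := mul_le_l hr1 (by positivity : 0 ≤ 8 * β ^ 4)
        have h2 := mul_le_l hρ (sq_nonneg β)
        nlinarith
  have m2 : ∫ z, b2f β h q r ρ z * sc (fd β h q z) ^ 2 ∂gs ≤ β ^ 2 * s4 β h q + (2 * β ^ 2 / q + 8 * β ^ 4) * r ^ 2 := by
    have is : Integrable (fun z => β ^ 2 * sc (fd β h q z) ^ 2) gs := (gs_int_bd (C := 1) (by fun_prop) (fun z => by rw [abs_pow]; exact pow_le_one₀ (abs_nonneg _) (sc_abs _))).const_mul _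
    calc _ ≤ ∫ z, ((2 * β ^ 2 * ρ ^ 2 * z ^ 2 + 8 * β ^ 4 * r ^ 2) + β ^ 2 * sc (fd β h q z) ^ 2) ∂gs :=
          integral_mono i2 ((hz _ _).add is) fun z => by
            have h1 := sq_two (β := β) (h := h) (q := q) r ρ z
            have h0 : sc (fd β h q z) ^ 2 ≤ 1 := pow_le_one₀ (sc_pos _).le (sc_le _)
            have h00 : 0 ≤ sc (fd β h q z) ^ 2 := sq_nonneg _
            simp only [b2f, add_mul]
            have h2 := mul_le_of_le_one_right (sq_nonneg (β * ρ * z + 2 * β ^ 2 * r * tanh (fd β h q z))) h0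
            have h3 : β ^ 2 * (1 - ρ ^ 2) * sc (fd β h q z) ^ 2 ≤ β ^ 2 * sc (fd β h q z) ^ 2 := by
              refine mul_le_r ?_ h00
              nlinarith [sq_nonneg β, sq_nonneg ρ, mul_nonneg (sq_nonneg β) (sq_nonneg ρ)]
            linarith
      _ = (2 * β ^ 2 * ρ ^ 2 + 8 * β ^ 4 * r ^ 2) + β ^ 2 * s4 β h q := by
        rw [integral_add (hz _ _) is, hzv, integral_const_mul, s4]
      _ = _ := by
        have hρr : ρ ^ 2 = r ^ 2 / q := by rw [← hr, mul_pow, sq_sqrt hq.le]; field_simp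
        rw [hρr]; ring
  calc _ ≤ ∫ z, ((b2f β h q r ρ z * sc (fd β h q z) + y * (b2f β h q r ρ z * sc (fd β h q z) ^ 2)) + 20 * y ^ 2 * b2f β h q r ρ z) ∂gs := by
        refine integral_mono (hbi (fun z => Kf (y ^ 2) y (tanh (fd β h q z))) (by unfold Kf; fun_prop) fun z => ?_) i123 fun z => ?_
        · rw [abs_of_nonneg (hK z).1]
          refine (hK z).2.trans ?_
          have h1 := sc_le (fd β h q z)
          have h2 : sc (fd β h q z) ^ 2 ≤ 1 := pow_le_one₀ (sc_pos _).le (sc_le _)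
          nlinarith [mul_le_mul hy h2 (sq_nonneg _) (by norm_num : (0:ℝ) ≤ 1 / 4)]
        · have := mul_le_l (hK z).2 (hb0 z)
          beta_reduce
          linarith
    _ = (∫ z, b2f β h q r ρ z * sc (fd β h q z) ∂gs) + y * (∫ z, b2f β h q r ρ z * sc (fd β h q z) ^ 2 ∂gs) + 20 * y ^ 2 * ∫ z, b2f β h q r ρ z ∂gs := by
        rw [integral_add i12 (i3.const_mul _), integral_add i1 (i2.const_mul y), integral_const_mul, integral_const_mul]
    _ ≤ _ := by
        rw [main_int hβ hq hqf hr]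
        have h1 := mul_le_l m2 hy0
        have h2 := mul_le_l m0 (by positivity : 0 ≤ 20 * y ^ 2)
        linarith

lemma psiT_int {r ρ y : ℝ} (hρ : ρ ^ 2 ≤ 1) (hi : Integrable (psiT β h q (y ^ 2) y r ρ) (gs.prod gs)) :
    ∫ w, psiT β h q (y ^ 2) y r ρ w ∂(gs.prod gs) = ∫ z, b2f β h q r ρ z * Kf (y ^ 2) y (tanh (fd β h q z)) ∂gs := by
  rw [integral_prod _ hi]
  congr 1; funext z
  have e : ∀ w, psiT β h q (y ^ 2) y r ρ (z, w) = ((β * ρ * z + 2 * β ^ 2 * r * tanh (fd β h q z)) + (β * √(1 - ρ ^ 2)) * w) ^ 2 * Kf (y ^ 2) y (tanh (fd β h q z)) := by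
    intro w; unfold psiT psi; ring
  simp_rw [e]
  rw [integral_mul_const, gs_quad_int, mul_pow β, sq_sqrt (by linarith)]
  rfl

lemma gap (hβ : 0 < β) (hfix : isFixedq β h q) (hAT : ATcond β h q) :
    ∃ y > 0, y ≤ 1 / 4 ∧ ∃ c1 > 0, ∀ r ρ : ℝ, √q * ρ = r → ρ ^ 2 ≤ 1 → Integrable (psiT β h q (y ^ 2) y r ρ) (gs.prod gs) →
      - y - 2 * β ^ 2 * r ^ 2 + ∫ w, psiT β h q (y ^ 2) y r ρ w ∂(gs.prod gs) ≤ β ^ 2 * (1 - q) - c1 := by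
  obtain ⟨hq0, hq1, hqf⟩ := hfix
  have hqf' : q = ∫ z, tanh (fd β h q z) ^ 2 ∂gs := hqf
  obtain ⟨α, hαd⟩ : ∃ α, β ^ 2 * s4 β h q = α := ⟨_, rfl⟩
  have hα : 0 < 1 - α := by
    suffices α < 1 by linarith
    rw [← hαd]; unfold s4 sc fd; unfold ATcond at hAT
    refine lt_of_eq_of_lt ?_ hAT
    congr 2; ext z; rw [← pow_mul]
  obtain ⟨C1, hC1⟩ : ∃ C1, C1 = 2 * β ^ 2 / q + 8 * β ^ 4 := ⟨_, rfl⟩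
  have hC10 : 0 < C1 := by rw [hC1]; positivity
  obtain ⟨D, hD⟩ : ∃ D, D = β ^ 2 + 4 * β ^ 4 := ⟨_, rfl⟩
  have hD0 : 0 < D := by rw [hD]; positivity
  obtain ⟨y, hy0, hy1, hy2, hy3⟩ : ∃ y > 0, y ≤ 1 / 4 ∧ y * C1 ≤ 2 * β ^ 2 * (1 - α) ∧ 40 * y * D ≤ (1 - α) / 2 := by
    refine ⟨min (1 / 4) (min (2 * β ^ 2 * (1 - α) / C1) ((1 - α) / 2 / (40 * D))), by positivity, min_le_left _ _, ?_, ?_⟩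
    · rw [← le_div_iff₀ hC10]; exact (min_le_right _ _).trans (min_le_left _ _)
    · rw [mul_comm 40, mul_assoc, ← le_div_iff₀ (by positivity)]; exact (min_le_right _ _).trans (min_le_right _ _)
  refine ⟨y, hy0, hy1, y * (1 - α) / 2, by positivity, fun r ρ hr hρ hi => ?_⟩
  rw [psiT_int hρ hi]
  have hr1 : r ^ 2 ≤ 1 := by rw [← hr, mul_pow, sq_sqrt hq0.le]; nlinarith [sq_nonneg ρ]
  have hg := gap_int hβ hq0 hqf' hr hρ hy0.le hy1 hr1
  rw [← hC1, ← hD, hαd] at hg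
  have e : 2 * β ^ 4 * r ^ 2 * s4 β h q = 2 * β ^ 2 * r ^ 2 * α := by rw [← hαd]; ring
  rw [e] at hg
  have h1 := mul_le_r hy2 (sq_nonneg r)
  have h2 := mul_le_l hy3 hy0.le
  linarith
end
end

section
variable {N n : ℕ}

lemma mg_cont (i : Fin N) : Continuous (fun x : Cfg N → ℝ => mg x i) :=
  continuous_finsetSum _ fun s _ => (gw_cont s).mul continuous_const

lemma Yv_cont (u : Fin N → ℝ) : Continuous (fun x : Cfg N → ℝ => Yv x u) :=
  (continuous_finsetSum _ fun i _ => continuous_const.mul (mg_cont i)).div_const _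

lemma BB_cont {η : ℝ} (hη : 0 < η) (β r L q : ℝ) (n : ℕ) (u : Fin N → ℝ) : Continuous (fun x : Cfg N → ℝ => BB η β r L q n x u) := by
  unfold BB phi
  have h1 : Continuous (fun x : Cfg N → ℝ => ∑ i, (1 + η - mg x i ^ 2)⁻¹ * u i ^ 2) := by
    refine continuous_finsetSum _ fun i _ => Continuous.mul (Continuous.inv₀ (continuous_const.sub ((mg_cont i).pow 2)) ?_) continuous_const
    intro x; have := mg_sq x i; linarith
  have h2 := Yv_cont u
  have h3 := Q2_cont (N := N) q
  fun_prop

/-- the exceptional event -/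
def Bad {V : Type*} (N n : ℕ) (β h q η r a : ℝ) (u : V → Fin N → ℝ) : Set (Edg N ⊕ Fin N → ℝ) :=
  {g | ∃ v, a ≤ ∑ k, AU N β (u v) k * g k + BB η β r (2 / (η ^ 2 * √n)) q n (XH N β h q 1 g) (u v)}

lemma Bad_meas {V : Type*} [Fintype V] (β h q r a : ℝ) {η : ℝ} (hη : 0 < η) (u : V → Fin N → ℝ) : MeasurableSet (Bad N n β h q η r a u) := by
  have : Bad N n β h q η r a u = ⋃ v, {g | a ≤ ∑ k, AU N β (u v) k * g k + BB η β r (2 / (η ^ 2 * √n)) q n (XH N β h q 1 g) (u v)} := by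
    ext g; simp [Bad]
  rw [this]
  refine MeasurableSet.iUnion fun v => (isClosed_le continuous_const ?_).measurableSet
  exact (continuous_finsetSum _ fun k _ => continuous_const.mul (continuous_apply k)).add ((BB_cont hη β r _ q n (u v)).comp (XH_cont β h q 1))

lemma bad_bd (hN : 0 < N) (hn : 0 < n) {V : Type*} [Fintype V] {β h q r ρ a δ m θ η y : ℝ} (hq0 : 0 ≤ q) (hq1 : q ≤ 1) (hρ : ρ ^ 2 ≤ 1) (hr : √q * ρ = r)
    (hm : 0 < m) (hm1 : m ≤ 1) (hθ : 0 ≤ θ) (hη : 0 < η) (hη1 : η ≤ 1) (hy0 : 0 ≤ y) (hy : y ≤ 1 / 4)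
    (u : V → Fin N → ℝ) (hu : ∀ v, ∑ i, u v i ^ 2 = 1)
    (hT : Integrable (TTs n β h q η y r ρ (m * θ)) (gs.prod gs)) (hT2 : ∫ w, TTs n β h q η y r ρ (m * θ) w ∂(gs.prod gs) ≤ exp (m * θ * a)) :
    m * θ * N * δ * (gp (Edg N ⊕ Fin N)).real (Bad N n β h q η r (a + δ) u)
      ≤ n * (N * RS β h q 1 - pN N β h q 1) + N * (β ^ 2 / 4) * n ^ 2 * ∫ g, Q2 q (XH N β h q 1 g) ∂gp (Edg N ⊕ Fin N) + m * log (Fintype.card V + 1) + log 2 := by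
  have h0 := t0_up (n := n) hN (β := β) (h := h) (q := q) (r := r) (ρ := ρ) (a := a) hm hθ hη hη1 hy0 hy u hu hT hT2
  have h1 := interp2 (n := n) hN (β := β) hq0 hρ hr hm hm1 hθ (UU u) (fun j => by
    cases j with
    | none => left; rfl
    | some v => right; exact hu v) (c2 N n β h η r a m θ u)
  have hB := Bad_meas (N := N) (n := n) β h q r (a + δ) hη u
  obtain ⟨Bd, hBd⟩ : ∃ B, B = Bad N n β h q η r (a + δ) u := ⟨_, rfl⟩
  rw [← hBd] at hB ⊢
  have i1 : Integrable (fun g => lse (XH N β h q 1 g)) (gp (Edg N ⊕ Fin N)) := lse_integrable (XH_integrable β h q 1)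
  have i2 : Integrable (fun g => Q2 q (XH N β h q 1 g)) (gp (Edg N ⊕ Fin N)) := Q2_integrable hq0 hq1 (XH_cont β h q 1).measurable
  have i3 : Integrable (fun g => Bd.indicator (fun _ => (1:ℝ)) g) (gp (Edg N ⊕ Fin N)) := (integrable_const _).indicator hB
  have iF : Integrable (fun g => Fm m (fun s => lf (GA N n β q m θ (UU u)) g s + c2 N n β h η r a m θ u s + d2 N n β q r m θ (UU u) s)) (gp (Edg N ⊕ Fin N)) := by
    have := (Fm_smooth hm).integrable (fun g s => lf (GA N n β q m θ (UU u)) g s + (c2 N n β h η r a m θ u s + d2 N n β q r m θ (UU u) s)) (fun s => lf_add_integrable _ (fun s => c2 N n β h η r a m θ u s + d2 N n β q r m θ (UU u) s) s)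
    simpa only [add_assoc] using this
  have key : ∀ g, (n:ℝ) * lse (XH N β h q 1 g) + (- (N * (β ^ 2 / 4) * n ^ 2)) * Q2 q (XH N β h q 1 g) + m * θ * N * δ * Bd.indicator (fun _ => (1:ℝ)) g + (m * θ * N * a - N * (β ^ 2 / 4) * (n * (1 - q) ^ 2))
      ≤ m * Fm m (fun s => lf (GA N n β q m θ (UU u)) g s + c2 N n β h η r a m θ u s + d2 N n β q r m θ (UU u) s) := by
    intro g
    have := t1_low hN hn (β := β) (h := h) (q := q) (r := r) (a := a) hm hθ hη u hu g (δ := δ * Bd.indicator (fun _ => (1:ℝ)) g) (by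
      by_cases hg : g ∈ Bd
      · right
        rw [Set.indicator_of_mem hg, mul_one]
        rw [hBd] at hg; exact hg
      · left; rw [Set.indicator_of_notMem hg, mul_zero])
    refine le_trans (le_of_eq ?_) this
    ring
  have e1 : Integrable (fun g => (n:ℝ) * lse (XH N β h q 1 g)) (gp (Edg N ⊕ Fin N)) := i1.const_mul _
  have e2 : Integrable (fun g => (- (N * (β ^ 2 / 4) * n ^ 2)) * Q2 q (XH N β h q 1 g)) (gp (Edg N ⊕ Fin N)) := i2.const_mul _
  have e3 : Integrable (fun g => m * θ * N * δ * Bd.indicator (fun _ => (1:ℝ)) g) (gp (Edg N ⊕ Fin N)) := i3.const_mul _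
  have e12 : Integrable (fun g => (n:ℝ) * lse (XH N β h q 1 g) + (- (N * (β ^ 2 / 4) * n ^ 2)) * Q2 q (XH N β h q 1 g)) (gp (Edg N ⊕ Fin N)) := e1.add e2
  have e123 : Integrable (fun g => (n:ℝ) * lse (XH N β h q 1 g) + (- (N * (β ^ 2 / 4) * n ^ 2)) * Q2 q (XH N β h q 1 g) + m * θ * N * δ * Bd.indicator (fun _ => (1:ℝ)) g) (gp (Edg N ⊕ Fin N)) := e12.add e3
  have e4 : Integrable (fun g : Edg N ⊕ Fin N → ℝ => m * θ * N * a - N * (β ^ 2 / 4) * (n * (1 - q) ^ 2)) (gp (Edg N ⊕ Fin N)) := integrable_const _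
  have e5 : Integrable (fun g => (n:ℝ) * lse (XH N β h q 1 g) + (- (N * (β ^ 2 / 4) * n ^ 2)) * Q2 q (XH N β h q 1 g) + m * θ * N * δ * Bd.indicator (fun _ => (1:ℝ)) g + (m * θ * N * a - N * (β ^ 2 / 4) * (n * (1 - q) ^ 2))) (gp (Edg N ⊕ Fin N)) := e123.add e4
  have h2 := integral_mono e5 (iF.const_mul m) key
  rw [integral_add e123 e4, integral_add e12 e3, integral_add e1 e2, integral_const_mul, integral_const_mul, integral_const_mul, integral_const_mul, integral_const,
    probReal_univ, one_smul, integral_indicator hB, setIntegral_const, smul_eq_mul, mul_one] at h2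
  have h3 := mul_le_l h1 hm.le
  have h4 : m * ∫ g, Fm m (fun s => lf (GA N n β q m θ (UU u)) g s + c2 N n β h η r a m θ u s + d2 N n β q r m θ (UU u) s) ∂gp (Edg N ⊕ Fin N) ≤ m * ∫ g, Fm m (fun s => lf (GB N n β q ρ m θ (UU u)) g s + c2 N n β h η r a m θ u s) ∂gp (Fin N ⊕ Fin N) := h3
  have h5 : RS β h q 1 = RS β h q 0 + β ^ 2 / 4 * (1 - q) ^ 2 := by unfold RS; ring
  rw [h5]
  unfold pN
  have h6 := h2.trans (h4.trans h0)
  generalize (∫ g, lse (XH N β h q 1 g) ∂gp (Edg N ⊕ Fin N)) = A at *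
  generalize (∫ g, Q2 q (XH N β h q 1 g) ∂gp (Edg N ⊕ Fin N)) = B at *
  linarith
end

section
variable {N n : ℕ}
open Metric Module in
lemma sep_card (s : Finset (EuclideanSpace ℝ (Fin N))) {δ : ℝ} (hδ : 0 < δ) (hs : ∀ c ∈ s, ‖c‖ = 1)
    (h : ∀ c ∈ s, ∀ d ∈ s, c ≠ d → δ ≤ ‖c - d‖) : (s.card : ℝ) ≤ ((1 + δ / 2) / (δ / 2)) ^ N := by
  let μ : Measure (EuclideanSpace ℝ (Fin N)) := Measure.addHaar
  have hρ : 0 < 1 + δ / 2 := by linarith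
  have hfr : finrank ℝ (EuclideanSpace ℝ (Fin N)) = N := by simp
  have D : Set.Pairwise (s : Set (EuclideanSpace ℝ (Fin N))) (Function.onFun Disjoint fun c => ball c (δ / 2)) := by
    rintro c hc d hd hcd
    apply ball_disjoint_ball
    rw [dist_eq_norm]
    have := h c hc d hd hcd
    linarith
  have A_subset : (⋃ c ∈ s, ball c (δ / 2)) ⊆ ball 0 (1 + δ / 2) := by
    refine Set.iUnion₂_subset fun x hx => ?_
    apply ball_subset_ball'
    rw [dist_zero_right, hs x hx, add_comm]
  have I : (s.card : ENNReal) * ENNReal.ofReal ((δ / 2) ^ N) * μ (ball 0 1) ≤ ENNReal.ofReal ((1 + δ / 2) ^ N) * μ (ball 0 1) := by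
    have e : μ (⋃ c ∈ s, ball c (δ / 2)) = (s.card : ENNReal) * ENNReal.ofReal ((δ / 2) ^ N) * μ (ball 0 1) := by
      rw [measure_biUnion_finset D fun c _ => measurableSet_ball]
      simp only [μ.addHaar_ball_of_pos _ (half_pos hδ), hfr]
      simp only [Finset.sum_const, nsmul_eq_mul, mul_assoc]
    rw [← e]
    refine (measure_mono A_subset).trans (le_of_eq ?_)
    rw [μ.addHaar_ball_of_pos _ hρ, hfr]
  have J := (ENNReal.mul_le_mul_iff_left (measure_ball_pos μ _ zero_lt_one).ne' measure_ball_lt_top.ne).1 I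
  have := ENNReal.toReal_le_of_le_ofReal (pow_nonneg hρ.le _) J
  rw [ENNReal.toReal_mul, ENNReal.toReal_ofReal (by positivity), ENNReal.toReal_natCast] at this
  rw [div_pow, le_div_iff₀ (by positivity)]
  exact this

lemma net {δ : ℝ} (hδ : 0 < δ) : ∃ C > 0, ∀ N : ℕ, 0 < N → ∃ (V : Type) (_ : Fintype V) (u : V → Fin N → ℝ), (∀ v, ∑ i, u v i ^ 2 = 1) ∧
    log (Fintype.card V + 1) ≤ C * N ∧ ∀ w : Fin N → ℝ, ∑ i, w i ^ 2 = 1 → ∃ v, ∑ i, (w i - u v i) ^ 2 ≤ δ ^ 2 := by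
  obtain ⟨R, hR⟩ : ∃ R, R = (1 + δ / 2) / (δ / 2) := ⟨_, rfl⟩
  have hR1 : 1 ≤ R := by rw [hR, le_div_iff₀ (half_pos hδ)]; linarith
  refine ⟨log R + log 2, by have := log_nonneg hR1; have := log_pos (one_lt_two (α := ℝ)); linarith, fun N hN => ?_⟩
  let P : Finset (EuclideanSpace ℝ (Fin N)) → Prop := fun s => (∀ c ∈ s, ‖c‖ = 1) ∧ (∀ c ∈ s, ∀ d ∈ s, c ≠ d → δ ≤ ‖c - d‖)
  let K : Set ℕ := {k | ∃ s, P s ∧ s.card = k}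
  have hK0 : K.Nonempty := ⟨0, ∅, ⟨by simp, by simp⟩, rfl⟩
  have hKb : BddAbove K := by
    refine ⟨⌈R ^ N⌉₊, ?_⟩
    rintro k ⟨s, hs, rfl⟩
    have := sep_card s hδ hs.1 hs.2
    rw [← hR] at this
    exact_mod_cast this.trans (Nat.le_ceil _)
  obtain ⟨s, hs, hsc⟩ := Nat.sSup_mem hK0 hKb
  refine ⟨s, inferInstance, fun v i => v.1 i, ?_, ?_, ?_⟩
  · intro v
    have := hs.1 v.1 v.2
    rw [EuclideanSpace.norm_eq] at this
    rw [sqrt_eq_one] at this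
    simpa using this
  · have h1 := sep_card s hδ hs.1 hs.2
    rw [← hR] at h1
    have h2 : (1:ℝ) ≤ R ^ N := one_le_pow₀ hR1
    have hNr : (1:ℝ) ≤ N := by exact_mod_cast hN
    have h3 : log ((s.card : ℝ) + 1) ≤ log (R ^ N * 2) := log_le_log (by positivity) (by linarith)
    rw [log_mul (by positivity) (by norm_num), log_pow] at h3
    have := log_pos (one_lt_two (α := ℝ))
    simp only [Fintype.card_coe]
    nlinarith
  · intro w hw
    by_contra hcon
    push Not at hcon
    let w' : EuclideanSpace ℝ (Fin N) := WithLp.toLp 2 w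
    have hn1 : ‖w'‖ = 1 := by
      rw [EuclideanSpace.norm_eq, sqrt_eq_one]; simpa [w'] using hw
    have hd : ∀ c ∈ s, δ < ‖w' - c‖ := by
      intro c hc
      have := hcon ⟨c, hc⟩
      rw [EuclideanSpace.norm_eq]
      refine lt_sqrt_of_sq_lt ?_
      simpa [w'] using this
    have hns : w' ∉ s := fun hm => by have := hd _ hm; simp at this; linarith
    have hP : P (insert w' s) := by
      constructor
      · intro c hc
        rcases Finset.mem_insert.1 hc with rfl | hc
        · exact hn1
        · exact hs.1 c hc
      · intro c hc d hd' hcd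
        rcases Finset.mem_insert.1 hc with h1 | hc <;> rcases Finset.mem_insert.1 hd' with h2 | hd'
        · exact absurd (h1.trans h2.symm) hcd
        · rw [h1]; exact (hd d hd').le
        · rw [h2, norm_sub_rev]; exact (hd c hc).le
        · exact hs.2 c hc d hd' hcd
    have : (insert w' s).card ≤ sSup K := le_csSup hKb ⟨_, hP, rfl⟩
    rw [Finset.card_insert_of_notMem hns, hsc] at this
    omega

/-- quadratic form of a matrix -/
def qf (M : Fin N → Fin N → ℝ) (u : Fin N → ℝ) : ℝ := ∑ i, ∑ j, M i j * u i * u j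

lemma qf_cont (M : Fin N → Fin N → ℝ) : Continuous (qf M) := by
  unfold qf; fun_prop

lemma qf_smul (M : Fin N → Fin N → ℝ) (t : ℝ) (u : Fin N → ℝ) : qf M (fun i => t * u i) = t ^ 2 * qf M u := by
  unfold qf; simp_rw [mul_sum]
  exact scg fun i _ => scg fun j _ => by ring

lemma qf_hom (M : Fin N → Fin N → ℝ) {S : ℝ} (hS : ∀ u : Fin N → ℝ, ∑ i, u i ^ 2 = 1 → qf M u ≤ S) (u : Fin N → ℝ) : qf M u ≤ S * ∑ i, u i ^ 2 := by
  by_cases h0 : ∑ i, u i ^ 2 = 0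
  · have : u = 0 := by
      ext i
      have := (Finset.sum_eq_zero_iff_of_nonneg (fun i _ => sq_nonneg (u i))).1 h0 i (mem_univ i)
      simpa using this
    rw [this]; simp [qf]
  · have hp : 0 < ∑ i, u i ^ 2 := lt_of_le_of_ne (sum_nonneg fun i _ => sq_nonneg _) (Ne.symm h0)
    obtain ⟨D, hD⟩ : ∃ D, D = ∑ i, u i ^ 2 := ⟨_, rfl⟩
    rw [← hD] at hp ⊢
    have hs := sq_sqrt hp.le
    have hsp := sqrt_pos.2 hp
    have h1 := hS (fun i => (√D)⁻¹ * u i) (by simp_rw [mul_pow]; rw [← mul_sum, ← hD, inv_pow, hs, inv_mul_cancel₀ hp.ne'])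
    rw [qf_smul, inv_pow, hs, inv_mul_le_iff₀ hp] at h1
    linarith

lemma qf_diff (M : Fin N → Fin N → ℝ) {S δ : ℝ} (hδ : 0 < δ) (hS : ∀ u : Fin N → ℝ, ∑ i, u i ^ 2 = 1 → |qf M u| ≤ S) {u v : Fin N → ℝ}
    (hu : ∑ i, u i ^ 2 = 1) (hv : ∑ i, v i ^ 2 = 1) (hd : ∑ i, (u i - v i) ^ 2 ≤ δ ^ 2) : |qf M u - qf M v| ≤ 2 * S * δ := by
  have hS0 : 0 ≤ S := (abs_nonneg _).trans (hS u hu)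
  obtain ⟨t, ht⟩ : ∃ t, t = √(δ / 2) := ⟨_, rfl⟩
  have ht0 : 0 < t := by rw [ht]; exact sqrt_pos.2 (by linarith)
  have ht2 : t ^ 2 = δ / 2 := by rw [ht]; exact sq_sqrt (by linarith)
  have hid : qf M u - qf M v = (1 / 4) * (qf M (fun i => t * (u i + v i) + t⁻¹ * (u i - v i)) - qf M (fun i => t * (u i + v i) - t⁻¹ * (u i - v i))) := by
    unfold qf
    rw [← sum_sub_distrib, ← sum_sub_distrib, mul_sum]
    refine scg fun i _ => ?_
    rw [← sum_sub_distrib, ← sum_sub_distrib, mul_sum]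
    refine scg fun j _ => ?_
    field_simp; ring
  have hab : ∀ w, |qf M w| ≤ S * ∑ i, w i ^ 2 := by
    intro w
    refine abs_le.2 ⟨?_, qf_hom M (fun u hu => (le_abs_self _).trans (hS u hu)) w⟩
    have h1 : ∀ w, qf (fun i j => - M i j) w = - qf M w := fun w => by unfold qf; simp [Finset.sum_neg_distrib]
    have := qf_hom (fun i j => - M i j) (S := S) (fun u hu => by rw [h1]; exact (neg_le_abs _).trans (hS u hu)) w
    rw [h1] at this; linarith
  have h1 := hab (fun i => t * (u i + v i) + t⁻¹ * (u i - v i))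
  have h2 := hab (fun i => t * (u i + v i) - t⁻¹ * (u i - v i))
  have e : ∑ i, (t * (u i + v i) + t⁻¹ * (u i - v i)) ^ 2 + ∑ i, (t * (u i + v i) - t⁻¹ * (u i - v i)) ^ 2 ≤ 8 * δ := by
    have : ∑ i, (t * (u i + v i) + t⁻¹ * (u i - v i)) ^ 2 + ∑ i, (t * (u i + v i) - t⁻¹ * (u i - v i)) ^ 2
        = 2 * t ^ 2 * (2 * ∑ i, u i ^ 2 + 2 * ∑ i, v i ^ 2 - ∑ i, (u i - v i) ^ 2) + 2 * (t ^ 2)⁻¹ * ∑ i, (u i - v i) ^ 2 := by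
      simp_rw [mul_sum, ← sum_add_distrib, ← sum_sub_distrib, mul_sum, ← sum_add_distrib]
      exact scg fun i _ => by field_simp; ring
    rw [this, hu, hv, ht2]
    have h3 : 0 ≤ ∑ i, (u i - v i) ^ 2 := sum_nonneg fun i _ => sq_nonneg _
    have h4 : 2 * (δ / 2)⁻¹ * ∑ i, (u i - v i) ^ 2 ≤ 2 * (δ / 2)⁻¹ * δ ^ 2 := mul_le_l hd (by positivity)
    have h5 : 2 * (δ / 2)⁻¹ * δ ^ 2 = 4 * δ := by field_simp; ring
    nlinarith
  rw [hid, abs_mul, abs_of_pos (by norm_num : (0:ℝ) < 1 / 4)]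
  have h6 := abs_sub (qf M (fun i => t * (u i + v i) + t⁻¹ * (u i - v i))) (qf M (fun i => t * (u i + v i) - t⁻¹ * (u i - v i)))
  have h7 := mul_le_l e hS0
  rw [mul_add] at h7
  linarith

lemma qf_net (hN : 0 < N) (M : Fin N → Fin N → ℝ) {V : Type*} {K : ℝ} (u : V → Fin N → ℝ) (hu : ∀ v, ∑ i, u v i ^ 2 = 1)
    (hn : ∀ w : Fin N → ℝ, ∑ i, w i ^ 2 = 1 → ∃ v, ∑ i, (w i - u v i) ^ 2 ≤ (1 / 4) ^ 2) (hK : ∀ v, |qf M (u v)| ≤ K) (w : Fin N → ℝ) (hw : ∑ i, w i ^ 2 = 1) :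
    |qf M w| ≤ 2 * K := by
  have hc : IsCompact {w : Fin N → ℝ | ∑ i, w i ^ 2 = 1} := by
    refine Metric.isCompact_of_isClosed_isBounded (isClosed_eq (by fun_prop) continuous_const) ?_
    refine (Metric.isBounded_closedBall (x := (0 : Fin N → ℝ)) (r := 1)).subset fun w hw => ?_
    rw [mem_closedBall_zero_iff, pi_norm_le_iff_of_nonneg zero_le_one]
    intro i
    have := single_le_sum (f := fun i => w i ^ 2) (fun i _ => sq_nonneg (w i)) (mem_univ i)
    rw [Real.norm_eq_abs, ← sq_le_one_iff_abs_le_one]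
    exact this.trans (le_of_eq hw)
  obtain ⟨w0, hw0, hmax⟩ := hc.exists_isMaxOn ⟨w, hw⟩ ((qf_cont M).abs.continuousOn)
  obtain ⟨v, hv⟩ := hn w0 hw0
  have h1 := qf_diff M (S := |qf M w0|) (by norm_num) (fun u hu => hmax hu) hw0 (hu v) hv
  have h2 := abs_sub_abs_le_abs_sub (qf M w0) (qf M (u v))
  have h3 := hK v
  have h4 : |qf M w| ≤ |qf M w0| := hmax hw
  linarith
end

section
variable {N n : ℕ}

lemma AU_tail (hN : 0 < N) (β C : ℝ) {V : Type*} [Fintype V] (u : V → Fin N → ℝ) (hu : ∀ v, ∑ i, u v i ^ 2 = 1) (hV : log (Fintype.card V + 1) ≤ C * N) :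
    (gp (Edg N ⊕ Fin N)).real {g | ∃ v, C + β ^ 2 + 1 ≤ |∑ k, AU N β (u v) k * g k|} ≤ 2 * exp (- N) := by
  have hNr : (0:ℝ) < N := by exact_mod_cast hN
  have hI : ∀ (σ : ℝ) v, Integrable (fun g : Edg N ⊕ Fin N → ℝ => exp (σ * ∑ k, AU N β (u v) k * g k)) (gp (Edg N ⊕ Fin N)) := by
    intro σ v
    refine (gp_integrable_exp (|σ| * ∑ k, |AU N β (u v) k|)).mono' (Continuous.aestronglyMeasurable (by fun_prop)) (ae_of_all _ fun g => ?_)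
    rw [Real.norm_eq_abs, abs_of_pos (exp_pos _)]
    refine exp_le_exp.2 ((le_abs_self _).trans ?_)
    rw [abs_mul, mul_assoc]
    refine mul_le_l ((abs_sum_le_sum_abs _ _).trans ?_) (abs_nonneg _)
    rw [sum_mul]
    refine sum_le_sum fun k _ => ?_
    rw [abs_mul]
    exact mul_le_l (single_le_sum (f := fun k => |g k|) (fun k _ => abs_nonneg _) (mem_univ k)) (abs_nonneg _)
  have hE : ∀ (σ : ℝ) v, σ ^ 2 = N ^ 2 → ∫ g, exp (σ * ∑ k, AU N β (u v) k * g k) ∂gp (Edg N ⊕ Fin N) ≤ exp (β ^ 2 * N) := by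
    intro σ v hσ
    have hs : ∑ k, AU N β (u v) k ^ 2 = √(∑ k, AU N β (u v) k ^ 2) ^ 2 := (sq_sqrt (sum_nonneg fun k _ => sq_nonneg _)).symm
    rw [gp_integral_linear _ (f := fun x => exp (σ * x)) (by fun_prop) hs]
    simp_rw [← mul_assoc]
    rw [gs_mgf, mul_pow, ← hs, hσ]
    have := AU_AU hN β (u v) (u v)
    simp_rw [← sq, hu] at this
    rw [this]
    refine exp_le_exp.2 ?_
    have h0 : 0 ≤ ∑ i, u v i ^ 2 * u v i ^ 2 := sum_nonneg fun i _ => by positivity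
    have : (N:ℝ) ^ 2 * (2 * β ^ 2 / N * (1 ^ 2 - ∑ i, u v i ^ 2 * u v i ^ 2)) / 2 = β ^ 2 * N * (1 - ∑ i, u v i ^ 2 * u v i ^ 2) := by field_simp
    simp_rw [← sq] at this h0 ⊢
    rw [this]
    nlinarith [mul_nonneg (mul_nonneg (sq_nonneg β) hNr.le) h0]
  have hiT : ∀ v, Integrable (fun g : Edg N ⊕ Fin N → ℝ => exp (N * ∑ k, AU N β (u v) k * g k) + exp (- N * ∑ k, AU N β (u v) k * g k)) (gp (Edg N ⊕ Fin N)) :=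
    fun v => (hI N v).add (hI (-N) v)
  have hT : Integrable (fun g : Edg N ⊕ Fin N → ℝ => ∑ v, (exp (N * ∑ k, AU N β (u v) k * g k) + exp (- N * ∑ k, AU N β (u v) k * g k))) (gp (Edg N ⊕ Fin N)) :=
    integrable_finsetSum _ fun v _ => hiT v
  have hM := mul_meas_ge_le_integral_of_nonneg (ae_of_all _ fun g => sum_nonneg fun v _ => by positivity) hT (exp (N * (C + β ^ 2 + 1)))
  have hIb : ∫ g, ∑ v, (exp (N * ∑ k, AU N β (u v) k * g k) + exp (- N * ∑ k, AU N β (u v) k * g k)) ∂gp (Edg N ⊕ Fin N) ≤ 2 * exp (C * N + β ^ 2 * N) := by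
    rw [integral_finsetSum _ fun v _ => hiT v]
    calc _ ≤ ∑ v : V, 2 * exp (β ^ 2 * N) := by
          refine sum_le_sum fun v _ => ?_
          rw [integral_add (hI N v) (hI (-N) v)]
          linarith [hE N v rfl, hE (-N) v (by ring)]
      _ = 2 * (Fintype.card V * exp (β ^ 2 * N)) := by simp; ring
      _ ≤ _ := by
          rw [exp_add]
          have h1 := (log_le_iff_le_exp (by positivity)).1 hV
          have := mul_le_r ((by linarith : (Fintype.card V : ℝ) ≤ Fintype.card V + 1).trans h1) (exp_pos (β ^ 2 * N)).le
          linarith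
  have hsub : (gp (Edg N ⊕ Fin N)).real {g | ∃ v, C + β ^ 2 + 1 ≤ |∑ k, AU N β (u v) k * g k|} ≤
      (gp (Edg N ⊕ Fin N)).real {g | exp (N * (C + β ^ 2 + 1)) ≤ ∑ v, (exp (N * ∑ k, AU N β (u v) k * g k) + exp (- N * ∑ k, AU N β (u v) k * g k))} := by
    refine measureReal_mono ?_ (measure_ne_top _ _)
    rintro g ⟨v, hv⟩
    refine le_trans ?_ (single_le_sum (f := fun v => exp (N * ∑ k, AU N β (u v) k * g k) + exp (- N * ∑ k, AU N β (u v) k * g k)) (fun v _ => by positivity) (mem_univ v))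
    beta_reduce
    rcases le_abs.1 hv with h | h
    · have := exp_le_exp.2 (mul_le_l h hNr.le)
      linarith [exp_pos (- N * ∑ k, AU N β (u v) k * g k)]
    · have := exp_le_exp.2 (mul_le_l h hNr.le)
      rw [mul_neg, ← neg_mul] at this
      linarith [exp_pos (N * ∑ k, AU N β (u v) k * g k)]
  refine hsub.trans ?_
  have h2 := hM.trans hIb
  rw [← le_div_iff₀' (exp_pos _)] at h2
  refine h2.trans (le_of_eq ?_)
  rw [mul_div_assoc, ← exp_sub]; congr 2; ring

/-- limiting quadratic form -/
def FF (N : ℕ) (β h q η : ℝ) (g : Edg N ⊕ Fin N → ℝ) (u : Fin N → ℝ) : ℝ :=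
  ∑ k, AU N β u k * g k - ∑ i, phi η (mg (XH N β h q 1 g) i) * u i ^ 2 + 2 * β ^ 2 * Yv (XH N β h q 1 g) u ^ 2

lemma FF_qf (hN : 0 < N) (β h q η : ℝ) (g : Edg N ⊕ Fin N → ℝ) : ∃ M, ∀ u, FF N β h q η g u = qf M u := by
  have hNr : (0:ℝ) < N := by exact_mod_cast hN
  refine ⟨fun i j => (if hij : i < j then 2 * β / √N * g (Sum.inl ⟨(i, j), hij⟩) else 0) - (if i = j then phi η (mg (XH N β h q 1 g) i) else 0)
    + 2 * β ^ 2 / N * (mg (XH N β h q 1 g) i * mg (XH N β h q 1 g) j), fun u => ?_⟩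
  unfold FF qf Yv
  generalize XH N β h q 1 g = x
  simp_rw [add_mul, sub_mul]
  simp only [sum_add_distrib, sum_sub_distrib]
  congr 1
  · congr 1
    · rw [sum_sum_type]
      simp only [AU, Sum.elim_inl, Sum.elim_inr, Pi.zero_apply, zero_mul, sum_const_zero, add_zero]
      have := sum_edg N (fun i j => (if hij : i < j then 2 * β / √N * g (Sum.inl ⟨(i, j), hij⟩) else 0) * u i * u j)
      rw [← sum_congr rfl (fun i _ => sum_congr rfl (fun j _ => ?_)), ← this]
      · refine scg fun p _ => ?_
        rw [dif_pos p.2]; ring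
      · by_cases hij : i < j
        · rw [if_pos hij]
        · rw [if_neg hij, dif_neg hij]; ring
    · refine scg fun i _ => ?_
      simp only [ite_mul, zero_mul, Finset.sum_ite_eq, mem_univ, if_true]
      ring
  · rw [div_pow, sq_sqrt hNr.le, sq (∑ i, u i * mg x i), sum_mul_sum, mul_div_assoc', mul_sum, sum_div]
    refine scg fun i _ => ?_
    rw [mul_sum, sum_div]
    exact scg fun j _ => by ring

lemma Yv_bd (hN : 0 < N) (q : ℝ) (x : Cfg N → ℝ) (u : Fin N → ℝ) (hu : ∑ i, u i ^ 2 = 1) : Yv x u ^ 2 ≤ q + √(Q2 q x) ∧ Yv x u ^ 2 ≤ 1 := by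
  have hNr : (0:ℝ) < N := by exact_mod_cast hN
  have h1 : Yv x u ^ 2 ≤ (∑ i, mg x i ^ 2) / N := by
    unfold Yv
    rw [div_pow, sq_sqrt hNr.le]
    refine div_le_div_of_nonneg_right ?_ hNr.le
    have := Finset.sum_mul_sq_le_sq_mul_sq Finset.univ u (mg x)
    rwa [hu, one_mul] at this
  constructor
  · refine h1.trans ?_
    have e1 : (∑ i, mg x i ^ 2) / N - q = ∑ a : Cfg N × Cfg N, (gw x a.1 * gw x a.2) * (ov a.1 a.2 / N - q) := by
      rw [sum_prod_type]
      simp_rw [sq, mg_mg, mul_sub, sum_sub_distrib]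
      congr 1
      · rw [sum_div]
        refine scg fun s _ => ?_
        rw [mul_sum, sum_div]
        exact scg fun s' _ => by ring
      · simp_rw [← sum_mul, ← mul_sum, gw_sum, mul_one, gw_sum, one_mul]
    have h2 := wjensen (α := Cfg N × Cfg N) (p := fun a => gw x a.1 * gw x a.2) (fun a => (mul_pos (gw_pos x _) (gw_pos x _)).le)
      (by rw [sum_prod_type]; simp_rw [← mul_sum, gw_sum, mul_one, gw_sum]) (fun a => ov a.1 a.2 / N - q)
    rw [← e1, sum_prod_type] at h2
    have : (∑ i, mg x i ^ 2) / N - q ≤ √(Q2 q x) := Real.le_sqrt_of_sq_le h2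
    linarith
  · refine h1.trans ((div_le_one hNr).2 ?_)
    calc _ ≤ ∑ i : Fin N, (1:ℝ) := sum_le_sum fun i _ => mg_sq x i
      _ = _ := by simp

/-- grid of overlap directions -/
def grd (K : ℕ) (k : Fin (2 * K + 1)) : ℝ := k / K - 1

lemma grd_sq {K : ℕ} (hK : 0 < K) (k : Fin (2 * K + 1)) : grd K k ^ 2 ≤ 1 := by
  have hKr : (0:ℝ) < K := by exact_mod_cast hK
  unfold grd
  have h1 : (0:ℝ) ≤ k / K := by positivity
  have h2 : (k:ℝ) / K ≤ 2 := by
    rw [div_le_iff₀ hKr]; exact_mod_cast Nat.lt_succ_iff.1 k.2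
  nlinarith

lemma grd_near {K : ℕ} (hK : 0 < K) {q Y s : ℝ} (hq0 : 0 < q) (hq1 : q < 1) (hs : 0 ≤ s) (hY : Y ^ 2 ≤ q + s) : ∃ k, (Y - √q * grd K k) ^ 2 ≤ s + 1 / K ^ 2 := by
  have hKr : (0:ℝ) < K := by exact_mod_cast hK
  have hsq := sq_sqrt hq0.le
  have hsp := sqrt_pos.2 hq0
  have hk2 : (0:ℝ) ≤ 1 / (K:ℝ) ^ 2 := by positivity
  rcases le_total Y (-√q) with h | h
  · refine ⟨⟨0, by omega⟩, ?_⟩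
    simp only [grd, Nat.cast_zero, zero_div]
    nlinarith
  rcases le_total (√q) Y with h' | h'
  · refine ⟨⟨2 * K, by omega⟩, ?_⟩
    have : grd K ⟨2 * K, by omega⟩ = 1 := by simp only [grd]; push_cast; field_simp; norm_num
    rw [this]
    nlinarith
  · obtain ⟨x, hx⟩ : ∃ x, x = Y / √q := ⟨_, rfl⟩
    have hx1 : -1 ≤ x := by rw [hx, le_div_iff₀ hsp]; linarith
    have hx2 : x ≤ 1 := by rw [hx, div_le_iff₀ hsp]; linarith
    have hxe : Y = √q * x := by rw [hx]; field_simp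
    have hn0 : 0 ≤ (x + 1) * K := mul_nonneg (by linarith) hKr.le
    have hf := Nat.floor_le hn0
    have hf2 := Nat.lt_floor_add_one ((x + 1) * K)
    have hb : ⌊(x + 1) * K⌋₊ < 2 * K + 1 := by
      have : ((⌊(x + 1) * K⌋₊ : ℕ) : ℝ) ≤ 2 * K := by nlinarith
      have : ⌊(x + 1) * K⌋₊ ≤ 2 * K := by exact_mod_cast this
      omega
    refine ⟨⟨_, hb⟩, ?_⟩
    simp only [grd]
    generalize ((⌊(x + 1) * K⌋₊ : ℕ) : ℝ) = f at *
    have e : (Y - √q * (f / K - 1)) ^ 2 = q * ((((x + 1) * K - f)) ^ 2 / K ^ 2) := by rw [hxe, ← hsq]; field_simp; rw [sqrt_sq hsp.le]; ring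
    rw [e]
    have h3 : ((x + 1) * K - f) ^ 2 ≤ 1 := by nlinarith
    have h4 : ((x + 1) * K - f) ^ 2 / (K:ℝ) ^ 2 ≤ 1 / (K:ℝ) ^ 2 := div_le_div_of_nonneg_right h3 (by positivity)
    have h5 : 0 ≤ ((x + 1) * K - f) ^ 2 / (K:ℝ) ^ 2 := by positivity
    nlinarith
end

section
variable {N n : ℕ} {β h q : ℝ}

lemma big_sqrt (A : ℝ) {B : ℝ} (hA : 0 ≤ A) (hB : 0 < B) : ∃ n0 : ℕ, ∀ n : ℕ, n0 ≤ n → 0 < n → A / √n ≤ B := by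
  refine ⟨⌈(A / B) ^ 2⌉₊, fun n hn hn0 => ?_⟩
  have hnr : (0:ℝ) < n := by exact_mod_cast hn0
  have h1 : (A / B) ^ 2 ≤ n := (Nat.le_ceil _).trans (by exact_mod_cast hn)
  have h2 : A / B ≤ √n := Real.le_sqrt_of_sq_le h1
  rw [div_le_iff₀ (sqrt_pos.2 hnr)]
  rw [div_le_iff₀ hB] at h2
  linarith

lemma bad_prob (hβ : 0 < β) (hfix : isFixedq β h q) (hAT : ATcond β h q) (hA : ATplus β h q) :
    ∃ η > 0, ∃ c1 > 0, ∃ n : ℕ, 0 < n ∧ 2 / (η ^ 2 * √n) ≤ c1 / 16 ∧ ∀ ρ, ρ ^ 2 ≤ 1 → ∀ Cn > 0, ∀ κ > 0, ∃ N0 : ℕ, ∀ N : ℕ, N0 ≤ N → 0 < N →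
      ∀ (V : Type) (_ : Fintype V) (u : V → Fin N → ℝ), (∀ v, ∑ i, u v i ^ 2 = 1) → log (Fintype.card V + 1) ≤ Cn * N →
      (gp (Edg N ⊕ Fin N)).real (Bad N n β h q η (√q * ρ) (β ^ 2 * (1 - q) - c1 / 2 + c1 / 8) u) ≤ κ := by
  obtain ⟨y, hy0, hy, c1, hc1, hgap⟩ := gap hβ hfix hAT
  obtain ⟨C, hC, ε0, hε0, hTT⟩ := TTs_bd β
  have hη : 0 < y ^ 2 := by positivity
  have hη1 : y ^ 2 ≤ 1 := by nlinarith
  obtain ⟨n1, hn1⟩ := big_sqrt C hC.le (by positivity : 0 < c1 / 4)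
  obtain ⟨n2, hn2⟩ := big_sqrt (2 / (y ^ 2) ^ 2) (by positivity) (by positivity : 0 < c1 / 16)
  obtain ⟨n, hn, hna, hnb⟩ : ∃ n : ℕ, 0 < n ∧ n1 ≤ n ∧ n2 ≤ n := ⟨n1 + n2 + 1, by omega, by omega, by omega⟩
  have hnr : (0:ℝ) < n := by exact_mod_cast hn
  refine ⟨y ^ 2, hη, c1, hc1, n, hn, ?_, ?_⟩
  · have := hn2 n hnb hn
    rwa [div_div] at this
  intro ρ hρ Cn hCn κ hκ
  obtain ⟨hq0, hq1, hqf⟩ := id hfix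
  obtain ⟨ε, hε, hεa, hεb⟩ : ∃ ε > 0, ε ≤ ε0 ∧ C * ε ≤ c1 / 4 := by
    refine ⟨min ε0 (c1 / (4 * C)), by positivity, min_le_left _ _, ?_⟩
    have := min_le_right ε0 (c1 / (4 * C))
    rw [le_div_iff₀ (by positivity)] at this
    linarith
  obtain ⟨r, hr⟩ : ∃ r, √q * ρ = r := ⟨_, rfl⟩
  have hr1 : r ^ 2 ≤ 1 := by rw [← hr, mul_pow, sq_sqrt hq0.le]; nlinarith [sq_nonneg ρ]
  obtain ⟨i1, i2, i3⟩ := hTT n h q ε (y ^ 2) y r ρ hn hε hεa hη hη1 hy0.le hy hr1 hρ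
  have hg := hgap r ρ hr hρ i1
  have hTa : ∫ w, TTs n β h q (y ^ 2) y r ρ ε w ∂(gs.prod gs) ≤ exp (ε * (β ^ 2 * (1 - q) - c1 / 2)) := by
    refine i3.trans (exp_le_exp.2 (mul_le_l ?_ hε.le))
    have := hn1 n hna hn
    linarith
  obtain ⟨Z, hZ⟩ : ∃ Z, Z = ε * (c1 / 8) * κ := ⟨_, rfl⟩
  have hZ0 : 0 < Z := by rw [hZ]; positivity
  obtain ⟨m, hm, hm1, hmC⟩ : ∃ m > 0, m ≤ 1 ∧ m * Cn ≤ Z / 4 := by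
    refine ⟨min 1 (Z / (4 * Cn)), by positivity, min_le_left _ _, ?_⟩
    have := min_le_right 1 (Z / (4 * Cn))
    rw [le_div_iff₀ (by positivity)] at this
    linarith
  have hmθ : m * (ε / m) = ε := by field_simp
  obtain ⟨D, hD⟩ : ∃ D, D = n + β ^ 2 / 4 * (n:ℝ) ^ 2 := ⟨_, rfl⟩
  have hD0 : 0 < D := by rw [hD]; positivity
  obtain ⟨N1, hN1⟩ := RS_main hβ hfix hAT hA (by positivity : 0 < Z / (4 * D))
  refine ⟨max N1 ⌈log 2 / (Z / 4)⌉₊, fun N hN hNp V _ u hu hV => ?_⟩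
  have hNr : (0:ℝ) < N := by exact_mod_cast hNp
  obtain ⟨h1, h2⟩ := hN1 N ((le_max_left _ _).trans hN) hNp
  have h3 : log 2 ≤ N * (Z / 4) := by
    have : log 2 / (Z / 4) ≤ N := (Nat.le_ceil _).trans (by exact_mod_cast (le_max_right _ _).trans hN)
    rwa [div_le_iff₀ (by positivity)] at this
  rw [hr]
  have key := bad_bd (n := n) (h := h) (a := β ^ 2 * (1 - q) - c1 / 2) (δ := c1 / 8) hNp hn hq0.le hq1.le hρ hr hm hm1 (by positivity : 0 ≤ ε / m) hη hη1 hy0.le hy u hu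
    (by rw [hmθ]; exact i2) (by rw [hmθ]; exact hTa)
  rw [hmθ] at key
  generalize (gp (Edg N ⊕ Fin N)).real (Bad N n β h q (y ^ 2) r (β ^ 2 * (1 - q) - c1 / 2 + c1 / 8) u) = p at *
  generalize (∫ g, Q2 q (XH N β h q 1 g) ∂gp (Edg N ⊕ Fin N)) = B at *
  have k1 := mul_le_l h1 hnr.le
  have k2 := mul_le_l h2 (by positivity : 0 ≤ N * (β ^ 2 / 4) * (n:ℝ) ^ 2)
  have k3 := mul_le_l hV hm.le
  have k4 := mul_le_r hmC hNr.le
  have k5 : (n:ℝ) * (N * (Z / (4 * D))) + N * (β ^ 2 / 4) * n ^ 2 * (Z / (4 * D)) = N * (Z / 4) := by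
    have : (n:ℝ) * (N * (Z / (4 * D))) + N * (β ^ 2 / 4) * n ^ 2 * (Z / (4 * D)) = N * (D * (Z / (4 * D))) := by rw [hD]; ring
    rw [this]; field_simp
  have k6 : ε * N * (c1 / 8) * p ≤ ε * N * (c1 / 8) * κ := by
    have : ε * N * (c1 / 8) * κ = N * Z := by rw [hZ]; ring
    rw [this]
    have : 0 < N * Z := by positivity
    linarith
  exact le_of_mul_le_mul_left k6 (by positivity)

/-- the favourable event -/
def Gd (N : ℕ) (β h q η c : ℝ) : Set (Edg N ⊕ Fin N → ℝ) :=
  {g | ∀ w : Fin N → ℝ, ∑ i, w i ^ 2 = 1 → FF N β h q η g w ≤ β ^ 2 * (1 - q) - c}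

lemma gp_main (hβ : 0 < β) (hfix : isFixedq β h q) (hAT : ATcond β h q) (hA : ATplus β h q) :
    ∃ η > 0, ∃ c > 0, ∀ κ > 0, ∃ N0 : ℕ, ∀ N : ℕ, N0 ≤ N → 0 < N → (gp (Edg N ⊕ Fin N)).real (Gd N β h q η c)ᶜ ≤ κ := by
  obtain ⟨η, hη, c1, hc1, n, hn, hL, hbad⟩ := bad_prob hβ hfix hAT hA
  have hnr : (0:ℝ) < n := by exact_mod_cast hn
  obtain ⟨hq0, hq1, hqf⟩ := id hfix
  refine ⟨η, hη, c1 / 8, by positivity, fun κ hκ => ?_⟩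
  obtain ⟨C1, hC1, hnet1⟩ := net (δ := 1 / 4) (by norm_num)
  obtain ⟨S, hS⟩ : ∃ S, S = 2 * (C1 + β ^ 2 + 1 + η⁻¹ + 2 * β ^ 2) := ⟨_, rfl⟩
  have hS0 : 0 < S := by rw [hS]; positivity
  obtain ⟨C2, hC2, hnet2⟩ := net (δ := c1 / (16 * S)) (by positivity)
  obtain ⟨K0, hK0⟩ := big_sqrt ((2 + n) * β ^ 2) (by positivity) (by positivity : 0 < c1 / 32)
  obtain ⟨K, hK, hKb⟩ : ∃ K : ℕ, 0 < K ∧ (2 + n) * β ^ 2 * (1 / (K:ℝ) ^ 2) ≤ c1 / 32 := by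
    refine ⟨K0 + 1, by omega, ?_⟩
    have h1 := hK0 ((K0 + 1) ^ 4) (by nlinarith [Nat.zero_le K0, sq_nonneg K0, pow_pos (Nat.succ_pos K0) 3, Nat.le_self_pow (n := 4) (by norm_num) (K0 + 1)]) (by positivity)
    have e : √(((K0 + 1) ^ 4 : ℕ) : ℝ) = ((K0 + 1 : ℕ) : ℝ) ^ 2 := by
      rw [show (((K0 + 1) ^ 4 : ℕ) : ℝ) = (((K0 + 1 : ℕ) : ℝ) ^ 2) ^ 2 by push_cast; ring]
      exact sqrt_sq (by positivity)
    rw [e] at h1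
    rw [mul_one_div]; exact h1
  obtain ⟨s, hs, hsb⟩ : ∃ s > 0, (2 + 5 * n) * β ^ 2 * s ≤ c1 / 32 := ⟨c1 / 32 / ((2 + 5 * n) * β ^ 2), by positivity, le_of_eq (by field_simp)⟩
  have hcard : (0:ℝ) < 2 * K + 1 := by positivity
  have hb := fun k : Fin (2 * K + 1) => hbad (grd K k) (grd_sq hK k) C2 hC2 (κ / 4 / (2 * K + 1)) (by positivity)
  choose Nk hNk using hb
  obtain ⟨N1, hN1⟩ := RS_main hβ hfix hAT hA (by positivity : 0 < κ / 4 * s ^ 2)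
  refine ⟨max (∑ k, Nk k) (max N1 ⌈8 / κ⌉₊), fun N hN hNp => ?_⟩
  have hNr : (0:ℝ) < N := by exact_mod_cast hNp
  obtain ⟨V1, _, u1, hu1, hV1, hc1'⟩ := hnet1 N hNp
  obtain ⟨V2, _, u2, hu2, hV2, hc2'⟩ := hnet2 N hNp
  obtain ⟨μ, hμ⟩ : ∃ μ, μ = gp (Edg N ⊕ Fin N) := ⟨_, rfl⟩
  obtain ⟨B0, hB0⟩ : ∃ B, B = ⋃ k : Fin (2 * K + 1), Bad N n β h q η (√q * grd K k) (β ^ 2 * (1 - q) - c1 / 2 + c1 / 8) u2 := ⟨_, rfl⟩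
  obtain ⟨B1, hB1⟩ : ∃ B, B = {g : Edg N ⊕ Fin N → ℝ | ∃ v, C1 + β ^ 2 + 1 ≤ |∑ k, AU N β (u1 v) k * g k|} := ⟨_, rfl⟩
  obtain ⟨B2, hB2⟩ : ∃ B, B = {g : Edg N ⊕ Fin N → ℝ | s ^ 2 ≤ Q2 q (XH N β h q 1 g)} := ⟨_, rfl⟩
  have p0 : (gp (Edg N ⊕ Fin N)).real B0 ≤ κ / 4 := by
    rw [hB0]
    refine (measureReal_iUnion_fintype_le _).trans ?_
    calc _ ≤ ∑ k : Fin (2 * K + 1), κ / 4 / (2 * K + 1) := sum_le_sum fun k _ =>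
          hNk k N ((single_le_sum (fun k _ => Nat.zero_le (Nk k)) (mem_univ k)).trans ((le_max_left _ _).trans hN)) hNp V2 _ u2 hu2 hV2
      _ = κ / 4 := by simp; field_simp
  have p1 : (gp (Edg N ⊕ Fin N)).real B1 ≤ κ / 4 := by
    rw [hB1]
    refine (AU_tail hNp β C1 u1 hu1 hV1).trans ?_
    have h1 : 8 / κ ≤ N := (Nat.le_ceil _).trans (by exact_mod_cast (le_max_right _ _).trans ((le_max_right _ _).trans hN))
    rw [div_le_iff₀ hκ] at h1
    have h2 := add_one_le_exp (N:ℝ)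
    rw [exp_neg, mul_inv_le_iff₀ (exp_pos _)]
    nlinarith
  have p2 : (gp (Edg N ⊕ Fin N)).real B2 ≤ κ / 4 := by
    have h1 := mul_meas_ge_le_integral_of_nonneg (ae_of_all _ fun g => Q2_nonneg q (XH N β h q 1 g)) (Q2_integrable (μ := gp (Edg N ⊕ Fin N)) hq0.le hq1.le (XH_cont β h q 1).measurable) (s ^ 2)
    have h2 := (hN1 N ((le_max_left _ _).trans ((le_max_right _ _).trans hN)) hNp).2
    have h3 := h1.trans h2
    rw [← hB2, mul_comm] at h3
    exact le_of_mul_le_mul_right h3 (by positivity)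
  have hsub : (Gd N β h q η (c1 / 8))ᶜ ⊆ B0 ∪ (B1 ∪ B2) := by
    rw [Set.compl_subset_comm]
    intro g hg
    simp only [Set.mem_compl_iff, Set.mem_union, not_or] at hg
    obtain ⟨g0, g1, g2⟩ := hg
    obtain ⟨M, hM⟩ := FF_qf hNp β h q η g
    rw [hB2] at g2
    rw [hB1] at g1
    rw [hB0] at g0
    simp only [Set.mem_iUnion, Set.mem_setOf_eq, Bad, not_exists, not_le] at g0 g1 g2
    obtain ⟨x, hx⟩ : ∃ x, x = XH N β h q 1 g := ⟨_, rfl⟩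
    have hQ : √(Q2 q x) ≤ s := by rw [Real.sqrt_le_left hs.le, hx]; exact g2.le
    have hQ0 := sqrt_nonneg (Q2 q x)
    have hS1 : ∀ w : Fin N → ℝ, ∑ i, w i ^ 2 = 1 → |qf M w| ≤ S := by
      intro w hw
      rw [hS]
      refine qf_net hNp M u1 hu1 hc1' (fun v => ?_) w hw
      rw [← hM]
      unfold FF
      rw [← hx]
      have a1 := g1 v
      have a2 := (Yv_bd hNp q x (u1 v) (hu1 v)).2
      have a3 : 0 ≤ ∑ i, phi η (mg x i) * u1 v i ^ 2 := sum_nonneg fun i _ => mul_nonneg (inv_nonneg.2 (by have := mg_sq x i; linarith)) (sq_nonneg _)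
      have a4 : ∑ i, phi η (mg x i) * u1 v i ^ 2 ≤ η⁻¹ := by
        calc _ ≤ ∑ i, η⁻¹ * u1 v i ^ 2 := sum_le_sum fun i _ => mul_le_r (inv_anti₀ hη (by have := mg_sq x i; linarith)) (sq_nonneg _)
          _ = η⁻¹ := by rw [← mul_sum, hu1, mul_one]
      have a5 := mul_le_l a2 (by positivity : 0 ≤ 2 * β ^ 2)
      have a6 := mul_nonneg (by positivity : 0 ≤ 2 * β ^ 2) (sq_nonneg (Yv x (u1 v)))
      rw [abs_lt] at a1
      rw [abs_le]
      constructor <;> linarith [inv_pos.2 hη, sq_nonneg β]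
    intro w hw
    obtain ⟨v, hv⟩ := hc2' w hw
    have h1 := (abs_le.1 (qf_diff M (by positivity) hS1 hw (hu2 v) hv)).2
    have e1 : 2 * S * (c1 / (16 * S)) = c1 / 8 := by field_simp; norm_num
    rw [e1, ← hM, ← hM] at h1
    obtain ⟨k, hk⟩ := grd_near hK hq0 hq1 hQ0 (Yv_bd hNp q x (u2 v) (hu2 v)).1
    have h2 := g0 k v
    unfold BB at h2
    have h3 : FF N β h q η g (u2 v) = ∑ k, AU N β (u2 v) k * g k - ∑ i, phi η (mg x i) * u2 v i ^ 2 + 2 * β ^ 2 * Yv x (u2 v) ^ 2 := by rw [hx]; rfl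
    rw [← hx] at h2
    have h4 := mul_le_l hk (by positivity : 0 ≤ (2 + n) * β ^ 2)
    have h5 := mul_le_l hQ (by positivity : 0 ≤ (2 + 5 * n) * β ^ 2)
    generalize √(Q2 q x) = t at *
    nlinarith
  calc _ ≤ (gp (Edg N ⊕ Fin N)).real (B0 ∪ (B1 ∪ B2)) := measureReal_mono hsub (measure_ne_top _ _)
    _ ≤ (gp (Edg N ⊕ Fin N)).real B0 + ((gp (Edg N ⊕ Fin N)).real B1 + (gp (Edg N ⊕ Fin N)).real B2) :=
        (measureReal_union_le _ _).trans (add_le_add le_rfl (measureReal_union_le _ _))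
    _ ≤ κ := by linarith
end

section
variable {N n : ℕ} {β h q : ℝ}

lemma mg_lt (x : Cfg N → ℝ) (i : Fin N) : mg x i ^ 2 < 1 := by
  have hg := gw_sum x
  have h1 : 0 < 1 - mg x i := by
    have e : 1 - mg x i = ∑ s, gw x s * (1 - sp (s i)) := by
      simp_rw [mul_sub, mul_one]; rw [sum_sub_distrib, hg]; rfl
    rw [e]
    refine Finset.sum_pos' (fun s _ => mul_nonneg (gw_pos x s).le ?_) ⟨fun _ => false, mem_univ _, ?_⟩
    · cases s i <;> simp [sp]
    · exact mul_pos (gw_pos x _) (by simp [sp])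
  have h2 : 0 < 1 + mg x i := by
    have e : 1 + mg x i = ∑ s, gw x s * (1 + sp (s i)) := by
      simp_rw [mul_add, mul_one]; rw [sum_add_distrib, hg]; rfl
    rw [e]
    refine Finset.sum_pos' (fun s _ => mul_nonneg (gw_pos x s).le ?_) ⟨fun _ => true, mem_univ _, ?_⟩
    · cases s i <;> simp [sp]
    · exact mul_pos (gw_pos x _) (by simp [sp])
  nlinarith

/-- Gaussian coordinates attached to a coupling matrix -/
def vec (N : ℕ) (G : Fin N → Fin N → ℝ) : Edg N → ℝ := fun p => √N * G p.1.1 p.1.2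

lemma XH_vec (hN : 0 < N) (β h q : ℝ) (G : Fin N → Fin N → ℝ) (s : Cfg N) :
    XH N β h q 1 (Sum.elim (vec N G) 0) s = hamiltonian N β G (fun _ => h) (fun i => spin (s i)) := by
  have hs : √(N:ℝ) ≠ 0 := (sqrt_pos.2 (by exact_mod_cast hN)).ne'
  unfold XH hamiltonian lf
  rw [sum_sum_type]
  simp only [Sum.elim_inl, Sum.elim_inr, Pi.zero_apply, mul_zero, sum_const_zero, add_zero]
  congr 1
  · rw [← sum_edg N (fun i j => G i j * spin (s i) * spin (s j)), mul_sum]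
    refine scg fun p _ => ?_
    simp only [HA, Sum.elim_inl, vec, sqrt_one, one_mul]
    have e : ∀ b, spin b = sp b := fun _ => rfl
    rw [e, e]
    field_simp
  · rw [mul_sum]; rfl

lemma mag_eq (hN : 0 < N) (β h q : ℝ) (G : Fin N → Fin N → ℝ) (i : Fin N) :
    mag N β G (fun _ => h) i = mg (XH N β h q 1 (Sum.elim (vec N G) 0)) i := by
  unfold mag gibbs partitionZ mg gw
  rw [sum_div]
  refine scg fun s _ => ?_
  simp_rw [XH_vec hN]
  have e : ∀ b, spin b = sp b := fun _ => rfl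
  rw [e]; ring

lemma AU_vec (hN : 0 < N) (β : ℝ) (G : Fin N → Fin N → ℝ) (hs : ∀ i j, G i j = G j i) (hd : ∀ i, G i i = 0) (u : Fin N → ℝ) :
    ∑ k, AU N β u k * (Sum.elim (vec N G) 0 : Edg N ⊕ Fin N → ℝ) k = ∑ i, ∑ j, u i * (β * G i j * u j) := by
  have hsq : √(N:ℝ) ≠ 0 := (sqrt_pos.2 (by exact_mod_cast hN)).ne'
  rw [sum_sum_type]
  simp only [AU, Sum.elim_inl, Sum.elim_inr, Pi.zero_apply, mul_zero, sum_const_zero, add_zero]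
  have h1 : ∀ i j, u i * (β * G i j * u j) = (if i < j then u i * (β * G i j * u j) else 0) + (if j < i then u i * (β * G i j * u j) else 0) := by
    intro i j
    rcases lt_trichotomy i j with h | h | h
    · simp [h, h.not_gt]
    · simp [h, hd]
    · simp [h, h.not_gt]
  rw [scg fun i _ => scg fun j _ => h1 i j]
  simp only [sum_add_distrib]
  have h2 : ∑ i, ∑ j, (if j < i then u i * (β * G i j * u j) else 0) = ∑ i, ∑ j, (if i < j then u i * (β * G i j * u j) else 0) := by
    rw [sum_comm]
    refine scg fun i _ => scg fun j _ => ?_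
    rw [hs j i]; congr 1; ring
  rw [h2, ← two_mul, ← sum_edg N (fun i j => u i * (β * G i j * u j)), mul_sum]
  refine scg fun p _ => ?_
  simp only [vec]; field_simp

lemma hess_dot (N : ℕ) (β h q : ℝ) (G : Fin N → Fin N → ℝ) (u : Fin N → ℝ) :
    dotp N u (mulVec N (hessMat N β h q G) u) = ∑ i, (1 - mag N β G (fun _ => h) i ^ 2)⁻¹ * u i ^ 2 + β ^ 2 * (1 - q) * ∑ i, u i ^ 2 - ∑ i, ∑ j, u i * (β * G i j * u j) := by
  unfold dotp mulVec hessMat idMat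
  rw [mul_sum, ← sum_add_distrib, ← sum_sub_distrib]
  refine scg fun i _ => ?_
  simp_rw [sub_mul, add_mul]
  rw [sum_sub_distrib, sum_add_distrib, mul_sub, mul_add, mul_sum (f := fun j => β * G i j * u j)]
  simp only [ite_mul, mul_ite, mul_one, mul_zero, zero_mul, Finset.sum_ite_eq, mem_univ, if_true]
  ring

lemma hess'_dot (N : ℕ) (β h q : ℝ) (G : Fin N → Fin N → ℝ) (u : Fin N → ℝ) :
    dotp N u (mulVec N (hessMat' N β h q G) u) = dotp N u (mulVec N (hessMat N β h q G) u) - 2 * β ^ 2 / N * (∑ i, u i * mag N β G (fun _ => h) i) ^ 2 := by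
  unfold dotp mulVec hessMat'
  rw [sq (∑ i, u i * mag N β G (fun _ => h) i), sum_mul_sum, mul_sum, ← sum_sub_distrib]
  refine scg fun i _ => ?_
  simp_rw [sub_mul]
  rw [sum_sub_distrib, mul_sub, mul_sum (f := fun j => 2 * β ^ 2 / N * (mag N β G (fun _ => h) i * mag N β G (fun _ => h) j) * u j), mul_sum (f := fun j => u i * mag N β G (fun _ => h) i * (u j * mag N β G (fun _ => h) j))]
  congr 1
  exact scg fun j _ => by ring

lemma hess'_low (hN : 0 < N) {η c : ℝ} (hη : 0 < η) (G : Fin N → Fin N → ℝ) (hs : ∀ i j, G i j = G j i) (hd : ∀ i, G i i = 0)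
    (hg : Sum.elim (vec N G) 0 ∈ Gd N β h q η c) (u : Fin N → ℝ) : c * (∑ i, u i ^ 2) ≤ dotp N u (mulVec N (hessMat' N β h q G) u) := by
  have hNr : (0:ℝ) < N := by exact_mod_cast hN
  obtain ⟨M, hM⟩ := FF_qf hN β h q η (Sum.elim (vec N G) 0)
  have h1 := qf_hom M (fun w hw => by rw [← hM]; exact hg w hw) u
  rw [← hM] at h1
  unfold FF at h1
  rw [AU_vec hN β G hs hd] at h1
  rw [hess'_dot, hess_dot]
  simp_rw [mag_eq hN β h q]
  generalize XH N β h q 1 (Sum.elim (vec N G) 0) = x at *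
  have h2 : ∑ i, phi η (mg x i) * u i ^ 2 ≤ ∑ i, (1 - mg x i ^ 2)⁻¹ * u i ^ 2 := sum_le_sum fun i _ =>
    mul_le_r (inv_anti₀ (by have := mg_lt x i; linarith) (by linarith)) (sq_nonneg _)
  have h3 : 2 * β ^ 2 * Yv x u ^ 2 = 2 * β ^ 2 / N * (∑ i, u i * mg x i) ^ 2 := by
    unfold Yv; rw [div_pow, sq_sqrt hNr.le]; ring
  linarith

lemma inv_of_low {c : ℝ} (hc : 0 < c) (A : Fin N → Fin N → ℝ) (hA : ∀ u : Fin N → ℝ, c * (∑ i, u i ^ 2) ≤ dotp N u (mulVec N A u)) :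
    ∃ B : Fin N → Fin N → ℝ, matMul N A B = idMat N ∧ matMul N B A = idMat N ∧ opNorm N B ≤ c⁻¹ := by
  let A' : Matrix (Fin N) (Fin N) ℝ := Matrix.of A
  have hz : ∀ u : Fin N → ℝ, A'.mulVec u = 0 → u = 0 := by
    intro u hu
    have h1 := hA u
    have h2 : mulVec N A u = 0 := hu
    rw [h2] at h1
    simp only [dotp, Pi.zero_apply, mul_zero, sum_const_zero] at h1
    have h3 : ∑ i, u i ^ 2 = 0 := le_antisymm (by nlinarith) (sum_nonneg fun i _ => sq_nonneg _)
    ext i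
    have := (Finset.sum_eq_zero_iff_of_nonneg (fun i _ => sq_nonneg (u i))).1 h3 i (mem_univ i)
    simpa using this
  have hinj : Function.Injective A'.mulVec := by
    intro u v huv
    have := hz (u - v) (by rw [Matrix.mulVec_sub, sub_eq_zero]; exact huv)
    exact sub_eq_zero.1 this
  have hU : IsUnit A'.det := (Matrix.isUnit_iff_isUnit_det _).1 (Matrix.mulVec_injective_iff_isUnit.1 hinj)
  have hid : ∀ i j, (1 : Matrix (Fin N) (Fin N) ℝ) i j = idMat N i j := fun i j => by simp [Matrix.one_apply, idMat]
  have hAB : matMul N A (fun i j => A'⁻¹ i j) = idMat N := by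
    ext i j
    rw [← hid, ← Matrix.mul_nonsing_inv A' hU]; rfl
  refine ⟨fun i j => A'⁻¹ i j, hAB, ?_, ?_⟩
  · ext i j
    rw [← hid, ← Matrix.nonsing_inv_mul A' hU]; rfl
  · refine Real.sSup_le ?_ (by positivity)
    rintro _ ⟨u, hu, rfl⟩
    obtain ⟨w, hw⟩ : ∃ w : Fin N → ℝ, w = fun i => ∑ j, A'⁻¹ i j * u j := ⟨_, rfl⟩
    have hAw : mulVec N A w = u := by
      have : A'.mulVec (A'⁻¹.mulVec u) = u := by rw [Matrix.mulVec_mulVec, Matrix.mul_nonsing_inv A' hU, Matrix.one_mulVec]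
      rw [hw]; exact this
    have h1 := hA w
    rw [hAw] at h1
    have e : ∑ i, (∑ j, A'⁻¹ i j * u j) ^ 2 = ∑ i, w i ^ 2 := by rw [hw]
    rw [e]
    have h2 := Finset.sum_mul_sq_le_sq_mul_sq Finset.univ w u
    rw [hu, mul_one] at h2
    unfold dotp at h1
    obtain ⟨D, hD⟩ : ∃ D, D = ∑ i, w i ^ 2 := ⟨_, rfl⟩
    have hD0 : 0 ≤ D := by rw [hD]; exact sum_nonneg fun i _ => sq_nonneg _
    rw [← hD] at h1 h2 ⊢
    have h3 : ∑ i, w i * u i ≤ √D := Real.le_sqrt_of_sq_le h2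
    have h4 := sq_sqrt hD0
    have h5 := sqrt_nonneg D
    rw [← one_div, le_div_iff₀ hc]
    by_contra hcon
    push Not at hcon
    have : 0 < √D := by
      rcases h5.lt_or_eq with h | h
      · exact h
      · rw [← h] at hcon; linarith
    nlinarith

lemma FF_cont {η : ℝ} (hη : 0 < η) (β h q : ℝ) (w : Fin N → ℝ) : Continuous (fun g => FF N β h q η g w) := by
  unfold FF phi
  have hx := XH_cont (N := N) β h q 1
  have h1 : Continuous (fun g => ∑ i, (1 + η - mg (XH N β h q 1 g) i ^ 2)⁻¹ * w i ^ 2) := by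
    refine continuous_finsetSum _ fun i _ => Continuous.mul (Continuous.inv₀ (continuous_const.sub (((mg_cont i).comp hx).pow 2)) ?_) continuous_const
    intro g; have := mg_sq (XH N β h q 1 g) i; linarith
  have h2 := (Yv_cont w).comp hx
  have h3 : Continuous (fun g : Edg N ⊕ Fin N → ℝ => ∑ k, AU N β w k * g k) := by fun_prop
  exact (h3.sub h1).add (continuous_const.mul (h2.pow 2))

lemma Gd_meas {η : ℝ} (hη : 0 < η) (β h q c : ℝ) : MeasurableSet (Gd N β h q η c) := by
  have : Gd N β h q η c = ⋂ w : Fin N → ℝ, ⋂ _ : ∑ i, w i ^ 2 = 1, {g | FF N β h q η g w ≤ β ^ 2 * (1 - q) - c} := by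
    ext g; simp [Gd]
  rw [this]
  exact (isClosed_iInter fun w => isClosed_iInter fun _ => isClosed_le (FF_cont hη β h q w) continuous_const).measurableSet

lemma FF_inl (β h q η : ℝ) (g : Edg N ⊕ Fin N → ℝ) (w : Fin N → ℝ) : FF N β h q η (Sum.elim (fun k => g (Sum.inl k)) 0) w = FF N β h q η g w := by
  have h1 : XH N β h q 1 (Sum.elim (fun k => g (Sum.inl k)) 0) = XH N β h q 1 g := by
    ext s; unfold XH lf; simp [sum_sum_type, HA]
  unfold FF
  rw [h1]
  congr 2
  simp [sum_sum_type, AU]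

lemma law_vec (hN : 0 < N) {Ω : Type*} [MeasurableSpace Ω] (P : Measure Ω) [IsProbabilityMeasure P] (G : Ω → Fin N → Fin N → ℝ) (hG : IsGOE N P G) :
    AEMeasurable (fun ω => vec N (G ω)) P ∧ P.map (fun ω => vec N (G ω)) = gp (Edg N) := by
  have hNr : (0:ℝ) < N := by exact_mod_cast hN
  obtain ⟨-, -, hi, hl⟩ := hG
  have hm : ∀ p : Edg N, AEMeasurable (fun ω => G ω p.1.1 p.1.2) P := by
    intro p
    by_contra hc
    have h1 := hl p
    rw [Measure.map_of_not_aemeasurable hc] at h1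
    have h2 : gaussianReal 0 (N : NNReal)⁻¹ Set.univ = 1 := measure_univ
    rw [← h1] at h2
    simp at h2
  have hm2 : ∀ p : Edg N, AEMeasurable ((fun x => √N * x) ∘ (fun ω => G ω p.1.1 p.1.2)) P := fun p => (measurable_const_mul _).comp_aemeasurable (hm p)
  have hi2 := hi.comp (fun _ x => √N * x) (fun _ => measurable_const_mul _)
  refine ⟨aemeasurable_pi_lambda _ hm2, ?_⟩
  have h3 := (iIndepFun_iff_map_fun_eq_pi_map hm2).1 hi2
  refine Eq.trans h3 ?_
  unfold gp
  congr 1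
  ext1 p
  rw [← AEMeasurable.map_map_of_aemeasurable (measurable_const_mul _).aemeasurable (hm p), hl p]
  rw [gaussianReal_map_const_mul, mul_zero]
  unfold gs
  congr 1
  ext
  push_cast
  rw [sq_sqrt hNr.le, mul_inv_cancel₀ hNr.ne']

lemma prob_low (hN : 0 < N) {Ω : Type*} [MeasurableSpace Ω] (P : Measure Ω) [IsProbabilityMeasure P] (G : Ω → Fin N → Fin N → ℝ) (hG : IsGOE N P G)
    {η c κ : ℝ} (hη : 0 < η) (hκ : (gp (Edg N ⊕ Fin N)).real (Gd N β h q η c)ᶜ ≤ κ) : 1 - κ ≤ P.real {ω | Sum.elim (vec N (G ω)) 0 ∈ Gd N β h q η c} := by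
  obtain ⟨h1, h2⟩ := law_vec hN P G hG
  have hGm := Gd_meas (N := N) hη β h q c
  have hc : Measurable (fun g' : Edg N → ℝ => (Sum.elim g' 0 : Edg N ⊕ Fin N → ℝ)) := by
    refine measurable_pi_lambda _ fun k => ?_
    cases k with
    | inl p => exact measurable_pi_apply p
    | inr i => exact measurable_const
  have hS : MeasurableSet {g' : Edg N → ℝ | Sum.elim g' 0 ∈ Gd N β h q η c} := hc hGm
  have e1 : P.real {ω | Sum.elim (vec N (G ω)) 0 ∈ Gd N β h q η c} = (gp (Edg N)).real {g' : Edg N → ℝ | Sum.elim g' 0 ∈ Gd N β h q η c} := by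
    unfold Measure.real
    rw [← h2, Measure.map_apply_of_aemeasurable h1 hS]; rfl
  have mp := gp_comp_inj (Sum.inl : Edg N → Edg N ⊕ Fin N) Sum.inl_injective
  have e2 : (gp (Edg N)).real {g' : Edg N → ℝ | Sum.elim g' 0 ∈ Gd N β h q η c} = (gp (Edg N ⊕ Fin N)).real (Gd N β h q η c) := by
    unfold Measure.real
    rw [← mp.measure_preimage hS.nullMeasurableSet]
    congr 2
    ext g
    simp only [Set.mem_preimage, Gd, Set.mem_ofPred_eq, FF_inl]
  rw [e1, e2]
  have := probReal_compl_eq_one_sub (μ := gp (Edg N ⊕ Fin N)) hGm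
  linarith

/-- Assume `(β,h)` satisfy the AT condition and (AT+). Then there exists
`c = c_{β,h} > 0`, independent of `N`, such that with probability tending to one as
`N → ∞`, `D + β²(1-q) - βG ≥ D + β²(1-q) - (2β²/N) m ⊗ m - βG ≥ c` as quadratic forms;
in particular, with probability tending to one, `D + β²(1-q) - βG` is invertible and its
inverse has operator norm at most `c⁻¹`. -/
theorem Hessian_lower_bound_and_invertibility
    (β h q : ℝ) (hβ : 0 < β) (hh : 0 < h)
    (hq : isFixedq β h q) (hAT : ATcond β h q) (hATp : ATplus β h q)
    (Ω : ℕ → Type) [∀ N, MeasurableSpace (Ω N)] (P : ∀ N, Measure (Ω N))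
    (hP : ∀ N, IsProbabilityMeasure (P N))
    (G : ∀ N, Ω N → Fin N → Fin N → ℝ) (hG : ∀ N, IsGOE N (P N) (G N)) :
    ∃ c : ℝ, 0 < c ∧
      Tendsto (fun N => ((P N) {ω |
          (∀ u : Fin N → ℝ,
            dotp N u (mulVec N (hessMat' N β h q (G N ω)) u)
              ≤ dotp N u (mulVec N (hessMat N β h q (G N ω)) u)) ∧
          (∀ u : Fin N → ℝ,
            c * (∑ i, u i ^ 2) ≤ dotp N u (mulVec N (hessMat' N β h q (G N ω)) u)) ∧
          (∃ B : Fin N → Fin N → ℝ,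
            matMul N (hessMat N β h q (G N ω)) B = idMat N ∧
            matMul N B (hessMat N β h q (G N ω)) = idMat N ∧
            opNorm N B ≤ c⁻¹)}).toReal)
        atTop (nhds 1) := by
  obtain ⟨η, hη, c, hc, hmain⟩ := gp_main hβ hq hAT hATp
  refine ⟨c, hc, ?_⟩
  rw [Metric.tendsto_atTop]
  intro κ hκ
  obtain ⟨N0, hN0⟩ := hmain (κ / 2) (by positivity)
  refine ⟨N0 + 1, fun N hN => ?_⟩
  have hNp : 0 < N := by omega
  have := hP N
  have h1 := prob_low (β := β) (h := h) (q := q) hNp (P N) (G N) (hG N) hη (hN0 N (by omega) hNp)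
  have h3 : ∀ s, ((P N) s).toReal ≤ 1 := fun s => measureReal_le_one
  rw [Real.dist_eq, abs_lt]
  refine ⟨lt_sub_iff_add_lt.2 (lt_of_lt_of_le ?_ (h1.trans (measureReal_mono (fun ω hω => ?_) (measure_ne_top _ _)))),
    (sub_nonpos.2 (h3 _)).trans_lt hκ⟩
  · linarith
  have a1 : ∀ u : Fin N → ℝ, dotp N u (mulVec N (hessMat' N β h q (G N ω)) u) ≤ dotp N u (mulVec N (hessMat N β h q (G N ω)) u) := by
    intro u
    rw [hess'_dot]
    have : 0 ≤ 2 * β ^ 2 / N * (∑ i, u i * mag N β (G N ω) (fun _ => h) i) ^ 2 := by positivity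
    linarith
  have a2 := hess'_low hNp hη (G N ω) ((hG N).1 ω) ((hG N).2.1 ω) hω
  exact ⟨a1, a2, inv_of_low hc _ fun u => (a2 u).trans (a1 u)⟩
end

end SK
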